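/- Let d ≥ 2 and let Γ ≤ SL_d(ℤ) be a countably infinite subgroup that is Zariski dense in SL_d(ℝ). Then the squaring map 𝔞 ↦ 𝔞 × 𝔞 on free weak equivalence classes is discontinuous; sequentially: there exist free p.m.p. actions α_i (i ∈ ℕ) and α of Γ on atomless standard probability spaces such that dist_H(C(α_i,S,k), C(α,S,k)) → 0 as i → ∞ for every finite S ⊆ Γ and every k ∈ ℕ⁺, while for some finite S ⊆ Γ and some k ∈ ℕ⁺ the sequence dist_H(C(α_i×α_i,S,k), C(α×α,S,k)) does not converge to 0. -/

import Mathlib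

open MeasureTheory Filter Topology

/-- A probability-measure-preserving (p.m.p.) action of a group `Γ`,
bundled together with the probability space it acts on. -/
structure PMP (Γ : Type) [Group Γ] where
  /-- the underlying space -/
  X : Type
  /-- the σ-algebra -/
  [mX : MeasurableSpace X]
  /-- the measure -/
  μ : @Measure X mX
  /-- the measure is a probability measure -/
  [prob : IsProbabilityMeasure μ]
  /-- the action map -/
  act : Γ → X → X
  one_act : ∀ x, act 1 x = x
  mul_act : ∀ γ δ x, act (γ * δ) x = act γ (act δ x)
  /-- each group element acts by a measure-preserving (in particular measurable) map -/
  preserves : ∀ γ, MeasurePreserving (act γ) μ μ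

attribute [instance] PMP.mX PMP.prob

variable {Γ : Type} [Group Γ]

/-- A p.m.p. action is free if almost every point has trivial stabilizer. -/
def PMP.Free (a : PMP Γ) : Prop :=
  a.μ {x | ∀ γ : Γ, γ ≠ 1 → a.act γ x ≠ x} = 1

/-- The vector `M^α_{S,k}[f] ∈ [0,1]^{S×k×k}`, defined by
`M^α_{S,k}[f](γ,i,j) = μ {x | f x = i ∧ f (γ • x) = j}`. -/
noncomputable def PMP.M (a : PMP Γ) (S : Finset Γ) (k : ℕ) (f : a.X → Fin k) :
    ↥S × Fin k × Fin k → ℝ :=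
  fun q => (a.μ {x | f x = q.2.1 ∧ f (a.act (q.1 : Γ) x) = q.2.2}).toReal

/-- `C(α,S,k)`: the closure of the set of vectors `M^α_{S,k}[f]`, where `f` ranges over
measurable maps `X → k`, taken in `[0,1]^{S×k×k}`.  (The space `↥S × Fin k × Fin k → ℝ`
carries the sup metric `dist_∞`, since the product distance on a finite product of copies
of `ℝ` is the max of the coordinate distances.) -/
noncomputable def PMP.C (a : PMP Γ) (S : Finset Γ) (k : ℕ) :
    Set (↥S × Fin k × Fin k → ℝ) :=
  closure {v | ∃ f : a.X → Fin k, Measurable f ∧ a.M S k f = v}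

/-- The product of two p.m.p. actions:  `γ • (x, y) = (γ • x, γ • y)` on `(X × Y, μ × ν)`. -/
noncomputable def PMP.prod (a b : PMP Γ) : PMP Γ where
  X := a.X × b.X
  μ := a.μ.prod b.μ
  act γ p := (a.act γ p.1, b.act γ p.2)
  one_act := by intro p; simp [a.one_act, b.one_act]
  mul_act := by intro γ δ p; simp [a.mul_act, b.mul_act]
  preserves γ := (a.preserves γ).prod (b.preserves γ)

/-- A subgroup `Γ ≤ SL_d(ℤ)` is Zariski dense in `SL_d(ℝ)` if every polynomial with real
coefficients in the `d²` matrix entries that vanishes on `Γ` vanishes on all of `SL_d(ℝ)`. -/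
def ZariskiDense (d : ℕ) (Γ : Subgroup (Matrix.SpecialLinearGroup (Fin d) ℤ)) : Prop :=
  ∀ P : MvPolynomial (Fin d × Fin d) ℝ,
    (∀ γ ∈ Γ, MvPolynomial.eval
        (fun ij => ((γ : Matrix (Fin d) (Fin d) ℤ) ij.1 ij.2 : ℝ)) P = 0) →
    ∀ A : Matrix.SpecialLinearGroup (Fin d) ℝ,
      MvPolynomial.eval (fun ij => (A : Matrix (Fin d) (Fin d) ℝ) ij.1 ij.2) P = 0

namespace FreeGroup

/-- The formal inverse of a letter. -/
def invLetter {α : Type} (s : α × Bool) : α × Bool := (s.1, !s.2)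

/-- A letter as an element of the free group. -/
def ofLetter {α : Type} (s : α × Bool) : FreeGroup α := mk [s]

/-- The first letter of the reduced word of an element of a free group. -/
def firstLetter {α : Type} [DecidableEq α] (f : FreeGroup α) : Option (α × Bool) :=
  f.toWord.head?

@[simp] theorem invLetter_invLetter {α : Type} (s : α × Bool) :
    invLetter (invLetter s) = s := by simp [invLetter]

theorem invLetter_ne {α : Type} (s : α × Bool) : invLetter s ≠ s := by
  intro h; have := congrArg Prod.snd h; simp [invLetter] at this

theorem ofLetter_invLetter {α : Type} (s : α × Bool) :
    ofLetter (invLetter s) = (ofLetter s)⁻¹ := by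
  simp [ofLetter, invLetter, inv_mk, invRev]

section
variable {α : Type} [DecidableEq α]

theorem toWord_ofLetter (s : α × Bool) : (ofLetter s).toWord = [s] := by
  simp [ofLetter, toWord_mk]

theorem isReduced_cons_iff {s : α × Bool} {L : List (α × Bool)} (hL : IsReduced L) :
    IsReduced (s :: L) ↔ L.head? ≠ some (invLetter s) := by
  cases L with
  | nil => simp
  | cons t L =>
    rw [isReduced_cons_cons]
    simp only [hL, and_true, List.head?_cons, ne_eq, Option.some.injEq, invLetter]
    constructor
    · rintro h rfl
      simpa using h rfl
    · intro h h1
      by_contra h2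
      apply h
      ext1
      · exact h1.symm
      · cases hs : s.2 <;> cases ht : t.2 <;> simp_all

theorem toWord_ofLetter_mul {s : α × Bool} {f : FreeGroup α}
    (h : f.firstLetter ≠ some (invLetter s)) : (ofLetter s * f).toWord = s :: f.toWord := by
  rw [toWord_mul, toWord_ofLetter]
  exact ((isReduced_cons_iff isReduced_toWord).2 h).reduce_eq

theorem firstLetter_ofLetter_mul {s : α × Bool} {f : FreeGroup α}
    (h : f.firstLetter ≠ some (invLetter s)) : (ofLetter s * f).firstLetter = some s := by
  simp [firstLetter, toWord_ofLetter_mul h]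

theorem exists_of_firstLetter {s : α × Bool} {f : FreeGroup α} (h : f.firstLetter = some s) :
    ∃ g : FreeGroup α, f = ofLetter s * g ∧ g.firstLetter ≠ some (invLetter s) := by
  obtain ⟨L, hL⟩ : ∃ L, f.toWord = s :: L := by
    cases h' : f.toWord with
    | nil => simp [firstLetter, h'] at h
    | cons t L => exact ⟨L, by simp [firstLetter, h'] at h; simp [h]⟩
  have hr : IsReduced (s :: L) := hL ▸ isReduced_toWord
  have hr' : IsReduced L := List.IsChain.tail hr
  refine ⟨mk L, ?_, ?_⟩
  · rw [ofLetter, mul_mk, List.singleton_append, ← hL, mk_toWord]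
  · rw [firstLetter, toWord_mk, hr'.reduce_eq]
    exact (isReduced_cons_iff hr').1 hr

theorem firstLetter_eq_none {f : FreeGroup α} : f.firstLetter = none ↔ f = 1 := by
  simp [firstLetter]

theorem exists_firstLetter {f : FreeGroup α} (h : f ≠ 1) : ∃ s, f.firstLetter = some s :=
  Option.ne_none_iff_exists'.1 (mt firstLetter_eq_none.1 h)

theorem firstLetter_mul_ofLetter {s : α × Bool} {f : FreeGroup α} (hf : f ≠ 1)
    (h : f⁻¹.firstLetter ≠ some s) : (f * ofLetter s).firstLetter = f.firstLetter := by
  have h1 : (f * ofLetter s)⁻¹.toWord = invLetter s :: f⁻¹.toWord := by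
    rw [mul_inv_rev, ← ofLetter_invLetter]
    exact toWord_ofLetter_mul (by simpa using h)
  have h2 : (f * ofLetter s).toWord = f.toWord ++ [s] := by
    rw [← inv_inv (f * ofLetter s), toWord_inv, h1, toWord_inv]
    simp [invRev, invLetter, Function.comp_def]
  have h3 : f.toWord ≠ [] := by simpa using hf
  rw [firstLetter, firstLetter, h2, List.head?_append_of_ne_nil _ h3]

theorem firstLetter_conj {s : α × Bool} {u : FreeGroup α} (hu : u ≠ 1)
    (h : u.firstLetter ≠ some (invLetter s)) (h' : u⁻¹.firstLetter ≠ some (invLetter s)) :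
    (ofLetter s * u * (ofLetter s)⁻¹).firstLetter = some s := by
  rw [mul_assoc]
  apply firstLetter_ofLetter_mul
  rw [← ofLetter_invLetter, firstLetter_mul_ofLetter hu h']
  exact h

/-- Conjugating by the inverse of the first letter never produces a word starting with the
inverse of that letter. -/
theorem firstLetter_inv_conj_ne {t : α × Bool} {v : FreeGroup α} (h : v.firstLetter = some t) :
    ((ofLetter t)⁻¹ * v * ofLetter t).firstLetter ≠ some (invLetter t) := by
  obtain ⟨x, rfl, hx⟩ := exists_of_firstLetter h
  intro hc
  have hc' : (x * ofLetter t).firstLetter = some (invLetter t) := by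
    rw [← hc]; congr 1; group
  by_cases hx1 : x = 1
  · subst hx1
    rw [one_mul, firstLetter, toWord_ofLetter] at hc'
    exact invLetter_ne t (by simpa using hc'.symm)
  by_cases hxt : x⁻¹.firstLetter = some t
  · obtain ⟨y, hy, hyt⟩ := exists_of_firstLetter hxt
    have hx2 : x * ofLetter t = y⁻¹ := by
      rw [← inv_inj, mul_inv_rev, hy]; group
    rw [hx2] at hc'
    have hy1 : y ≠ 1 := by
      rintro rfl; rw [inv_one, firstLetter_eq_none.2 rfl] at hc'; simp at hc'
    have : (y⁻¹ * ofLetter (invLetter t)).firstLetter = y⁻¹.firstLetter :=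
      firstLetter_mul_ofLetter (inv_ne_one.2 hy1) (by simpa using hyt)
    rw [hc', ofLetter_invLetter, ← mul_inv_rev, ← hy, inv_inv] at this
    exact hx this
  · rw [firstLetter_mul_ofLetter hx1 hxt] at hc'
    exact hx hc'

theorem firstLetter_pow_and_length {u : FreeGroup α} (hu : u ≠ 1) (n : ℕ) (hn : n ≠ 0) :
    (u ^ n).firstLetter = u.firstLetter ∧ n ≤ (u ^ n).toWord.length := by
  have hrc : reduceCyclically u.toWord ≠ [] := by
    intro h0
    apply hu
    have h1 := reduceCyclically.conj_conjugator_reduceCyclically u.toWord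
    rw [h0, List.append_nil] at h1
    rw [← mk_toWord (x := u), ← h1, ← mul_mk, ← inv_mk, mul_inv_cancel]
  have h1 := reduceCyclically.conj_conjugator_reduceCyclically u.toWord
  have h2 := toWord_pow u n
  rw [reduceCyclically.reduce_flatten_replicate isReduced_toWord, if_neg hn] at h2
  constructor
  · rw [firstLetter, firstLetter, h2]
    conv_rhs => rw [← h1]
    cases hc : reduceCyclically.conjugator u.toWord with
    | cons a L => simp
    | nil =>
      obtain ⟨k, rfl⟩ := Nat.exists_eq_succ_of_ne_zero hn
      obtain ⟨a, L, haL⟩ := List.exists_cons_of_ne_nil hrc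
      simp [haL, List.replicate_succ]
  · rw [h2]
    have : 1 ≤ (reduceCyclically u.toWord).length := List.length_pos_iff.2 hrc
    simp only [List.length_append, List.length_flatten, List.map_replicate, List.sum_replicate,
      smul_eq_mul]
    nlinarith

end

end FreeGroup

namespace FreeGroup

/-- Every action of a free group carries an inward labelling of its points by sets of letters,
where non-subsingleton labels consist of first letters of stabilizer elements. -/
theorem exists_letter_labelling {α : Type} [DecidableEq α] (Ω : Type)
    [MulAction (FreeGroup α) Ω] :
    ∃ A : Ω → Set (α × Bool),
      (∀ ω s, invLetter s ∉ A ω → A (ofLetter s • ω) = {s}) ∧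
      ∀ ω, (A ω).Subsingleton ∨
        ∀ s ∈ A ω, ∃ u ∈ MulAction.stabilizer (FreeGroup α) ω, u ≠ 1 ∧ u.firstLetter = some s := by
  classical
  let rep : Ω → Ω := fun ω =>
    (Quotient.mk (MulAction.orbitRel (FreeGroup α) Ω) ω).out
  have hrep : ∀ ω, ∃ f : FreeGroup α, f • rep ω = ω := by
    intro ω
    have : (MulAction.orbitRel (FreeGroup α) Ω).r ω (rep ω) :=
      (MulAction.orbitRel (FreeGroup α) Ω).symm (Quotient.mk_out (s := MulAction.orbitRel (FreeGroup α) Ω) ω)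
    exact this
  choose fr hfr using hrep
  have rep_smul : ∀ (g : FreeGroup α) (ω : Ω), rep (g • ω) = rep ω := by
    intro g ω
    have : Quotient.mk (MulAction.orbitRel (FreeGroup α) Ω) (g • ω) = Quotient.mk _ ω :=
      Quotient.sound (s := MulAction.orbitRel (FreeGroup α) Ω) ⟨g, rfl⟩
    simp only [rep, this]
  let A : Ω → Set (α × Bool) := fun ω =>
    if MulAction.stabilizer (FreeGroup α) ω = ⊥ then {s | (fr ω).firstLetter = some s}
    else {s | ∃ u ∈ MulAction.stabilizer (FreeGroup α) ω, u ≠ 1 ∧ u.firstLetter = some s}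
  have stab_iff : ∀ (g u : FreeGroup α) (ω : Ω), u ∈ MulAction.stabilizer (FreeGroup α) (g • ω) ↔
      g⁻¹ * u * g ∈ MulAction.stabilizer (FreeGroup α) ω := by
    intro g u ω
    simp only [MulAction.mem_stabilizer_iff, mul_smul]
    rw [inv_smul_eq_iff]
  have stab_bot : ∀ (g : FreeGroup α) (ω : Ω), MulAction.stabilizer (FreeGroup α) (g • ω) = ⊥ ↔
      MulAction.stabilizer (FreeGroup α) ω = ⊥ := by
    intro g ω
    simp only [Subgroup.eq_bot_iff_forall, stab_iff]
    constructor
    · intro h x hx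
      have := h (g * x * g⁻¹) (by simpa [mul_assoc] using hx)
      simpa using this
    · intro h x hx
      have := h _ hx
      rw [mul_assoc, inv_mul_eq_one] at this
      simpa using this.symm
  refine ⟨A, ?_, ?_⟩
  · intro ω s hs
    by_cases hb : MulAction.stabilizer (FreeGroup α) ω = ⊥
    · have hA : A ω = {s | (fr ω).firstLetter = some s} := if_pos hb
      have hA' : A (ofLetter s • ω) = {t | (fr (ofLetter s • ω)).firstLetter = some t} :=
        if_pos ((stab_bot _ _).2 hb)
      have hfr' : fr (ofLetter s • ω) = ofLetter s * fr ω := by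
        have h1 : fr (ofLetter s • ω) • rep ω = (ofLetter s * fr ω) • rep ω := by
          rw [mul_smul, hfr, ← rep_smul (ofLetter s) ω, hfr]
        have h2 : MulAction.stabilizer (FreeGroup α) (rep ω) = ⊥ := by
          rw [← stab_bot (fr ω), hfr, hb]
        have h3 : (ofLetter s * fr ω)⁻¹ * fr (ofLetter s • ω) ∈
            MulAction.stabilizer (FreeGroup α) (rep ω) := by
          rw [MulAction.mem_stabilizer_iff, mul_smul, h1, inv_smul_smul]
        rw [h2, Subgroup.mem_bot, inv_mul_eq_one] at h3
        exact h3.symm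
      rw [hA] at hs
      rw [hA', hfr', firstLetter_ofLetter_mul hs]
      ext t; simp [eq_comm]
    · have hA : A ω = _ := if_neg hb
      have hA' : A (ofLetter s • ω) = _ := if_neg (mt (stab_bot _ _).1 hb)
      have key : ∀ u ∈ MulAction.stabilizer (FreeGroup α) ω, u ≠ 1 →
          (ofLetter s * u * (ofLetter s)⁻¹).firstLetter = some s := by
        intro u hu hu1
        rw [hA] at hs
        exact firstLetter_conj hu1 (fun h => hs ⟨u, hu, hu1, h⟩)
          (fun h => hs ⟨u⁻¹, inv_mem hu, inv_ne_one.2 hu1, h⟩)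
      rw [hA']
      ext t
      simp only [Set.mem_ofPred_eq, Set.mem_singleton_iff]
      constructor
      · rintro ⟨u, hu, hu1, hut⟩
        rw [stab_iff] at hu
        have := key _ hu (by
          intro h; rw [mul_assoc, inv_mul_eq_one] at h; exact hu1 (by simpa using h.symm))
        have h2 : ofLetter s * ((ofLetter s)⁻¹ * u * ofLetter s) * (ofLetter s)⁻¹ = u := by group
        rw [h2, hut] at this
        simpa using this
      · rintro rfl
        obtain ⟨⟨u, hu⟩, hu1⟩ := Subgroup.ne_bot_iff_exists_ne_one.1 hb
        have hu1 : u ≠ 1 := fun h' => hu1 (Subtype.ext h')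
        refine ⟨ofLetter t * u * (ofLetter t)⁻¹, ?_, ?_, key u hu hu1⟩
        · rw [stab_iff]
          convert hu using 1; group
        · intro h; apply hu1; simpa using h
  · intro ω
    by_cases hb : MulAction.stabilizer (FreeGroup α) ω = ⊥
    · left
      have hA : A ω = {s | (fr ω).firstLetter = some s} := if_pos hb
      rw [hA]
      intro s hs t ht
      simp only [Set.mem_ofPred_eq] at hs ht
      rw [hs] at ht; simpa using ht
    · right
      have hA : A ω = _ := if_neg hb
      intro s hs
      rw [hA] at hs
      exact hs

/-- Either some conjugation spreads out the first letters of a family of nontrivial words, or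
there is an infinite reduced ray along which a majority of the conjugates follow the ray. -/
theorem exists_spread_or_ray {α ι : Type} [DecidableEq α] [Fintype ι] [Nonempty ι]
    (w : ι → FreeGroup α) :
    (∃ f : FreeGroup α, ∀ t,
      2 * (Finset.univ.filter fun i => (f⁻¹ * w i * f).firstLetter = some t).card
        ≤ Fintype.card ι) ∨
    ∃ (f : ℕ → FreeGroup α) (t : ℕ → α × Bool), ∀ k, (f k).toWord.length = k ∧
      (f k)⁻¹.firstLetter ≠ some (t k) ∧ Fintype.card ι <
        2 * (Finset.univ.filter fun i => ((f k)⁻¹ * w i * f k).firstLetter = some (t k)).card := by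
  classical
  by_cases h : ∃ f : FreeGroup α, ∀ t,
      2 * (Finset.univ.filter fun i => (f⁻¹ * w i * f).firstLetter = some t).card
        ≤ Fintype.card ι
  · exact Or.inl h
  right
  push Not at h
  choose T hT using h
  let f : ℕ → FreeGroup α := fun k => Nat.rec 1 (fun _ g => g * ofLetter (T g)) k
  have hf : ∀ k, f (k + 1) = f k * ofLetter (T (f k)) := fun k => rfl
  refine ⟨f, fun k => T (f k), fun k => ?_⟩
  have key : ∀ k, (f k)⁻¹.toWord.length = k ∧ (f k)⁻¹.firstLetter ≠ some (T (f k)) := by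
    intro k
    induction k with
    | zero =>
      have : f 0 = 1 := rfl
      simp [this, firstLetter]
    | succ k ih =>
      have h1 : (f (k + 1))⁻¹ = ofLetter (invLetter (T (f k))) * (f k)⁻¹ := by
        rw [hf, mul_inv_rev, ofLetter_invLetter]
      have h2 : (f k)⁻¹.firstLetter ≠ some (invLetter (invLetter (T (f k)))) := by
        rw [invLetter_invLetter]; exact ih.2
      constructor
      · rw [h1, toWord_ofLetter_mul h2, List.length_cons, ih.1]
      · rw [h1, firstLetter_ofLetter_mul h2]
        intro hc
        obtain ⟨i, hi⟩ : ((Finset.univ.filter fun i =>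
            ((f k)⁻¹ * w i * f k).firstLetter = some (T (f k))) ∩ Finset.univ.filter fun i =>
            ((f (k+1))⁻¹ * w i * f (k+1)).firstLetter = some (T (f (k+1)))).Nonempty := by
          rw [Finset.nonempty_iff_ne_empty]
          intro he
          have h3 := Finset.card_union_add_card_inter (Finset.univ.filter fun i =>
            ((f k)⁻¹ * w i * f k).firstLetter = some (T (f k))) (Finset.univ.filter fun i =>
            ((f (k+1))⁻¹ * w i * f (k+1)).firstLetter = some (T (f (k+1))))
          rw [he, Finset.card_empty] at h3
          have h4 := Finset.card_le_univ ((Finset.univ.filter fun i =>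
            ((f k)⁻¹ * w i * f k).firstLetter = some (T (f k))) ∪ Finset.univ.filter fun i =>
            ((f (k+1))⁻¹ * w i * f (k+1)).firstLetter = some (T (f (k+1))))
          have h5 := hT (f k)
          have h6 := hT (f (k+1))
          omega
        simp only [Finset.mem_inter, Finset.mem_filter, Finset.mem_univ, true_and] at hi
        apply firstLetter_inv_conj_ne hi.1
        rw [Option.some_inj.1 hc, ← hi.2, hf]
        congr 1; group
  refine ⟨?_, (key k).2, hT (f k)⟩
  have := (key k).1
  rw [toWord_inv, invRev_length] at this
  exact this

end FreeGroup

/-- Multiplying a nearly rank-one operator by a nearly rank-one operator in general position. -/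
theorem nearlyRankOne_step {V : Type*} [NormedAddCommGroup V] [NormedSpace ℝ V]
    {C κ ε : ℝ} (hC : 0 < C) (hκ : 0 < κ) (hε : 0 ≤ ε)
    (hε2 : ε * (2 / κ) * (1 + C * (C + 1) * (2 / κ)) ≤ 1 / 2)
    {η θ : V →L[ℝ] ℝ} {p P : V} {D E : V →L[ℝ] V}
    (hη : ‖η‖ ≤ C) (hP : ‖P‖ ≤ C + 1) (hD : ‖D‖ ≤ ε) (ha : κ / 2 ≤ |η P|) :
    ∃ (P' : V) (θ' : V →L[ℝ] ℝ) (E' : V →L[ℝ] V),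
      (η.smulRight p + D) * (θ.smulRight P + E) = (η P) • (θ'.smulRight P' + E') ∧
      ‖P' - p‖ ≤ ε * (C + 1) * (2 / κ) ∧ ‖θ' - θ‖ ≤ C * (2 / κ) * ‖E‖ ∧ ‖E'‖ ≤ ‖E‖ / 2 := by
  set a := η P with ha_def
  have ha0 : 0 < |a| := lt_of_lt_of_le (by positivity) ha
  have ha' : a ≠ 0 := abs_pos.1 ha0
  have hinv : |a⁻¹| ≤ 2 / κ := by
    rw [abs_inv, ← inv_div]
    exact inv_anti₀ (by positivity) ha
  have hDP : ‖D P‖ ≤ ε * (C + 1) :=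
    (D.le_opNorm P).trans (mul_le_mul hD hP (norm_nonneg _) hε)
  have hηE : ‖η.comp E‖ ≤ C * ‖E‖ :=
    (ContinuousLinearMap.opNorm_comp_le _ _).trans (by gcongr)
  refine ⟨p + a⁻¹ • D P, θ + a⁻¹ • η.comp E,
    a⁻¹ • (D * E) - (a⁻¹ * a⁻¹) • (η.comp E).smulRight (D P), ?_, ?_, ?_, ?_⟩
  · ext v
    simp only [mul_apply_eq_comp, add_apply,
      ContinuousLinearMap.smulRight_apply, smul_apply, map_add, map_smul,
      sub_apply, ContinuousLinearMap.comp_apply, smul_eq_mul, ← ha_def]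
    simp only [smul_add, smul_sub, add_smul, smul_smul]
    match_scalars <;> field_simp
    ring
  · rw [add_sub_cancel_left, norm_smul, Real.norm_eq_abs]
    calc |a⁻¹| * ‖D P‖ ≤ (2 / κ) * (ε * (C + 1)) := by gcongr
      _ = _ := by ring
  · rw [add_sub_cancel_left, norm_smul, Real.norm_eq_abs]
    calc |a⁻¹| * ‖η.comp E‖ ≤ (2 / κ) * (C * ‖E‖) := by gcongr
      _ = _ := by ring
  · have h1 : ‖a⁻¹ • (D * E)‖ ≤ (2 / κ) * (ε * ‖E‖) := by
      rw [norm_smul, Real.norm_eq_abs]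
      gcongr
      exact (norm_mul_le _ _).trans (by gcongr)
    have h2 : ‖(a⁻¹ * a⁻¹) • (η.comp E).smulRight (D P)‖ ≤
        ((2 / κ) * (2 / κ)) * ((C * ‖E‖) * (ε * (C + 1))) := by
      rw [norm_smul, Real.norm_eq_abs, abs_mul, ContinuousLinearMap.norm_smulRight_apply]
      gcongr
    calc _ ≤ _ := norm_sub_le _ _
      _ ≤ _ := add_le_add h1 h2
      _ = (ε * (2 / κ) * (1 + C * (C + 1) * (2 / κ))) * ‖E‖ := by ring
      _ ≤ 1 / 2 * ‖E‖ := by gcongr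
      _ = _ := by ring

/-- Products of letters close to rank-one operators along admissible words stay close to
rank-one operators, with exponentially small relative error. -/
theorem exists_nearlyRankOne_words {V S : Type*} [NormedAddCommGroup V] [NormedSpace ℝ V]
    [Finite S] (r : S → S → Prop) (p : S → V) (η : S → V →L[ℝ] ℝ)
    (hr : ∀ s t, r s t → η s (p t) ≠ 0) {δ : ℝ} (hδ : 0 < δ) :
    ∃ ε > 0, ∀ R : S → V →L[ℝ] V,
      (∀ s, ∃ c : ℝ, c ≠ 0 ∧ ‖c • R s - (η s).smulRight (p s)‖ ≤ ε) →
      ∀ (L : List S) (hL : L ≠ []), L.IsChain r →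
        ∃ (l : ℝ) (P : V) (θ : V →L[ℝ] ℝ) (E : V →L[ℝ] V), l ≠ 0 ∧
          (L.map R).prod = l • (θ.smulRight P + E) ∧ ‖P - p (L.head hL)‖ ≤ δ ∧
          ‖θ - η (L.getLast hL)‖ ≤ δ ∧ ‖E‖ ≤ δ * (1 / 2) ^ L.length := by
  classical
  have := Fintype.ofFinite S
  obtain ⟨C, hC, hpC, hηC⟩ : ∃ C : ℝ, 0 < C ∧ (∀ s, ‖p s‖ ≤ C) ∧ ∀ s, ‖η s‖ ≤ C := by
    refine ⟨1 + ∑ s, ‖p s‖ + ∑ s, ‖η s‖, by positivity, fun s => ?_, fun s => ?_⟩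
    · have := Finset.single_le_sum (fun t _ => norm_nonneg (p t)) (Finset.mem_univ s)
      have : 0 ≤ ∑ s, ‖η s‖ := by positivity
      linarith
    · have := Finset.single_le_sum (fun t _ => norm_nonneg (η t)) (Finset.mem_univ s)
      have : 0 ≤ ∑ s, ‖p s‖ := by positivity
      linarith
  obtain ⟨κ, hκ, hκr⟩ : ∃ κ : ℝ, 0 < κ ∧ ∀ s t, r s t → κ ≤ |η s (p t)| := by
    by_cases hne : (Finset.univ.filter fun q : S × S => r q.1 q.2).Nonempty
    · obtain ⟨q, hq, hmin⟩ := Finset.exists_min_image _ (fun q : S × S => |η q.1 (p q.2)|) hne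
      refine ⟨_, abs_pos.2 (hr q.1 q.2 (by simpa using hq)), fun s t hst => ?_⟩
      exact hmin (s, t) (by simpa using hst)
    · refine ⟨1, one_pos, fun s t hst => ?_⟩
      exact absurd ⟨(s, t), by simpa using hst⟩ hne
  set δ' := min δ (min 1 (κ / (2 * C))) with hδ'
  have hδ'0 : 0 < δ' := lt_min hδ (lt_min one_pos (by positivity))
  have hδ1 : δ' ≤ δ := min_le_left _ _
  have hδ2 : δ' ≤ 1 := (min_le_right _ _).trans (min_le_left _ _)
  have hδ3 : δ' ≤ κ / (2 * C) := (min_le_right _ _).trans (min_le_right _ _)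
  set K1 := (2 / κ) * (1 + C * (C + 1) * (2 / κ)) with hK1
  set K2 := (C + 1) * (2 / κ)
  set K3 := C * (2 / κ)
  have hK10 : 0 < K1 := by positivity
  have hK20 : 0 < K2 := by positivity
  have hK30 : 0 < K3 := by positivity
  set ε := min (1 / (2 * K1)) (min (δ' / K2) (min (δ' / (2 * K3)) (δ / 2))) with hεdef
  have hε0 : 0 < ε := by
    refine lt_min (by positivity) (lt_min (by positivity) (lt_min (by positivity) (by positivity)))
  have hε1 : ε ≤ 1 / (2 * K1) := min_le_left _ _
  have hε2 : ε ≤ δ' / K2 := (min_le_right _ _).trans (min_le_left _ _)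
  have hε3 : ε ≤ δ' / (2 * K3) :=
    (min_le_right _ _).trans ((min_le_right _ _).trans (min_le_left _ _))
  have hε4 : ε ≤ δ / 2 :=
    (min_le_right _ _).trans ((min_le_right _ _).trans (min_le_right _ _))
  refine ⟨ε, hε0, fun R hR L hL hchain => ?_⟩
  have hdec : ∀ s, ∃ (c : ℝ) (D : V →L[ℝ] V), c ≠ 0 ∧ ‖D‖ ≤ ε ∧
      R s = c • ((η s).smulRight (p s) + D) := by
    intro s
    obtain ⟨c, hc, hcε⟩ := hR s
    refine ⟨c⁻¹, c • R s - (η s).smulRight (p s), inv_ne_zero hc, hcε, ?_⟩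
    rw [add_sub_cancel, smul_smul, inv_mul_cancel₀ hc, one_smul]
  have main : ∀ (L : List S) (hL : L ≠ []), L.IsChain r →
      ∃ (l : ℝ) (P : V) (θ : V →L[ℝ] ℝ) (E : V →L[ℝ] V), l ≠ 0 ∧
        (L.map R).prod = l • (θ.smulRight P + E) ∧ ‖P - p (L.head hL)‖ ≤ δ' ∧
        ‖θ - η (L.getLast hL)‖ ≤ 2 * K3 * ε - 2 * K3 * ‖E‖ ∧
        ‖E‖ ≤ 2 * ε * (1 / 2) ^ L.length := by
    intro L
    induction L with
    | nil => intro hL; exact absurd rfl hL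
    | cons s L ih =>
      intro _ hch
      obtain ⟨c, D, hc, hD, hRs⟩ := hdec s
      by_cases hLn : L = []
      · subst hLn
        refine ⟨c, p s, η s, D, hc, by simp [hRs], by simpa using hδ'0.le, ?_, ?_⟩
        · simp only [List.getLast_singleton, sub_self, norm_zero]
          nlinarith
        · simp only [List.length_singleton, pow_one]; linarith
      · obtain ⟨l, P, θ, E, hl, hprod, hP, hθ, hE⟩ := ih hLn hch.tail
        have hst : r s (L.head hLn) := by
          obtain ⟨t, L', rfl⟩ := List.exists_cons_of_ne_nil hLn
          exact (List.isChain_cons_cons.1 hch).1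
        have hPn : ‖P‖ ≤ C + 1 := by
          calc ‖P‖ = ‖p (L.head hLn) + (P - p (L.head hLn))‖ := by rw [add_sub_cancel]
            _ ≤ _ := norm_add_le _ _
            _ ≤ C + 1 := add_le_add (hpC _) (hP.trans hδ2)
        have ha : κ / 2 ≤ |η s P| := by
          have h1 := hκr _ _ hst
          have h2 : |η s (P - p (L.head hLn))| ≤ κ / 2 := by
            have := (η s).le_opNorm (P - p (L.head hLn))
            rw [Real.norm_eq_abs] at this
            calc _ ≤ _ := this
              _ ≤ C * (κ / (2 * C)) := by
                gcongr
                · exact hηC s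
                · exact hP.trans hδ3
              _ = κ / 2 := by field_simp
          rw [map_sub] at h2
          have h3 := abs_sub_abs_le_abs_sub (η s (p (L.head hLn))) (η s P)
          rw [abs_sub_comm] at h3
          linarith
        have hεK : ε * (2 / κ) * (1 + C * (C + 1) * (2 / κ)) ≤ 1 / 2 := by
          rw [mul_assoc, ← hK1]
          calc ε * K1 ≤ 1 / (2 * K1) * K1 := by gcongr
            _ = 1 / 2 := by field_simp
        obtain ⟨P', θ', E', hmul, hP', hθ', hE'⟩ :=
          nearlyRankOne_step (p := p s) (θ := θ) (E := E) hC hκ hε0.le hεK (hηC s) hPn hD ha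
        have ha0 : η s P ≠ 0 := abs_pos.1 (lt_of_lt_of_le (by positivity) ha)
        refine ⟨c * l * η s P, P', θ', E', mul_ne_zero (mul_ne_zero hc hl) ha0, ?_, ?_, ?_, ?_⟩
        · rw [List.map_cons, List.prod_cons, hprod, hRs, smul_mul_smul_comm, hmul, smul_smul]
        · rw [List.head_cons]
          refine hP'.trans ?_
          rw [mul_assoc]
          calc ε * K2 ≤ δ' / K2 * K2 := by gcongr
            _ = δ' := by field_simp
        · rw [List.getLast_cons hLn]
          have : ‖θ' - η (L.getLast hLn)‖ ≤ ‖θ' - θ‖ + ‖θ - η (L.getLast hLn)‖ :=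
            norm_sub_le_norm_sub_add_norm_sub _ _ _
          have h5 : ‖θ' - θ‖ ≤ K3 * ‖E‖ := hθ'
          have h6 : K3 * ‖E'‖ ≤ K3 * (‖E‖ / 2) := by gcongr
          linarith
        · rw [List.length_cons, pow_succ]
          linarith
  obtain ⟨l, P, θ, E, hl, hprod, hP, hθ, hE⟩ := main L hL hchain
  refine ⟨l, P, θ, E, hl, hprod, hP.trans hδ1, ?_, ?_⟩
  · have h1 : 0 ≤ 2 * K3 * ‖E‖ := by positivity
    have h2 : 2 * K3 * ε ≤ δ' := by
      calc 2 * K3 * ε ≤ 2 * K3 * (δ' / (2 * K3)) := by gcongr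
        _ = δ' := by field_simp
    linarith
  · refine hE.trans ?_
    gcongr
    linarith

theorem le_norm_of_norm_sub_le {V : Type*} [NormedAddCommGroup V] {P p : V} {δ : ℝ}
    (h : ‖P - p‖ ≤ δ) (hp : 2 * δ ≤ ‖p‖) : δ ≤ ‖P‖ := by
  have := norm_sub_norm_le p P
  rw [norm_sub_rev] at this
  linarith

section LimitVectors
variable {V : Type*} [NormedAddCommGroup V] [NormedSpace ℝ V]

/-- A limit of multiples of vectors converging to `w ≠ 0` is a multiple of `w`. -/
theorem exists_smul_eq_of_tendsto_smul {a : ℕ → ℝ} {w : ℕ → V} {u w₀ : V} (hw₀ : w₀ ≠ 0)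
    (hw : Tendsto w atTop (𝓝 w₀)) (hu : Tendsto (fun k => a k • w k) atTop (𝓝 u)) :
    ∃ c : ℝ, u = c • w₀ ∧ Tendsto a atTop (𝓝 c) := by
  have hn : Tendsto (fun k => ‖w k‖) atTop (𝓝 ‖w₀‖) := hw.norm
  have hn0 : ‖w₀‖ ≠ 0 := norm_ne_zero_iff.2 hw₀
  obtain ⟨φ, hφ, hφw⟩ : ∃ φ : V →L[ℝ] ℝ, ‖φ‖ = 1 ∧ φ w₀ = ‖w₀‖ := by
    simpa using exists_dual_vector ℝ w₀ hn0
  have h1 : Tendsto (fun k => φ (w k)) atTop (𝓝 ‖w₀‖) := by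
    rw [← hφw]; exact (φ.continuous.tendsto _).comp hw
  have h2 : Tendsto (fun k => a k * φ (w k)) atTop (𝓝 (φ u)) := by
    have := (φ.continuous.tendsto _).comp hu
    simpa [Function.comp_def] using this
  have h3 : Tendsto a atTop (𝓝 (φ u / ‖w₀‖)) := by
    refine (h2.div h1 hn0).congr' ?_
    filter_upwards [h1.eventually_ne hn0] with k hk
    simp only [Pi.div_apply]
    field_simp
  exact ⟨_, tendsto_nhds_unique hu (h3.smul hw), h3⟩

/-- `y` is a nonzero vector in the image of a nonzero limit of rescaled powers of `T`. -/
def IsLimitVector (T : V →L[ℝ] V) (y : V) : Prop :=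
  y ≠ 0 ∧ ∃ (n : ℕ → ℕ) (κ : ℕ → ℝ) (B : V →L[ℝ] V), StrictMono n ∧
    Tendsto (fun j => κ j • T ^ n j) atTop (𝓝 B) ∧ ∃ x, B x = y

theorem exists_isLimitVector [FiniteDimensional ℝ V] {T : V →L[ℝ] V} (hT : ∀ n, T ^ n ≠ 0) :
    ∃ y, IsLimitVector T y := by
  have hb : Bornology.IsBounded (Set.range fun n : ℕ => ‖T ^ n‖⁻¹ • T ^ n) := by
    refine (Metric.isBounded_closedBall (x := (0 : V →L[ℝ] V)) (r := 1)).subset ?_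
    rintro _ ⟨n, rfl⟩
    simp [norm_smul, inv_mul_cancel₀ (norm_ne_zero_iff.2 (hT n))]
  have : ProperSpace (V →L[ℝ] V) := FiniteDimensional.proper ℝ _
  obtain ⟨B, -, φ, hφ, hB⟩ := tendsto_subseq_of_bounded hb (fun n => Set.mem_range_self n)
  have hB1 : ‖B‖ = 1 := by
    refine tendsto_nhds_unique hB.norm (tendsto_const_nhds.congr fun k => ?_)
    simp [norm_smul, inv_mul_cancel₀ (norm_ne_zero_iff.2 (hT (φ k)))]
  have hB0 : B ≠ 0 := by rintro rfl; simp at hB1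
  obtain ⟨x, hx⟩ : ∃ x, B x ≠ 0 := by
    by_contra h; push Not at h; exact hB0 (ContinuousLinearMap.ext h)
  exact ⟨B x, hx, φ, _, B, hφ, hB, x, rfl⟩

theorem IsLimitVector.conj {T U U' S : V →L[ℝ] V} {y : V} (hy : IsLimitVector T y)
    (hU : U' * U = 1) {c : ℝ} (hc : c ≠ 0) (hS : S = c • (U * T * U')) :
    IsLimitVector S (U y) := by
  obtain ⟨hy0, n, κ, B, hn, hB, x, rfl⟩ := hy
  have hinj : ∀ v, U' (U v) = v := fun v => by
    rw [← mul_apply_eq_comp, hU, one_apply_eq_self]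
  refine ⟨fun h => hy0 ?_, n, fun j => κ j * (c ^ n j)⁻¹, U * B * U', hn, ?_, U x, ?_⟩
  · rw [← hinj (B x), h, map_zero]
  · have h1 : ∀ k, S ^ k = c ^ k • (U * T ^ k * U') ∨ k = 0 := by
      intro k
      induction k with
      | zero => right; rfl
      | succ k ih =>
        left
        rcases ih with ih | rfl
        · rw [pow_succ, ih, hS, smul_mul_smul_comm, ← pow_succ]
          congr 1
          calc U * T ^ k * U' * (U * T * U') = U * T ^ k * (U' * U) * T * U' := by
                simp only [mul_assoc]
            _ = _ := by rw [hU, mul_one, pow_succ, mul_assoc U]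
        · rw [zero_add, pow_one, pow_one, pow_one, hS]
    have h2 : Tendsto (fun j => U * (κ j • T ^ n j) * U') atTop (𝓝 (U * B * U')) :=
      (tendsto_const_nhds.mul hB).mul tendsto_const_nhds
    refine h2.congr' ?_
    filter_upwards [Filter.eventually_ge_atTop 1] with j hj
    rcases h1 (n j) with h | h
    · rw [h, smul_smul, mul_assoc (κ j), inv_mul_cancel₀ (pow_ne_zero _ hc), mul_one, mul_smul_comm,
        smul_mul_assoc]
    · have := hn.id_le j
      simp only [id] at this
      omega
  · simp only [mul_apply_eq_comp, hinj]

end LimitVectors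

section PingPong
variable {V : Type*} [NormedAddCommGroup V] [NormedSpace ℝ V] {α : Type} [DecidableEq α]

/-- All nontrivial words are `δ`-close to rank-one operators with prescribed image and kernel. -/
def IsPingPong (R : FreeGroup α →* (V →L[ℝ] V)) (p : α × Bool → V) (η : α × Bool → V →L[ℝ] ℝ)
    (δ : ℝ) : Prop :=
  ∀ (f : FreeGroup α) (s t : α × Bool), f.firstLetter = some s →
    f⁻¹.firstLetter = some (FreeGroup.invLetter t) →
    ∃ (l : ℝ) (P : V) (θ : V →L[ℝ] ℝ) (E : V →L[ℝ] V), l ≠ 0 ∧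
      R f = l • (θ.smulRight P + E) ∧ ‖P - p s‖ ≤ δ ∧
      ‖θ - η t‖ ≤ δ ∧ ‖E‖ ≤ δ * (1 / 2) ^ f.toWord.length

/-- The line of `y` passes close to `p`. -/
def NearLine (δ : ℝ) (p y : V) : Prop := ∃ c : ℝ, c ≠ 0 ∧ ‖c • y - p‖ ≤ δ

theorem exists_isPingPong [Finite α] (p : α × Bool → V) (η : α × Bool → V →L[ℝ] ℝ)
    (hr : ∀ s t, t ≠ FreeGroup.invLetter s → η s (p t) ≠ 0) {δ : ℝ} (hδ : 0 < δ) :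
    ∃ ε > 0, ∀ R : FreeGroup α →* (V →L[ℝ] V),
      (∀ s, ∃ c : ℝ, c ≠ 0 ∧
        ‖c • R (FreeGroup.ofLetter s) - (η s).smulRight (p s)‖ ≤ ε) →
      IsPingPong R p η δ := by
  obtain ⟨ε, hε, H⟩ := exists_nearlyRankOne_words
    (fun s t => t ≠ FreeGroup.invLetter s) p η hr hδ
  refine ⟨ε, hε, fun R hR f s t hs ht => ?_⟩
  have hL : f.toWord ≠ [] := by
    intro h; simp [FreeGroup.firstLetter, h] at hs
  have hch : f.toWord.IsChain (fun s t => t ≠ FreeGroup.invLetter s) := by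
    refine (FreeGroup.isReduced_toWord (x := f)).imp ?_
    rintro a b hab rfl
    simp [FreeGroup.invLetter] at hab
  have hprod : (f.toWord.map fun s => R (FreeGroup.ofLetter s)).prod = R f := by
    have : ∀ L : List (α × Bool), (L.map fun s => R (FreeGroup.ofLetter s)).prod =
        R (FreeGroup.mk L) := by
      intro L
      induction L with
      | nil => simp [← FreeGroup.one_eq_mk]
      | cons s L ih =>
        rw [List.map_cons, List.prod_cons, ih, ← map_mul, FreeGroup.ofLetter, FreeGroup.mul_mk,
          List.singleton_append]
    rw [this, FreeGroup.mk_toWord]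
  have hhead : f.toWord.head hL = s := by
    rw [FreeGroup.firstLetter, List.head?_eq_some_head hL] at hs
    simpa using hs
  have hlast : f.toWord.getLast hL = t := by
    rw [FreeGroup.firstLetter, FreeGroup.toWord_inv] at ht
    have h1 := congrArg (Option.map FreeGroup.invLetter) ht
    rw [Option.map_some, FreeGroup.invLetter_invLetter] at h1
    simp only [FreeGroup.invRev, List.head?_reverse, List.getLast?_map, Option.map_map] at h1
    rw [List.getLast?_eq_some_getLast hL] at h1
    simpa [FreeGroup.invLetter] using h1
  obtain ⟨l, P, θ, E, h1, h2, h3, h4, h5⟩ := H (fun s => R (FreeGroup.ofLetter s)) hR _ hL hch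
  exact ⟨l, P, θ, E, h1, hprod ▸ h2, hhead ▸ h3, hlast ▸ h4, h5⟩

theorem exists_last {f : FreeGroup α} (hf : f ≠ 1) :
    ∃ t, f⁻¹.firstLetter = some (FreeGroup.invLetter t) := by
  obtain ⟨t, ht⟩ := FreeGroup.exists_firstLetter (inv_ne_one.2 hf)
  exact ⟨FreeGroup.invLetter t, by rw [ht, FreeGroup.invLetter_invLetter]⟩

variable {R : FreeGroup α →* (V →L[ℝ] V)} {p : α × Bool → V} {η : α × Bool → V →L[ℝ] ℝ}
  {δ : ℝ}

theorem IsPingPong.nearLine [FiniteDimensional ℝ V] (hR : IsPingPong R p η δ) (hδ : 0 < δ)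
    (hp : ∀ s, 2 * δ ≤ ‖p s‖) (hη : ∀ s, 2 * δ ≤ ‖η s‖) {f : FreeGroup α} {s : α × Bool}
    (hs : f.firstLetter = some s) {y : V} (hy : IsLimitVector (R f) y) :
    NearLine δ (p s) y := by
  obtain ⟨hy0, n, κ, B, hn, hB, x, rfl⟩ := hy
  have hf : f ≠ 1 := by rintro rfl; simp [FreeGroup.firstLetter] at hs
  have hdat : ∀ j, ∃ (l : ℝ) (P : V) (θ : V →L[ℝ] ℝ) (E : V →L[ℝ] V),
      R f ^ n (j + 1) = l • (θ.smulRight P + E) ∧ ‖P - p s‖ ≤ δ ∧ δ ≤ ‖θ‖ ∧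
      ‖E‖ ≤ δ * (1 / 2) ^ (j + 1) := by
    intro j
    have hj : j + 1 ≤ n (j + 1) := hn.id_le (j + 1)
    have hpl := FreeGroup.firstLetter_pow_and_length hf (n (j + 1)) (by omega)
    have hf' : f ^ n (j + 1) ≠ 1 := by
      intro h
      have := hpl.2
      rw [h, FreeGroup.toWord_one] at this
      simp at this; omega
    obtain ⟨t, ht⟩ := exists_last hf'
    obtain ⟨l, P, θ, E, -, h2, h3, h4, h5⟩ := hR _ s t (hpl.1.trans hs) ht
    refine ⟨l, P, θ, E, by rw [← map_pow, h2], h3, le_norm_of_norm_sub_le h4 (hη t), h5.trans ?_⟩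
    exact mul_le_mul_of_nonneg_left
      (pow_le_pow_of_le_one (by norm_num) (by norm_num) (hj.trans hpl.2)) hδ.le
  choose l P θ E hpow hP hθ hE using hdat
  have hPb : Bornology.IsBounded (Set.range P) := by
    refine (Metric.isBounded_closedBall (x := p s) (r := δ)).subset ?_
    rintro _ ⟨j, rfl⟩
    simpa [dist_eq_norm] using hP j
  have : ProperSpace V := FiniteDimensional.proper ℝ _
  obtain ⟨P₀, -, φ, hφ, hP₀⟩ := tendsto_subseq_of_bounded hPb (fun n => Set.mem_range_self n)
  have hP₀s : ‖P₀ - p s‖ ≤ δ := le_of_tendsto (hP₀.sub_const _).norm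
    (Eventually.of_forall fun j => hP (φ j))
  have hP₀0 : P₀ ≠ 0 := by
    have := le_norm_of_norm_sub_le hP₀s (hp s)
    rintro rfl
    simp at this; linarith
  set A : ℕ → ℝ := fun j => κ (j + 1) * l j with hA
  have hlim : Tendsto (fun j => A j • ((θ j).smulRight (P j) + E j)) atTop (𝓝 B) := by
    refine ((tendsto_add_atTop_iff_nat 1).2 hB).congr fun j => ?_
    rw [hpow, smul_smul]
  have hE0 : Tendsto (fun j => ‖E j‖) atTop (𝓝 0) := by
    refine squeeze_zero (fun _ => norm_nonneg _) hE ?_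
    have := (tendsto_pow_atTop_nhds_zero_of_lt_one (r := (1 / 2 : ℝ)) (by norm_num)
      (by norm_num)).const_mul δ
    rw [mul_zero] at this
    exact (tendsto_add_atTop_iff_nat 1).2 this
  have hAE : Tendsto (fun j => A j • E j) atTop (𝓝 0) := by
    refine squeeze_zero_norm' (a := fun j => ((‖B‖ + 1) / (δ * δ / 2)) * ‖E j‖) ?_ ?_
    · filter_upwards [hE0.eventually_lt_const (u := δ * δ / 2) (by positivity),
        hlim.norm.eventually_lt_const (u := ‖B‖ + 1) (by linarith)] with j h1 h2
      have h3 : δ * δ / 2 ≤ ‖(θ j).smulRight (P j) + E j‖ := by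
        have h4 := norm_sub_le_norm_add ((θ j).smulRight (P j)) (E j)
        rw [ContinuousLinearMap.norm_smulRight_apply] at h4
        have h5 : δ * δ ≤ ‖θ j‖ * ‖P j‖ :=
          mul_le_mul (hθ j) (le_norm_of_norm_sub_le (hP j) (hp s)) hδ.le (norm_nonneg _)
        linarith
      rw [norm_smul] at h2 ⊢
      gcongr
      rw [le_div_iff₀ (by positivity)]
      calc ‖A j‖ * (δ * δ / 2) ≤ ‖A j‖ * ‖(θ j).smulRight (P j) + E j‖ := by gcongr
        _ ≤ _ := h2.le
    · simpa using hE0.const_mul ((‖B‖ + 1) / (δ * δ / 2))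
  have hfin : Tendsto (fun j => (A j * θ j x) • P j) atTop (𝓝 (B x)) := by
    have h1 := hlim.sub hAE
    rw [sub_zero] at h1
    have h2 := ((ContinuousLinearMap.apply ℝ V x).continuous.tendsto B).comp h1
    refine h2.congr fun j => ?_
    simp [smul_smul]
  obtain ⟨c, hc, -⟩ := exists_smul_eq_of_tendsto_smul hP₀0 hP₀
    (hfin.comp hφ.tendsto_atTop)
  have hc0 : c ≠ 0 := by
    rintro rfl; rw [zero_smul] at hc; exact hy0 hc
  refine ⟨c⁻¹, inv_ne_zero hc0, ?_⟩
  rw [hc, smul_smul, inv_mul_cancel₀ hc0, one_smul]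
  exact hP₀s

/-- Two vectors staying near the tip of a common reduced ray are parallel. -/
theorem IsPingPong.parallel_of_ray [Finite α] [FiniteDimensional ℝ V]
    (hR : IsPingPong R p η δ) (hδ : 0 < δ)
    (hp : ∀ s, 2 * δ ≤ ‖p s‖) {κ : ℝ} (hκ : 0 < κ)
    (hηp : ∀ s t, t ≠ FreeGroup.invLetter s → ∀ (θ : V →L[ℝ] ℝ) (v : V), ‖θ - η s‖ ≤ δ →
      ‖v - p t‖ ≤ δ → κ ≤ |θ v|)
    {f : ℕ → FreeGroup α} {t : ℕ → α × Bool} {φ : ℕ → ℕ} (hφ : StrictMono φ)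
    (hf : ∀ k, (f k).toWord.length = k ∧ (f k)⁻¹.firstLetter ≠ some (t k))
    {z z' : V} (hz : ∀ k, NearLine δ (p (t (φ k))) (R (f (φ k))⁻¹ z))
    (hz' : ∀ k, NearLine δ (p (t (φ k))) (R (f (φ k))⁻¹ z')) :
    ∃ c : ℝ, c ≠ 0 ∧ z = c • z' := by
  obtain ⟨C, hC⟩ : ∃ C : ℝ, ∀ s, ‖p s‖ ≤ C := by
    obtain ⟨C, hC⟩ := (Set.finite_range fun s => ‖p s‖).bddAbove
    exact ⟨C, fun s => hC ⟨s, rfl⟩⟩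
  have hdat : ∀ k, ∃ (P : V) (E : V →L[ℝ] V) (s : α × Bool), ‖P - p s‖ ≤ δ ∧
      ‖E‖ ≤ δ * (1 / 2) ^ k ∧ ∀ y, NearLine δ (p (t (φ (k + 1)))) (R (f (φ (k + 1)))⁻¹ y) →
        ∃ (a : ℝ) (v : V), ‖v‖ ≤ (C + δ) / κ ∧ a • y = P + E v := by
    intro k
    set g := f (φ (k + 1)) with hg
    have hlen : g.toWord.length = φ (k + 1) := (hf _).1
    have hk : k + 1 ≤ φ (k + 1) := hφ.id_le (k + 1)
    have hg1 : g ≠ 1 := by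
      intro h; rw [h, FreeGroup.toWord_one] at hlen; simp at hlen; omega
    obtain ⟨s, hs⟩ := FreeGroup.exists_firstLetter hg1
    obtain ⟨s', hs'⟩ := exists_last hg1
    obtain ⟨l, P, θ, E, hl, h2, h3, h4, h5⟩ := hR g s s' hs hs'
    refine ⟨P, E, s, h3, h5.trans ?_, ?_⟩
    · exact mul_le_mul_of_nonneg_left
        (pow_le_pow_of_le_one (by norm_num) (by norm_num) (by omega)) hδ.le
    · rintro y ⟨c, hc, hcy⟩
      set v := c • R g⁻¹ y with hv
      have hne : t (φ (k + 1)) ≠ FreeGroup.invLetter s' := by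
        intro h
        apply (hf (φ (k + 1))).2
        rw [← hg, hs', h]
      have hθv := hηp s' _ hne θ v h4 hcy
      have hθ0 : θ v ≠ 0 := abs_pos.1 (hκ.trans_le hθv)
      have hgv : R g v = c • y := by
        rw [hv, map_smul, ← mul_apply_eq_comp, ← map_mul, mul_inv_cancel, map_one,
          one_apply_eq_self]
      refine ⟨(θ v)⁻¹ * (l⁻¹ * c), (θ v)⁻¹ • v, ?_, ?_⟩
      · rw [norm_smul, norm_inv, Real.norm_eq_abs, inv_mul_eq_div]
        have hvC : ‖v‖ ≤ C + δ := by
          calc ‖v‖ = ‖p (t (φ (k + 1))) + (v - p (t (φ (k + 1))))‖ := by rw [add_sub_cancel]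
            _ ≤ _ := norm_add_le _ _
            _ ≤ _ := add_le_add (hC _) hcy
        have : 0 ≤ C + δ := (norm_nonneg _).trans hvC
        gcongr
      · rw [mul_smul, mul_smul, ← hgv, h2, smul_apply, smul_smul l⁻¹, inv_mul_cancel₀ hl,
          one_smul, add_apply, ContinuousLinearMap.smulRight_apply, smul_add, smul_smul,
          inv_mul_cancel₀ hθ0, one_smul, ← map_smul]
  choose P E s hP hE hvec using hdat
  have hE0 : Tendsto (fun j => ‖E j‖) atTop (𝓝 0) := by
    refine squeeze_zero (fun _ => norm_nonneg _) hE ?_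
    have := (tendsto_pow_atTop_nhds_zero_of_lt_one (r := (1 / 2 : ℝ)) (by norm_num)
      (by norm_num)).const_mul δ
    rwa [mul_zero] at this
  have hPb : Bornology.IsBounded (Set.range P) := by
    refine (Metric.isBounded_closedBall (x := (0 : V)) (r := C + δ)).subset ?_
    rintro _ ⟨j, rfl⟩
    rw [mem_closedBall_zero_iff]
    calc ‖P j‖ = ‖p (s j) + (P j - p (s j))‖ := by rw [add_sub_cancel]
      _ ≤ _ := norm_add_le _ _
      _ ≤ _ := add_le_add (hC _) (hP j)
  have : ProperSpace V := FiniteDimensional.proper ℝ _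
  obtain ⟨P₀, -, ψ, hψ, hP₀⟩ := tendsto_subseq_of_bounded hPb (fun n => Set.mem_range_self n)
  have hP₀0 : P₀ ≠ 0 := by
    have h1 : δ ≤ ‖P₀‖ := ge_of_tendsto hP₀.norm (Eventually.of_forall fun j =>
      le_norm_of_norm_sub_le (hP (ψ j)) (hp _))
    rintro rfl
    simp at h1; linarith
  have key : ∀ y, (∀ k, NearLine δ (p (t (φ k))) (R (f (φ k))⁻¹ y)) →
      ∃ c : ℝ, P₀ = c • y := by
    intro y hy
    choose a v hv hav using fun k => hvec k y (hy (k + 1))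
    have hEv : Tendsto (fun k => E k (v k)) atTop (𝓝 0) := by
      refine squeeze_zero_norm (a := fun k => ‖E k‖ * ((C + δ) / κ)) (fun k => ?_) ?_
      · exact ((E k).le_opNorm _).trans (by gcongr; exact hv k)
      · simpa using hE0.mul_const ((C + δ) / κ)
    have h1 : Tendsto (fun k => a (ψ k) • y) atTop (𝓝 P₀) := by
      have := hP₀.add (hEv.comp hψ.tendsto_atTop)
      rw [add_zero] at this
      exact this.congr fun k => (hav (ψ k)).symm
    have hy0 : y ≠ 0 := by
      rintro rfl
      simp only [smul_zero] at h1
      exact hP₀0 (tendsto_nhds_unique h1 tendsto_const_nhds)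
    obtain ⟨c, hc, -⟩ := exists_smul_eq_of_tendsto_smul hy0 tendsto_const_nhds h1
    exact ⟨c, hc⟩
  obtain ⟨c, hc⟩ := key z hz
  obtain ⟨c', hc'⟩ := key z' hz'
  have hc0 : c ≠ 0 := by rintro rfl; exact hP₀0 (by rw [hc, zero_smul])
  have hc'0 : c' ≠ 0 := by rintro rfl; exact hP₀0 (by rw [hc', zero_smul])
  refine ⟨c⁻¹ * c', mul_ne_zero (inv_ne_zero hc0) hc'0, ?_⟩
  rw [mul_smul, ← hc', hc, smul_smul, inv_mul_cancel₀ hc0, one_smul]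

end PingPong

section RigidCompactness
variable {V : Type*} [NormedAddCommGroup V] [NormedSpace ℝ V] [FiniteDimensional ℝ V]
  {S : Type*} [DecidableEq S]

/-- Any at most `dim V` of the vectors are linearly independent. -/
def InGeneralPosition (p : S → V) : Prop :=
  ∀ F : Finset S, F.card ≤ Module.finrank ℝ V → LinearIndepOn ℝ p (F : Set S)

theorem InGeneralPosition.span_eq_top {p : S → V} (hp : InGeneralPosition p) {F : Finset S}
    (hF : Module.finrank ℝ V ≤ F.card) : Submodule.span ℝ (p '' F) = ⊤ := by
  obtain ⟨F', hF', hc⟩ := Finset.exists_subset_card_eq hF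
  have h1 := hp F' hc.le
  have h2 : Submodule.span ℝ (p '' F') = ⊤ := by
    have := LinearIndependent.span_eq_top_of_card_eq_finrank' h1 (by simpa using hc)
    rw [← this]
    congr 1
    ext; simp
  rw [eq_top_iff, ← h2]
  exact Submodule.span_mono (Set.image_mono hF')

theorem InGeneralPosition.card_lt {p : S → V} (hp : InGeneralPosition p) {F : Finset S}
    {W : Submodule ℝ V} (hW : W ≠ ⊤) (h : ∀ s ∈ F, p s ∈ W) : F.card < Module.finrank ℝ V := by
  by_contra! hF
  apply hW
  rw [eq_top_iff, ← hp.span_eq_top hF, Submodule.span_le]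
  rintro _ ⟨s, hs, rfl⟩
  exact h s hs

theorem InGeneralPosition.eq_of_smul {p : S → V} (hp : InGeneralPosition p)
    (hN : 2 ≤ Module.finrank ℝ V) {s t : S} {c : ℝ} (h : p s = c • p t) : s = t := by
  by_contra hst
  have h1 := hp {s, t} ((Finset.card_le_two).trans hN)
  rw [Finset.coe_pair, LinearIndepOn.pair_iff _ hst] at h1
  have := h1 1 (-c) (by rw [h]; simp)
  simp at this

theorem InGeneralPosition.ne_zero {p : S → V} (hp : InGeneralPosition p)
    (hN : 1 ≤ Module.finrank ℝ V) (s : S) : p s ≠ 0 := by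
  have h1 := hp {s} (by simpa using hN)
  exact h1.ne_zero (by simp)

theorem InGeneralPosition.injective_of_clusters {p : S → V} (hp : InGeneralPosition p)
    (hN : 2 ≤ Module.finrank ℝ V) {r : ℕ}
    (hr : Module.finrank ℝ V * Module.finrank ℝ V + Module.finrank ℝ V ≤ r)
    {s t : Fin r → S} (hs : Function.Injective s)
    (ht : ∀ t₀, 2 * (Finset.univ.filter fun i => t i = t₀).card ≤ r) {A : V →L[ℝ] V}
    (hA : A ≠ 0) {c : Fin r → ℝ} (hc : ∀ i, A (p (s i)) = c i • p (t i)) :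
    Function.Injective A := by
  classical
  by_contra hinj
  set N := Module.finrank ℝ V with hNdef
  set K : Finset (Fin r) := Finset.univ.filter fun i => c i ≠ 0 with hK
  have hker : (Finset.univ.filter fun i => c i = 0).card < N := by
    rw [← Finset.card_image_of_injective _ hs]
    refine hp.card_lt (W := A.toLinearMap.ker) ?_ ?_
    · intro h
      apply hA
      ext v
      have : v ∈ A.toLinearMap.ker := h ▸ Submodule.mem_top
      simpa using this
    · intro x hx
      obtain ⟨i, hi, rfl⟩ := Finset.mem_image.1 hx
      simp only [Finset.mem_filter, Finset.mem_univ, true_and] at hi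
      simp [hc, hi]
  have hKc : r < K.card + N := by
    have := Finset.card_filter_add_card_filter_not (s := (Finset.univ : Finset (Fin r)))
      (fun i => c i = 0)
    simp only [Finset.card_univ, Fintype.card_fin] at this
    rw [hK]; simp only [ne_eq]; omega
  have hmem : ∀ i ∈ K, p (t i) ∈ A.toLinearMap.range := by
    intro i hi
    simp only [hK, Finset.mem_filter, Finset.mem_univ, true_and] at hi
    refine ⟨(c i)⁻¹ • p (s i), ?_⟩
    simp [hc, smul_smul, inv_mul_cancel₀ hi]
  have htK : (K.image t).card < N := by
    refine hp.card_lt (W := A.toLinearMap.range) ?_ ?_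
    · intro h
      exact hinj (LinearMap.injective_iff_surjective.2 (LinearMap.range_eq_top.1 h))
    · intro x hx
      obtain ⟨i, hi, rfl⟩ := Finset.mem_image.1 hx
      exact hmem i hi
  obtain ⟨t₀, -, ht₀⟩ := Finset.exists_lt_card_fiber_of_mul_lt_card_of_maps_to
    (s := K) (t := K.image t) (f := t) (n := N - 1) (fun i hi => Finset.mem_image_of_mem t hi) (by
      calc (K.image t).card * (N - 1) ≤ N * N := Nat.mul_le_mul htK.le (by omega)
        _ < K.card := by omega)
  have hrange : ∀ v, A v ∈ Submodule.span ℝ {p t₀} := by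
    have h1 := hp.span_eq_top (F := (K.filter fun i => t i = t₀).image s)
      (by rw [Finset.card_image_of_injective _ hs]; omega)
    intro v
    have hv : v ∈ Submodule.span ℝ (p '' ((K.filter fun i => t i = t₀).image s : Finset S)) :=
      h1 ▸ Submodule.mem_top
    have hle : Submodule.span ℝ (p '' ((K.filter fun i => t i = t₀).image s : Finset S)) ≤
        (Submodule.span ℝ {p t₀}).comap A.toLinearMap := by
      rw [Submodule.span_le]
      rintro _ ⟨x, hx, rfl⟩
      rw [Finset.mem_coe] at hx
      obtain ⟨i, hi, rfl⟩ := Finset.mem_image.1 hx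
      have hti := (Finset.mem_filter.1 hi).2
      change A (p (s i)) ∈ Submodule.span ℝ {p t₀}
      rw [hc, hti]
      exact Submodule.smul_mem _ _ (Submodule.mem_span_singleton_self _)
    exact hle hv
  have hall : ∀ i ∈ K, t i = t₀ := by
    intro i hi
    obtain ⟨v, hv⟩ := hmem i hi
    have := hrange v
    obtain ⟨a, ha⟩ := Submodule.mem_span_singleton.1 this
    refine hp.eq_of_smul hN (c := a) ?_
    rw [ha]; exact hv.symm
  have hfin : K.card ≤ (Finset.univ.filter fun i => t i = t₀).card :=
    Finset.card_le_card fun i hi => by simp [hall i hi]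
  have := ht t₀
  nlinarith

set_option maxHeartbeats 800000 in
theorem exists_scalar_of_tendsto {Γ : Type*} [Group Γ] {ρ : Γ →* (V →L[ℝ] V)} {p : S → V}
    (hp : InGeneralPosition p) (hN : 2 ≤ Module.finrank ℝ V) {k₀ r : ℕ}
    (hr : Module.finrank ℝ V * Module.finrank ℝ V + Module.finrank ℝ V ≤ r) (hkr : k₀ ≤ r)
    (hrig : ∀ T : V →L[ℝ] V, Function.Injective T → ∀ F : Finset S, k₀ ≤ F.card →
      (∀ s ∈ F, ∃ t, ∃ c : ℝ, c ≠ 0 ∧ T (p s) = c • p t) → ∃ c : ℝ, T = c • 1)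
    (hdet : ∀ γ, |(ρ γ).det| = 1) (hdisc : ∀ C : ℝ, {T | ‖T‖ ≤ C ∧ ∃ γ, ρ γ = T}.Finite)
    {s t : Fin r → S} (hs : Function.Injective s)
    (ht : ∀ t₀, 2 * (Finset.univ.filter fun i => t i = t₀).card ≤ r)
    {g : ℕ → Γ} {y : ℕ → Fin r → V} {c : ℕ → Fin r → ℝ} (hc : ∀ k i, c k i ≠ 0)
    (hy : ∀ i, Tendsto (fun k => y k i) atTop (𝓝 (p (s i))))
    (hgy : ∀ i, Tendsto (fun k => c k i • ρ (g k) (y k i)) atTop (𝓝 (p (t i)))) :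
    ∃ k, ∃ a : ℝ, ρ (g k) = a • 1 := by
  have hne : Nontrivial V := Module.nontrivial_of_finrank_pos (R := ℝ) (by omega)
  have hT0 : ∀ γ, ρ γ ≠ 0 := by
    intro γ h
    have := hdet γ
    rw [h, show (0 : V →L[ℝ] V).det = 0 from by
      rw [ContinuousLinearMap.det, ContinuousLinearMap.toLinearMap_zero, LinearMap.det_zero,
        zero_pow (by omega)]] at this
    simp at this
  set B : ℕ → (V →L[ℝ] V) := fun k => ‖ρ (g k)‖⁻¹ • ρ (g k) with hB
  have hB1 : ∀ k, ‖B k‖ = 1 := fun k => by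
    rw [hB, norm_smul, norm_inv, norm_norm, inv_mul_cancel₀ (norm_ne_zero_iff.2 (hT0 _))]
  have : ProperSpace (V →L[ℝ] V) := FiniteDimensional.proper ℝ _
  obtain ⟨A, -, φ, hφ, hA⟩ := tendsto_subseq_of_bounded (x := B)
    (Metric.isBounded_closedBall (x := (0 : V →L[ℝ] V)) (r := 1)) (fun k => by
      rw [mem_closedBall_zero_iff, hB1])
  have hA1 : ‖A‖ = 1 := tendsto_nhds_unique hA.norm (by simp [hB1])
  have hA0 : A ≠ 0 := by rintro rfl; simp at hA1
  have hAp : ∀ i, ∃ a : ℝ, A (p (s i)) = a • p (t i) := by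
    intro i
    have h1 : Tendsto (fun k => B (φ k) (y (φ k) i)) atTop (𝓝 (A (p (s i)))) :=
      ((isBoundedBilinearMap_apply (𝕜 := ℝ) (E := V) (F := V)).continuous.tendsto
        (A, p (s i))).comp (hA.prodMk_nhds ((hy i).comp hφ.tendsto_atTop))
    obtain ⟨a, ha, -⟩ := exists_smul_eq_of_tendsto_smul
      (a := fun k => ‖ρ (g (φ k))‖⁻¹ * (c (φ k) i)⁻¹)
      (w := fun k => c (φ k) i • ρ (g (φ k)) (y (φ k) i)) (hp.ne_zero (by omega) (t i))
      ((hgy i).comp hφ.tendsto_atTop)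
      (h1.congr fun k => by
        rw [mul_smul, smul_smul (c (φ k) i)⁻¹, inv_mul_cancel₀ (hc _ _), one_smul]; rfl)
    exact ⟨a, ha⟩
  choose a ha using hAp
  have hinj : Function.Injective A := hp.injective_of_clusters hN hr hs ht hA0 ha
  have hdetA : A.det ≠ 0 := by
    have := LinearMap.isUnit_det A.toLinearMap
      ((LinearMap.isUnit_iff_ker_eq_bot _).2 (LinearMap.ker_eq_bot.2 hinj))
    exact this.ne_zero
  have hdetlim := ((ContinuousLinearMap.continuous_det (E := V)).tendsto A).comp hA
  have hdetB : ∀ k, |(B k).det| = (‖ρ (g k)‖⁻¹) ^ Module.finrank ℝ V := by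
    intro k
    rw [hB, ContinuousLinearMap.det, ContinuousLinearMap.toLinearMap_smul, LinearMap.det_smul,
      abs_mul, ← ContinuousLinearMap.det, hdet, mul_one, abs_of_nonneg (by positivity)]
  set N := Module.finrank ℝ V
  have hbd : ∃ C : ℝ, ∀ᶠ k in atTop, ‖ρ (g (φ k))‖ ≤ C := by
    set b := |A.det| / 2 with hb
    have hbpos : 0 < b := by have := abs_pos.2 hdetA; positivity
    refine ⟨max 1 b⁻¹, ?_⟩
    filter_upwards [hdetlim.abs.eventually_const_lt (u := b) (by
      have := abs_pos.2 hdetA; rw [hb]; linarith)] with k hk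
    simp only [Function.comp_apply, hdetB] at hk
    have hpos : 0 < ‖ρ (g (φ k))‖ := norm_pos_iff.2 (hT0 _)
    by_cases h1 : ‖ρ (g (φ k))‖ ≤ 1
    · exact h1.trans (le_max_left _ _)
    · refine le_trans ?_ (le_max_right _ _)
      rw [le_inv_comm₀ hpos hbpos]
      refine hk.le.trans ?_
      refine pow_le_of_le_one (by positivity) ?_ (by omega)
      exact inv_le_one_of_one_le₀ (not_le.1 h1).le
  obtain ⟨C, hC⟩ := hbd
  obtain ⟨T, hT⟩ : ∃ T, ∃ᶠ k in atTop, ρ (g (φ k)) = T := by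
    by_contra! hcon
    have h1 : ∀ᶠ k in atTop, ∀ T ∈ {T | ‖T‖ ≤ C ∧ ∃ γ, ρ γ = T}, ρ (g (φ k)) ≠ T :=
      (eventually_all_finite (hdisc C)).2 fun T _ => hcon T
    obtain ⟨k, hk1, hk2⟩ := (h1.and hC).exists
    exact hk1 _ ⟨hk2, _, rfl⟩ rfl
  have hAT : A = ‖T‖⁻¹ • T := by
    have h1 : ∃ᶠ k in atTop, B (φ k) ∈ ({‖T‖⁻¹ • T} : Set (V →L[ℝ] V)) :=
      hT.mono fun k hk => by simp [hB, hk]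
    exact (isClosed_singleton (x := ‖T‖⁻¹ • T)).mem_of_frequently_of_tendsto h1 hA
  obtain ⟨k, hk⟩ := hT.exists
  have hai : ∀ i, a i ≠ 0 := by
    intro i hi
    have h1 := ha i
    rw [hi, zero_smul, ← map_zero A] at h1
    exact hp.ne_zero (by omega) _ (hinj h1)
  obtain ⟨c', hc'⟩ := hrig A hinj (Finset.univ.image s)
    (by rw [Finset.card_image_of_injective _ hs]; simpa using hkr) (by
      intro x hx
      obtain ⟨i, -, rfl⟩ := Finset.mem_image.1 hx
      exact ⟨t i, a i, hai i, ha i⟩)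
  refine ⟨φ k, ‖T‖ * c', ?_⟩
  have hTn : ‖T‖ ≠ 0 := by rw [← hk]; exact norm_ne_zero_iff.2 (hT0 _)
  rw [hk, mul_smul, ← hc', hAT, smul_smul, mul_inv_cancel₀ hTn, one_smul]

end RigidCompactness

section FewStabilizerLetters
variable {V : Type*} [NormedAddCommGroup V] [NormedSpace ℝ V]
  {α : Type} [DecidableEq α]

theorem NearLine.of_smul {δ a : ℝ} {p y : V} (ha : a ≠ 0) (h : NearLine δ p (a • y)) :
    NearLine δ p y := by
  obtain ⟨c, hc, h⟩ := h
  exact ⟨c * a, mul_ne_zero hc ha, by rwa [mul_smul]⟩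

/-- Smallness conditions on the ping-pong parameter. -/
structure IsSmallFor (p : α × Bool → V) (η : α × Bool → V →L[ℝ] ℝ) (κ δ : ℝ) : Prop where
  pos : 0 < δ
  le_p : ∀ s, 2 * δ ≤ ‖p s‖
  le_η : ∀ s, 2 * δ ≤ ‖η s‖
  le_mul : ∀ s t, 8 * δ ≤ ‖η t‖ * ‖p s‖
  le_apply : ∀ s t, t ≠ FreeGroup.invLetter s → ∀ (θ : V →L[ℝ] ℝ) (v : V), ‖θ - η s‖ ≤ δ →
      ‖v - p t‖ ≤ δ → κ ≤ |θ v|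
  eq_of_nearLine : ∀ s t y, NearLine δ (p s) y → NearLine δ (p t) y → s = t

theorem exists_isSmallFor [Finite α] {p : α × Bool → V} {η : α × Bool → V →L[ℝ] ℝ}
    (hp0 : ∀ s, p s ≠ 0) (hη0 : ∀ s, η s ≠ 0)
    (hpp : ∀ s t (c : ℝ), p s = c • p t → s = t)
    (hr : ∀ s t, t ≠ FreeGroup.invLetter s → η s (p t) ≠ 0) :
    ∃ κ > 0, ∀ᶠ δ in 𝓝[>] (0 : ℝ), IsSmallFor p η κ δ := by
  have hlin : ∀ (a : ℝ) {b : ℝ}, 0 < b → ∀ᶠ δ in 𝓝[>] (0 : ℝ), a * δ ≤ b := by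
    intro a b hb
    have h1 : Tendsto (fun δ : ℝ => a * δ) (𝓝[>] 0) (𝓝 (a * 0)) :=
      (tendsto_id.const_mul a).mono_left nhdsWithin_le_nhds
    rw [mul_zero] at h1
    exact h1.eventually_le_const hb
  obtain ⟨κ, hκ, hκ'⟩ : ∃ κ > 0, ∀ s t, t ≠ FreeGroup.invLetter s → κ < |η s (p t)| := by
    have : ∀ᶠ κ in 𝓝[>] (0 : ℝ), ∀ s t, t ≠ FreeGroup.invLetter s → κ < |η s (p t)| := by
      refine eventually_all.2 fun s => eventually_all.2 fun t => ?_
      by_cases h : t = FreeGroup.invLetter s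
      · simp [h]
      · filter_upwards [hlin 2 (abs_pos.2 (hr s t h)), self_mem_nhdsWithin] with κ h1 h2 _
        simp only [Set.mem_Ioi] at h2
        linarith
    obtain ⟨κ, h1, h2⟩ := (this.and self_mem_nhdsWithin).exists
    exact ⟨κ, h2, h1⟩
  refine ⟨κ, hκ, ?_⟩
  have happ : ∀ᶠ δ in 𝓝[>] (0 : ℝ), ∀ s t, t ≠ FreeGroup.invLetter s →
      ∀ (θ : V →L[ℝ] ℝ) (v : V), ‖θ - η s‖ ≤ δ → ‖v - p t‖ ≤ δ → κ ≤ |θ v| := by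
    refine eventually_all.2 fun s => eventually_all.2 fun t => ?_
    by_cases h : t = FreeGroup.invLetter s
    · simp [h]
    · have hc : Continuous fun q : (V →L[ℝ] ℝ) × V => |q.1 q.2| :=
        (isBoundedBilinearMap_apply (𝕜 := ℝ) (E := V) (F := ℝ)).continuous.abs
      have h1 := (hc.tendsto (η s, p t)).eventually_const_lt (hκ' s t h)
      obtain ⟨ε, hε, h2⟩ := Metric.eventually_nhds_iff_ball.1 h1
      filter_upwards [hlin 2 hε, self_mem_nhdsWithin] with δ h3 h4 _ θ v hθ hv
      simp only [Set.mem_Ioi] at h4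
      refine (h2 (θ, v) ?_).le
      rw [Metric.mem_ball, Prod.dist_eq, max_lt_iff, dist_eq_norm, dist_eq_norm]
      constructor <;> simp only <;> linarith
  have hcone : ∀ᶠ δ in 𝓝[>] (0 : ℝ), ∀ s t, s ≠ t → ∀ y, NearLine δ (p s) y →
      ¬ NearLine δ (p t) y := by
    refine eventually_all.2 fun s => eventually_all.2 fun t => ?_
    by_cases h : s = t
    · simp [h]
    · by_contra hcon
      rw [not_eventually] at hcon
      obtain ⟨d, hd, hd'⟩ := exists_seq_forall_of_frequently hcon
      push Not at hd'
      choose _ y hs ht using hd'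
      choose a ha ha' using hs
      choose b hb hb' using ht
      have hd0 : Tendsto d atTop (𝓝 0) := hd.mono_right nhdsWithin_le_nhds
      have h1 : Tendsto (fun k => a k • y k) atTop (𝓝 (p s)) :=
        tendsto_iff_norm_sub_tendsto_zero.2 (squeeze_zero (fun _ => norm_nonneg _) ha' hd0)
      have h2 : Tendsto (fun k => b k • y k) atTop (𝓝 (p t)) :=
        tendsto_iff_norm_sub_tendsto_zero.2 (squeeze_zero (fun _ => norm_nonneg _) hb' hd0)
      obtain ⟨c, hc, -⟩ := exists_smul_eq_of_tendsto_smul (a := fun k => a k * (b k)⁻¹) (hp0 t) h2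
        (h1.congr fun k => by
          rw [smul_smul, mul_assoc, inv_mul_cancel₀ (hb k), mul_one])
      exact h (hpp s t c hc)
  filter_upwards [self_mem_nhdsWithin,
    eventually_all.2 fun s => hlin 2 (norm_pos_iff.2 (hp0 s)),
    eventually_all.2 fun s => hlin 2 (norm_pos_iff.2 (hη0 s)),
    eventually_all.2 fun s => eventually_all.2 fun t =>
      hlin 8 (mul_pos (norm_pos_iff.2 (hη0 t)) (norm_pos_iff.2 (hp0 s))), happ, hcone]
    with δ h1 h2 h3 h4 h5 h6
  exact ⟨h1, h2, h3, h4, h5, fun s t y hs ht => by_contra fun h => h6 s t h y hs ht⟩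

theorem IsPingPong.ne_smul_one [FiniteDimensional ℝ V] (hN : 2 ≤ Module.finrank ℝ V)
    {R : FreeGroup α →* (V →L[ℝ] V)}
    {p : α × Bool → V} {η : α × Bool → V →L[ℝ] ℝ} {κ δ : ℝ} (hR : IsPingPong R p η δ)
    (hδ : IsSmallFor p η κ δ) {f : FreeGroup α} (hf : f ≠ 1) (c : ℝ) : R f ≠ c • 1 := by
  intro h
  have hne : Nontrivial V := Module.nontrivial_of_finrank_pos (R := ℝ) (by omega)
  obtain ⟨s, hs⟩ := FreeGroup.exists_firstLetter hf
  obtain ⟨t, ht⟩ := exists_last hf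
  obtain ⟨l, P, θ, E, hl, h2, h3, h4, h5⟩ := hR f s t hs ht
  have hd := hδ.pos
  have hE : ‖E‖ ≤ δ / 2 := by
    refine h5.trans ?_
    have h6 : f.toWord.length ≠ 0 := by
      intro h0
      exact hf (FreeGroup.toWord_eq_nil_iff.1 (List.length_eq_zero_iff.1 h0))
    have : (1 / 2 : ℝ) ^ f.toWord.length ≤ 1 / 2 :=
      pow_le_of_le_one (by norm_num) (by norm_num) h6
    nlinarith
  have hθP : 2 * δ ≤ ‖θ.smulRight P‖ := by
    rw [ContinuousLinearMap.norm_smulRight_apply]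
    have h6 : ‖η t‖ / 2 ≤ ‖θ‖ := by
      have := norm_sub_norm_le (η t) θ
      rw [norm_sub_rev] at this
      have := hδ.le_η t
      linarith
    have h7 : ‖p s‖ / 2 ≤ ‖P‖ := by
      have := norm_sub_norm_le (p s) P
      rw [norm_sub_rev] at this
      have := hδ.le_p s
      linarith
    have h8 := mul_le_mul h6 h7 (by positivity) (by positivity)
    have := hδ.le_mul s t
    linarith
  obtain ⟨v, hv, hv0⟩ : ∃ v, θ v = 0 ∧ v ≠ 0 := by
    have : (LinearMap.ker θ.toLinearMap) ≠ ⊥ := by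
      apply LinearMap.ker_ne_bot_of_finrank_lt
      rw [Module.finrank_self]
      omega
    obtain ⟨v, hv, hv0⟩ := Submodule.exists_mem_ne_zero_of_ne_bot this
    exact ⟨v, hv, hv0⟩
  have h6 : |c| ≤ |l| * (δ / 2) := by
    have h7 : c • v = l • E v := by
      have := congrArg (fun T : V →L[ℝ] V => T v) (h.symm.trans h2)
      simpa [hv] using this
    have h8 := congrArg norm h7
    rw [norm_smul, norm_smul, Real.norm_eq_abs, Real.norm_eq_abs] at h8
    have h9 : |l| * ‖E v‖ ≤ |l| * (δ / 2 * ‖v‖) := by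
      gcongr
      exact (E.le_opNorm v).trans (by gcongr)
    have hv1 : 0 < ‖v‖ := norm_pos_iff.2 hv0
    refine le_of_mul_le_mul_right ?_ hv1
    rw [h8]; linarith
  have h7 : |c| = |l| * ‖θ.smulRight P + E‖ := by
    have := congrArg norm (h.symm.trans h2)
    rwa [norm_smul, norm_smul, norm_one, mul_one, Real.norm_eq_abs, Real.norm_eq_abs] at this
  have h8 : δ ≤ ‖θ.smulRight P + E‖ := by
    have := norm_sub_le_norm_add (θ.smulRight P) E
    linarith
  have h9 : |l| * δ ≤ |c| := by rw [h7]; gcongr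
  have : 0 < |l| := abs_pos.2 hl
  nlinarith

theorem exists_spread_images [FiniteDimensional ℝ V] [Finite α] (hN : 2 ≤ Module.finrank ℝ V)
    {Γ : Type*} [Group Γ] {ρ : Γ →* (V →L[ℝ] V)} {j : FreeGroup α →* Γ}
    {p : α × Bool → V} {η : α × Bool → V →L[ℝ] ℝ} {κ δ : ℝ} (hκ : 0 < κ)
    (hR : IsPingPong (ρ.comp j) p η δ) (hδ : IsSmallFor p η κ δ) {r : ℕ} (hr2 : 2 ≤ r) {γ : Γ}
    {s : Fin r → α × Bool} (hs : Function.Injective s)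
    (h : ∀ i, ∃ u w : FreeGroup α, ∃ c : ℝ, u.firstLetter = some (s i) ∧ c ≠ 0 ∧
      ρ (γ⁻¹ * j u * γ) = c • ρ (j w)) :
    ∃ (f : FreeGroup α) (t : Fin r → α × Bool) (y : Fin r → V) (c : Fin r → ℝ),
      (∀ t₀, 2 * (Finset.univ.filter fun i => t i = t₀).card ≤ r) ∧ (∀ i, c i ≠ 0) ∧
      (∀ i, ‖y i - p (s i)‖ ≤ δ) ∧ ∀ i, ‖c i • ρ (γ * j f)⁻¹ (y i) - p (t i)‖ ≤ δ := by
  have hne : Nontrivial V := Module.nontrivial_of_finrank_pos (R := ℝ) (by omega)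
  have hinv : ∀ a : Γ, ρ a⁻¹ * ρ a = 1 := fun a => by rw [← map_mul, inv_mul_cancel, map_one]
  have hne0 : ∀ a : Γ, ρ a ≠ 0 := by
    intro a ha
    have := hinv a
    rw [ha, mul_zero] at this
    exact zero_ne_one this
  set R := ρ.comp j with hRdef
  choose u w c hus hc hw using h
  have hlim : ∀ i, ∃ y, IsLimitVector (R (u i)) y := by
    intro i
    refine exists_isLimitVector fun n => ?_
    rw [← map_pow]
    exact hne0 _
  choose y hy using hlim
  have hny : ∀ i, NearLine δ (p (s i)) (y i) := fun i =>
    hR.nearLine hδ.pos hδ.le_p hδ.le_η (hus i) (hy i)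
  set z : Fin r → V := fun i => ρ γ⁻¹ (y i) with hz
  have hzlim : ∀ i, IsLimitVector (R (w i)) (z i) := by
    intro i
    refine (hy i).conj (U := ρ γ⁻¹) (U' := ρ γ) (c := (c i)⁻¹) ?_ (inv_ne_zero (hc i)) ?_
    · rw [← map_mul, mul_inv_cancel, map_one]
    · rw [hRdef, MonoidHom.comp_apply, MonoidHom.comp_apply, ← map_mul, ← map_mul, hw, smul_smul,
        inv_mul_cancel₀ (hc i), one_smul]
  have hzconj : ∀ i (f : FreeGroup α), IsLimitVector (R (f⁻¹ * w i * f)) (R f⁻¹ (z i)) := by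
    intro i f
    refine (hzlim i).conj (U := R f⁻¹) (U' := R f) (c := 1) ?_ one_ne_zero ?_
    · rw [← map_mul, mul_inv_cancel, map_one]
    · rw [one_smul, map_mul, map_mul]
  have hw1 : ∀ i, w i ≠ 1 := by
    intro i hi
    have hu1 : u i ≠ 1 := by
      intro h0
      have := hus i
      rw [h0] at this
      simp [FreeGroup.firstLetter] at this
    refine hR.ne_smul_one hN hδ hu1 (c i) ?_
    have h1 := hw i
    rw [hi, map_one, map_one] at h1
    have h2 : ρ (j (u i)) = ρ γ * ρ (γ⁻¹ * j (u i) * γ) * ρ γ⁻¹ := by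
      rw [← map_mul, ← map_mul]; congr 1; group
    rw [hRdef, MonoidHom.comp_apply, h2, h1, mul_smul_comm, mul_one, smul_mul_assoc, ← map_mul,
      mul_inv_cancel, map_one]
  have hnon : Nonempty (Fin r) := ⟨⟨0, by omega⟩⟩
  rcases FreeGroup.exists_spread_or_ray w with ⟨f, hf⟩ | ⟨f, t, hft⟩
  · have hcw : ∀ i, f⁻¹ * w i * f ≠ 1 := by
      intro i hi
      apply hw1 i
      have : w i = f * (f⁻¹ * w i * f) * f⁻¹ := by group
      rw [this, hi]; group
    choose t ht using fun i => FreeGroup.exists_firstLetter (hcw i)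
    have hnt : ∀ i, NearLine δ (p (t i)) (R f⁻¹ (z i)) := fun i =>
      hR.nearLine hδ.pos hδ.le_p hδ.le_η (ht i) (hzconj i f)
    choose a ha ha' using hny
    choose b hb hb' using hnt
    refine ⟨f, t, fun i => a i • y i, fun i => b i * (a i)⁻¹, fun t₀ => ?_,
      fun i => mul_ne_zero (hb i) (inv_ne_zero (ha i)), ha', fun i => ?_⟩
    · have := hf t₀
      simpa [ht] using this
    · convert hb' i using 3
      rw [map_smul, smul_smul, mul_assoc, inv_mul_cancel₀ (ha i), mul_one, mul_inv_rev, map_mul,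
        mul_apply_eq_comp, ← map_inv]
      rfl
  · exfalso
    have hpair : ∃ᶠ k in atTop, ∃ q : Fin r × Fin r, q.1 ≠ q.2 ∧
        ((f k)⁻¹ * w q.1 * f k).firstLetter = some (t k) ∧
        ((f k)⁻¹ * w q.2 * f k).firstLetter = some (t k) := by
      refine Eventually.frequently (Eventually.of_forall fun k => ?_)
      have h1 := (hft k).2.2
      rw [Fintype.card_fin] at h1
      obtain ⟨a, ha, b, hb, hab⟩ := Finset.one_lt_card.1 (show 1 < (Finset.univ.filter fun i =>
        ((f k)⁻¹ * w i * f k).firstLetter = some (t k)).card by omega)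
      simp only [Finset.mem_filter, Finset.mem_univ, true_and] at ha hb
      exact ⟨(a, b), hab, ha, hb⟩
    obtain ⟨q, hq⟩ : ∃ q : Fin r × Fin r, ∃ᶠ k in atTop, q.1 ≠ q.2 ∧
        ((f k)⁻¹ * w q.1 * f k).firstLetter = some (t k) ∧
        ((f k)⁻¹ * w q.2 * f k).firstLetter = some (t k) := by
      by_contra! hcon
      apply hpair
      filter_upwards [eventually_all.2 hcon] with k hk
      rintro ⟨q, h1, h2, h3⟩
      exact hk q h1 h2 h3
    obtain ⟨φ, hφ, hφq⟩ := extraction_of_frequently_atTop hq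
    obtain ⟨c, hc0, hzz⟩ := hR.parallel_of_ray hδ.pos hδ.le_p hκ hδ.le_apply hφ
      (fun k => ⟨(hft k).1, (hft k).2.1⟩)
      (fun k => hR.nearLine hδ.pos hδ.le_p hδ.le_η (hφq k).2.1 (hzconj q.1 (f (φ k))))
      (fun k => hR.nearLine hδ.pos hδ.le_p hδ.le_η (hφq k).2.2 (hzconj q.2 (f (φ k))))
    have hyz : ∀ i, y i = ρ γ (z i) := by
      intro i
      rw [hz, ← mul_apply_eq_comp, ← map_mul, mul_inv_cancel, map_one, one_apply_eq_self]
    have hyy : y q.1 = c • y q.2 := by rw [hyz, hyz, hzz, map_smul]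
    refine (hφq 0).1 (hs ?_)
    refine hδ.eq_of_nearLine _ _ (y q.2) ?_ (hny q.2)
    exact NearLine.of_smul hc0 (hyy ▸ hny q.1)

end FewStabilizerLetters

section SparseLabelling

/-- The elements acting as scalars. -/
def scalarKernel {V : Type*} [NormedAddCommGroup V] [NormedSpace ℝ V] {Γ : Type*} [Group Γ]
    (ρ : Γ →* (V →L[ℝ] V)) : Subgroup Γ where
  carrier := {γ | ∃ c : ℝ, ρ γ = c • 1}
  one_mem' := ⟨1, by rw [map_one, one_smul]⟩
  mul_mem' := by
    rintro a b ⟨c, hc⟩ ⟨d, hd⟩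
    exact ⟨c * d, by rw [map_mul, hc, hd, smul_mul_smul_comm, mul_one]⟩
  inv_mem' := by
    rintro a ⟨c, hc⟩
    by_cases h : c = 0
    · refine ⟨0, ?_⟩
      have h1 : ρ a⁻¹ * ρ a = 1 := by rw [← map_mul, inv_mul_cancel, map_one]
      rw [hc, h, zero_smul, mul_zero] at h1
      have h2 : ρ a⁻¹ = 1 * ρ a⁻¹ := (one_mul _).symm
      rw [h2, ← h1, zero_mul, zero_smul]
    · refine ⟨c⁻¹, ?_⟩
      have h1 : ρ a * ρ a⁻¹ = 1 := by rw [← map_mul, mul_inv_cancel, map_one]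
      rw [hc, smul_mul_assoc, one_mul] at h1
      rw [← h1, smul_smul, inv_mul_cancel₀ h, one_smul]

theorem scalarKernel_normal {V : Type*} [NormedAddCommGroup V] [NormedSpace ℝ V] {Γ : Type*}
    [Group Γ] (ρ : Γ →* (V →L[ℝ] V)) : (scalarKernel ρ).Normal := by
  constructor
  rintro n ⟨c, hc⟩ g
  refine ⟨c, ?_⟩
  rw [map_mul, map_mul, hc, mul_smul_comm, mul_one, smul_mul_assoc, ← map_mul, mul_inv_cancel,
    map_one]

/-- A free subgroup of a quotient of `Γ` such that on every nontrivial coset the letters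
carry a sparse labelling following the rule of `FreeGroup.exists_letter_labelling`. -/
def HasSparseFreeSubgroup (Γ : Type) [Group Γ] (r m : ℕ) : Prop :=
  ∃ (Q : Type) (_ : Group Q) (π : Γ →* Q) (j : FreeGroup (Fin m) →* Γ),
    Function.Surjective π ∧ Function.Injective (π.comp j) ∧
    ∃ A : Q ⧸ (π.comp j).range → Set (Fin m × Bool),
      (∀ ω, ω ≠ ((1 : Q) : Q ⧸ (π.comp j).range) → (A ω).ncard ≤ r) ∧
      ∀ ω s, FreeGroup.invLetter s ∉ A ω → A (π (j (FreeGroup.ofLetter s)) • ω) = {s}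

variable {V : Type*} [NormedAddCommGroup V] [NormedSpace ℝ V] [FiniteDimensional ℝ V]

theorem hasSparseFreeSubgroup {Γ : Type} [Group Γ] {ρ : Γ →* (V →L[ℝ] V)} {m : ℕ}
    {p : Fin m × Bool → V} {η : Fin m × Bool → V →L[ℝ] ℝ}
    (hp : InGeneralPosition p) (hη : ∀ s, η s ≠ 0) (hN : 2 ≤ Module.finrank ℝ V)
    (hpη : ∀ s t, t ≠ FreeGroup.invLetter s → η s (p t) ≠ 0) {k₀ r : ℕ}
    (hr : Module.finrank ℝ V * Module.finrank ℝ V + Module.finrank ℝ V ≤ r) (hkr : k₀ ≤ r)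
    (hrig : ∀ T : V →L[ℝ] V, Function.Injective T → ∀ F : Finset (Fin m × Bool), k₀ ≤ F.card →
      (∀ s ∈ F, ∃ t, ∃ c : ℝ, c ≠ 0 ∧ T (p s) = c • p t) → ∃ c : ℝ, T = c • 1)
    (hdet : ∀ γ, |(ρ γ).det| = 1) (hdisc : ∀ C : ℝ, {T | ‖T‖ ≤ C ∧ ∃ γ, ρ γ = T}.Finite)
    (happ : ∀ ε > 0, ∃ j : FreeGroup (Fin m) →* Γ, ∀ s, ∃ c : ℝ, c ≠ 0 ∧
      ‖c • ρ (j (FreeGroup.ofLetter s)) - (η s).smulRight (p s)‖ ≤ ε) :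
    HasSparseFreeSubgroup Γ r m := by
  classical
  have hne : Nontrivial V := Module.nontrivial_of_finrank_pos (R := ℝ) (by omega)
  obtain ⟨κ, hκ, hsm⟩ := exists_isSmallFor (fun s => hp.ne_zero (by omega) s) hη
    (fun s t c h => hp.eq_of_smul hN h) hpη
  obtain ⟨d, hd, hd'⟩ : ∃ d : ℕ → ℝ, Tendsto d atTop (𝓝 0) ∧ ∀ n, IsSmallFor p η κ (d n) := by
    obtain ⟨d, h1, h2⟩ := exists_seq_forall_of_frequently hsm.frequently
    exact ⟨d, h1.mono_right nhdsWithin_le_nhds, h2⟩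
  have hj : ∀ n, ∃ j : FreeGroup (Fin m) →* Γ, IsPingPong (ρ.comp j) p η (d n) := by
    intro n
    obtain ⟨ε, hε, h⟩ := exists_isPingPong p η hpη (hd' n).pos
    obtain ⟨j, hj⟩ := happ ε hε
    exact ⟨j, h _ hj⟩
  choose j hj using hj
  have hnorm := scalarKernel_normal ρ
  set π : Γ →* Γ ⧸ scalarKernel ρ := QuotientGroup.mk' (scalarKernel ρ) with hπ
  have hπeq : ∀ a b, π a = π b ↔ ∃ c : ℝ, ρ (a⁻¹ * b) = c • 1 := by
    intro a b
    rw [hπ, QuotientGroup.mk'_apply, QuotientGroup.mk'_apply, QuotientGroup.eq]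
    rfl
  have hcne : ∀ (γ : Γ) (c : ℝ), ρ γ = c • 1 → c ≠ 0 := by
    rintro γ c h rfl
    have h1 : ρ γ * ρ γ⁻¹ = 1 := by rw [← map_mul, mul_inv_cancel, map_one]
    rw [h, zero_smul, zero_mul] at h1
    exact zero_ne_one h1
  obtain ⟨n, hn⟩ : ∃ n, ∀ γ, π γ ∉ (π.comp (j n)).range → ∀ s : Fin r → Fin m × Bool,
      Function.Injective s → ¬ ∀ i, ∃ u w : FreeGroup (Fin m), ∃ c : ℝ,
        u.firstLetter = some (s i) ∧ c ≠ 0 ∧ ρ (γ⁻¹ * j n u * γ) = c • ρ (j n w) := by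
    by_contra! hcon
    choose γ hγ s hs h using hcon
    have hsp := fun n => exists_spread_images hN hκ (hj n) (hd' n) (r := r) (by nlinarith)
      (hs n) (h n)
    choose f t y c ht hc hy hy' using hsp
    obtain ⟨⟨s₀, t₀⟩, hst⟩ : ∃ q : (Fin r → Fin m × Bool) × (Fin r → Fin m × Bool),
        ∃ᶠ n in atTop, (s n, t n) = q := by
      by_contra! hcon
      obtain ⟨n, hn⟩ := (eventually_all.2 hcon).exists
      exact hn _ rfl
    obtain ⟨φ, hφ, hφst⟩ := extraction_of_frequently_atTop hst
    simp only [Prod.mk.injEq] at hφst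
    have hdφ := hd.comp hφ.tendsto_atTop
    obtain ⟨k, a, ha⟩ := exists_scalar_of_tendsto (ρ := ρ) hp hN hr hkr hrig hdet hdisc
      (s := s₀) (t := t₀) ((hφst 0).1 ▸ hs _) (by
        have := ht (φ 0)
        rwa [(hφst 0).2] at this)
      (g := fun k => (γ (φ k) * j (φ k) (f (φ k)))⁻¹) (y := fun k => y (φ k))
      (c := fun k => c (φ k)) (fun k => hc (φ k))
      (fun i => tendsto_iff_norm_sub_tendsto_zero.2 (squeeze_zero (fun _ => norm_nonneg _)
        (fun k => by rw [← (hφst k).1]; exact hy (φ k) i) hdφ))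
      (fun i => tendsto_iff_norm_sub_tendsto_zero.2 (squeeze_zero (fun _ => norm_nonneg _)
        (fun k => by rw [← (hφst k).2]; exact hy' (φ k) i) hdφ))
    apply hγ (φ k)
    refine ⟨(f (φ k))⁻¹, ?_⟩
    have h1 : π (γ (φ k) * j (φ k) (f (φ k))) = π 1 :=
      (hπeq _ _).2 ⟨a, by rw [mul_one, ha]⟩
    rw [map_mul, map_one, mul_eq_one_iff_eq_inv] at h1
    rw [h1, MonoidHom.comp_apply, map_inv, map_inv]
  refine ⟨Γ ⧸ scalarKernel ρ, inferInstance, π, j n, QuotientGroup.mk'_surjective _, ?_, ?_⟩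
  · rw [injective_iff_map_eq_one]
    intro f hf
    by_contra hf1
    have h1 : π 1 = π (j n f) := by rw [map_one]; exact hf.symm
    obtain ⟨c, hc⟩ := (hπeq _ _).1 h1
    rw [inv_one, one_mul] at hc
    exact (hj n).ne_smul_one hN (hd' n) hf1 c hc
  · let _ : MulAction (FreeGroup (Fin m)) ((Γ ⧸ scalarKernel ρ) ⧸ (π.comp (j n)).range) :=
      MulAction.compHom _ (π.comp (j n))
    obtain ⟨A, hA, hA'⟩ := FreeGroup.exists_letter_labelling (α := Fin m)
      ((Γ ⧸ scalarKernel ρ) ⧸ (π.comp (j n)).range)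
    refine ⟨A, fun ω hω => ?_, fun ω s hs => hA ω s hs⟩
    rcases hA' ω with hsub | hst
    · have h1 : (A ω).ncard ≤ 1 := Set.ncard_le_one_iff_subsingleton.2 hsub
      nlinarith
    · by_contra! hcard
      obtain ⟨q, rfl⟩ := QuotientGroup.mk_surjective ω
      obtain ⟨γ, rfl⟩ := QuotientGroup.mk'_surjective (scalarKernel ρ) q
      obtain ⟨B, hB, hBc⟩ := Set.exists_subset_card_eq hcard.le
      have hBf : B.Finite := B.toFinite
      have e : Fin r ≃ B := (Fintype.equivFinOfCardEq (by
        rw [← Nat.card_eq_fintype_card]; exact hBc)).symm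
      refine hn γ ?_ (fun i => (e i : Fin m × Bool)) (Subtype.val_injective.comp e.injective) ?_
      · intro hmem
        apply hω
        rw [QuotientGroup.eq, mul_one]
        exact inv_mem hmem
      · intro i
        obtain ⟨u, hu, hu1, hus⟩ := hst (e i) (hB (e i).2)
        rw [MulAction.mem_stabilizer_iff] at hu
        change (((π (j n u) * π γ : Γ ⧸ scalarKernel ρ)) :
          (Γ ⧸ scalarKernel ρ) ⧸ (π.comp (j n)).range) = ((π γ : Γ ⧸ scalarKernel ρ) :
          (Γ ⧸ scalarKernel ρ) ⧸ (π.comp (j n)).range) at hu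
        obtain ⟨w, hw⟩ := QuotientGroup.eq.1 hu.symm
        rw [MonoidHom.comp_apply, ← map_mul, ← map_inv, ← map_mul] at hw
        obtain ⟨c, hc⟩ := (hπeq _ _).1 hw
        refine ⟨u, w, c, hus, hcne _ _ hc, ?_⟩
        have h2 : γ⁻¹ * j n u * γ = j n w * ((j n w)⁻¹ * (γ⁻¹ * (j n u * γ))) := by group
        rw [h2, map_mul, hc, mul_smul_comm, mul_one]

end SparseLabelling

section Selection
variable {V : Type*} [NormedAddCommGroup V] [NormedSpace ℝ V]

theorem InGeneralPosition.comp {S S' : Type*} {p : S → V} (hp : InGeneralPosition p)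
    {f : S' → S} (hf : Function.Injective f) : InGeneralPosition (p ∘ f) := by
  classical
  intro F hF
  have h := hp (F.map ⟨f, hf⟩) (by rwa [Finset.card_map])
  rw [Finset.coe_map, Function.Embedding.coeFn_mk] at h
  exact h.comp_of_image hf.injOn

/-- Generic vectors chosen one after another are in general position. -/
theorem inGeneralPosition_of_seq {q : ℕ → V} (h : ∀ n (G : Finset ℕ), (∀ k ∈ G, k < n) →
    G.card < Module.finrank ℝ V → q n ∉ Submodule.span ℝ (q '' G)) : InGeneralPosition q := by
  intro F
  induction F using Finset.induction_on_max with
  | empty => intro _; simp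
  | insert a s ha ih =>
    intro hc
    rw [Finset.card_insert_of_notMem (fun h => (ha a h).false)] at hc
    rw [Finset.coe_insert]
    exact (ih (by omega)).insert (h a s ha (by omega))

variable [FiniteDimensional ℝ V]

theorem InGeneralPosition.card_le_finrank {S : Type*} [DecidableEq S] {p : S → V}
    (hp : InGeneralPosition p) {F : Finset S} {W : Submodule ℝ V} (hW : W ≠ ⊤)
    (h : ∀ s ∈ F, p s ∈ W) : F.card ≤ Module.finrank ℝ W := by
  have h1 := hp F (hp.card_lt hW h).le
  have h2 : LinearIndependent ℝ (fun s : F => (⟨p s, h s s.2⟩ : W)) :=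
    LinearIndependent.of_comp W.subtype h1
  simpa using h2.fintype_card_le_finrank

/-- An endomorphism with `dim V + 1` eigenvectors in general position is scalar. -/
theorem InGeneralPosition.exists_eq_smul_one {S : Type*} [DecidableEq S] {p : S → V}
    (hp : InGeneralPosition p) (hN : 1 ≤ Module.finrank ℝ V) {F : Finset S}
    (hF : Module.finrank ℝ V < F.card) {T : V →L[ℝ] V}
    (hT : ∀ s ∈ F, ∃ c : ℝ, T (p s) = c • p s) : ∃ c : ℝ, T = c • 1 := by
  classical
  obtain ⟨s₀, hs₀⟩ := Finset.card_pos.1 (by omega : 0 < F.card)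
  obtain ⟨c, hc⟩ := hT s₀ hs₀
  refine ⟨c, ?_⟩
  by_contra hne
  set U : V →ₗ[ℝ] V := T.toLinearMap - c • LinearMap.id with hU
  have hUapp : ∀ v, U v = T v - c • v := fun v => rfl
  have hker : LinearMap.ker U ≠ ⊤ := by
    intro h
    apply hne
    ext v
    have : v ∈ LinearMap.ker U := h ▸ Submodule.mem_top
    rw [LinearMap.mem_ker, hUapp, sub_eq_zero] at this
    rw [this, smul_apply, one_apply_eq_self]
  have hran : LinearMap.range U ≠ ⊤ := by
    intro h
    have h1 := LinearMap.injective_iff_surjective.2 (LinearMap.range_eq_top.1 h)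
    have h2 : U (p s₀) = U 0 := by rw [hUapp, hc, sub_self, map_zero]
    exact hp.ne_zero hN s₀ (h1 h2)
  have h1 := hp.card_le_finrank (F := F.filter fun s => p s ∈ LinearMap.ker U) hker
    (fun s hs => (Finset.mem_filter.1 hs).2)
  have h2 := hp.card_le_finrank (F := F.filter fun s => ¬ p s ∈ LinearMap.ker U) hran (by
    intro s hs
    obtain ⟨hs, hs'⟩ := Finset.mem_filter.1 hs
    obtain ⟨d, hd⟩ := hT s hs
    have hdc : d - c ≠ 0 := by
      intro h
      apply hs'
      rw [LinearMap.mem_ker, hUapp, hd, ← sub_smul, h, zero_smul]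
    refine ⟨(d - c)⁻¹ • p s, ?_⟩
    rw [map_smul, hUapp, hd, ← sub_smul, smul_smul, inv_mul_cancel₀ hdc, one_smul])
  have h3 := LinearMap.finrank_range_add_finrank_ker U
  have h4 := Finset.card_filter_add_card_filter_not (s := F) (fun s => p s ∈ LinearMap.ker U)
  omega

theorem InGeneralPosition.exists_eq_smul {S : Type*} [DecidableEq S] {p : S → V}
    (hp : InGeneralPosition p) (hN : 1 ≤ Module.finrank ℝ V) {F : Finset S}
    (hF : Module.finrank ℝ V < F.card) {T T' : V →L[ℝ] V} (hT' : Function.Injective T')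
    {y : S → V} (hTy : ∀ s ∈ F, ∃ c : ℝ, T (p s) = c • y s)
    (hTy' : ∀ s ∈ F, ∃ c : ℝ, c ≠ 0 ∧ T' (p s) = c • y s) : ∃ c : ℝ, T = c • T' := by
  set e := (LinearEquiv.ofInjectiveEndo T'.toLinearMap hT').toContinuousLinearEquiv with he
  have heT : ∀ v, e v = T' v := fun v => rfl
  obtain ⟨c, hc⟩ := hp.exists_eq_smul_one hN hF (T := e.symm.toContinuousLinearMap ∘L T) (by
    intro s hs
    obtain ⟨c, hc⟩ := hTy s hs
    obtain ⟨c', hc0, hc'⟩ := hTy' s hs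
    refine ⟨c * c'⁻¹, ?_⟩
    have h1 : y s = c'⁻¹ • e (p s) := by
      rw [heT, hc', smul_smul, inv_mul_cancel₀ hc0, one_smul]
    rw [ContinuousLinearMap.comp_apply, hc, h1, smul_smul]
    exact (map_smul e.symm _ _).trans (by rw [ContinuousLinearEquiv.symm_apply_apply]))
  refine ⟨c, ?_⟩
  ext v
  have h1 := congrArg (fun U : V →L[ℝ] V => e (U v)) hc
  simp only [ContinuousLinearMap.comp_apply] at h1
  have h2 : e (e.symm.toContinuousLinearMap (T v)) = T v := e.apply_symm_apply _
  rw [h2, smul_apply, one_apply_eq_self, map_smul, heT] at h1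
  rw [h1, smul_apply]

/-- `T` is injective and maps the line of each `x i` to that of `y i`. -/
def MapsLines {ι : Type*} (T : V →L[ℝ] V) (x y : ι → V) : Prop :=
  Function.Injective T ∧ ∀ i, ∃ c : ℝ, c ≠ 0 ∧ T (x i) = c • y i

/-- The vector `v` avoids the images of the vectors of `B` under the maps determined by their
action on `n` of the lines spanned by elements of `B`. -/
def AvoidsImages (n : ℕ) (B : Set V) (v : V) : Prop :=
  ∀ x y : Fin n → V, (∀ i, x i ∈ B) → (∀ i, y i ∈ B) →
    (∀ T T' : V →L[ℝ] V, MapsLines T x y → MapsLines T' x y → ∃ a : ℝ, T = a • T') →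
    ∀ T : V →L[ℝ] V, MapsLines T x y → ∀ w ∈ B, ∀ a : ℝ, v ≠ a • T w

theorem exists_rigid {q : ℕ → V} (hq : InGeneralPosition q) (hN : 2 ≤ Module.finrank ℝ V)
    (hav : ∀ n, AvoidsImages (Module.finrank ℝ V + 1) (q '' Set.Iio n) (q n))
    {T : V →L[ℝ] V} (hT : Function.Injective T) {F : Finset ℕ}
    (hF : 2 * Module.finrank ℝ V + 3 ≤ F.card)
    (hTF : ∀ k ∈ F, ∃ l, ∃ c : ℝ, c ≠ 0 ∧ T (q k) = c • q l) : ∃ c : ℝ, T = c • 1 := by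
  set N := Module.finrank ℝ V with hNdef
  have hTF' : ∀ k, ∃ l, ∃ c : ℝ, k ∈ F → c ≠ 0 ∧ T (q k) = c • q l := by
    intro k
    by_cases h : k ∈ F
    · obtain ⟨l, c, h1⟩ := hTF k h
      exact ⟨l, c, fun _ => h1⟩
    · exact ⟨0, 0, fun h' => absurd h' h⟩
  choose τ c hτ using hTF'
  by_cases hdiag : N < (F.filter fun k => τ k = k).card
  · refine hq.exists_eq_smul_one (by omega) hdiag fun k hk => ?_
    obtain ⟨hk, hkk⟩ := Finset.mem_filter.1 hk
    exact ⟨c k, by rw [(hτ k hk).2, hkk]⟩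
  exfalso
  set O := F.filter fun k => ¬ τ k = k with hO
  have hOc : N + 3 ≤ O.card := by
    have := Finset.card_filter_add_card_filter_not (s := F) (fun k => τ k = k)
    change _ + O.card = _ at this
    omega
  have hOF : ∀ k ∈ O, k ∈ F := fun k hk => (Finset.mem_filter.1 hk).1
  have hτinj : Set.InjOn τ (F : Set ℕ) := by
    intro k hk l hl hkl
    refine hq.eq_of_smul hN (c := c k * (c l)⁻¹) (hT ?_)
    rw [map_smul, (hτ k hk).2, (hτ l hl).2, hkl, smul_smul, mul_assoc,
      inv_mul_cancel₀ (hτ l hl).1, mul_one]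
  obtain ⟨k₀, hk₀, hmax⟩ := Finset.exists_max_image O (fun k => max k (τ k))
    (Finset.card_pos.1 (by omega))
  set K := max k₀ (τ k₀) with hK
  set O' := O.filter fun k => k < K ∧ τ k < K with hO'
  have hO'c : N + 1 ≤ O'.card := by
    have h1 : O \ O' ⊆ insert K ((F.filter fun k => τ k = K)) := by
      intro k hk
      obtain ⟨hk1, hk2⟩ := Finset.mem_sdiff.1 hk
      have h2 := hmax k hk1
      rw [hO', Finset.mem_filter] at hk2
      have h3 : k ≤ K := (le_max_left _ _).trans h2
      have h4 : τ k ≤ K := (le_max_right _ _).trans h2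
      rw [Finset.mem_insert, Finset.mem_filter]
      by_cases h5 : k = K
      · exact Or.inl h5
      · refine Or.inr ⟨hOF k hk1, ?_⟩
        by_contra h6
        exact hk2 ⟨hk1, lt_of_le_of_ne h3 h5, lt_of_le_of_ne h4 h6⟩
    have h2 : (F.filter fun k => τ k = K).card ≤ 1 := by
      rw [Finset.card_le_one]
      intro a ha b hb
      rw [Finset.mem_filter] at ha hb
      exact hτinj ha.1 hb.1 (ha.2.trans hb.2.symm)
    have h3 := (Finset.card_le_card h1).trans (Finset.card_insert_le _ _)
    have h4 := Finset.card_sdiff_add_card_eq_card (s := O') (t := O) (Finset.filter_subset _ O)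
    omega
  obtain ⟨P, hPO, hPc⟩ := Finset.exists_subset_card_eq hO'c
  have hP : ∀ k ∈ P, k ∈ F ∧ k < K ∧ τ k < K := by
    intro k hk
    obtain ⟨h1, h2⟩ := Finset.mem_filter.1 (hPO hk)
    exact ⟨hOF k h1, h2⟩
  set e : Fin (N + 1) ≃ P := (P.equivFinOfCardEq hPc).symm with he
  have heP : ∀ s (hs : s ∈ P), ∃ i, (e i : ℕ) = s := fun s hs =>
    ⟨e.symm ⟨s, hs⟩, by rw [Equiv.apply_symm_apply]⟩
  have hne := hOF k₀ hk₀
  have hk₀τ : τ k₀ ≠ k₀ := (Finset.mem_filter.1 hk₀).2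
  rcases lt_or_gt_of_ne hk₀τ with hlt | hlt
  · have hKk : K = k₀ := max_eq_left hlt.le
    set E := (LinearEquiv.ofInjectiveEndo T.toLinearMap hT).toContinuousLinearEquiv with hE
    have hET : ∀ v, E v = T v := fun v => rfl
    have hEsymm : ∀ k ∈ F, E.symm (q (τ k)) = (c k)⁻¹ • q k := by
      intro k hk
      rw [ContinuousLinearEquiv.symm_apply_eq, map_smul, hET, (hτ k hk).2, smul_smul,
        inv_mul_cancel₀ (hτ k hk).1, one_smul]
    refine hav K (fun i => q (τ (e i))) (fun i => q (e i))
      (fun i => ⟨_, (hP _ (e i).2).2.2, rfl⟩) (fun i => ⟨_, (hP _ (e i).2).2.1, rfl⟩) ?_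
      E.symm.toContinuousLinearMap ⟨E.symm.injective, fun i => ⟨_,
        inv_ne_zero (hτ _ (hP _ (e i).2).1).1, hEsymm _ (hP _ (e i).2).1⟩⟩ (q (τ k₀))
      ⟨_, by rw [hKk]; exact hlt, rfl⟩ (c k₀) ?_
    · rintro U U' ⟨-, hU⟩ ⟨hU', hU2⟩
      have hcard : (P.image τ).card = N + 1 := by
        rw [Finset.card_image_of_injOn (hτinj.mono fun k hk => (hP k hk).1), hPc]
      have hinv : ∀ k ∈ P, Function.invFunOn τ P (τ k) = k := fun k hk =>
        (hτinj.mono fun k hk => (hP k hk).1).leftInvOn_invFunOn hk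
      refine hq.exists_eq_smul (by omega) (F := P.image τ) (by rw [hcard]; omega) hU'
        (y := fun l => q (Function.invFunOn τ P l)) ?_ ?_
      · intro l hl
        obtain ⟨k, hk, rfl⟩ := Finset.mem_image.1 hl
        obtain ⟨i, rfl⟩ := heP k hk
        obtain ⟨a, -, ha⟩ := hU i
        exact ⟨a, by simp only [hinv _ hk]; exact ha⟩
      · intro l hl
        obtain ⟨k, hk, rfl⟩ := Finset.mem_image.1 hl
        obtain ⟨i, rfl⟩ := heP k hk
        obtain ⟨a, ha0, ha⟩ := hU2 i
        exact ⟨a, ha0, by simp only [hinv _ hk]; exact ha⟩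
    · change q K = c k₀ • E.symm (q (τ k₀))
      rw [hEsymm _ hne, smul_smul, mul_inv_cancel₀ (hτ _ hne).1, one_smul, hKk]
  · have hKk : K = τ k₀ := max_eq_right hlt.le
    refine hav K (fun i => q (e i)) (fun i => q (τ (e i)))
      (fun i => ⟨_, (hP _ (e i).2).2.1, rfl⟩) (fun i => ⟨_, (hP _ (e i).2).2.2, rfl⟩) ?_
      T ⟨hT, fun i => ⟨_, hτ _ (hP _ (e i).2).1⟩⟩ (q k₀)
      ⟨_, by rw [hKk]; exact hlt, rfl⟩ (c k₀)⁻¹ ?_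
    · rintro U U' ⟨-, hU⟩ ⟨hU', hU2⟩
      refine hq.exists_eq_smul (by omega) (F := P) (by omega) hU' (y := fun k => q (τ k)) ?_ ?_
      · intro k hk
        obtain ⟨i, rfl⟩ := heP k hk
        obtain ⟨a, -, ha⟩ := hU i
        exact ⟨a, ha⟩
      · intro k hk
        obtain ⟨i, rfl⟩ := heP k hk
        exact hU2 i
    · rw [(hτ _ hne).2, smul_smul, inv_mul_cancel₀ (hτ _ hne).1, one_smul, hKk]

end Selection

section Selection

theorem exists_seq_image_Iio {G : Type*} {P : Set G → G → Prop}
    (h : ∀ F : Set G, F.Finite → ∃ c, P F c) : ∃ c : ℕ → G, ∀ n, P (c '' Set.Iio n) (c n) := by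
  have : Nonempty G := ⟨(h ∅ Set.finite_empty).choose⟩
  have h' : ∀ F : Set G, ∃ c, F.Finite → P F c := by
    intro F
    by_cases hF : F.Finite
    · obtain ⟨c, hc⟩ := h F hF
      exact ⟨c, fun _ => hc⟩
    · exact ⟨Classical.arbitrary G, fun h => absurd h hF⟩
  choose pick hpick using h'
  let s : ℕ → Set G := fun n => Nat.rec ∅ (fun _ t => insert (pick t) t) n
  have hs : ∀ n, s (n + 1) = insert (pick (s n)) (s n) := fun n => rfl
  have hfin : ∀ n, (s n).Finite := by
    intro n
    induction n with
    | zero => exact Set.finite_empty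
    | succ n ih => rw [hs]; exact ih.insert _
  have himg : ∀ n, (fun k => pick (s k)) '' Set.Iio n = s n := by
    intro n
    induction n with
    | zero => simp [s]
    | succ n ih =>
      have h : Set.Iio (n + 1) = insert n (Set.Iio n) := by
        ext k
        simp only [Set.mem_Iio, Set.mem_insert_iff]
        omega
      rw [h, Set.image_insert_eq, ih]
  refine ⟨fun n => pick (s n), fun n => ?_⟩
  rw [himg]
  exact hpick _ (hfin n)

variable {V : Type*} [NormedAddCommGroup V] [NormedSpace ℝ V] [FiniteDimensional ℝ V]
  {Γ : Type*} [Group Γ]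

theorem exists_functional_ne_zero {W : Submodule ℝ V} (hW : W ≠ ⊤) :
    ∃ l : V →L[ℝ] ℝ, l ≠ 0 ∧ ∀ v ∈ W, l v = 0 := by
  obtain ⟨f, hf, hfW⟩ := Submodule.exists_le_ker_of_lt_top W (lt_top_iff_ne_top.2 hW)
  refine ⟨f.toContinuousLinearMap, ?_, fun v hv => hfW hv⟩
  intro h
  apply hf
  ext v
  exact congrArg (fun l : V →L[ℝ] ℝ => l v) h

/-- Finitely many nonvanishing conditions on matrix coefficients of `ρ γ` and `ρ γ⁻¹` can be
satisfied simultaneously. -/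
def HasGenericElements (ρ : Γ →* (V →L[ℝ] V)) : Prop :=
  ∀ L L' : Set ((V →L[ℝ] ℝ) × V), L.Finite → L'.Finite → (∀ q ∈ L, q.1 ≠ 0 ∧ q.2 ≠ 0) →
    (∀ q ∈ L', q.1 ≠ 0 ∧ q.2 ≠ 0) →
    ∃ γ, (∀ q ∈ L, q.1 (ρ γ q.2) ≠ 0) ∧ ∀ q ∈ L', q.1 (ρ γ⁻¹ q.2) ≠ 0

theorem exists_generic_element (hN : 2 ≤ Module.finrank ℝ V) {ρ : Γ →* (V →L[ℝ] V)}
    (hgen : HasGenericElements ρ) {β : V} (hβ : β ≠ 0) {η η' : V →L[ℝ] ℝ} (hη : η ≠ 0)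
    (hη' : η' ≠ 0) (n : ℕ) {F : Set Γ} (hF : F.Finite) :
    ∃ c : Γ, (∀ u ∈ F, η (ρ u⁻¹ (ρ c β)) ≠ 0 ∧ η' (ρ u⁻¹ (ρ c β)) ≠ 0 ∧
        η (ρ c⁻¹ (ρ u β)) ≠ 0 ∧ η' (ρ c⁻¹ (ρ u β)) ≠ 0) ∧
      (∀ D ⊆ (fun u => ρ u β) '' F, Submodule.span ℝ D ≠ ⊤ → ρ c β ∉ Submodule.span ℝ D) ∧
      AvoidsImages n ((fun u => ρ u β) '' F) (ρ c β) := by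
  have hinv : ∀ u v, ρ u⁻¹ (ρ u v) = v := fun u v => by
    rw [← mul_apply_eq_comp, ← map_mul, inv_mul_cancel, map_one, one_apply_eq_self]
  have hβu : ∀ u, ρ u β ≠ 0 := fun u h => hβ (by rw [← hinv u β, h, map_zero])
  have hcomp : ∀ (l : V →L[ℝ] ℝ) (u : Γ), l ≠ 0 → l.comp (ρ u⁻¹) ≠ 0 := by
    intro l u hl h
    apply hl
    ext v
    have := congrArg (fun l : V →L[ℝ] ℝ => l (ρ u v)) h
    simpa [hinv] using this
  set B := (fun u => ρ u β) '' F with hB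
  have hBfin : Finite B := hF.image _
  have hFfin : Finite F := hF
  have hD : ∀ D : Set B, ∃ l : V →L[ℝ] ℝ, l ≠ 0 ∧ (Submodule.span ℝ (Subtype.val '' D : Set V) ≠ ⊤ →
      ∀ v ∈ Submodule.span ℝ (Subtype.val '' D : Set V), l v = 0) := by
    intro D
    by_cases h : Submodule.span ℝ (Subtype.val '' D : Set V) = ⊤
    · exact ⟨η, hη, fun h' => absurd h h'⟩
    · obtain ⟨l, h1, h2⟩ := exists_functional_ne_zero h
      exact ⟨l, h1, fun _ => h2⟩
  choose lD hlD hlD' using hD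
  have hR : ∀ q : (Fin n → B) × (Fin n → B) × B, ∃ l : V →L[ℝ] ℝ, l ≠ 0 ∧
      ((∀ T T' : V →L[ℝ] V, MapsLines T (fun i => (q.1 i : V)) (fun i => (q.2.1 i : V)) →
        MapsLines T' (fun i => (q.1 i : V)) (fun i => (q.2.1 i : V)) → ∃ a : ℝ, T = a • T') →
      ∀ T : V →L[ℝ] V, MapsLines T (fun i => (q.1 i : V)) (fun i => (q.2.1 i : V)) →
        l (T q.2.2) = 0) := by
    rintro ⟨x, y, w⟩
    by_cases h : ∃ T : V →L[ℝ] V, MapsLines T (fun i => (x i : V)) (fun i => (y i : V))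
    · obtain ⟨T₀, hT₀⟩ := h
      obtain ⟨l, h1, h2⟩ := exists_functional_ne_zero (W := Submodule.span ℝ {T₀ w}) (by
        intro h
        have h3 := finrank_span_le_card (R := ℝ) ({T₀ w} : Set V)
        rw [Set.toFinset_singleton, Finset.card_singleton] at h3
        rw [h, finrank_top] at h3
        omega)
      refine ⟨l, h1, fun hu T hT => ?_⟩
      obtain ⟨a, rfl⟩ := hu T T₀ hT hT₀
      rw [smul_apply, map_smul, h2 _ (Submodule.mem_span_singleton_self _), smul_zero]
    · exact ⟨η, hη, fun _ T hT => absurd ⟨T, hT⟩ h⟩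
  choose lR hlR hlR' using hR
  obtain ⟨c, hc, hc'⟩ := hgen
    (((Set.range fun u : F => (η.comp (ρ (u : Γ)⁻¹), β)) ∪
      (Set.range fun u : F => (η'.comp (ρ (u : Γ)⁻¹), β))) ∪
      ((Set.range fun D => (lD D, β)) ∪ (Set.range fun q => (lR q, β))))
    ((Set.range fun u : F => (η, ρ (u : Γ) β)) ∪ (Set.range fun u : F => (η', ρ (u : Γ) β)))
    (((Set.finite_range _).union (Set.finite_range _)).union
      ((Set.finite_range _).union (Set.finite_range _)))
    ((Set.finite_range _).union (Set.finite_range _)) (by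
      rintro _ ((⟨u, rfl⟩ | ⟨u, rfl⟩) | (⟨D, rfl⟩ | ⟨q, rfl⟩))
      exacts [⟨hcomp _ _ hη, hβ⟩, ⟨hcomp _ _ hη', hβ⟩, ⟨hlD D, hβ⟩, ⟨hlR q, hβ⟩]) (by
      rintro _ (⟨u, rfl⟩ | ⟨u, rfl⟩)
      exacts [⟨hη, hβu _⟩, ⟨hη', hβu _⟩])
  refine ⟨c, fun u hu => ⟨?_, ?_, ?_, ?_⟩, ?_, ?_⟩
  · exact hc (_, _) (Or.inl (Or.inl ⟨⟨u, hu⟩, rfl⟩))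
  · exact hc (_, _) (Or.inl (Or.inr ⟨⟨u, hu⟩, rfl⟩))
  · exact hc' (_, _) (Or.inl ⟨⟨u, hu⟩, rfl⟩)
  · exact hc' (_, _) (Or.inr ⟨⟨u, hu⟩, rfl⟩)
  · intro D hDB hDt hmem
    have h1 : Subtype.val '' (Subtype.val ⁻¹' D : Set B) = D := by
      rw [Subtype.image_preimage_coe]; exact Set.inter_eq_right.2 hDB
    refine hc (lD (Subtype.val ⁻¹' D), β) (Or.inr (Or.inl ⟨_, rfl⟩)) (hlD' _ ?_ _ ?_)
    · rwa [h1]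
    · rwa [h1]
  · intro x y hx hy hu T hT w hw a ha
    refine hc (lR (fun i => ⟨x i, hx i⟩, fun i => ⟨y i, hy i⟩, ⟨w, hw⟩), β)
      (Or.inr (Or.inr ⟨_, rfl⟩)) ?_
    simp only
    rw [ha, map_smul, hlR' (fun i => ⟨x i, hx i⟩, fun i => ⟨y i, hy i⟩, ⟨w, hw⟩) hu T hT,
      smul_zero]

/-- A sequence whose rescalings tend to a rank-one operator yields one that does so together
with the sequence of inverses. -/
theorem exists_proximal_pair (hN : 2 ≤ Module.finrank ℝ V) {ρ : Γ →* (V →L[ℝ] V)}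
    (hgen : HasGenericElements ρ) {h : ℕ → Γ} {c : ℕ → ℝ} {θ : V →L[ℝ] ℝ} {β : V} (hθ : θ ≠ 0)
    (hh : Tendsto (fun n => c n • ρ (h n)) atTop (𝓝 (θ.smulRight β))) :
    ∃ (H : ℕ → Γ) (a b : ℕ → ℝ) (η η' : V →L[ℝ] ℝ), η ≠ 0 ∧ η' ≠ 0 ∧
      Tendsto (fun n => a n • ρ (H n)) atTop (𝓝 (η.smulRight β)) ∧
      Tendsto (fun n => b n • ρ (H n)⁻¹) atTop (𝓝 (η'.smulRight β)) := by
  have hne : Nontrivial V := Module.nontrivial_of_finrank_pos (R := ℝ) (by omega)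
  have hne0 : ∀ a : Γ, ρ a ≠ 0 := by
    intro a ha
    have : ρ a⁻¹ * ρ a = 1 := by rw [← map_mul, inv_mul_cancel, map_one]
    rw [ha, mul_zero] at this
    exact zero_ne_one this
  set B : ℕ → (V →L[ℝ] V) := fun k => ‖ρ (h k)⁻¹‖⁻¹ • ρ (h k)⁻¹ with hB
  have hB1 : ∀ k, ‖B k‖ = 1 := fun k => by
    rw [hB, norm_smul, norm_inv, norm_norm, inv_mul_cancel₀ (norm_ne_zero_iff.2 (hne0 _))]
  have : ProperSpace (V →L[ℝ] V) := FiniteDimensional.proper ℝ _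
  obtain ⟨A, -, φ, hφ, hA⟩ := tendsto_subseq_of_bounded (x := B)
    (Metric.isBounded_closedBall (x := (0 : V →L[ℝ] V)) (r := 1)) (fun k => by
      rw [mem_closedBall_zero_iff, hB1])
  have hA1 : ‖A‖ = 1 := tendsto_nhds_unique hA.norm (by simp [hB1])
  have hA0 : A ≠ 0 := by rintro rfl; simp at hA1
  obtain ⟨v, hv⟩ : ∃ v, A v ≠ 0 := by
    by_contra! hcon; exact hA0 (ContinuousLinearMap.ext hcon)
  obtain ⟨g, hg, hg'⟩ := hgen {(θ, A v)} {(θ, A v)} (Set.finite_singleton _)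
    (Set.finite_singleton _) (by rintro _ rfl; exact ⟨hθ, hv⟩) (by rintro _ rfl; exact ⟨hθ, hv⟩)
  have key : ∀ g : Γ, Tendsto (fun n => (c (φ n) * ‖ρ (h (φ n))⁻¹‖⁻¹) •
      ρ (h (φ n) * g * (h (φ n))⁻¹)) atTop (𝓝 ((θ.comp ((ρ g).comp A)).smulRight β)) := by
    intro g
    have h1 := ((hh.comp hφ.tendsto_atTop).mul (tendsto_const_nhds (x := ρ g))).mul hA
    have h2 : θ.smulRight β * ρ g * A = (θ.comp ((ρ g).comp A)).smulRight β := by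
      ext w; simp
    rw [h2] at h1
    refine h1.congr fun n => ?_
    simp only [Function.comp_apply, hB]
    rw [map_mul, map_mul, smul_mul_assoc, smul_mul_smul_comm]
  refine ⟨fun n => h (φ n) * g * (h (φ n))⁻¹, _, fun n => c (φ n) * ‖ρ (h (φ n))⁻¹‖⁻¹,
    _, θ.comp ((ρ g⁻¹).comp A), ?_, ?_, key g, ?_⟩
  · intro h0
    exact hg (θ, A v) rfl (congrArg (fun l : V →L[ℝ] ℝ => l v) h0)
  · intro h0
    exact hg' (θ, A v) rfl (congrArg (fun l : V →L[ℝ] ℝ => l v) h0)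
  · refine (key g⁻¹).congr fun n => ?_
    congr 2
    group

/-- The position of a letter in the enumeration `x₀, x₀⁻¹, x₁, x₁⁻¹, …`. -/
def letterIndex {m : ℕ} (s : Fin m × Bool) : ℕ := 2 * s.1 + bif s.2 then 0 else 1

theorem letterIndex_injective {m : ℕ} : Function.Injective (letterIndex (m := m)) := by
  rintro ⟨i, a⟩ ⟨j, b⟩ h
  cases a <;> cases b <;> simp [letterIndex] at h ⊢ <;> omega

theorem exists_hasSparseFreeSubgroup {Γ : Type} [Group Γ] (hN : 2 ≤ Module.finrank ℝ V)
    {ρ : Γ →* (V →L[ℝ] V)} (hgen : HasGenericElements ρ)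
    (hdet : ∀ γ, |(ρ γ).det| = 1) (hdisc : ∀ C : ℝ, {T | ‖T‖ ≤ C ∧ ∃ γ, ρ γ = T}.Finite)
    {h : ℕ → Γ} {c : ℕ → ℝ} {θ : V →L[ℝ] ℝ} {β : V} (hθ : θ ≠ 0) (hβ : β ≠ 0)
    (hh : Tendsto (fun n => c n • ρ (h n)) atTop (𝓝 (θ.smulRight β))) :
    ∃ r, ∀ m, HasSparseFreeSubgroup Γ r m := by
  classical
  obtain ⟨H, a, b, η, η', hη, hη', ha, hb⟩ := exists_proximal_pair hN hgen hθ hh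
  set N := Module.finrank ℝ V with hNdef
  refine ⟨N * N + N + (2 * N + 3), fun m => ?_⟩
  obtain ⟨x, hx⟩ := exists_seq_image_Iio fun F hF =>
    exists_generic_element hN hgen hβ hη hη' (N + 1) hF
  set q : ℕ → V := fun k => ρ (x k) β with hq
  have himg : ∀ n, (fun u => ρ u β) '' (x '' Set.Iio n) = q '' Set.Iio n := fun n => by
    rw [← Set.image_comp]; rfl
  have hne : ∀ k l, k ≠ l → η (ρ (x k)⁻¹ (q l)) ≠ 0 ∧ η' (ρ (x k)⁻¹ (q l)) ≠ 0 := by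
    intro k l hkl
    rcases lt_or_gt_of_ne hkl with hlt | hlt
    · have := (hx l).1 (x k) ⟨k, hlt, rfl⟩
      exact ⟨this.1, this.2.1⟩
    · have := (hx k).1 (x l) ⟨l, hlt, rfl⟩
      exact ⟨this.2.2.1, this.2.2.2⟩
  have hgp : InGeneralPosition q := by
    refine inGeneralPosition_of_seq fun n G hG hGc => (hx n).2.1 _ ?_ ?_
    · rw [himg]
      exact Set.image_mono fun k hk => hG k hk
    · intro htop
      have h1 := finrank_span_finset_le_card (R := ℝ) (G.image q)
      rw [Finset.coe_image, Set.finrank, htop, finrank_top] at h1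
      have := Finset.card_image_le (s := G) (f := q)
      omega
  have hlt : Function.Injective (letterIndex (m := m)) := letterIndex_injective
  have hcompne : ∀ (l : V →L[ℝ] ℝ) (u : Γ), l ≠ 0 → l.comp (ρ u) ≠ 0 := by
    intro l u hl h
    apply hl
    ext v
    have := congrArg (fun l : V →L[ℝ] ℝ => l (ρ u⁻¹ v)) h
    simpa [← mul_apply_eq_comp, ← map_mul] using this
  refine hasSparseFreeSubgroup (ρ := ρ) (p := q ∘ letterIndex)
    (η := fun s => (bif s.2 then η else η').comp
      (ρ (x (letterIndex (FreeGroup.invLetter s)))⁻¹)) (k₀ := 2 * N + 3)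
    (hgp.comp hlt) ?_ hN ?_ (Nat.le_add_right _ _) (by omega) ?_ hdet hdisc ?_
  · rintro ⟨i, _ | _⟩
    exacts [hcompne _ _ hη', hcompne _ _ hη]
  · intro s t hst
    have hk := hne (letterIndex (FreeGroup.invLetter s)) (letterIndex t)
      (fun h => hst (hlt h).symm)
    obtain ⟨i, _ | _⟩ := s
    exacts [hk.2, hk.1]
  · intro T hT F hF hTF
    refine exists_rigid hgp hN (fun n => ?_) hT (F := F.image letterIndex)
      (by rwa [Finset.card_image_of_injective _ hlt]) ?_
    · rw [← himg]; exact (hx n).2.2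
    · intro k hk
      obtain ⟨s, hs, rfl⟩ := Finset.mem_image.1 hk
      obtain ⟨t, c, hc⟩ := hTF s hs
      exact ⟨letterIndex t, c, hc⟩
  · intro ε hε
    have hconj : ∀ (u v : Γ) {d : ℕ → ℝ} {G : ℕ → Γ} {l : V →L[ℝ] ℝ}, l ≠ 0 →
        Tendsto (fun n => d n • ρ (G n)) atTop (𝓝 (l.smulRight β)) →
        ∀ᶠ n in atTop, d n ≠ 0 ∧
          ‖d n • ρ (u * G n * v⁻¹) - (l.comp (ρ v⁻¹)).smulRight (ρ u β)‖ ≤ ε := by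
      intro u v d G l hl hd
      have h1 : l.smulRight β ≠ 0 := by
        intro h0
        apply hl
        ext w
        have := congrArg (fun T : V →L[ℝ] V => T w) h0
        simpa [hβ] using this
      have h2 := ((tendsto_const_nhds (x := ρ u)).mul hd).mul (tendsto_const_nhds (x := ρ v⁻¹))
      have h3 : ρ u * l.smulRight β * ρ v⁻¹ = (l.comp (ρ v⁻¹)).smulRight (ρ u β) := by
        ext w; simp
      rw [h3] at h2
      have h4 := (tendsto_iff_norm_sub_tendsto_zero.1 h2).eventually_le_const hε
      filter_upwards [h4, hd.eventually_ne h1] with n h5 h6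
      refine ⟨fun h0 => h6 (by rw [h0, zero_smul]), ?_⟩
      rw [map_mul, map_mul]
      rwa [mul_smul_comm, smul_mul_assoc] at h5
    have hall : ∀ᶠ n in atTop, ∀ i : Fin m,
        (a n ≠ 0 ∧ ‖a n • ρ (x (2 * i) * H n * (x (2 * i + 1))⁻¹) -
          (η.comp (ρ (x (2 * i + 1))⁻¹)).smulRight (ρ (x (2 * i)) β)‖ ≤ ε) ∧
        (b n ≠ 0 ∧ ‖b n • ρ (x (2 * i + 1) * (H n)⁻¹ * (x (2 * i))⁻¹) -
          (η'.comp (ρ (x (2 * i))⁻¹)).smulRight (ρ (x (2 * i + 1)) β)‖ ≤ ε) :=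
      eventually_all.2 fun i => (hconj _ _ hη ha).and (hconj _ _ hη' hb)
    obtain ⟨n, hn⟩ := hall.exists
    refine ⟨FreeGroup.lift fun i : Fin m => x (2 * i) * H n * (x (2 * i + 1))⁻¹, ?_⟩
    rintro ⟨i, _ | _⟩
    · refine ⟨b n, (hn i).2.1, ?_⟩
      have h1 : (FreeGroup.lift fun i : Fin m => x (2 * i) * H n * (x (2 * i + 1))⁻¹)
          (FreeGroup.ofLetter (i, false)) = x (2 * i + 1) * (H n)⁻¹ * (x (2 * i))⁻¹ := by
        simp [FreeGroup.ofLetter]; group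
      rw [h1]
      simpa [letterIndex, FreeGroup.invLetter, hq] using (hn i).2.2
    · refine ⟨a n, (hn i).1.1, ?_⟩
      have h1 : (FreeGroup.lift fun i : Fin m => x (2 * i) * H n * (x (2 * i + 1))⁻¹)
          (FreeGroup.ofLetter (i, true)) = x (2 * i) * H n * (x (2 * i + 1))⁻¹ := by
        simp [FreeGroup.ofLetter]
      rw [h1]
      simpa [letterIndex, FreeGroup.invLetter, hq] using (hn i).1.2

end Selection

section Compound

variable {d r : ℕ}

/-- The increasing enumeration of an `r`-element subset of `Fin d`. -/
noncomputable def enum (s : Set.powersetCard (Fin d) r) : Fin r ↪o Fin d :=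
  Set.powersetCard.ofFinEmbEquiv.symm s

theorem range_enum (s : Set.powersetCard (Fin d) r) : Set.range (enum s) = (s : Set (Fin d)) := by
  ext i
  exact Set.powersetCard.mem_range_ofFinEmbEquiv_symm_iff_mem s i

/-- The matrix of `r × r` minors. -/
noncomputable def compound {R : Type*} [CommRing R] (r : ℕ) (M : Matrix (Fin d) (Fin d) R) :
    Matrix (Set.powersetCard (Fin d) r) (Set.powersetCard (Fin d) r) R :=
  Matrix.of fun s t => (M.submatrix (enum s) (enum t)).det

theorem compound_map {R R' : Type*} [CommRing R] [CommRing R'] (f : R →+* R')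
    (M : Matrix (Fin d) (Fin d) R) : compound r (M.map f) = (compound r M).map f := by
  ext s t
  simp only [compound, Matrix.of_apply, Matrix.map_apply]
  rw [RingHom.map_det]
  rfl

theorem compound_smul {R : Type*} [CommRing R] (a : R) (M : Matrix (Fin d) (Fin d) R) :
    compound r (a • M) = a ^ r • compound r M := by
  ext s t
  simp only [compound, Matrix.of_apply, Matrix.smul_apply, smul_eq_mul]
  rw [show (a • M).submatrix (enum s) (enum t) = a • M.submatrix (enum s) (enum t) from rfl,
    Matrix.det_smul, Fintype.card_fin]

theorem continuous_compound :
    Continuous (compound r : Matrix (Fin d) (Fin d) ℝ → _) := by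
  refine continuous_matrix fun s t => ?_
  exact Continuous.matrix_det (continuous_id.matrix_submatrix _ _)

theorem compound_eq_toMatrix (M : Matrix (Fin d) (Fin d) ℝ) :
    compound r M = LinearMap.toMatrix ((Pi.basisFun ℝ (Fin d)).exteriorPower r)
      ((Pi.basisFun ℝ (Fin d)).exteriorPower r) (exteriorPower.map r (Matrix.toLin' M)) := by
  ext s t
  rw [LinearMap.toMatrix_apply, exteriorPower.basis_apply, exteriorPower.basis_repr_apply,
    exteriorPower.map_apply_ιMulti_family, exteriorPower.ιMulti_family,
    exteriorPower.ιMultiDual_apply_ιMulti, ← Matrix.det_transpose]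
  refine congrArg Matrix.det (Matrix.ext fun i j => ?_)
  simp [Pi.basisFun_apply, enum]

theorem compound_mul (M N : Matrix (Fin d) (Fin d) ℝ) :
    compound r (M * N) = compound r M * compound r N := by
  rw [compound_eq_toMatrix, compound_eq_toMatrix, compound_eq_toMatrix, ← LinearMap.toMatrix_comp,
    Matrix.toLin'_mul, exteriorPower.map_comp]

theorem compound_one : compound r (1 : Matrix (Fin d) (Fin d) ℝ) = 1 := by
  rw [compound_eq_toMatrix, Matrix.toLin'_one, exteriorPower.map_id, LinearMap.toMatrix_id]

theorem exists_compound_eq_single (s t : Set.powersetCard (Fin d) r) :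
    ∃ M : Matrix (Fin d) (Fin d) ℝ, ∀ s' t', compound r M s' t' =
      if s' = s ∧ t' = t then 1 else 0 := by
  classical
  have hsub : ∀ s s' : Set.powersetCard (Fin d) r, s' ≠ s → ∃ i, enum s' i ∉ Set.range (enum s) := by
    intro s s' h
    by_contra! hc
    apply h
    have h1 : (s' : Finset (Fin d)) ⊆ s := by
      intro x hx
      have h2 : x ∈ Set.range (enum s') := by rw [range_enum]; exact hx
      obtain ⟨i, rfl⟩ := h2
      have := hc i
      rw [range_enum] at this
      exact this
    exact Subtype.ext (Finset.eq_of_subset_of_card_le h1 (by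
      rw [s.2, s'.2]))
  refine ⟨Matrix.of fun a b => if ∃ i, enum s i = a ∧ enum t i = b then 1 else 0, fun s' t' => ?_⟩
  split_ifs with h
  · obtain ⟨rfl, rfl⟩ := h
    simp only [compound, Matrix.of_apply]
    refine (congrArg Matrix.det (Matrix.ext fun i j => ?_)).trans
      (Matrix.det_one (n := Fin r) (R := ℝ))
    simp only [Matrix.submatrix_apply, Matrix.of_apply, Matrix.one_apply]
    congr 1
    simp
  · simp only [compound, Matrix.of_apply]
    by_cases hs : s' = s
    · obtain ⟨j, hj⟩ := hsub t t' fun ht => h ⟨hs, ht⟩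
      refine Matrix.det_eq_zero_of_column_eq_zero j fun i => ?_
      simp only [Matrix.submatrix_apply, Matrix.of_apply]
      refine if_neg ?_
      rintro ⟨k, -, hk⟩
      exact hj ⟨k, hk⟩
    · obtain ⟨i, hi⟩ := hsub s s' hs
      refine Matrix.det_eq_zero_of_row_eq_zero i fun j => ?_
      simp only [Matrix.submatrix_apply, Matrix.of_apply]
      refine if_neg ?_
      rintro ⟨k, hk, -⟩
      exact hi ⟨k, hk⟩

theorem exists_toLin'_compound_eq {A : Matrix (Fin d) (Fin d) ℝ}
    (hA : Module.finrank ℝ (LinearMap.range (Matrix.toLin' A)) = r) :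
    ∃ (θ : (Set.powersetCard (Fin d) r → ℝ) →L[ℝ] ℝ) (β : Set.powersetCard (Fin d) r → ℝ),
      θ ≠ 0 ∧ β ≠ 0 ∧
      LinearMap.toContinuousLinearMap (Matrix.toLin' (compound r A)) = θ.smulRight β := by
  set f := Matrix.toLin' A with hf
  set W := LinearMap.range f
  set b := (Pi.basisFun ℝ (Fin d)).exteriorPower r
  have h1 : Module.finrank ℝ (⋀[ℝ]^r W) = 1 := by
    rw [exteriorPower.finrank_eq, hA, Nat.choose_self]
  have hsurj : Function.Surjective (exteriorPower.map r f.rangeRestrict) :=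
    exteriorPower.map_surjective f.surjective_rangeRestrict
  have hinj : Function.Injective (exteriorPower.map r W.subtype) :=
    exteriorPower.map_injective_field W.injective_subtype
  have hcomp : exteriorPower.map r f = exteriorPower.map r W.subtype ∘ₗ
      exteriorPower.map r f.rangeRestrict := by
    rw [← exteriorPower.map_comp]
    rfl
  obtain ⟨w, hw, hspan⟩ := finrank_eq_one_iff'.1 h1
  choose φ hφ using hspan
  have hφu : ∀ (a : ℝ) x, a • w = x → φ x = a := fun a x h =>
    smul_left_injective ℝ hw ((hφ x).trans h.symm)
  let φl : ⋀[ℝ]^r W →ₗ[ℝ] ℝ :=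
    { toFun := φ
      map_add' := fun x y => hφu _ _ (by rw [add_smul, hφ, hφ])
      map_smul' := fun c x => hφu _ _ (by rw [smul_eq_mul, RingHom.id_apply, mul_smul, hφ]) }
  let e := b.equivFun
  have he : ∀ v, Matrix.toLin' (compound r A) v = e (exteriorPower.map r f (e.symm v)) := by
    intro v
    rw [compound_eq_toMatrix]
    have := LinearMap.toMatrix_mulVec_repr b b (exteriorPower.map r f) (e.symm v)
    rw [Matrix.toLin'_apply]
    have h2 : ⇑(b.repr (e.symm v)) = v := e.apply_symm_apply v
    rw [h2] at this
    exact this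
  refine ⟨LinearMap.toContinuousLinearMap
      (φl ∘ₗ exteriorPower.map r f.rangeRestrict ∘ₗ e.symm.toLinearMap),
    e (exteriorPower.map r W.subtype w), ?_, ?_, ?_⟩
  · intro h
    obtain ⟨u, hu⟩ := hsurj w
    have h2 := congrArg (fun l : _ →L[ℝ] ℝ => l (e u)) h
    simp only [LinearMap.coe_toContinuousLinearMap', LinearMap.comp_apply,
      LinearEquiv.coe_coe, e.symm_apply_apply, hu] at h2
    have h3 : φ w = 1 := hφu 1 w (one_smul _ _)
    exact one_ne_zero (h3.symm.trans h2)
  · intro h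
    rw [LinearEquiv.map_eq_zero_iff] at h
    exact hw (hinj (h.trans (map_zero _).symm))
  · ext1 v
    rw [LinearMap.coe_toContinuousLinearMap', he, hcomp, ContinuousLinearMap.smulRight_apply,
      LinearMap.comp_apply]
    conv_lhs => rw [← hφ (exteriorPower.map r f.rangeRestrict (e.symm v))]
    rw [map_smul, map_smul]
    rfl

end Compound

section Zariski

variable {d : ℕ}

/-- The evaluation of a polynomial in the matrix entries. -/
noncomputable def evalMatrix (M : Matrix (Fin d) (Fin d) ℝ) (P : MvPolynomial (Fin d × Fin d) ℝ) :
    ℝ :=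
  MvPolynomial.eval (fun ij => M ij.1 ij.2) P

theorem eq_zero_of_evalMatrix_of_det_pos {P : MvPolynomial (Fin d × Fin d) ℝ}
    (h : ∀ M, 0 < M.det → evalMatrix M P = 0) : P = 0 := by
  refine MvPolynomial.funext fun x => ?_
  let N : Matrix (Fin d) (Fin d) ℝ := Matrix.of fun i j => x (i, j)
  let q : Polynomial ℝ := MvPolynomial.aeval (fun ij : Fin d × Fin d =>
    Polynomial.C ((1 : Matrix (Fin d) (Fin d) ℝ) ij.1 ij.2) +
      Polynomial.X * Polynomial.C ((N - 1) ij.1 ij.2)) P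
  have hq : ∀ t, q.eval t = evalMatrix (1 + t • (N - 1)) P := by
    intro t
    have h1 : q.eval t = Polynomial.aeval t q := (Polynomial.coe_aeval_eq_eval t ▸ rfl)
    rw [h1]
    change ((Polynomial.aeval t).comp (MvPolynomial.aeval _)) P = _
    rw [MvPolynomial.comp_aeval, evalMatrix, MvPolynomial.aeval_eq_eval]
    congr 2
    ext ij
    simp
  have hcont : Continuous fun t : ℝ => (1 + t • (N - 1)).det := by fun_prop
  have hpos : ∀ᶠ t in 𝓝 (0 : ℝ), 0 < (1 + t • (N - 1)).det := by
    refine hcont.continuousAt.eventually (lt_mem_nhds ?_)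
    simp
  have hq0 : q = 0 := by
    refine Polynomial.eq_zero_of_infinite_isRoot q ?_
    refine Set.Infinite.mono (s := {t : ℝ | 0 < (1 + t • (N - 1)).det})
      (fun t ht => ?_) (infinite_of_mem_nhds 0 hpos)
    exact (hq t).trans (h _ ht)
  have h1 := hq 1
  rw [hq0, Polynomial.eval_zero, one_smul, add_sub_cancel] at h1
  exact h1.symm

/-- A polynomial in the matrix entries is homogeneous of degree `k`, as a function. -/
def HomogeneousOfDegree (P : MvPolynomial (Fin d × Fin d) ℝ) (k : ℕ) : Prop :=
  ∀ (t : ℝ) M, evalMatrix (t • M) P = t ^ k * evalMatrix M P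

theorem exists_evalMatrix_prod_ne_zero (hd : d ≠ 0) {ι : Type*} (L : Finset ι)
    (P : ι → MvPolynomial (Fin d × Fin d) ℝ) (k : ι → ℕ)
    (hP : ∀ i ∈ L, HomogeneousOfDegree (P i) (k i)) (hP0 : ∀ i ∈ L, P i ≠ 0) :
    ∃ A : Matrix.SpecialLinearGroup (Fin d) ℝ, evalMatrix (A : Matrix _ _ ℝ) (∏ i ∈ L, P i) ≠ 0 := by
  by_contra! hc
  have hprod : ∀ M, evalMatrix M (∏ i ∈ L, P i) = ∏ i ∈ L, evalMatrix M (P i) := fun M => by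
    simp [evalMatrix, map_prod]
  refine Finset.prod_ne_zero_iff.2 hP0 (eq_zero_of_evalMatrix_of_det_pos fun M hM => ?_)
  set t : ℝ := M.det ^ ((d : ℝ)⁻¹) with ht
  have htpos : 0 < t := Real.rpow_pos_of_pos hM _
  have htd : t ^ d = M.det := by
    rw [ht, ← Real.rpow_natCast, ← Real.rpow_mul hM.le, inv_mul_cancel₀ (by exact_mod_cast hd),
      Real.rpow_one]
  have h1 := hc ⟨t⁻¹ • M, by
    rw [Matrix.det_smul, Fintype.card_fin, inv_pow, htd, inv_mul_cancel₀ hM.ne']⟩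
  change evalMatrix (t⁻¹ • M) _ = 0 at h1
  rw [hprod, Finset.prod_eq_zero_iff] at h1
  obtain ⟨i, hi, h1⟩ := h1
  rw [hP i hi, mul_eq_zero] at h1
  rw [hprod]
  refine Finset.prod_eq_zero hi (h1.resolve_left ?_)
  positivity

theorem ZariskiDense.exists_evalMatrix_ne_zero
    {Γ : Subgroup (Matrix.SpecialLinearGroup (Fin d) ℤ)} (hZD : ZariskiDense d Γ)
    {P : MvPolynomial (Fin d × Fin d) ℝ} {A : Matrix.SpecialLinearGroup (Fin d) ℝ}
    (hA : evalMatrix (A : Matrix _ _ ℝ) P ≠ 0) :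
    ∃ γ ∈ Γ, evalMatrix ((γ : Matrix (Fin d) (Fin d) ℤ).map (Int.cast : ℤ → ℝ)) P ≠ 0 := by
  by_contra! hc
  exact hA (hZD P hc A)

end Zariski

section Representation

variable {d r : ℕ}

/-- The polynomial computing `l (⋀ʳM v)` from the entries of the universal matrix. -/
noncomputable def minorPolynomial (l v : Set.powersetCard (Fin d) r → ℝ)
    (M : Matrix (Fin d) (Fin d) (MvPolynomial (Fin d × Fin d) ℝ)) :
    MvPolynomial (Fin d × Fin d) ℝ :=
  ∑ s, ∑ t, MvPolynomial.C (l s * v t) * compound r M s t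

theorem evalMatrix_minorPolynomial (l v : Set.powersetCard (Fin d) r → ℝ)
    (M : Matrix (Fin d) (Fin d) (MvPolynomial (Fin d × Fin d) ℝ)) (A : Matrix (Fin d) (Fin d) ℝ) :
    evalMatrix A (minorPolynomial l v M) = l ⬝ᵥ (compound r (M.map (MvPolynomial.eval
      fun ij => A ij.1 ij.2))).mulVec v := by
  rw [compound_map]
  simp only [evalMatrix, minorPolynomial, map_sum, map_mul, MvPolynomial.eval_C, dotProduct,
    Matrix.mulVec, Matrix.map_apply, Finset.mul_sum]
  refine Finset.sum_congr rfl fun s _ => Finset.sum_congr rfl fun t _ => ?_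
  ring

theorem universalMatrix_map (A : Matrix (Fin d) (Fin d) ℝ) :
    (Matrix.mvPolynomialX (Fin d) (Fin d) ℝ).map (MvPolynomial.eval fun ij => A ij.1 ij.2) = A := by
  ext i j
  simp

theorem universalMatrix_adjugate_map (A : Matrix (Fin d) (Fin d) ℝ) :
    (Matrix.mvPolynomialX (Fin d) (Fin d) ℝ).adjugate.map
      (MvPolynomial.eval fun ij => A ij.1 ij.2) = A.adjugate := by
  have := RingHom.map_adjugate (MvPolynomial.eval fun ij : Fin d × Fin d => A ij.1 ij.2)
    (Matrix.mvPolynomialX (Fin d) (Fin d) ℝ)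
  rw [RingHom.mapMatrix_apply, RingHom.mapMatrix_apply, universalMatrix_map] at this
  exact this

theorem homogeneous_minorPolynomial (l v : Set.powersetCard (Fin d) r → ℝ) :
    HomogeneousOfDegree (minorPolynomial l v (Matrix.mvPolynomialX (Fin d) (Fin d) ℝ)) r := by
  intro t A
  rw [evalMatrix_minorPolynomial, evalMatrix_minorPolynomial, universalMatrix_map,
    universalMatrix_map, compound_smul, Matrix.smul_mulVec, dotProduct_smul, smul_eq_mul]

theorem homogeneous_minorPolynomial_adjugate (l v : Set.powersetCard (Fin d) r → ℝ) :
    HomogeneousOfDegree (minorPolynomial l v (Matrix.mvPolynomialX (Fin d) (Fin d) ℝ).adjugate)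
      ((d - 1) * r) := by
  intro t A
  rw [evalMatrix_minorPolynomial, evalMatrix_minorPolynomial, universalMatrix_adjugate_map,
    universalMatrix_adjugate_map, Matrix.adjugate_smul, compound_smul, Matrix.smul_mulVec,
    dotProduct_smul, smul_eq_mul, Fintype.card_fin, pow_mul]

theorem minorPolynomial_ne_zero {l v : Set.powersetCard (Fin d) r → ℝ} (hl : l ≠ 0) (hv : v ≠ 0) :
    minorPolynomial l v (Matrix.mvPolynomialX (Fin d) (Fin d) ℝ) ≠ 0 := by
  intro h0
  obtain ⟨s, hs⟩ := Function.ne_iff.1 hl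
  obtain ⟨t, ht⟩ := Function.ne_iff.1 hv
  obtain ⟨A, hA⟩ := exists_compound_eq_single s t
  have h1 := evalMatrix_minorPolynomial l v (Matrix.mvPolynomialX (Fin d) (Fin d) ℝ) A
  rw [h0, universalMatrix_map] at h1
  have h2 : l ⬝ᵥ (compound r A).mulVec v = l s * v t := by
    simp only [dotProduct, Matrix.mulVec, hA]
    rw [Finset.sum_eq_single s, Finset.sum_eq_single t]
    · simp
    · intro b _ hb
      simp [hb]
    · simp
    · intro b _ hb
      simp [hb]
    · simp
  rw [h2] at h1
  refine mul_ne_zero hs ht (h1.symm.trans ?_)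
  simp [evalMatrix]

theorem minorPolynomial_adjugate_ne_zero (hd : d ≠ 0) {l v : Set.powersetCard (Fin d) r → ℝ}
    (hl : l ≠ 0) (hv : v ≠ 0) :
    minorPolynomial l v (Matrix.mvPolynomialX (Fin d) (Fin d) ℝ).adjugate ≠ 0 := by
  intro h0
  obtain ⟨A, hA⟩ := exists_evalMatrix_prod_ne_zero hd {()} (fun _ => minorPolynomial l v
    (Matrix.mvPolynomialX (Fin d) (Fin d) ℝ)) (fun _ => r)
    (fun _ _ => homogeneous_minorPolynomial l v) (fun _ _ => minorPolynomial_ne_zero hl hv)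
  rw [Finset.prod_singleton, evalMatrix_minorPolynomial, universalMatrix_map] at hA
  have h1 := evalMatrix_minorPolynomial l v (Matrix.mvPolynomialX (Fin d) (Fin d) ℝ).adjugate
    ((A⁻¹ : Matrix.SpecialLinearGroup (Fin d) ℝ) : Matrix _ _ ℝ)
  rw [h0, universalMatrix_adjugate_map, ← Matrix.SpecialLinearGroup.coe_inv, inv_inv] at h1
  refine hA (h1.symm.trans ?_)
  simp [evalMatrix]

/-- The action of `SL_d(ℤ)` on the `r`th exterior power of `ℝ^d`, in coordinates. -/
noncomputable def exteriorRep (Γ : Subgroup (Matrix.SpecialLinearGroup (Fin d) ℤ)) (r : ℕ) :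
    Γ →* ((Set.powersetCard (Fin d) r → ℝ) →L[ℝ] (Set.powersetCard (Fin d) r → ℝ)) where
  toFun γ := LinearMap.toContinuousLinearMap (Matrix.toLin' (compound r
    (((γ : Matrix.SpecialLinearGroup (Fin d) ℤ) : Matrix (Fin d) (Fin d) ℤ).map
      (Int.castRingHom ℝ))))
  map_one' := by
    ext1 v
    simp [compound_one, Matrix.map_one]
  map_mul' γ δ := by
    ext1 v
    simp only [Subgroup.coe_mul, Matrix.SpecialLinearGroup.coe_mul, Matrix.map_mul, compound_mul]
    simp [Matrix.mulVec_mulVec]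

variable {Γ : Subgroup (Matrix.SpecialLinearGroup (Fin d) ℤ)}

theorem exteriorRep_apply (γ : Γ) (v : Set.powersetCard (Fin d) r → ℝ) :
    exteriorRep Γ r γ v = (compound r
      (((γ : Matrix.SpecialLinearGroup (Fin d) ℤ) : Matrix (Fin d) (Fin d) ℤ).map
        (Int.castRingHom ℝ))).mulVec v := by
  simp [exteriorRep]

theorem abs_det_exteriorRep (γ : Γ) : |(exteriorRep Γ r γ).det| = 1 := by
  have hint : ∀ γ : Γ, ∃ z : ℤ, (exteriorRep Γ r γ).det = z := by
    intro γ
    refine ⟨(compound r ((γ : Matrix.SpecialLinearGroup (Fin d) ℤ) :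
      Matrix (Fin d) (Fin d) ℤ)).det, ?_⟩
    change LinearMap.det (Matrix.toLin' (compound r
      (((γ : Matrix.SpecialLinearGroup (Fin d) ℤ) : Matrix (Fin d) (Fin d) ℤ).map
        (Int.castRingHom ℝ)))) = _
    rw [LinearMap.det_toLin', compound_map]
    exact (RingHom.map_det (Int.castRingHom ℝ) _).symm
  obtain ⟨a, ha⟩ := hint γ
  obtain ⟨b, hb⟩ := hint γ⁻¹
  have h1 : (exteriorRep Γ r γ).det * (exteriorRep Γ r γ⁻¹).det = 1 := by
    have h := LinearMap.det_comp (exteriorRep Γ r γ).toLinearMap (exteriorRep Γ r γ⁻¹).toLinearMap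
    have h' : (exteriorRep Γ r γ).toLinearMap ∘ₗ (exteriorRep Γ r γ⁻¹).toLinearMap =
        LinearMap.id := by
      have := congrArg ContinuousLinearMap.toLinearMap
        (map_mul (exteriorRep Γ r) γ γ⁻¹)
      rw [mul_inv_cancel, map_one] at this
      exact this.symm
    rw [h', LinearMap.det_id] at h
    exact h.symm
  rw [ha, hb] at h1
  have h2 : a * b = 1 := by exact_mod_cast h1
  rw [ha]
  rcases Int.eq_one_or_neg_one_of_mul_eq_one h2 with rfl | rfl <;> simp

theorem exists_exteriorRep_ne_zero (hd : d ≠ 0) (hZD : ZariskiDense d Γ) :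
    HasGenericElements (exteriorRep Γ r) := by
  classical
  intro L L' hL hL' hLn hLn'
  let vec : ((Set.powersetCard (Fin d) r → ℝ) →L[ℝ] ℝ) → Set.powersetCard (Fin d) r → ℝ :=
    fun l s => l (Pi.single s 1)
  have hvec : ∀ l v, l v = vec l ⬝ᵥ v := by
    intro l v
    conv_lhs => rw [pi_eq_sum_univ' v]
    simp only [map_sum, map_smul, dotProduct, vec, smul_eq_mul]
    refine Finset.sum_congr rfl fun s _ => ?_
    rw [mul_comm]
  have hvec0 : ∀ l, l ≠ 0 → vec l ≠ 0 := by
    intro l hl h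
    apply hl
    ext1 v
    rw [hvec, h]
    simp
  let P : Bool × (((Set.powersetCard (Fin d) r → ℝ) →L[ℝ] ℝ) × (Set.powersetCard (Fin d) r → ℝ)) →
      MvPolynomial (Fin d × Fin d) ℝ := fun q => minorPolynomial (vec q.2.1) q.2.2
        (bif q.1 then Matrix.mvPolynomialX (Fin d) (Fin d) ℝ else
          (Matrix.mvPolynomialX (Fin d) (Fin d) ℝ).adjugate)
  let F := {true} ×ˢ hL.toFinset ∪ {false} ×ˢ hL'.toFinset
  obtain ⟨A, hA⟩ := exists_evalMatrix_prod_ne_zero hd F P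
    (fun q => bif q.1 then r else (d - 1) * r)
    (by
      rintro ⟨_ | _, l, v⟩ -
      exacts [homogeneous_minorPolynomial_adjugate _ _, homogeneous_minorPolynomial _ _])
    (by
      rintro ⟨_ | _, l, v⟩ hq
      · have : (l, v) ∈ L' := by simpa [F] using hq
        exact minorPolynomial_adjugate_ne_zero hd (hvec0 _ (hLn' _ this).1) (hLn' _ this).2
      · have : (l, v) ∈ L := by simpa [F] using hq
        exact minorPolynomial_ne_zero (hvec0 _ (hLn _ this).1) (hLn _ this).2)
  obtain ⟨γ, hγ, hne⟩ := hZD.exists_evalMatrix_ne_zero hA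
  have hne' : ∀ q ∈ F, evalMatrix ((γ : Matrix (Fin d) (Fin d) ℤ).map (Int.cast : ℤ → ℝ)) (P q) ≠ 0 := by
    rw [evalMatrix, map_prod, Finset.prod_ne_zero_iff] at hne
    exact hne
  refine ⟨⟨γ, hγ⟩, fun q hq => ?_, fun q hq => ?_⟩
  · have := hne' (true, q) (by simp [F, hq])
    rw [hvec, exteriorRep_apply]
    simp only [P, cond_true] at this
    rw [evalMatrix_minorPolynomial, universalMatrix_map] at this
    exact this
  · have := hne' (false, q) (by simp [F, hq])
    rw [hvec, exteriorRep_apply]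
    simp only [P, cond_false] at this
    rw [evalMatrix_minorPolynomial, universalMatrix_adjugate_map] at this
    convert this using 4
    rw [InvMemClass.coe_inv, Matrix.SpecialLinearGroup.coe_inv]
    exact RingHom.map_adjugate (Int.castRingHom ℝ) _

theorem finite_integer_matrices {ι : Type*} [Finite ι] (C : ℝ) :
    {M : Matrix ι ι ℤ | ∀ i j, |(M i j : ℝ)| ≤ C}.Finite := by
  have h : {z : ℤ | |(z : ℝ)| ≤ C}.Finite := by
    refine (Set.finite_Icc (-⌈C⌉) ⌈C⌉).subset fun z hz => ?_
    have hz'' : |(z : ℝ)| ≤ C := hz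
    have hz' := abs_le.1 hz''
    have := Int.le_ceil C
    constructor
    · have : (-⌈C⌉ : ℝ) ≤ z := by linarith
      exact_mod_cast this
    · have : (z : ℝ) ≤ ⌈C⌉ := by linarith
      exact_mod_cast this
  exact (Set.Finite.pi' fun _ => Set.Finite.pi' fun _ => h)

theorem finite_exteriorRep_le (C : ℝ) :
    {T | ‖T‖ ≤ C ∧ ∃ γ, exteriorRep Γ r γ = T}.Finite := by
  classical
  refine ((finite_integer_matrices C).image fun M => LinearMap.toContinuousLinearMap
    (Matrix.toLin' (M.map (Int.castRingHom ℝ)))).subset ?_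
  rintro T ⟨hT, γ, rfl⟩
  refine ⟨compound r ((γ : Matrix.SpecialLinearGroup (Fin d) ℤ) : Matrix (Fin d) (Fin d) ℤ), ?_, ?_⟩
  · intro s t
    have h1 : exteriorRep Γ r γ (Pi.single t 1) s = (compound r
        ((γ : Matrix.SpecialLinearGroup (Fin d) ℤ) : Matrix (Fin d) (Fin d) ℤ) s t : ℤ) := by
      rw [exteriorRep_apply, compound_map, Matrix.mulVec_single_one]
      rfl
    rw [← h1, ← Real.norm_eq_abs]
    calc _ ≤ ‖exteriorRep Γ r γ (Pi.single t 1)‖ := norm_le_pi_norm _ _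
      _ ≤ ‖exteriorRep Γ r γ‖ * ‖(Pi.single t 1 : Set.powersetCard (Fin d) r → ℝ)‖ :=
        ContinuousLinearMap.le_opNorm _ _
      _ ≤ C := by rw [Pi.norm_single, norm_one, mul_one]; exact hT
  · simp only [exteriorRep, compound_map]
    rfl

theorem exists_rank_one_limit (hd : 2 ≤ d) [Infinite Γ] :
    ∃ r, 1 ≤ r ∧ r < d ∧ ∃ (h : ℕ → Γ) (c : ℕ → ℝ)
      (θ : (Set.powersetCard (Fin d) r → ℝ) →L[ℝ] ℝ) (β : Set.powersetCard (Fin d) r → ℝ),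
      θ ≠ 0 ∧ β ≠ 0 ∧
      Tendsto (fun n => c n • exteriorRep Γ r (h n)) atTop (𝓝 (θ.smulRight β)) := by
  classical
  let h₀ : ℕ ↪ Γ := Infinite.natEmbedding Γ
  let F : Γ → Fin d → Fin d → ℝ := fun γ => Matrix.map
    ((γ : Matrix.SpecialLinearGroup (Fin d) ℤ) : Matrix (Fin d) (Fin d) ℤ) (Int.castRingHom ℝ)
  have hFdet : ∀ γ, Matrix.det (F γ : Matrix (Fin d) (Fin d) ℝ) = 1 := by
    intro γ
    have := RingHom.map_det (Int.castRingHom ℝ)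
      ((γ : Matrix.SpecialLinearGroup (Fin d) ℤ) : Matrix (Fin d) (Fin d) ℤ)
    rw [Matrix.SpecialLinearGroup.det_coe, map_one] at this
    exact this.symm
  have hF0 : ∀ γ, F γ ≠ 0 := by
    intro γ h
    have h1 := hFdet γ
    have h2 : Nonempty (Fin d) := ⟨⟨0, by omega⟩⟩
    rw [h] at h1
    exact zero_ne_one ((Matrix.det_zero (n := Fin d) (R := ℝ)).symm.trans h1)
  have hbig : Tendsto (fun n => ‖F (h₀ n)‖) atTop atTop := by
    rw [← Nat.cofinite_eq_atTop]
    refine tendsto_atTop.2 fun C => ?_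
    rw [Filter.eventually_cofinite]
    refine Set.Finite.of_finite_image (f := fun n => (((h₀ n : Γ) :
      Matrix.SpecialLinearGroup (Fin d) ℤ) : Matrix (Fin d) (Fin d) ℤ))
      ((finite_integer_matrices C).subset ?_) ?_
    · rintro _ ⟨n, hn, rfl⟩ i j
      have hn' : ‖F (h₀ n)‖ < C := not_le.1 hn
      calc _ = ‖F (h₀ n) i j‖ := rfl
        _ ≤ ‖F (h₀ n) i‖ := norm_le_pi_norm _ _
        _ ≤ ‖F (h₀ n)‖ := norm_le_pi_norm _ _
        _ ≤ C := hn'.le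
    · intro a _ b _ hab
      exact h₀.injective (Subtype.ext (Subtype.ext hab))
  let u : ℕ → Fin d → Fin d → ℝ := fun n => ‖F (h₀ n)‖⁻¹ • F (h₀ n)
  have hu : ∀ n, ‖u n‖ = 1 := fun n => norm_smul_inv_norm (𝕜 := ℝ) (hF0 _)
  obtain ⟨A, hA, φ, hφ, hlim⟩ := tendsto_subseq_of_bounded (x := u)
    (Metric.isBounded_closedBall (x := 0) (r := 1)) (fun n => by simp [hu])
  have hAn : ‖A‖ = 1 := tendsto_nhds_unique hlim.norm (by simp [hu])
  have hAdet : Matrix.det (A : Matrix (Fin d) (Fin d) ℝ) = 0 := by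
    have hc : Continuous fun M : Fin d → Fin d → ℝ => Matrix.det (M : Matrix (Fin d) (Fin d) ℝ) :=
      Continuous.matrix_det continuous_id
    refine tendsto_nhds_unique ((hc.tendsto A).comp hlim) ?_
    have h1 : ∀ n, Matrix.det (u n : Matrix (Fin d) (Fin d) ℝ) = ‖F (h₀ n)‖⁻¹ ^ d := by
      intro n
      have := Matrix.det_smul (F (h₀ n) : Matrix (Fin d) (Fin d) ℝ) (‖F (h₀ n)‖⁻¹)
      rw [Fintype.card_fin, hFdet, mul_one] at this
      exact this
    have h2 : Tendsto (fun n => ‖F (h₀ n)‖⁻¹ ^ d) atTop (𝓝 0) := by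
      have := (tendsto_inv_atTop_zero.comp hbig).pow d
      rwa [zero_pow (by omega)] at this
    exact (h2.comp hφ.tendsto_atTop).congr fun n => (h1 _).symm
  let B : Matrix (Fin d) (Fin d) ℝ := Matrix.of A
  have hBdet : B.det = 0 := hAdet
  set f := Matrix.toLin' B with hf
  have hr1 : 1 ≤ Module.finrank ℝ (LinearMap.range f) := by
    rw [Nat.one_le_iff_ne_zero, Ne, Submodule.finrank_eq_zero, LinearMap.range_eq_bot, hf,
      LinearEquiv.map_eq_zero_iff]
    intro h
    have : A = 0 := congrArg Matrix.of.symm h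
    rw [this, norm_zero] at hAn
    exact zero_ne_one hAn
  have hr2 : Module.finrank ℝ (LinearMap.range f) < d := by
    have h1 : LinearMap.range f ≠ ⊤ := by
      intro h
      have h2 : LinearMap.ker f = ⊥ := LinearMap.ker_eq_bot_iff_range_eq_top.2 h
      have h3 : IsUnit (LinearMap.det f) :=
        LinearEquiv.isUnit_det' (LinearEquiv.ofBijective f
          ⟨LinearMap.ker_eq_bot.1 h2, LinearMap.range_eq_top.1 h⟩)
      rw [hf, LinearMap.det_toLin', hBdet] at h3
      exact not_isUnit_zero h3
    have := Submodule.finrank_lt (lt_top_iff_ne_top.2 h1).ne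
    rwa [Module.finrank_fin_fun] at this
  obtain ⟨θ, β, hθ, hβ, h1⟩ := exists_toLin'_compound_eq (A := B) rfl
  refine ⟨_, hr1, hr2, h₀ ∘ φ, fun n => ‖F (h₀ (φ n))‖⁻¹ ^ Module.finrank ℝ (LinearMap.range f),
    θ, β, hθ, hβ, ?_⟩
  rw [← h1]
  have hc : Continuous fun M : Fin d → Fin d → ℝ => LinearMap.toContinuousLinearMap
      (Matrix.toLin' (compound (Module.finrank ℝ (LinearMap.range f))
        (M : Matrix (Fin d) (Fin d) ℝ))) := by
    have h2 : Continuous fun M : Matrix (Set.powersetCard (Fin d) (Module.finrank ℝ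
        (LinearMap.range f))) (Set.powersetCard (Fin d) (Module.finrank ℝ
        (LinearMap.range f))) ℝ => LinearMap.toContinuousLinearMap (Matrix.toLin' M) :=
      LinearMap.continuous_of_finiteDimensional
        ((Matrix.toLin' (R := ℝ)).trans LinearMap.toContinuousLinearMap).toLinearMap
    exact h2.comp continuous_compound
  refine ((hc.tendsto A).comp hlim).congr fun n => ?_
  change LinearMap.toContinuousLinearMap (Matrix.toLin' (compound _
    (‖F (h₀ (φ n))‖⁻¹ • Matrix.of (F (h₀ (φ n)))))) = _
  rw [compound_smul, map_smul, map_smul]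
  rfl

theorem ZariskiDense.exists_hasSparseFreeSubgroup (hd : 2 ≤ d) [Infinite Γ]
    (hZD : ZariskiDense d Γ) : ∃ r, ∀ m, HasSparseFreeSubgroup Γ r m := by
  obtain ⟨r, hr1, hr2, h, c, θ, β, hθ, hβ, hh⟩ := exists_rank_one_limit (Γ := Γ) hd
  refine _root_.exists_hasSparseFreeSubgroup ?_ (exists_exteriorRep_ne_zero (by omega) hZD)
    abs_det_exteriorRep finite_exteriorRep_le hθ hβ hh
  have h1 : Module.finrank ℝ (Set.powersetCard (Fin d) r → ℝ) = d.choose r := by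
    have h2 := exteriorPower.finrank_eq (R := ℝ) (M := Fin d → ℝ) (n := r)
    rw [Module.finrank_fin_fun,
      Module.finrank_eq_card_basis ((Pi.basisFun ℝ (Fin d)).exteriorPower r)] at h2
    rw [Module.finrank_fintype_fun_eq_card, h2]
  rw [h1]
  obtain ⟨k, rfl⟩ := Nat.exists_eq_add_of_le hr1
  obtain ⟨n, rfl⟩ := Nat.exists_eq_add_of_le (show 1 ≤ d by omega)
  rw [add_comm 1 n, add_comm 1 k, Nat.choose_succ_succ']
  have h2 := Nat.choose_pos (n := n) (k := k) (by omega)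
  have h3 := Nat.choose_pos (n := n) (k := k + 1) (by omega)
  omega

end Representation

section UnitaryDisplacement

variable {G V : Type*} [Group G] [NormedAddCommGroup V] [InnerProductSpace ℂ V]

theorem unitary_mul_apply (π : G →* (V ≃ₗᵢ[ℂ] V)) (g h : G) (v : V) :
    π (g * h) v = π g (π h v) := by
  rw [map_mul]; rfl

theorem norm_unitary_mul_sub_le (π : G →* (V ≃ₗᵢ[ℂ] V)) (v : V) (g h : G) :
    ‖π (g * h) v - v‖ ≤ ‖π g v - v‖ + ‖π h v - v‖ := by
  have h1 : π (g * h) v - v = π g (π h v - v) + (π g v - v) := by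
    rw [unitary_mul_apply, map_sub]
    abel
  rw [h1]
  refine (norm_add_le _ _).trans ?_
  rw [LinearIsometryEquiv.norm_map, add_comm]

theorem norm_unitary_inv_sub (π : G →* (V ≃ₗᵢ[ℂ] V)) (v : V) (g : G) :
    ‖π g⁻¹ v - v‖ = ‖π g v - v‖ := by
  have h1 : π g (π g⁻¹ v - v) = -(π g v - v) := by
    rw [map_sub, ← unitary_mul_apply]
    simp
  rw [← LinearIsometryEquiv.norm_map (π g), h1, norm_neg]

end UnitaryDisplacement

/-- The spectral component, at the character `z`, of a vector in a unitary representation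
restricted to a family `u` of group elements indexed by `(ℤ/p)²`. -/
noncomputable def spectralComponent {G V : Type*} [Group G] [NormedAddCommGroup V]
    [InnerProductSpace ℂ V] {p : ℕ} [NeZero p] (π : G →* (V ≃ₗᵢ[ℂ] V))
    (u : ZMod p × ZMod p → G) (z : ZMod p × ZMod p) (v : V) : V :=
  ((p : ℂ) ^ 2)⁻¹ • ∑ w : ZMod p × ZMod p,
    ZMod.stdAddChar (-(z.1 * w.1 + z.2 * w.2)) • π (u w) v

section SpectralComponent

variable {G V : Type*} [Group G] [NormedAddCommGroup V]
  [InnerProductSpace ℂ V] {p : ℕ} [NeZero p] (π : G →* (V ≃ₗᵢ[ℂ] V))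
  (u : ZMod p × ZMod p → G)

theorem spectralComponent_sub (z : ZMod p × ZMod p) (v w : V) :
    spectralComponent π u z (v - w) = spectralComponent π u z v - spectralComponent π u z w := by
  simp only [spectralComponent, map_sub, smul_sub, Finset.sum_sub_distrib]

theorem sum_stdAddChar_mul (b : ZMod p) :
    ∑ x : ZMod p, ZMod.stdAddChar (x * b) = if b = 0 then (p : ℂ) else 0 := by
  rw [AddChar.sum_mulShift b (ZMod.isPrimitive_stdAddChar p)]
  simp

theorem sum_spectralComponent (hu1 : u 0 = 1) (v : V) :
    ∑ z, spectralComponent π u z v = v := by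
  have hp : ((p : ℂ) ^ 2) ≠ 0 := pow_ne_zero _ (Nat.cast_ne_zero.2 (NeZero.ne p))
  simp only [spectralComponent]
  rw [← Finset.smul_sum, Finset.sum_comm]
  have h1 : ∀ w : ZMod p × ZMod p,
      ∑ z : ZMod p × ZMod p, ZMod.stdAddChar (-(z.1 * w.1 + z.2 * w.2)) • π (u w) v =
        if w = 0 then ((p : ℂ) ^ 2) • v else 0 := by
    intro w
    rw [← Finset.sum_smul, Fintype.sum_prod_type]
    have h2 : ∀ x y : ZMod p, (ZMod.stdAddChar (-(x * w.1 + y * w.2)) : ℂ) =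
        ZMod.stdAddChar (x * -w.1) * ZMod.stdAddChar (y * -w.2) := by
      intro x y
      rw [← AddChar.map_add_eq_mul]
      congr 1
      ring
    simp only [h2]
    simp only [← Finset.mul_sum, sum_stdAddChar_mul, ← Finset.sum_mul, neg_eq_zero]
    by_cases hw1 : w.1 = 0
    · by_cases hw2 : w.2 = 0
      · have hw : w = 0 := Prod.ext hw1 hw2
        simp [hw, hu1, pow_two]
      · have hw : w ≠ 0 := fun h => hw2 (by simp [h])
        simp [hw, hw2]
    · have hw : w ≠ 0 := fun h => hw1 (by simp [h])
      simp [hw, hw1]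
  simp only [h1, Finset.sum_ite_eq', Finset.mem_univ, if_true]
  rw [smul_smul, inv_mul_cancel₀ hp, one_smul]

variable {u} in
theorem map_spectralComponent (hu : ∀ w w', u (w + w') = u w * u w')
    (z w : ZMod p × ZMod p) (v : V) :
    π (u w) (spectralComponent π u z v) =
      (ZMod.stdAddChar (z.1 * w.1 + z.2 * w.2) : ℂ) • spectralComponent π u z v := by
  simp only [spectralComponent]
  rw [map_smul, map_sum, smul_comm (ZMod.stdAddChar (z.1 * w.1 + z.2 * w.2) : ℂ) ((p : ℂ) ^ 2)⁻¹]
  congr 1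
  rw [Finset.smul_sum]
  refine Fintype.sum_bijective (fun w' => w + w') (Equiv.addLeft w).bijective _ _ fun w' => ?_
  rw [map_smul, smul_smul, hu, ← AddChar.map_add_eq_mul, unitary_mul_apply]
  congr 2
  simp only [Prod.fst_add, Prod.snd_add]
  ring

theorem conj_stdAddChar (x : ZMod p) :
    (starRingEnd ℂ) (ZMod.stdAddChar x) = ZMod.stdAddChar (-x) := by
  rw [AddChar.map_neg_eq_conj]

variable {u} in
theorem inner_spectralComponent_self (hu : ∀ w w', u (w + w') = u w * u w')
    (z : ZMod p × ZMod p) (v : V) :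
    inner ℂ (spectralComponent π u z v) (spectralComponent π u z v) =
      inner ℂ v (spectralComponent π u z v) := by
  have hp : ((p : ℂ) ^ 2) ≠ 0 := pow_ne_zero _ (Nat.cast_ne_zero.2 (NeZero.ne p))
  set y := spectralComponent π u z v with hy
  have h1 : ∀ w, inner ℂ ((ZMod.stdAddChar (-(z.1 * w.1 + z.2 * w.2)) : ℂ) • π (u w) v) y =
      inner ℂ v y := by
    intro w
    have h2 : y = (ZMod.stdAddChar (-(z.1 * w.1 + z.2 * w.2)) : ℂ) • π (u w) y := by
      rw [hy, map_spectralComponent π hu, smul_smul, ← AddChar.map_add_eq_mul]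
      simp
    conv_lhs => rw [h2]
    rw [inner_smul_left, inner_smul_right, LinearIsometryEquiv.inner_map_map, conj_stdAddChar,
      ← mul_assoc, ← AddChar.map_add_eq_mul]
    simp
  have h3 : inner ℂ (spectralComponent π u z v) y = inner ℂ v y := by
    rw [spectralComponent, inner_smul_left, sum_inner]
    simp only [h1]
    simp only [Finset.sum_const, Finset.card_univ, Fintype.card_prod, ZMod.card]
    rw [map_inv₀, map_pow, Complex.conj_natCast, nsmul_eq_mul]
    push_cast
    rw [← pow_two, ← mul_assoc, inv_mul_cancel₀ hp, one_mul]
  exact h3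

variable {u} in
theorem sum_norm_sq_spectralComponent (hu : ∀ w w', u (w + w') = u w * u w') (hu1 : u 0 = 1)
    (v : V) : ∑ z, ‖spectralComponent π u z v‖ ^ 2 = ‖v‖ ^ 2 := by
  have h1 : ((∑ z, ‖spectralComponent π u z v‖ ^ 2 : ℝ) : ℂ) = ((‖v‖ ^ 2 : ℝ) : ℂ) := by
    push_cast
    have h2 : ∀ x : V, ((‖x‖ : ℂ)) ^ 2 = inner ℂ x x := fun x =>
      (inner_self_eq_norm_sq_to_K (𝕜 := ℂ) x).symm
    simp only [h2, inner_spectralComponent_self π hu]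
    rw [← inner_sum, sum_spectralComponent π u hu1]
  exact_mod_cast h1

variable {u} in
theorem spectralComponent_map_sub (hu : ∀ w w', u (w + w') = u w * u w') 
    (z w : ZMod p × ZMod p) (v : V) :
    spectralComponent π u z (π (u w) v - v) =
      ((ZMod.stdAddChar (z.1 * w.1 + z.2 * w.2) : ℂ) - 1) • spectralComponent π u z v := by
  rw [spectralComponent_sub, sub_smul, one_smul, ← map_spectralComponent π hu]
  congr 1
  simp only [spectralComponent]
  rw [map_smul, map_sum]
  congr 1
  refine Finset.sum_congr rfl fun w' _ => ?_
  rw [map_smul, ← unitary_mul_apply, ← unitary_mul_apply, ← hu, ← hu, add_comm w w']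

theorem map_spectralComponent_of_conj (g : G) (e f : ZMod p × ZMod p → ZMod p × ZMod p)
    (he : Function.Bijective e) (hg : ∀ w, g * u w = u (e w) * g)
    (hf : ∀ z w : ZMod p × ZMod p,
      z.1 * w.1 + z.2 * w.2 = (f z).1 * (e w).1 + (f z).2 * (e w).2)
    (z : ZMod p × ZMod p) (v : V) :
    π g (spectralComponent π u z v) = spectralComponent π u (f z) (π g v) := by
  simp only [spectralComponent]
  rw [map_smul, map_sum]
  congr 1
  refine Fintype.sum_bijective e he _ _ fun w => ?_
  rw [map_smul, ← unitary_mul_apply, ← unitary_mul_apply, hg, hf z w]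

variable {u} in
/-- Moving spectral mass by a group element normalizing `u`. -/
theorem sqrt_spectralMass_le (hu : ∀ w w', u (w + w') = u w * u w') (hu1 : u 0 = 1)
    (g : G) (e f : ZMod p × ZMod p → ZMod p × ZMod p)
    (he : Function.Bijective e) (hfi : Function.Injective f) (hg : ∀ w, g * u w = u (e w) * g)
    (hf : ∀ z w : ZMod p × ZMod p,
      z.1 * w.1 + z.2 * w.2 = (f z).1 * (e w).1 + (f z).2 * (e w).2)
    (A : Finset (ZMod p × ZMod p)) (v : V) :
    √(∑ z ∈ A, ‖spectralComponent π u z v‖ ^ 2) ≤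
      √(∑ z ∈ A.image f, ‖spectralComponent π u z v‖ ^ 2) + ‖π g v - v‖ := by
  have h1 : ∑ z ∈ A, ‖spectralComponent π u z v‖ ^ 2 =
      ∑ z ∈ A.image f, ‖spectralComponent π u z (π g v)‖ ^ 2 := by
    rw [Finset.sum_image fun _ _ _ _ h => hfi h]
    refine Finset.sum_congr rfl fun z _ => ?_
    rw [← map_spectralComponent_of_conj π u g e f he hg hf, LinearIsometryEquiv.norm_map]
  rw [h1]
  generalize A.image f = B
  let T : V → PiLp 2 (fun _ : B => V) := fun w =>
    WithLp.toLp 2 (fun z : B => spectralComponent π u z w)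
  have hT : ∀ w, ‖T w‖ = √(∑ z ∈ B, ‖spectralComponent π u z w‖ ^ 2) := by
    intro w
    rw [PiLp.norm_eq_of_L2, ← Finset.sum_coe_sort B fun z => ‖spectralComponent π u z w‖ ^ 2]
  rw [← hT, ← hT]
  have h2 : ‖T (π g v - v)‖ ≤ ‖π g v - v‖ := by
    rw [hT]
    refine Real.sqrt_le_iff.2 ⟨norm_nonneg _, ?_⟩
    rw [← sum_norm_sq_spectralComponent π hu hu1 (π g v - v)]
    exact Finset.sum_le_sum_of_subset_of_nonneg (Finset.subset_univ _) fun _ _ _ => sq_nonneg _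
  have h3 : T (π g v) = T v + T (π g v - v) := by
    ext z
    simp [T, spectralComponent_sub]
  rw [h3]
  exact (norm_add_le _ _).trans (by gcongr)

end SpectralComponent

/-- The spectral mass in two opposite quadrants, near the origin, is small for almost
invariant vectors. -/
theorem quadrant_spectralMass_le {G V : Type*} [Group G] [NormedAddCommGroup V]
    [InnerProductSpace ℂ V] {p : ℕ} [NeZero p] (π : G →* (V ≃ₗᵢ[ℂ] V))
    {u : ZMod p × ZMod p → G}
    (hu : ∀ w w', u (w + w') = u w * u w') (hu1 : u 0 = 1) (t₁ t₂ : G)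
    (ht₁ : ∀ w, t₁ * u w = u (w.1 + w.2, w.2) * t₁)
    (ht₂ : ∀ w, t₂ * u w = u (w.1, w.2 + w.1) * t₂)
    {v : V} (hv : ‖v‖ ≤ 1) {ε : ℝ} (hε : ε ≤ 1)
    (h₁ : ‖π t₁ v - v‖ ≤ ε) (h₂ : ‖π t₂ v - v‖ ≤ ε)
    (hbox : ∑ z : ZMod p × ZMod p with ¬ (8 * z.1.valMinAbs.natAbs ≤ p ∧
      8 * z.2.valMinAbs.natAbs ≤ p), ‖spectralComponent π u z v‖ ^ 2 ≤ 4 * ε ^ 2) :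
    ∑ z : ZMod p × ZMod p with (8 * z.1.valMinAbs.natAbs ≤ p ∧
      8 * z.2.valMinAbs.natAbs ≤ p) ∧ z ≠ 0 ∧ 0 ≤ z.1.valMinAbs * z.2.valMinAbs,
      ‖spectralComponent π u z v‖ ^ 2 ≤ 20 * ε := by
  have hε0 : 0 ≤ ε := (norm_nonneg _).trans h₁
  have hp0 : 0 < p := NeZero.pos p
  let m : ZMod p × ZMod p → ℝ := fun z => ‖spectralComponent π u z v‖ ^ 2
  have hm : ∀ z, 0 ≤ m z := fun z => sq_nonneg _
  have hmono : ∀ A B : Finset (ZMod p × ZMod p), A ⊆ B → ∑ z ∈ A, m z ≤ ∑ z ∈ B, m z :=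
    fun A B h => Finset.sum_le_sum_of_subset_of_nonneg h fun _ _ _ => hm _
  have htot : ∀ A : Finset (ZMod p × ZMod p), ∑ z ∈ A, m z ≤ 1 := by
    intro A
    refine (hmono A _ (Finset.subset_univ _)).trans ?_
    rw [sum_norm_sq_spectralComponent π hu hu1]
    exact pow_le_one₀ (norm_nonneg _) hv
  let Q₁ : Finset (ZMod p × ZMod p) := Finset.univ.filter fun z =>
    (8 * z.1.valMinAbs.natAbs ≤ p ∧ 8 * z.2.valMinAbs.natAbs ≤ p) ∧
      z.2.valMinAbs ≠ 0 ∧ 0 ≤ z.1.valMinAbs * z.2.valMinAbs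
  let Q₂ : Finset (ZMod p × ZMod p) := Finset.univ.filter fun z =>
    (8 * z.1.valMinAbs.natAbs ≤ p ∧ 8 * z.2.valMinAbs.natAbs ≤ p) ∧
      z.1.valMinAbs ≠ 0 ∧ 0 ≤ z.1.valMinAbs * z.2.valMinAbs
  let D : Finset (ZMod p × ZMod p) := Finset.univ.filter fun z =>
    ¬ (8 * z.1.valMinAbs.natAbs ≤ p ∧ 8 * z.2.valMinAbs.natAbs ≤ p)
  let f₁ : ZMod p × ZMod p → ZMod p × ZMod p := fun z => (z.1 + 2 * z.2, z.2)
  let f₂ : ZMod p × ZMod p → ZMod p × ZMod p := fun z => (z.1, z.2 + 2 * z.1)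
  have hf₁ : Function.Injective f₁ := by
    rintro ⟨a, b⟩ ⟨c, d⟩ h
    simp only [f₁, Prod.mk.injEq] at h ⊢
    obtain ⟨h1, rfl⟩ := h
    exact ⟨add_right_cancel h1, rfl⟩
  have hf₂ : Function.Injective f₂ := by
    rintro ⟨a, b⟩ ⟨c, d⟩ h
    simp only [f₂, Prod.mk.injEq] at h ⊢
    obtain ⟨rfl, h1⟩ := h
    exact ⟨rfl, add_right_cancel h1⟩
  have hstep : ∀ (A : Finset (ZMod p × ZMod p)) (g : G) (e f : ZMod p × ZMod p → ZMod p × ZMod p)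
      (_ : Function.Bijective e) (_ : Function.Injective f) (_ : ∀ w, g * u w = u (e w) * g)
      (_ : ∀ z w : ZMod p × ZMod p,
        z.1 * w.1 + z.2 * w.2 = (f z).1 * (e w).1 + (f z).2 * (e w).2)
      (_ : ‖π g v - v‖ ≤ 2 * ε),
      ∑ z ∈ A, m z ≤ ∑ z ∈ A.image f, m z + (4 * ε + 4 * ε ^ 2) := by
    intro A g e f he hfi hg hf hgv
    have h1 := (sqrt_spectralMass_le π hu hu1 g e f he hfi hg hf A v).trans
      (add_le_add_right hgv _)
    change √(∑ z ∈ A, m z) ≤ √(∑ z ∈ A.image f, m z) + 2 * ε at h1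
    have h2 : 0 ≤ ∑ z ∈ A, m z := Finset.sum_nonneg fun _ _ => hm _
    have h3 : 0 ≤ ∑ z ∈ A.image f, m z := Finset.sum_nonneg fun _ _ => hm _
    have h4 : √(∑ z ∈ A.image f, m z) ≤ 1 := Real.sqrt_le_one.2 (htot _)
    have h5 := Real.sq_sqrt h2
    have h6 := Real.sq_sqrt h3
    have h7 := Real.sqrt_nonneg (∑ z ∈ A, m z)
    have h8 := Real.sqrt_nonneg (∑ z ∈ A.image f, m z)
    nlinarith
  have hinv2 : ∀ t : G, ‖π t v - v‖ ≤ ε → ‖π (t⁻¹ * t⁻¹) v - v‖ ≤ 2 * ε := by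
    intro t ht
    have h := norm_unitary_mul_sub_le π v t⁻¹ t⁻¹
    rw [norm_unitary_inv_sub] at h
    linarith
  have hS₁ := hstep Q₁ (t₂⁻¹ * t₂⁻¹) (fun w => (w.1, w.2 - 2 * w.1)) f₁
    (Function.bijective_iff_has_inverse.2 ⟨fun w => (w.1, w.2 + 2 * w.1),
      fun w => by simp, fun w => by simp⟩) hf₁
    (by
      intro w
      have h1 := ht₂ (w.1, w.2 - w.1)
      have h2 := ht₂ (w.1, w.2 - 2 * w.1)
      simp only [sub_add_cancel] at h1
      have h3 : w.2 - 2 * w.1 + w.1 = w.2 - w.1 := by ring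
      simp only [h3] at h2
      rw [← eq_inv_mul_iff_mul_eq] at h1 h2
      rw [h2, h1]
      group)
    (by intro z w; simp only [f₁]; ring) (hinv2 t₂ h₂)
  have hS₂ := hstep Q₂ (t₁⁻¹ * t₁⁻¹) (fun w => (w.1 - 2 * w.2, w.2)) f₂
    (Function.bijective_iff_has_inverse.2 ⟨fun w => (w.1 + 2 * w.2, w.2),
      fun w => by simp, fun w => by simp⟩) hf₂
    (by
      intro w
      have h1 := ht₁ (w.1 - w.2, w.2)
      have h2 := ht₁ (w.1 - 2 * w.2, w.2)
      simp only [sub_add_cancel] at h1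
      have h3 : w.1 - 2 * w.2 + w.2 = w.1 - w.2 := by ring
      simp only [h3] at h2
      rw [← eq_inv_mul_iff_mul_eq] at h1 h2
      rw [h2, h1]
      group)
    (by intro z w; simp only [f₂]; ring) (hinv2 t₁ h₁)
  have key₁ : ∀ z ∈ Q₁, (f₁ z).1.valMinAbs = z.1.valMinAbs + 2 * z.2.valMinAbs := by
    intro z hz
    obtain ⟨⟨hz1, hz2⟩, hz3, hz4⟩ := (Finset.mem_filter.1 hz).2
    refine (ZMod.valMinAbs_spec _ _).2 ⟨?_, ?_, ?_⟩
    · push_cast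
      simp [f₁]
    · omega
    · omega
  have key₂ : ∀ z ∈ Q₂, (f₂ z).2.valMinAbs = z.2.valMinAbs + 2 * z.1.valMinAbs := by
    intro z hz
    obtain ⟨⟨hz1, hz2⟩, hz3, hz4⟩ := (Finset.mem_filter.1 hz).2
    refine (ZMod.valMinAbs_spec _ _).2 ⟨?_, ?_, ?_⟩
    · push_cast
      simp [f₂]
    · omega
    · omega
  have hdisj : Disjoint (Q₁.image f₁) (Q₂.image f₂) := by
    rw [Finset.disjoint_left]
    intro y hy1 hy2
    obtain ⟨z, hz, rfl⟩ := Finset.mem_image.1 hy1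
    obtain ⟨z', hz', he⟩ := Finset.mem_image.1 hy2
    have k1 := key₁ z hz
    have k2 := key₂ z' hz'
    rw [he] at k2
    have k3 : (f₁ z).1 = z'.1 := by rw [← he]
    have k4 : (f₁ z).2 = z.2 := rfl
    rw [k3] at k1
    rw [k4] at k2
    obtain ⟨-, hz3, hz4⟩ := (Finset.mem_filter.1 hz).2
    obtain ⟨-, hz3', hz4'⟩ := (Finset.mem_filter.1 hz').2
    generalize z.1.valMinAbs = a at *
    generalize z.2.valMinAbs = b at *
    generalize z'.1.valMinAbs = a' at *
    generalize z'.2.valMinAbs = b' at *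
    have h5 : 0 < b ^ 2 := by positivity
    have h6 : a = a' - 2 * b := by linarith
    have h7 : b' = b - 2 * a' := by linarith
    rw [h6] at hz4
    rw [h7] at hz4'
    nlinarith [sq_nonneg (a' - b), sq_nonneg a']
  have hsub : Q₁.image f₁ ∪ Q₂.image f₂ ⊆ (Q₁ ∩ Q₂) ∪ D := by
    intro y hy
    rw [Finset.mem_union, Finset.mem_inter]
    by_cases hb : 8 * y.1.valMinAbs.natAbs ≤ p ∧ 8 * y.2.valMinAbs.natAbs ≤ p
    · left
      simp only [Q₁, Q₂, Finset.mem_filter, Finset.mem_univ, true_and]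
      rcases Finset.mem_union.1 hy with h | h
      · obtain ⟨z, hz, rfl⟩ := Finset.mem_image.1 h
        have k1 := key₁ z hz
        have k4 : (f₁ z).2 = z.2 := rfl
        obtain ⟨-, hz3, hz4⟩ := (Finset.mem_filter.1 hz).2
        have h5 : 0 < z.2.valMinAbs ^ 2 := by positivity
        have h6 : 0 < (f₁ z).1.valMinAbs * (f₁ z).2.valMinAbs := by
          rw [k1, k4]; nlinarith
        exact ⟨⟨hb, (right_ne_zero_of_mul h6.ne'), h6.le⟩, hb, left_ne_zero_of_mul h6.ne', h6.le⟩
      · obtain ⟨z, hz, rfl⟩ := Finset.mem_image.1 h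
        have k1 := key₂ z hz
        have k4 : (f₂ z).1 = z.1 := rfl
        obtain ⟨-, hz3, hz4⟩ := (Finset.mem_filter.1 hz).2
        have h5 : 0 < z.1.valMinAbs ^ 2 := by positivity
        have h6 : 0 < (f₂ z).1.valMinAbs * (f₂ z).2.valMinAbs := by
          rw [k1, k4]; nlinarith
        exact ⟨⟨hb, (right_ne_zero_of_mul h6.ne'), h6.le⟩, hb, left_ne_zero_of_mul h6.ne', h6.le⟩
    · right
      exact Finset.mem_filter.2 ⟨Finset.mem_univ _, hb⟩
  have e1 : ∑ z ∈ Q₁.image f₁, m z + ∑ z ∈ Q₂.image f₂, m z ≤ ∑ z ∈ Q₁ ∩ Q₂, m z + 4 * ε ^ 2 := by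
    rw [← Finset.sum_union hdisj]
    refine (hmono _ _ hsub).trans ?_
    have := Finset.sum_union_inter (s₁ := Q₁ ∩ Q₂) (s₂ := D) (f := m)
    have h0 : 0 ≤ ∑ z ∈ (Q₁ ∩ Q₂) ∩ D, m z := Finset.sum_nonneg fun _ _ => hm _
    have hb' : ∑ z ∈ D, m z ≤ 4 * ε ^ 2 := hbox
    linarith
  have e2 := Finset.sum_union_inter (s₁ := Q₁) (s₂ := Q₂) (f := m)
  refine (hmono _ (Q₁ ∪ Q₂) ?_).trans ?_
  · intro z hz
    obtain ⟨hb, hz0, hz1⟩ := (Finset.mem_filter.1 hz).2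
    rw [Finset.mem_union]
    by_cases h2 : z.2 = 0
    · right
      refine Finset.mem_filter.2 ⟨Finset.mem_univ _, hb, ?_, hz1⟩
      rw [Ne, ZMod.valMinAbs_eq_zero]
      exact fun h => hz0 (Prod.ext h h2)
    · left
      refine Finset.mem_filter.2 ⟨Finset.mem_univ _, hb, ?_, hz1⟩
      rwa [Ne, ZMod.valMinAbs_eq_zero]
  · nlinarith

theorem half_le_norm_stdAddChar_sub_one_sq {p : ℕ} [NeZero p] (x : ZMod p)
    (hx : p < 8 * x.valMinAbs.natAbs) : 1 / 2 ≤ ‖(ZMod.stdAddChar x : ℂ) - 1‖ ^ 2 := by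
  have hp : (0 : ℝ) < p := Nat.cast_pos.2 (NeZero.pos p)
  set θ : ℝ := 2 * Real.pi * x.valMinAbs / p with hθ
  have h1 : (ZMod.stdAddChar x : ℂ) = Complex.exp (θ * Complex.I) := by
    conv_lhs => rw [← ZMod.coe_valMinAbs x]
    rw [ZMod.stdAddChar_coe]
    congr 1
    rw [hθ]
    push_cast
    ring
  have h2 : ‖(ZMod.stdAddChar x : ℂ) - 1‖ ^ 2 = 2 - 2 * Real.cos θ := by
    rw [h1, Complex.exp_mul_I, Complex.sq_norm, Complex.normSq_apply]
    simp only [Complex.sub_re, Complex.add_re, Complex.mul_re, Complex.I_re, Complex.I_im,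
      Complex.one_re, Complex.sub_im, Complex.add_im, Complex.mul_im, Complex.one_im,
      ← Complex.ofReal_cos, ← Complex.ofReal_sin, Complex.ofReal_re, Complex.ofReal_im]
    nlinarith [Real.sin_sq_add_cos_sq θ]
  have h3 : Real.cos θ ≤ √2 / 2 := by
    rw [← Real.cos_abs, ← Real.cos_pi_div_four]
    have h4 : |θ| = 2 * Real.pi * (x.valMinAbs.natAbs : ℝ) / p := by
      rw [hθ, abs_div, abs_mul, abs_of_pos hp, abs_of_pos Real.two_pi_pos, Nat.cast_natAbs,
        Int.cast_abs]
    have h5 : (p : ℝ) ≤ 8 * x.valMinAbs.natAbs := by exact_mod_cast hx.le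
    have h6 : (2 : ℝ) * x.valMinAbs.natAbs ≤ p := by
      have h7 : 2 * x.valMinAbs.natAbs ≤ p := by
        have := ZMod.natAbs_valMinAbs_le x
        omega
      exact_mod_cast h7
    apply Real.cos_le_cos_of_nonneg_of_le_pi
    · positivity
    · rw [h4, div_le_iff₀ hp]
      nlinarith [Real.pi_pos]
    · rw [h4, le_div_iff₀ hp]
      nlinarith [Real.pi_pos]
  have h4 : √2 ≤ 3 / 2 := Real.sqrt_le_iff.2 ⟨by norm_num, by norm_num⟩
  rw [h2]
  linarith

section RelativePropertyT

variable {G V : Type*} [Group G] [NormedAddCommGroup V]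
    [InnerProductSpace ℂ V] {p : ℕ} [NeZero p] (π : G →* (V ≃ₗᵢ[ℂ] V))
    {u : ZMod p × ZMod p → G}

theorem norm_unitary_sub_sq_eq_sum (hu : ∀ w w', u (w + w') = u w * u w') (hu1 : u 0 = 1)
    (w : ZMod p × ZMod p) (v : V) :
    ‖π (u w) v - v‖ ^ 2 = ∑ z, ‖(ZMod.stdAddChar (z.1 * w.1 + z.2 * w.2) : ℂ) - 1‖ ^ 2 *
      ‖spectralComponent π u z v‖ ^ 2 := by
  rw [← sum_norm_sq_spectralComponent π hu hu1]
  refine Finset.sum_congr rfl fun z _ => ?_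
  rw [spectralComponent_map_sub π hu, norm_smul, mul_pow]

theorem boxed_spectralMass_le (hu : ∀ w w', u (w + w') = u w * u w') (hu1 : u 0 = 1)
    {v : V} {ε : ℝ} (h₁ : ‖π (u (1, 0)) v - v‖ ≤ ε) (h₂ : ‖π (u (0, 1)) v - v‖ ≤ ε) :
    ∑ z : ZMod p × ZMod p with ¬ (8 * z.1.valMinAbs.natAbs ≤ p ∧
      8 * z.2.valMinAbs.natAbs ≤ p), ‖spectralComponent π u z v‖ ^ 2 ≤ 4 * ε ^ 2 := by
  have e1 : ‖π (u (1, 0)) v - v‖ ^ 2 ≤ ε ^ 2 := pow_le_pow_left₀ (norm_nonneg _) h₁ 2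
  have e2 : ‖π (u (0, 1)) v - v‖ ^ 2 ≤ ε ^ 2 := pow_le_pow_left₀ (norm_nonneg _) h₂ 2
  rw [norm_unitary_sub_sq_eq_sum π hu hu1] at e1 e2
  have e3 : ∑ z : ZMod p × ZMod p with ¬ (8 * z.1.valMinAbs.natAbs ≤ p ∧
      8 * z.2.valMinAbs.natAbs ≤ p), ‖spectralComponent π u z v‖ ^ 2 ≤
      ∑ z : ZMod p × ZMod p, (2 * (‖(ZMod.stdAddChar z.1 : ℂ) - 1‖ ^ 2 *
        ‖spectralComponent π u z v‖ ^ 2) + 2 * (‖(ZMod.stdAddChar z.2 : ℂ) - 1‖ ^ 2 *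
        ‖spectralComponent π u z v‖ ^ 2)) := by
    rw [Finset.sum_filter]
    refine Finset.sum_le_sum fun z _ => ?_
    have h0 := sq_nonneg ‖spectralComponent π u z v‖
    have h1 := sq_nonneg ‖(ZMod.stdAddChar z.1 : ℂ) - 1‖
    have h2 := sq_nonneg ‖(ZMod.stdAddChar z.2 : ℂ) - 1‖
    have h3 := mul_nonneg h1 h0
    have h4 := mul_nonneg h2 h0
    split_ifs with h
    · linarith
    · rw [not_and_or, not_le, not_le] at h
      rcases h with h | h
      · have := mul_le_mul_of_nonneg_right (half_le_norm_stdAddChar_sub_one_sq _ h) h0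
        linarith
      · have := mul_le_mul_of_nonneg_right (half_le_norm_stdAddChar_sub_one_sq _ h) h0
        linarith
  rw [Finset.sum_add_distrib, ← Finset.mul_sum, ← Finset.mul_sum] at e3
  simp only [mul_one, mul_zero, add_zero, zero_add] at e1 e2
  linarith

/-- Relative property (T) for `(ℤ/p)²`, with uniform constants. -/
theorem norm_unitary_sub_le_of_relative (hu : ∀ w w', u (w + w') = u w * u w') (t₁ t₂ : G)
    (ht₁ : ∀ w, t₁ * u w = u (w.1 + w.2, w.2) * t₁)
    (ht₂ : ∀ w, t₂ * u w = u (w.1, w.2 + w.1) * t₂)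
    {v : V} (hv : ‖v‖ ≤ 1) {ε : ℝ} (hε : ε ≤ 1)
    (h₁ : ‖π t₁ v - v‖ ≤ ε) (h₂ : ‖π t₂ v - v‖ ≤ ε)
    (h₃ : ‖π (u (1, 0)) v - v‖ ≤ ε) (h₄ : ‖π (u (0, 1)) v - v‖ ≤ ε) (w : ZMod p × ZMod p) :
    ‖π (u w) v - v‖ ≤ 2 * √(44 * ε) := by
  have hε0 : 0 ≤ ε := (norm_nonneg _).trans h₁
  have hu1 : u 0 = 1 := by
    have := hu 0 0
    rw [add_zero] at this
    exact (left_eq_mul.1 this)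
  let u' : ZMod p × ZMod p → G := fun w => u (w.1, -w.2)
  have hu' : ∀ w w', u' (w + w') = u' w * u' w' := by
    intro w w'
    simp only [u']
    rw [← hu]
    congr 1
    simp [add_comm]
  have hu1' : u' 0 = 1 := by simpa [u', ← Prod.mk_zero_zero] using hu1
  have hspec : ∀ z : ZMod p × ZMod p,
      spectralComponent π u' z v = spectralComponent π u (z.1, -z.2) v := by
    intro z
    simp only [spectralComponent, u']
    congr 1
    refine Fintype.sum_bijective (fun w : ZMod p × ZMod p => (w.1, -w.2))
      (Function.bijective_iff_has_inverse.2 ⟨fun w : ZMod p × ZMod p => (w.1, -w.2),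
      fun w => by simp, fun w => by simp⟩) _ _ fun w => ?_
    simp
  have hb := boxed_spectralMass_le π hu hu1 h₃ h₄
  have hb' : ∑ z : ZMod p × ZMod p with ¬ (8 * z.1.valMinAbs.natAbs ≤ p ∧
      8 * z.2.valMinAbs.natAbs ≤ p), ‖spectralComponent π u' z v‖ ^ 2 ≤ 4 * ε ^ 2 := by
    refine boxed_spectralMass_le π hu' hu1' ?_ ?_
    · simpa [u'] using h₃
    · have : u' (0, 1) = (u (0, 1))⁻¹ := by
        rw [eq_inv_iff_mul_eq_one]
        simp only [u']
        rw [← hu, ← hu1, ← Prod.mk_zero_zero]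
        simp
      rw [this, norm_unitary_inv_sub]
      exact h₄
  have hq := quadrant_spectralMass_le π hu hu1 t₁ t₂ ht₁ ht₂ hv hε h₁ h₂ hb
  have hq' := quadrant_spectralMass_le π hu' hu1' t₁⁻¹ t₂⁻¹ (v := v) (ε := ε)
    (by
      intro w
      have := ht₁ (w.1 + w.2, -w.2)
      rw [inv_mul_eq_iff_eq_mul, ← mul_assoc, eq_mul_inv_iff_mul_eq]
      simp only [u'] at this ⊢
      rw [this]
      simp)
    (by
      intro w
      have := ht₂ (w.1, -(w.2 + w.1))
      rw [inv_mul_eq_iff_eq_mul, ← mul_assoc, eq_mul_inv_iff_mul_eq]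
      simp only [u'] at this ⊢
      rw [this]
      simp) hv hε (by rwa [norm_unitary_inv_sub]) (by rwa [norm_unitary_inv_sub]) hb'
  simp only [hspec] at hq'
  have hneg : ∀ y : ZMod p, 8 * y.valMinAbs.natAbs ≤ p → (-y).valMinAbs = -y.valMinAbs := by
    intro y hy
    have hp0 : 0 < p := NeZero.pos p
    refine (ZMod.valMinAbs_spec _ _).2 ⟨by simp, ?_, ?_⟩ <;> omega
  have hall : ∑ z : ZMod p × ZMod p with z ≠ 0, ‖spectralComponent π u z v‖ ^ 2 ≤ 44 * ε := by
    have e1 : ∑ z : ZMod p × ZMod p with (8 * z.1.valMinAbs.natAbs ≤ p ∧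
        8 * z.2.valMinAbs.natAbs ≤ p) ∧ z ≠ 0 ∧ z.1.valMinAbs * z.2.valMinAbs ≤ 0,
        ‖spectralComponent π u z v‖ ^ 2 ≤ 20 * ε := by
      refine le_trans (le_of_eq ?_) hq'
      refine Finset.sum_bij' (fun z _ => (z.1, -z.2)) (fun z _ => (z.1, -z.2)) ?_ ?_ ?_ ?_ ?_
      · intro z hz
        obtain ⟨⟨h1, h2⟩, h3, h4⟩ := (Finset.mem_filter.1 hz).2
        refine Finset.mem_filter.2 ⟨Finset.mem_univ _, ⟨h1, ?_⟩, ?_, ?_⟩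
        · simpa [ZMod.natAbs_valMinAbs_neg] using h2
        · intro h
          apply h3
          simpa [Prod.ext_iff] using h
        · rw [hneg _ h2]
          linarith
      · intro z hz
        obtain ⟨⟨h1, h2⟩, h3, h4⟩ := (Finset.mem_filter.1 hz).2
        refine Finset.mem_filter.2 ⟨Finset.mem_univ _, ⟨h1, ?_⟩, ?_, ?_⟩
        · simpa [ZMod.natAbs_valMinAbs_neg] using h2
        · intro h
          apply h3
          simpa [Prod.ext_iff] using h
        · rw [hneg _ h2]
          linarith
      · intro z _; simp
      · intro z _; simp
      · intro z _; simp
    have e2 : ∑ z : ZMod p × ZMod p with z ≠ 0, ‖spectralComponent π u z v‖ ^ 2 ≤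
        20 * ε + 20 * ε + 4 * ε ^ 2 := by
      refine le_trans ?_ (add_le_add (add_le_add hq e1) hb)
      rw [Finset.sum_filter, Finset.sum_filter, Finset.sum_filter, Finset.sum_filter,
        ← Finset.sum_add_distrib, ← Finset.sum_add_distrib]
      refine Finset.sum_le_sum fun z _ => ?_
      have h0 := sq_nonneg ‖spectralComponent π u z v‖
      by_cases hz : z = 0
      · rw [if_neg (by simpa using hz)]
        split_ifs <;> linarith
      · by_cases hB : 8 * z.1.valMinAbs.natAbs ≤ p ∧ 8 * z.2.valMinAbs.natAbs ≤ p
        · rcases le_total 0 (z.1.valMinAbs * z.2.valMinAbs) with h | h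
          · rw [if_pos hz, if_pos ⟨hB, hz, h⟩]
            split_ifs <;> linarith
          · rw [if_pos hz, if_pos (⟨hB, hz, h⟩ : _ ∧ _ ∧ z.1.valMinAbs * z.2.valMinAbs ≤ 0)]
            split_ifs <;> linarith
        · rw [if_pos hz, if_pos hB]
          split_ifs <;> linarith
    nlinarith
  have hfin : ‖π (u w) v - v‖ ^ 2 ≤ 4 * (44 * ε) := by
    rw [norm_unitary_sub_sq_eq_sum π hu hu1]
    refine le_trans ?_ (mul_le_mul_of_nonneg_left hall (by norm_num))
    rw [Finset.mul_sum, Finset.sum_filter]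
    refine Finset.sum_le_sum fun z _ => ?_
    have h0 := sq_nonneg ‖spectralComponent π u z v‖
    split_ifs with h
    · refine mul_le_mul_of_nonneg_right ?_ h0
      have h5 : ‖(ZMod.stdAddChar (z.1 * w.1 + z.2 * w.2) : ℂ) - 1‖ ≤ 2 := by
        refine (norm_sub_le _ _).trans ?_
        rw [ZMod.stdAddChar_apply]
        simp only [Circle.norm_coe, norm_one]
        norm_num
      nlinarith [norm_nonneg ((ZMod.stdAddChar (z.1 * w.1 + z.2 * w.2) : ℂ) - 1)]
    · rw [ne_eq, not_not] at h
      simp [h]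
  refine (pow_le_pow_iff_left₀ (norm_nonneg _) (by positivity) two_ne_zero).1 ?_
  rw [mul_pow, Real.sq_sqrt (by positivity)]
  linarith

end RelativePropertyT

section SpecialLinearThree

open Matrix Matrix.SpecialLinearGroup

variable {F : Type*} [Field F]

theorem coe_transvection_mul_apply {i j : Fin 3} (hij : i ≠ j) (a : F)
    (g : SpecialLinearGroup (Fin 3) F) (k l : Fin 3) :
    (transvection hij a * g) k l = g k l + if k = i then a * g j l else 0 := by
  rw [Matrix.SpecialLinearGroup.coe_mul, transvection_coe, add_mul, one_mul, Matrix.add_apply]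
  congr 1
  split_ifs with h
  · subst h
    rw [Matrix.single_mul_apply_same]
  · rw [Matrix.single_mul_apply_of_ne _ _ _ _ _ h]

theorem coe_mul_transvection_apply {i j : Fin 3} (hij : i ≠ j) (a : F)
    (g : SpecialLinearGroup (Fin 3) F) (k l : Fin 3) :
    (g * transvection hij a) k l = g k l + if l = j then g k i * a else 0 := by
  rw [Matrix.SpecialLinearGroup.coe_mul, transvection_coe, mul_add, mul_one, Matrix.add_apply]
  congr 1
  split_ifs with h
  · subst h
    rw [Matrix.mul_single_apply_same]
  · rw [Matrix.mul_single_apply_of_ne _ _ _ _ _ h]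

/-- Bounded generation of `SL₃` over a field by transvections. -/
theorem le_of_subadditive_of_transvection (L : SpecialLinearGroup (Fin 3) F → ℝ)
    (hL : ∀ g h, L (g * h) ≤ L g + L h) (δ : ℝ)
    (hδ : ∀ (i j : Fin 3) (hij : i ≠ j) (a : F), L (transvection hij a) ≤ δ)
    (g : SpecialLinearGroup (Fin 3) F) : L g ≤ 10 * δ := by
  have h01 : (0 : Fin 3) ≠ 1 := by decide
  have h02 : (0 : Fin 3) ≠ 2 := by decide
  have h12 : (1 : Fin 3) ≠ 2 := by decide
  have hδ0 : 0 ≤ δ := by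
    have h1 := hL 1 1
    have h2 := hδ 0 1 h01 0
    rw [transvection_coeff_zero] at h2
    rw [one_mul] at h1
    linarith
  have hleft : ∀ {i j : Fin 3} (hij : i ≠ j) (a : F) (g : SpecialLinearGroup (Fin 3) F),
      L g ≤ δ + L (transvection hij a * g) := by
    intro i j hij a g
    have h1 : g = transvection hij (-a) * (transvection hij a * g) := by
      rw [← mul_assoc, ← transvection_inv, inv_mul_cancel, one_mul]
    conv_lhs => rw [h1]
    exact (hL _ _).trans (add_le_add_left (hδ _ _ _ _) _)
  have hright : ∀ {i j : Fin 3} (hij : i ≠ j) (a : F) (g : SpecialLinearGroup (Fin 3) F),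
      L g ≤ δ + L (g * transvection hij a) := by
    intro i j hij a g
    have h1 : g = (g * transvection hij a) * transvection hij (-a) := by
      rw [mul_assoc, ← transvection_inv, mul_inv_cancel, mul_one]
    conv_lhs => rw [h1]
    refine (hL _ _).trans ?_
    have := hδ _ _ hij (-a)
    linarith
  have A1 : ∀ g : SpecialLinearGroup (Fin 3) F, g 0 0 = 1 → g 1 0 = 0 → g 2 0 = 0 → g 0 1 = 0 →
      g 0 2 = 0 → g 1 1 = 1 → g 2 1 = 0 → L g ≤ δ := by
    intro g h1 h2 h3 h4 h5 h6 h7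
    have hd := g.det_coe
    rw [Matrix.det_fin_three, h1, h2, h3, h4, h5, h6, h7] at hd
    have h8 : g 2 2 = 1 := by simpa using hd
    have h9 : g = transvection h12 (g 1 2) := by
      ext k l
      rw [transvection_coe]
      fin_cases k <;> fin_cases l <;> simp [h1, h2, h3, h4, h5, h6, h7, h8]
    rw [h9]
    exact hδ _ _ _ _
  have A2 : ∀ g : SpecialLinearGroup (Fin 3) F, g 0 0 = 1 → g 1 0 = 0 → g 2 0 = 0 → g 0 1 = 0 →
      g 0 2 = 0 → g 1 1 = 1 → L g ≤ 2 * δ := by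
    intro g h1 h2 h3 h4 h5 h6
    have := hleft h12.symm (-g 2 1) g
    have := A1 (transvection h12.symm (-g 2 1) * g)
      (by simp [coe_transvection_mul_apply, *]) (by simp [coe_transvection_mul_apply, *])
      (by simp [coe_transvection_mul_apply, *]) (by simp [coe_transvection_mul_apply, *])
      (by simp [coe_transvection_mul_apply, *]) (by simp [coe_transvection_mul_apply, *])
      (by simp [coe_transvection_mul_apply, *])
    linarith
  have A3 : ∀ g : SpecialLinearGroup (Fin 3) F, g 0 0 = 1 → g 1 0 = 0 → g 2 0 = 0 → g 0 1 = 0 →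
      g 0 2 = 0 → g 2 1 ≠ 0 → L g ≤ 3 * δ := by
    intro g h1 h2 h3 h4 h5 h6
    have := hleft h12 ((1 - g 1 1) / g 2 1) g
    have := A2 (transvection h12 ((1 - g 1 1) / g 2 1) * g)
      (by simp [coe_transvection_mul_apply, *]) (by simp [coe_transvection_mul_apply, *])
      (by simp [coe_transvection_mul_apply, *]) (by simp [coe_transvection_mul_apply, *])
      (by simp [coe_transvection_mul_apply, *]) (by simp [coe_transvection_mul_apply, *])
    linarith
  have A4 : ∀ g : SpecialLinearGroup (Fin 3) F, g 0 0 = 1 → g 1 0 = 0 → g 2 0 = 0 → g 0 1 = 0 →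
      g 0 2 = 0 → L g ≤ 4 * δ := by
    intro g h1 h2 h3 h4 h5
    by_cases h6 : g 2 1 = 0
    · have h7 : g 1 1 ≠ 0 := by
        intro h7
        have hd := g.det_coe
        rw [Matrix.det_fin_three, h1, h2, h3, h4, h5, h6, h7] at hd
        simp at hd
      have := hleft h12.symm 1 g
      have := A3 (transvection h12.symm 1 * g)
        (by simp [coe_transvection_mul_apply, *]) (by simp [coe_transvection_mul_apply, *])
        (by simp [coe_transvection_mul_apply, *]) (by simp [coe_transvection_mul_apply, *])
        (by simp [coe_transvection_mul_apply, *]) (by simp [coe_transvection_mul_apply, *])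
      linarith
    · have := A3 g h1 h2 h3 h4 h5 h6
      linarith
  have A5 : ∀ g : SpecialLinearGroup (Fin 3) F, g 0 0 = 1 → g 1 0 = 0 → g 2 0 = 0 → g 0 1 = 0 →
      L g ≤ 5 * δ := by
    intro g h1 h2 h3 h4
    have := hright h02 (-g 0 2) g
    have := A4 (g * transvection h02 (-g 0 2))
      (by simp [coe_mul_transvection_apply, *]) (by simp [coe_mul_transvection_apply, *])
      (by simp [coe_mul_transvection_apply, *]) (by simp [coe_mul_transvection_apply, *])
      (by simp [coe_mul_transvection_apply, *])
    linarith
  have A6 : ∀ g : SpecialLinearGroup (Fin 3) F, g 0 0 = 1 → g 1 0 = 0 → g 2 0 = 0 →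
      L g ≤ 6 * δ := by
    intro g h1 h2 h3
    have := hright h01 (-g 0 1) g
    have := A5 (g * transvection h01 (-g 0 1))
      (by simp [coe_mul_transvection_apply, *]) (by simp [coe_mul_transvection_apply, *])
      (by simp [coe_mul_transvection_apply, *]) (by simp [coe_mul_transvection_apply, *])
    linarith
  have A7 : ∀ g : SpecialLinearGroup (Fin 3) F, g 0 0 = 1 → g 1 0 = 0 → L g ≤ 7 * δ := by
    intro g h1 h2
    have := hleft h02.symm (-g 2 0) g
    have := A6 (transvection h02.symm (-g 2 0) * g)
      (by simp [coe_transvection_mul_apply, *]) (by simp [coe_transvection_mul_apply, *])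
      (by simp [coe_transvection_mul_apply, *])
    linarith
  have A8 : ∀ g : SpecialLinearGroup (Fin 3) F, g 0 0 = 1 → L g ≤ 8 * δ := by
    intro g h1
    have := hleft h01.symm (-g 1 0) g
    have := A7 (transvection h01.symm (-g 1 0) * g)
      (by simp [coe_transvection_mul_apply, *]) (by simp [coe_transvection_mul_apply, *])
    linarith
  have A9 : ∀ g : SpecialLinearGroup (Fin 3) F, g 1 0 ≠ 0 → L g ≤ 9 * δ := by
    intro g h1
    have := hleft h01 ((1 - g 0 0) / g 1 0) g
    have := A8 (transvection h01 ((1 - g 0 0) / g 1 0) * g)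
      (by simp [coe_transvection_mul_apply, *])
    linarith
  by_cases h1 : g 1 0 = 0
  · by_cases h2 : g 2 0 = 0
    · have h3 : g 0 0 ≠ 0 := by
        intro h3
        have hd := g.det_coe
        rw [Matrix.det_fin_three, h1, h2, h3] at hd
        simp at hd
      have := hleft h01.symm 1 g
      have := A9 (transvection h01.symm 1 * g) (by simp [coe_transvection_mul_apply, *])
      linarith
    · have := hleft h02 ((1 - g 0 0) / g 2 0) g
      have := A8 (transvection h02 ((1 - g 0 0) / g 2 0) * g)
        (by simp [coe_transvection_mul_apply, *])
      linarith
  · have := A9 g h1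
    linarith

theorem transvection_comm_of_ne {i j k : Fin 3} (hij : i ≠ j) (hkj : k ≠ j) (a b : F) :
    transvection hij a * transvection hkj b = transvection hkj b * transvection hij a := by
  apply Subtype.ext
  simp only [Matrix.SpecialLinearGroup.coe_mul, transvection_coe, mul_add, add_mul, mul_one, one_mul]
  rw [single_mul_single_of_ne _ _ _ _ hkj.symm, single_mul_single_of_ne _ _ _ _ hij.symm]
  abel

theorem transvection_mul_transvection {i j k : Fin 3} (hik : i ≠ k) (hij : i ≠ j) (hkj : k ≠ j)
    (b : F) : transvection hik 1 * transvection hkj b =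
      transvection hij b * transvection hkj b * transvection hik 1 := by
  apply Subtype.ext
  simp only [Matrix.SpecialLinearGroup.coe_mul, transvection_coe, mul_add, add_mul, mul_one, one_mul]
  rw [single_mul_single_same, single_mul_single_of_ne _ _ _ _ hkj.symm,
    single_mul_single_of_ne _ _ _ _ hij.symm, single_mul_single_of_ne _ _ _ _ hij.symm,
    zero_mul]
  simp only [one_mul]
  abel

end SpecialLinearThree

section SpectralGap

open Matrix Matrix.SpecialLinearGroup

variable {V : Type*} [NormedAddCommGroup V] [InnerProductSpace ℂ V] {p : ℕ} [Fact p.Prime]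
  (π : SpecialLinearGroup (Fin 3) (ZMod p) →* (V ≃ₗᵢ[ℂ] V))

theorem norm_unitary_transvection_sub_le {v : V} (hv : ‖v‖ ≤ 1) {ε : ℝ} (hε : ε ≤ 1)
    (h : ∀ (i j : Fin 3) (hij : i ≠ j), ‖π (transvection hij 1) v - v‖ ≤ ε)
    (i j : Fin 3) (hij : i ≠ j) (a : ZMod p) :
    ‖π (transvection hij a) v - v‖ ≤ 2 * √(44 * ε) := by
  obtain ⟨k, hki, hkj⟩ : ∃ k : Fin 3, k ≠ i ∧ k ≠ j := by
    revert i j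
    decide
  have key := norm_unitary_sub_le_of_relative π
    (u := fun w : ZMod p × ZMod p => transvection hij w.1 * transvection hkj w.2)
    (by
      intro w w'
      simp only [Prod.fst_add, Prod.snd_add, transvection_add]
      rw [mul_assoc, mul_assoc, ← mul_assoc (transvection hkj w.2),
        transvection_comm_of_ne hkj hij]
      simp only [mul_assoc])
    (transvection hki.symm 1) (transvection hki 1)
    (by
      intro w
      dsimp only
      rw [← mul_assoc]
      have h1 : transvection hki.symm 1 * transvection hij w.1 =
          transvection hij w.1 * transvection hki.symm (1 : ZMod p) := by
        apply Subtype.ext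
        simp only [Matrix.SpecialLinearGroup.coe_mul, transvection_coe, mul_add, add_mul, mul_one,
          one_mul]
        rw [single_mul_single_of_ne _ _ _ _ hki, single_mul_single_of_ne _ _ _ _ hij.symm]
        abel
      rw [h1, mul_assoc, transvection_mul_transvection hki.symm hij hkj, transvection_add]
      simp only [mul_assoc])
    (by
      intro w
      dsimp only
      rw [← mul_assoc, transvection_mul_transvection hki hkj hij]
      have h1 : transvection hki 1 * transvection hkj w.2 =
          transvection hkj w.2 * transvection hki (1 : ZMod p) := by
        apply Subtype.ext
        simp only [Matrix.SpecialLinearGroup.coe_mul, transvection_coe, mul_add, add_mul, mul_one,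
          one_mul]
        rw [single_mul_single_of_ne _ _ _ _ hki.symm, single_mul_single_of_ne _ _ _ _ hkj.symm]
        abel
      rw [mul_assoc, h1, add_comm, transvection_add, transvection_comm_of_ne hkj hij]
      simp only [mul_assoc])
    hv hε (h _ _ _) (h _ _ _) (by simpa using h _ _ _) (by simpa using h _ _ _) (a, 0)
  simpa using key

/-- A uniform spectral gap for `SL₃(ℤ/p)` with respect to elementary matrices. -/
theorem exists_transvection_norm_sub_ge (v : V) (hv : ∑ g, π g v = 0) :
    ∃ (i j : Fin 3) (hij : i ≠ j), ‖v‖ / 20000 ≤ ‖π (transvection hij 1) v - v‖ := by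
  by_cases hv0 : v = 0
  · exact ⟨0, 1, by decide, by simp [hv0]⟩
  by_contra! hcon
  have hpos : 0 < ‖v‖ := norm_pos_iff.2 hv0
  set w : V := ((‖v‖⁻¹ : ℝ) : ℂ) • v with hw
  have hw1 : ‖w‖ = 1 := by
    rw [hw, norm_smul, Complex.norm_real, norm_inv, norm_norm, inv_mul_cancel₀ hpos.ne']
  have hws : ∑ g, π g w = 0 := by
    simp only [hw, map_smul]
    rw [← Finset.smul_sum, hv, smul_zero]
  have h1 : ∀ (i j : Fin 3) (hij : i ≠ j), ‖π (transvection hij 1) w - w‖ ≤ 1 / 20000 := by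
    intro i j hij
    rw [hw, map_smul, ← smul_sub, norm_smul, Complex.norm_real, norm_inv, norm_norm,
      inv_mul_le_iff₀ hpos]
    have := (hcon i j hij).le
    linarith
  have h2 := le_of_subadditive_of_transvection (fun g => ‖π g w - w‖)
    (norm_unitary_mul_sub_le π w) _
    (norm_unitary_transvection_sub_le π hw1.le (by norm_num) h1)
  have h3 : √(44 * (1 / 20000) : ℝ) < 1 / 20 := by
    rw [Real.sqrt_lt' (by norm_num)]
    norm_num
  have h4 : ‖∑ g : SpecialLinearGroup (Fin 3) (ZMod p), (π g w - w)‖ <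
      Fintype.card (SpecialLinearGroup (Fin 3) (ZMod p)) * 1 := by
    refine (norm_sum_le _ _).trans_lt ?_
    rw [← Finset.card_univ, ← nsmul_eq_mul, ← Finset.sum_const]
    refine Finset.sum_lt_sum_of_nonempty ⟨1, Finset.mem_univ _⟩ fun g _ => ?_
    have := h2 g
    linarith
  rw [Finset.sum_sub_distrib, hws, zero_sub, norm_neg, Finset.sum_const, ← Nat.cast_smul_eq_nsmul ℂ,
    norm_smul, hw1, Finset.card_univ] at h4
  simp at h4

end SpectralGap

section Quasirandom

open Matrix Matrix.SpecialLinearGroup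

variable {V : Type*} [NormedAddCommGroup V] [InnerProductSpace ℂ V] {p : ℕ} [Fact p.Prime]
  (π : SpecialLinearGroup (Fin 3) (ZMod p) →* (V ≃ₗᵢ[ℂ] V))

theorem exists_torus_conj {F : Type*} [Field F] {i j : Fin 3} (hij : i ≠ j) (t : Fˣ) :
    ∃ h : SpecialLinearGroup (Fin 3) F, ∀ a : F,
      h * transvection hij a = transvection hij (t * a) * h := by
  obtain ⟨k, hki, hkj⟩ : ∃ k : Fin 3, k ≠ i ∧ k ≠ j := by
    revert i j
    decide
  refine ⟨⟨Matrix.diagonal fun l => if l = i then (t : F) else if l = k then (t : F)⁻¹ else 1, ?_⟩,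
    fun a => ?_⟩
  · rw [Matrix.det_diagonal, Fin.prod_univ_three]
    fin_cases i <;> fin_cases k <;> simp_all
  · apply Subtype.ext
    change Matrix.diagonal _ * Matrix.transvection _ _ _ =
      Matrix.transvection _ _ _ * Matrix.diagonal _
    simp only [Matrix.transvection, mul_add, add_mul, mul_one, one_mul]
    congr 1
    ext k' l'
    rw [Matrix.diagonal_mul, Matrix.mul_diagonal]
    by_cases h1 : k' = i
    · by_cases h2 : l' = j
      · subst h1 h2
        simp [hij.symm, hkj.symm]
      · simp [Ne.symm h2]
    · simp [Ne.symm h1]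

/-- Every nonzero invariant subspace without invariant vectors has large dimension. -/
theorem le_finrank_of_invariant [FiniteDimensional ℂ V] (W : Submodule ℂ V)
    (hW : ∀ g, ∀ w ∈ W, π g w ∈ W) {v : V} (hvW : v ∈ W) (hv0 : v ≠ 0) (hv : ∑ g, π g v = 0) :
    p - 1 ≤ Module.finrank ℂ W := by
  obtain ⟨i, j, hij, hge⟩ := exists_transvection_norm_sub_ge π v hv
  let u : ZMod p × ZMod p → SpecialLinearGroup (Fin 3) (ZMod p) := fun w => transvection hij w.1
  have hu : ∀ w w', u (w + w') = u w * u w' := fun w w' => transvection_add hij _ _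
  have hu1 : u 0 = 1 := transvection_coeff_zero hij
  obtain ⟨z, hz1, hz2⟩ : ∃ z : ZMod p × ZMod p, z.1 ≠ 0 ∧ spectralComponent π u z v ≠ 0 := by
    by_contra! hcon
    have h1 := norm_unitary_sub_sq_eq_sum π hu hu1 (1, 0) v
    rw [Finset.sum_eq_zero] at h1
    · have h2 : 0 < ‖v‖ := norm_pos_iff.2 hv0
      have h3 : ‖π (u (1, 0)) v - v‖ = 0 := by simpa using h1
      have h4 : ‖π (u (1, 0)) v - v‖ = ‖π (transvection hij 1) v - v‖ := rfl
      linarith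
    · intro z _
      by_cases hz : z.1 = 0
      · simp [hz]
      · simp [hcon z hz]
  set y := spectralComponent π u z v with hy
  have hyW : y ∈ W := by
    rw [hy, spectralComponent]
    exact W.smul_mem _ (W.sum_mem fun w _ => W.smul_mem _ (hW _ _ hvW))
  choose h hh using fun t : (ZMod p)ˣ => exists_torus_conj hij t
  let T : Module.End ℂ V := (π (transvection hij 1)).toLinearEquiv.toLinearMap
  have hT : ∀ x, T x = π (transvection hij 1) x := fun x => rfl
  have heig : ∀ t : (ZMod p)ˣ, T.HasEigenvector (ZMod.stdAddChar (z.1 * ((t⁻¹ : (ZMod p)ˣ) : ZMod p)))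
      (π (h t) y) := by
    intro t
    refine ⟨Module.End.mem_eigenspace_iff.2 ?_, ?_⟩
    · have h1 := hh t ((t⁻¹ : (ZMod p)ˣ) : ZMod p)
      rw [Units.mul_inv] at h1
      have h2 := map_spectralComponent π hu z (((t⁻¹ : (ZMod p)ˣ) : ZMod p), 0) v
      simp only [mul_zero, add_zero] at h2
      rw [hT, ← unitary_mul_apply, ← h1, unitary_mul_apply, ← map_smul]
      exact congrArg _ h2
    · intro h0
      exact hz2 ((π (h t)).map_eq_zero_iff.1 h0)
  have hli := T.eigenvectors_linearIndependent'
    (fun t : (ZMod p)ˣ => ZMod.stdAddChar (z.1 * ((t⁻¹ : (ZMod p)ˣ) : ZMod p)))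
    (by
      intro t t' htt
      have h1 := mul_left_cancel₀ hz1 (ZMod.injective_stdAddChar htt)
      exact inv_injective (Units.ext h1)) _ heig
  have hcard := finrank_span_eq_card hli
  rw [ZMod.card_units] at hcard
  rw [← hcard]
  refine Submodule.finrank_mono (Submodule.span_le.2 ?_)
  rintro _ ⟨t, rfl⟩
  exact hW _ _ hyW

/-- An operator commuting with the representation and killing the invariant vectors has norm
much smaller than its Hilbert–Schmidt norm. -/
theorem mul_norm_sq_le_of_commute [FiniteDimensional ℂ V] (T : V →ₗ[ℂ] V)
    (hT : ∀ g v, T (π g v) = π g (T v)) (hT0 : ∀ v, (∀ g, π g v = v) → T v = 0) (C : ℝ)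
    (hC : ∀ (n : ℕ) (e : Fin n → V), Orthonormal ℂ e → ∑ k, ‖T (e k)‖ ^ 2 ≤ C) (v : V) :
    (p - 1 : ℕ) * ‖T v‖ ^ 2 ≤ C * ‖v‖ ^ 2 := by
  have hC0 : 0 ≤ C := by simpa using hC 0 Fin.elim0 ⟨fun i => i.elim0, fun i => i.elim0⟩
  let A : V →ₗ[ℂ] V := LinearMap.adjoint T ∘ₗ T
  have hAi : ∀ x y, inner ℂ (A x) y = inner ℂ (T x) (T y) := fun x y => by
    simp [A, LinearMap.adjoint_inner_left]
  have hA : A.IsSymmetric := by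
    intro x y
    rw [hAi, ← inner_conj_symm, ← inner_conj_symm x, hAi]
  have hAcomm : ∀ g v, A (π g v) = π g (A v) := by
    intro g v
    refine ext_inner_right ℂ fun w => ?_
    have h1 : w = π g (π g⁻¹ w) := by
      rw [← unitary_mul_apply]; simp
    rw [hAi, hT, h1, hT, LinearIsometryEquiv.inner_map_map, LinearIsometryEquiv.inner_map_map, hAi]
  have heigen : ∀ i, (p - 1 : ℕ) * hA.eigenvalues rfl i ≤ C := by
    intro i
    set l := hA.eigenvalues rfl i with hl
    set x := hA.eigenvectorBasis rfl i with hx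
    have hAx : A x = (l : ℂ) • x := hA.apply_eigenvectorBasis rfl i
    have hx0 : x ≠ 0 := by
      intro h0
      have := (hA.eigenvectorBasis rfl).norm_eq_one i
      rw [← hx, h0, norm_zero] at this
      exact zero_ne_one this
    by_cases hl0 : l = 0
    · rw [hl0, mul_zero]; exact hC0
    let W : Submodule ℂ V := Module.End.eigenspace A (l : ℂ)
    have hmW : ∀ w, w ∈ W ↔ A w = (l : ℂ) • w := fun w => Module.End.mem_eigenspace_iff
    have hdim := le_finrank_of_invariant π W
      (by
        intro g w hw
        rw [hmW] at hw ⊢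
        rw [hAcomm, hw, map_smul])
      ((hmW x).2 hAx) hx0
      (by
        set s := ∑ g, π g x with hs
        have hinv : ∀ g, π g s = s := by
          intro g
          rw [hs, map_sum]
          refine Fintype.sum_bijective (fun k => g * k) (Group.mulLeft_bijective g) _ _ fun k => ?_
          rw [unitary_mul_apply]
        have h1 : A s = (l : ℂ) • s := by
          rw [hs, map_sum, Finset.smul_sum]
          refine Finset.sum_congr rfl fun g _ => ?_
          rw [hAcomm, hAx, map_smul]
        have h2 : A s = 0 := by simp [A, hT0 s hinv]
        rw [h2] at h1
        rcases smul_eq_zero.1 h1.symm with h | h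
        · exact absurd (by exact_mod_cast h) hl0
        · exact h)
    let b := stdOrthonormalBasis ℂ W
    have hon : Orthonormal ℂ fun k => (b k : V) :=
      b.orthonormal.comp_linearIsometry W.subtypeₗᵢ
    have h3 := hC _ _ hon
    have h4 : ∀ k, ‖T (b k : V)‖ ^ 2 = l := by
      intro k
      have h5 : inner ℂ (T (b k : V)) (T (b k : V)) = (l : ℂ) := by
        rw [← hAi, (hmW _).1 (b k).2, inner_smul_left, inner_self_eq_norm_sq_to_K, hon.1 k]
        simp
      rw [inner_self_eq_norm_sq_to_K] at h5
      exact Complex.ofReal_injective (by simpa using h5)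
    simp only [h4, Finset.sum_const, Finset.card_univ, Fintype.card_fin, nsmul_eq_mul] at h3
    have h6 : 0 ≤ l := by
      have : 0 < Module.finrank ℂ W :=
        Module.finrank_pos_iff_exists_ne_zero.2 ⟨⟨x, (hmW x).2 hAx⟩, fun h => hx0 (by
          simpa using congrArg Subtype.val h)⟩
      rw [← h4 ⟨0, this⟩]
      positivity
    refine le_trans ?_ h3
    gcongr
  have hexp : ‖T v‖ ^ 2 = ∑ i, hA.eigenvalues rfl i * ‖inner ℂ (hA.eigenvectorBasis rfl i) v‖ ^ 2 := by
    have h1 : (‖T v‖ ^ 2 : ℂ) = inner ℂ (A v) v := by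
      rw [hAi, inner_self_eq_norm_sq_to_K]; rfl
    have h2 := (hA.eigenvectorBasis rfl).sum_inner_mul_inner (A v) v
    rw [← h1] at h2
    have h3 : ∀ i, inner ℂ (A v) (hA.eigenvectorBasis rfl i) * inner ℂ (hA.eigenvectorBasis rfl i) v =
        ((hA.eigenvalues rfl i * ‖inner ℂ (hA.eigenvectorBasis rfl i) v‖ ^ 2 : ℝ) : ℂ) := by
      intro i
      rw [hA v, hA.apply_eigenvectorBasis, inner_smul_right, mul_assoc, ← inner_conj_symm v,
        Complex.conj_mul']
      push_cast
      rfl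
    rw [Finset.sum_congr rfl fun i _ => h3 i, ← Complex.ofReal_sum] at h2
    exact Complex.ofReal_injective (by rw [h2]; push_cast; rfl)
  rw [hexp, ← (hA.eigenvectorBasis rfl).sum_sq_norm_inner_right v, Finset.mul_sum, Finset.mul_sum]
  refine Finset.sum_le_sum fun i _ => ?_
  rw [← mul_assoc]
  exact mul_le_mul_of_nonneg_right (heigen i) (sq_nonneg _)

end Quasirandom

section Mixing

open Matrix Matrix.SpecialLinearGroup

/-- The permutation representation on complex functions on a finite set. -/
noncomputable def permRep (G : Type*) [Group G] (Y : Type*) [Fintype Y] [MulAction G Y] :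
    G →* (EuclideanSpace ℂ Y ≃ₗᵢ[ℂ] EuclideanSpace ℂ Y) where
  toFun g := LinearIsometryEquiv.piLpCongrLeft 2 ℂ ℂ (MulAction.toPerm g)
  map_one' := by
    ext v y
    simp [LinearIsometryEquiv.piLpCongrLeft_apply]
  map_mul' g h := by
    ext v y
    simp [LinearIsometryEquiv.piLpCongrLeft_apply, mul_smul]

theorem permRep_apply {G : Type*} [Group G] {Y : Type*} [Fintype Y] [MulAction G Y] (g : G)
    (v : EuclideanSpace ℂ Y) (y : Y) : permRep G Y g v y = v (g⁻¹ • y) := rfl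

variable {p : ℕ} [Fact p.Prime]

/-- A spectral gap for elementary matrices acting on functions on a finite set, uniform in `p`. -/
theorem exists_transvection_sum_sq_le {Y : Type*} [Fintype Y]
    [MulAction (SpecialLinearGroup (Fin 3) (ZMod p)) Y] (f : Y → ℝ)
    (hf : ∀ y, ∑ g : SpecialLinearGroup (Fin 3) (ZMod p), f (g • y) = 0) :
    ∃ (i j : Fin 3) (hij : i ≠ j), ∑ y, f y ^ 2 ≤
      20000 ^ 2 * ∑ y, (f ((transvection hij 1 : SpecialLinearGroup (Fin 3) (ZMod p)) • y) - f y) ^ 2 := by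
  let v : EuclideanSpace ℂ Y := WithLp.toLp 2 fun y => (f y : ℂ)
  have hv : ∑ g, permRep (SpecialLinearGroup (Fin 3) (ZMod p)) Y g v = 0 := by
    ext y
    rw [WithLp.ofLp_sum, Finset.sum_apply]
    have h1 := hf y
    rw [← Equiv.sum_comp (Equiv.inv _)] at h1
    simp only [permRep_apply]
    have h2 := congrArg (fun r : ℝ => (r : ℂ)) h1
    simp only [Equiv.inv_apply, Complex.ofReal_sum, Complex.ofReal_zero] at h2
    exact h2
  obtain ⟨i, j, hij, h⟩ := exists_transvection_norm_sub_ge _ v hv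
  refine ⟨i, j, hij, ?_⟩
  set e : SpecialLinearGroup (Fin 3) (ZMod p) := transvection hij 1 with he
  have h1 : ‖v‖ ^ 2 = ∑ y, f y ^ 2 := by
    rw [EuclideanSpace.norm_sq_eq]
    simp [v]
  have h2 : ‖permRep _ Y e v - v‖ ^ 2 = ∑ y, (f (e • y) - f y) ^ 2 := by
    rw [EuclideanSpace.norm_sq_eq, ← Equiv.sum_comp (MulAction.toPerm e)]
    refine Finset.sum_congr rfl fun y _ => ?_
    rw [PiLp.sub_apply, permRep_apply, MulAction.toPerm_apply, inv_smul_smul]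
    change ‖((f y : ℂ) - (f (e • y) : ℂ))‖ ^ 2 = _
    rw [← Complex.ofReal_sub, Complex.norm_real, Real.norm_eq_abs, sq_abs]
    ring
  rw [← h1, ← h2, ← mul_pow]
  gcongr
  linarith

/-- Quasirandomness of `SL₃(𝔽_p)` in bilinear form. -/
theorem mul_sq_sum_le_of_sum_eq_zero (a b ψ : SpecialLinearGroup (Fin 3) (ZMod p) → ℝ)
    (hψ : ∑ g, ψ g = 0) :
    (p - 1 : ℕ) * (∑ g, ∑ h, a g * b h * ψ (g⁻¹ * h)) ^ 2 ≤
      (Fintype.card (SpecialLinearGroup (Fin 3) (ZMod p)) * ∑ g, ψ g ^ 2) *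
        ((∑ g, a g ^ 2) * ∑ g, b g ^ 2) := by
  let row : (SpecialLinearGroup (Fin 3) (ZMod p)) →
      EuclideanSpace ℂ (SpecialLinearGroup (Fin 3) (ZMod p)) := fun g =>
    WithLp.toLp 2 fun h => (ψ (g⁻¹ * h) : ℂ)
  let T : EuclideanSpace ℂ (SpecialLinearGroup (Fin 3) (ZMod p)) →ₗ[ℂ]
      EuclideanSpace ℂ (SpecialLinearGroup (Fin 3) (ZMod p)) :=
    { toFun := fun v => WithLp.toLp 2 fun g => inner ℂ (row g) v
      map_add' := fun v w => by ext g; simp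
      map_smul' := fun c v => by ext g; simp }
  have hTa : ∀ v g, T v g = ∑ h, (ψ (g⁻¹ * h) : ℂ) * v h := by
    intro v g
    change inner ℂ (row g) v = _
    rw [PiLp.inner_apply]
    refine Finset.sum_congr rfl fun h _ => ?_
    simp [row, mul_comm]
  have hrow : ∀ g, ‖row g‖ ^ 2 = ∑ h, ψ h ^ 2 := by
    intro g
    rw [EuclideanSpace.norm_sq_eq, ← Equiv.sum_comp (Equiv.mulLeft g⁻¹) fun h => ψ h ^ 2]
    simp [row]
  have hT : ∀ g v,
      T (permRep (SpecialLinearGroup (Fin 3) (ZMod p)) (SpecialLinearGroup (Fin 3) (ZMod p)) g v) =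
        permRep (SpecialLinearGroup (Fin 3) (ZMod p)) (SpecialLinearGroup (Fin 3) (ZMod p)) g (T v) := by
    intro k v
    ext g
    rw [permRep_apply, hTa, hTa, ← Equiv.sum_comp (Equiv.mulLeft k)]
    refine Finset.sum_congr rfl fun h _ => ?_
    rw [permRep_apply]
    simp [mul_assoc]
  have hT0 : ∀ v,
      (∀ g, permRep (SpecialLinearGroup (Fin 3) (ZMod p)) (SpecialLinearGroup (Fin 3) (ZMod p)) g v = v) →
        T v = 0 := by
    intro v hv
    have hc : ∀ h, v h = v 1 := by
      intro h
      conv_lhs => rw [← hv h]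
      rw [permRep_apply]
      simp
    ext g
    rw [hTa]
    simp only [hc]
    rw [← Finset.sum_mul, show ∑ i, (ψ (g⁻¹ * i) : ℂ) = ∑ i, (ψ i : ℂ) from
      Equiv.sum_comp (Equiv.mulLeft g⁻¹) fun h => (ψ h : ℂ), ← Complex.ofReal_sum, hψ]
    simp
  have hC : ∀ (n : ℕ) (e : Fin n → EuclideanSpace ℂ (SpecialLinearGroup (Fin 3) (ZMod p))), Orthonormal ℂ e →
      ∑ k, ‖T (e k)‖ ^ 2 ≤ Fintype.card (SpecialLinearGroup (Fin 3) (ZMod p)) * ∑ h, ψ h ^ 2 := by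
    intro n e he
    simp only [EuclideanSpace.norm_sq_eq]
    rw [Finset.sum_comm]
    calc _ ≤ ∑ g : (SpecialLinearGroup (Fin 3) (ZMod p)), ‖row g‖ ^ 2 := by
          refine Finset.sum_le_sum fun g _ => ?_
          have := he.sum_inner_products_le (row g) (s := Finset.univ)
          refine le_trans (Finset.sum_le_sum fun k _ => ?_) this
          rw [norm_inner_symm]
          exact le_rfl
      _ = _ := by simp [hrow]
  let va : EuclideanSpace ℂ (SpecialLinearGroup (Fin 3) (ZMod p)) := WithLp.toLp 2 fun h => (a h : ℂ)
  let vb : EuclideanSpace ℂ (SpecialLinearGroup (Fin 3) (ZMod p)) := WithLp.toLp 2 fun h => (b h : ℂ)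
  have hmain := mul_norm_sq_le_of_commute
    (permRep (SpecialLinearGroup (Fin 3) (ZMod p)) (SpecialLinearGroup (Fin 3) (ZMod p))) T hT hT0 _ hC vb
  have hva : ‖va‖ ^ 2 = ∑ g, a g ^ 2 := by
    rw [EuclideanSpace.norm_sq_eq]; simp [va]
  have hvb : ‖vb‖ ^ 2 = ∑ g, b g ^ 2 := by
    rw [EuclideanSpace.norm_sq_eq]; simp [vb]
  have hin : inner ℂ va (T vb) = ((∑ g, ∑ h, a g * b h * ψ (g⁻¹ * h) : ℝ) : ℂ) := by
    rw [PiLp.inner_apply]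
    push_cast
    refine Finset.sum_congr rfl fun g _ => ?_
    rw [hTa]
    simp only [va, vb, RCLike.inner_apply, Complex.conj_ofReal, Finset.sum_mul]
    refine Finset.sum_congr rfl fun h _ => ?_
    ring
  have hcs := norm_inner_le_norm (𝕜 := ℂ) va (T vb)
  rw [hin, Complex.norm_real, Real.norm_eq_abs] at hcs
  have hcs2 := mul_self_le_mul_self (abs_nonneg _) hcs
  rw [abs_mul_abs_self] at hcs2
  rw [← hva, ← hvb]
  calc _ ≤ ((p - 1 : ℕ) : ℝ) * (‖va‖ ^ 2 * ‖T vb‖ ^ 2) := by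
        gcongr
        nlinarith
    _ = ‖va‖ ^ 2 * (((p - 1 : ℕ) : ℝ) * ‖T vb‖ ^ 2) := by ring
    _ ≤ ‖va‖ ^ 2 * ((Fintype.card (SpecialLinearGroup (Fin 3) (ZMod p)) * ∑ h, ψ h ^ 2) * ‖vb‖ ^ 2) := by gcongr
    _ = _ := by ring

end Mixing

section Bernoulli

set_option linter.unusedSectionVars false

/-- The uniform probability measure on a finite type. -/
noncomputable def uniformMeasure (G : Type) [Fintype G] [MeasurableSpace G] : Measure G :=
  (Fintype.card G : ENNReal)⁻¹ • Measure.count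

instance isProbabilityMeasure_uniformMeasure {G : Type} [Fintype G] [Nonempty G]
    [MeasurableSpace G] : IsProbabilityMeasure (uniformMeasure G) := by
  refine ⟨?_⟩
  rw [uniformMeasure, Measure.smul_apply, Measure.count_apply MeasurableSet.univ]
  simp only [Set.encard_univ, ENat.card_eq_coe_fintype_card, smul_eq_mul, ENat.toENNReal_coe]
  exact ENNReal.inv_mul_cancel (by simp) (by simp)

variable {J G : Type} [Group G] [Fintype G] [MeasurableSpace G] [DiscreteMeasurableSpace G]

theorem uniformMeasure_preimage_mul (g : G) (B : Set G) :
    uniformMeasure G ((fun x => g * x) ⁻¹' B) = uniformMeasure G B := by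
  rw [uniformMeasure, Measure.smul_apply, Measure.smul_apply,
    Measure.count_apply (.of_discrete), Measure.count_apply (.of_discrete)]
  congr 2
  exact (Set.encard_preimage_of_bijective (Group.mulLeft_bijective g) B)

variable (J G) in
/-- The Bernoulli measure with uniform marginals. -/
noncomputable def bernoulliMeasure : Measure (J → G) := Measure.infinitePi fun _ => uniformMeasure G

instance isProbabilityMeasure_bernoulliMeasure : IsProbabilityMeasure (bernoulliMeasure J G) := by
  unfold bernoulliMeasure; infer_instance

/-- Permute the coordinates by `σ` while multiplying the coordinate `j` by `t j`. -/
def twist (σ : Equiv.Perm J) (t : J → G) (x : J → G) : J → G :=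
  fun k => t (σ.symm k) * x (σ.symm k)

@[simp] theorem twist_apply_perm (σ : Equiv.Perm J) (t : J → G) (x : J → G) (j : J) :
    twist σ t x (σ j) = t j * x j := by simp [twist]

theorem measurePreserving_twist (σ : Equiv.Perm J) (t : J → G) :
    MeasurePreserving (twist σ t) (bernoulliMeasure J G) (bernoulliMeasure J G) := by
  have hm : Measurable (twist σ t) := by
    refine measurable_pi_iff.2 fun k => ?_
    exact (Measurable.of_discrete (f := fun g : G => t (σ.symm k) * g)).comp
      (measurable_pi_apply _)
  refine ⟨hm, ?_⟩
  rw [bernoulliMeasure]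
  refine Measure.eq_infinitePi _ fun s B _ => ?_
  rw [Measure.map_apply hm (MeasurableSet.pi s.countable_toSet fun _ _ => .of_discrete)]
  have h1 : twist σ t ⁻¹' (s : Set J).pi B =
      ((s.map σ.symm.toEmbedding : Finset J) : Set J).pi fun j => (fun g => t j * g) ⁻¹' B (σ j) := by
    ext x
    simp only [twist, Set.mem_preimage, Set.mem_pi, Finset.mem_coe, Finset.mem_map_equiv,
      Equiv.symm_symm]
    exact ⟨fun h j hj => by simpa using h (σ j) hj, fun h k hk => by
      simpa using h (σ.symm k) (by simpa using hk)⟩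
  rw [h1, Measure.infinitePi_pi _ fun _ _ => .of_discrete, Finset.prod_map]
  refine Finset.prod_congr rfl fun k _ => ?_
  rw [uniformMeasure_preimage_mul]
  simp

/-- A function of finitely many coordinates. -/
def IsCylinder {α : Type} (F : (J → G) → α) : Prop := ∃ K : Finset J, DependsOn F (K : Set J)

theorem IsCylinder.measurable {α : Type} [MeasurableSpace α] [Nonempty α] {F : (J → G) → α}
    (hF : IsCylinder F) : Measurable F := by
  obtain ⟨K, hK⟩ := hF
  obtain ⟨F', rfl⟩ := dependsOn_iff_exists_comp.1 hK
  exact (measurable_of_countable F').comp (by fun_prop)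

theorem IsCylinder.exists_bound {F : (J → G) → ℝ} (hF : IsCylinder F) : ∃ C, ∀ x, ‖F x‖ ≤ C := by
  obtain ⟨K, hK⟩ := hF
  obtain ⟨F', rfl⟩ := dependsOn_iff_exists_comp.1 hK
  obtain ⟨C, hC⟩ := (Set.finite_range fun y => ‖F' y‖).bddAbove
  exact ⟨C, fun x => hC ⟨_, rfl⟩⟩

theorem IsCylinder.integrable {F : (J → G) → ℝ} (hF : IsCylinder F) :
    Integrable F (bernoulliMeasure J G) := by
  obtain ⟨C, hC⟩ := hF.exists_bound
  exact Integrable.of_bound hF.measurable.aestronglyMeasurable C (Eventually.of_forall hC)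

theorem IsCylinder.comp₂ {α β γ : Type} {F : (J → G) → α} {F' : (J → G) → β} (hF : IsCylinder F)
    (hF' : IsCylinder F') (f : α → β → γ) : IsCylinder fun x => f (F x) (F' x) := by
  classical
  obtain ⟨K, hK⟩ := hF
  obtain ⟨L, hL⟩ := hF'
  refine ⟨K ∪ L, fun x y hxy => ?_⟩
  simp only
  rw [hK fun i hi => hxy i (by simp_all), hL fun i hi => hxy i (by simp_all)]

theorem IsCylinder.comp {α β : Type} {F : (J → G) → α} (hF : IsCylinder F) (f : α → β) :
    IsCylinder fun x => f (F x) :=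
  hF.comp₂ hF fun a _ => f a

theorem IsCylinder.sum {ι : Type} {s : Finset ι} {F : ι → (J → G) → ℝ}
    (hF : ∀ i, IsCylinder (F i)) : IsCylinder fun x => ∑ i ∈ s, F i x := by
  classical
  choose K hK using hF
  refine ⟨s.biUnion K, fun x y hxy => ?_⟩
  exact Finset.sum_congr rfl fun i hi => hK i fun j hj =>
    hxy j (Finset.mem_biUnion.2 ⟨i, hi, hj⟩)

theorem IsCylinder.comp_twist {α : Type} {F : (J → G) → α} (hF : IsCylinder F) (σ : Equiv.Perm J)
    (t : J → G) : IsCylinder fun x => F (twist σ t x) := by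
  obtain ⟨K, hK⟩ := hF
  refine ⟨K.map σ.symm.toEmbedding, fun x y hxy => hK fun i hi => ?_⟩
  rw [twist, twist, hxy (σ.symm i) (by simpa using hi)]

theorem integral_twist {F : (J → G) → ℝ} (hF : IsCylinder F) (σ : Equiv.Perm J) (t : J → G) :
    ∫ x, F (twist σ t x) ∂bernoulliMeasure J G = ∫ x, F x ∂bernoulliMeasure J G := by
  have h := measurePreserving_twist (G := G) σ t
  rw [← integral_map (f := F) h.measurable.aemeasurable (hF.measurable.aestronglyMeasurable), h.map_eq]

variable [DecidableEq J]

theorem twist_update (σ : Equiv.Perm J) (t : J → G) (x : J → G) (j : J) (g : G) :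
    twist σ t (Function.update x j g) = Function.update (twist σ t x) (σ j) (t j * g) := by
  funext k
  by_cases hk : k = σ j
  · subst hk
    simp
  · rw [Function.update_of_ne hk, twist, twist, Function.update_of_ne]
    intro h
    exact hk (by rw [← h]; simp)

/-- Averaging over one coordinate preserves integrals. -/
theorem card_mul_integral {F : (J → G) → ℝ} (hF : IsCylinder F) (j : J) :
    Fintype.card G * ∫ x, F x ∂bernoulliMeasure J G =
      ∫ x, ∑ g, F (Function.update x j g) ∂bernoulliMeasure J G := by
  have h1 : ∀ g : G, ∀ x : J → G,
      twist (Equiv.refl J) (Pi.mulSingle j g) x = Function.update x j (g * x j) := by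
    intro g x
    funext k
    by_cases hk : k = j
    · subst hk; simp [twist]
    · simp [twist, hk]
  have h2 : ∀ x : J → G, ∑ g, F (Function.update x j g) =
      ∑ g, F (twist (Equiv.refl J) (Pi.mulSingle j g) x) := by
    intro x
    simp only [h1]
    exact (Equiv.sum_comp (Equiv.mulRight (x j)) fun g => F (Function.update x j g)).symm
  simp only [h2]
  rw [integral_finsetSum _ fun g _ => (hF.comp_twist _ _).integrable]
  simp [integral_twist hF]

/-- Functions of the coordinates in `A` with vanishing average over each of them. -/
def pureSubmodule (G : Type) [Fintype G] {J : Type} [DecidableEq J] (A : Finset J) :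
    Submodule ℝ ((J → G) → ℝ) where
  carrier := {F | DependsOn F (A : Set J) ∧ ∀ j ∈ A, ∀ x, ∑ g, F (Function.update x j g) = 0}
  zero_mem' := ⟨fun _ _ _ => rfl, fun _ _ _ => by simp⟩
  add_mem' := by
    rintro F F' ⟨h1, h2⟩ ⟨h3, h4⟩
    exact ⟨fun x y h => by simp [h1 h, h3 h], fun j hj x => by
      simp [Finset.sum_add_distrib, h2 j hj, h4 j hj]⟩
  smul_mem' := by
    rintro c F ⟨h1, h2⟩
    exact ⟨fun x y h => by simp [h1 h], fun j hj x => by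
      simp [← Finset.mul_sum, h2 j hj]⟩

theorem isCylinder_of_mem_pureSubmodule {A : Finset J} {F : (J → G) → ℝ}
    (hF : F ∈ pureSubmodule G A) : IsCylinder F := ⟨A, hF.1⟩

theorem DependsOn.update_eq {A : Finset J} {F : (J → G) → ℝ} (hF : DependsOn F (A : Set J)) {j : J}
    (hj : j ∉ A) (x : J → G) (g : G) : F (Function.update x j g) = F x := by
  refine hF fun i hi => Function.update_of_ne ?_ _ _
  rintro rfl
  exact hj hi

theorem integral_mul_eq_zero_of_notMem {A : Finset J} {F F' : (J → G) → ℝ}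
    (hF : F ∈ pureSubmodule G A) (hF' : IsCylinder F') {j : J} (hj : j ∈ A)
    (h : ∀ x g, F' (Function.update x j g) = F' x) :
    ∫ x, F x * F' x ∂bernoulliMeasure J G = 0 := by
  have h1 := card_mul_integral
    ((isCylinder_of_mem_pureSubmodule hF).comp₂ hF' fun a b => a * b) j
  simp only [h, ← Finset.sum_mul, hF.2 j hj, zero_mul, integral_zero] at h1
  exact (mul_eq_zero.1 h1).resolve_left (by simp)

theorem integral_mul_eq_zero_of_ne {A B : Finset J} {F F' : (J → G) → ℝ}
    (hF : F ∈ pureSubmodule G A) (hF' : F' ∈ pureSubmodule G B) (hAB : A ≠ B) :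
    ∫ x, F x * F' x ∂bernoulliMeasure J G = 0 := by
  by_cases h : A ⊆ B
  · obtain ⟨j, hj, hjA⟩ := Finset.exists_of_ssubset (Finset.ssubset_iff_subset_ne.2 ⟨h, hAB⟩)
    simp only [mul_comm (F _)]
    exact integral_mul_eq_zero_of_notMem hF' ⟨A, hF.1⟩ hj fun x g => hF.1.update_eq hjA x g
  · obtain ⟨j, hj, hjB⟩ := Finset.not_subset.1 h
    exact integral_mul_eq_zero_of_notMem hF ⟨B, hF'.1⟩ hj fun x g => hF'.1.update_eq hjB x g

theorem mem_iSup_pureSubmodule_aux (K : Finset J) : ∀ (L : Finset J) (F : (J → G) → ℝ), Disjoint K L →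
    DependsOn F ((K ∪ L : Finset J) : Set J) →
    (∀ j ∈ L, ∀ x, ∑ g, F (Function.update x j g) = 0) → F ∈ ⨆ A, pureSubmodule G A := by
  induction K using Finset.induction_on with
  | empty =>
    intro L F _ h1 h2
    rw [Finset.empty_union] at h1
    exact Submodule.mem_iSup_of_mem L ⟨h1, h2⟩
  | insert j K hjK ih =>
    intro L F hd h1 h2
    rw [Finset.disjoint_insert_left] at hd
    let P : (J → G) → ℝ := fun x => (Fintype.card G : ℝ)⁻¹ * ∑ g, F (Function.update x j g)
    have hP : ∀ x g, P (Function.update x j g) = P x := by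
      intro x g
      simp [P]
    have hP1 : DependsOn P ((K ∪ L : Finset J) : Set J) := by
      intro x y hxy
      simp only [P]
      congr 1
      refine Finset.sum_congr rfl fun g _ => h1 fun i hi => ?_
      by_cases hij : i = j
      · subst hij; simp
      · rw [Function.update_of_ne hij, Function.update_of_ne hij]
        refine hxy i ?_
        simp_all
    have hP2 : ∀ l ∈ L, ∀ x, ∑ g, P (Function.update x l g) = 0 := by
      intro l hl x
      simp only [P]
      rw [← Finset.mul_sum, Finset.sum_comm]
      have hlj : l ≠ j := fun h => hd.1 (h ▸ hl)
      simp_rw [Function.update_comm hlj]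
      simp [h2 l hl]
    have hF : F = P + (F - P) := by simp
    rw [hF]
    refine Submodule.add_mem _ (ih L P hd.2 hP1 hP2) (ih (insert j L) _ ?_ ?_ ?_)
    · rw [Finset.disjoint_insert_right]
      exact ⟨hjK, hd.2⟩
    · intro x y hxy
      rw [Pi.sub_apply, Pi.sub_apply, hP1 fun i hi => hxy i (by
          simp only [Finset.coe_union, Finset.coe_insert, Set.mem_union,
            Set.mem_insert_iff] at hi ⊢
          tauto),
        h1 fun i hi => hxy i (by
          simp only [Finset.coe_union, Finset.coe_insert, Set.mem_union,
            Set.mem_insert_iff] at hi ⊢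
          tauto)]
    · intro l hl x
      simp only [Pi.sub_apply, Finset.sum_sub_distrib]
      rcases Finset.mem_insert.1 hl with rfl | hl
      · simp only [hP, Finset.sum_const, Finset.card_univ, nsmul_eq_mul]
        simp [P]
      · rw [h2 l hl, hP2 l hl, sub_zero]

theorem IsCylinder.exists_finsupp {F : (J → G) → ℝ} (hF : IsCylinder F) :
    ∃ Φ : Finset J →₀ ((J → G) → ℝ), (∀ A, Φ A ∈ pureSubmodule G A) ∧ (Φ.sum fun _ f => f) = F := by
  obtain ⟨K, hK⟩ := hF
  exact (Submodule.mem_iSup_iff_exists_finsupp _ _).1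
    (mem_iSup_pureSubmodule_aux K ∅ F (by simp) (by simpa using hK) (by simp))

/-- The Pythagorean theorem for pure functions. -/
theorem integral_sq_sum_pure {T : Finset (Finset J)} {Φ : Finset J → (J → G) → ℝ}
    (hΦ : ∀ A, Φ A ∈ pureSubmodule G A) :
    ∫ x, (∑ A ∈ T, Φ A x) ^ 2 ∂bernoulliMeasure J G =
      ∑ A ∈ T, ∫ x, Φ A x ^ 2 ∂bernoulliMeasure J G := by
  have hc := fun A => isCylinder_of_mem_pureSubmodule (hΦ A)
  simp only [sq, Finset.sum_mul_sum]
  rw [integral_finsetSum _ fun A _ =>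
    (IsCylinder.sum fun B => (hc A).comp₂ (hc B) fun a b => a * b).integrable]
  refine Finset.sum_congr rfl fun A hA => ?_
  rw [integral_finsetSum _ fun B _ => ((hc A).comp₂ (hc B) fun a b => a * b).integrable,
    Finset.sum_eq_single_of_mem A hA]
  intro B _ hBA
  exact integral_mul_eq_zero_of_ne (hΦ A) (hΦ B) hBA.symm

theorem twist_mem_pureSubmodule {A : Finset J} {F : (J → G) → ℝ} (σ : Equiv.Perm J) (t : J → G)
    (hF : F ∈ pureSubmodule G (A.map σ.toEmbedding)) :
    (fun x => F (twist σ t x)) ∈ pureSubmodule G A := by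
  refine ⟨fun x y hxy => hF.1 fun i hi => ?_, fun j hj x => ?_⟩
  · obtain ⟨j, hj, rfl⟩ : ∃ j ∈ A, σ j = i := by
      simpa only [Finset.coe_map, Set.mem_image, Finset.mem_coe, Equiv.coe_toEmbedding] using hi
    simp [hxy j hj]
  · simp only [twist_update]
    exact (Equiv.sum_comp (Equiv.mulLeft (t j)) fun g =>
      F (Function.update (twist σ t x) (σ j) g)).trans (hF.2 _ (Finset.mem_map_of_mem _ hj) _)

end Bernoulli

/-- Double counting along a labelled action: the labels decide which of the two bounds on the
overlap `I` is used. -/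
theorem sum_tsum_overlap_le {Z : Type} {m r : ℕ} (σ : Fin m × Bool → Equiv.Perm Z) (n : Z → ℝ)
    (hn0 : ∀ z, 0 ≤ n z) (hn : n.support.Finite) (L : Z → Set (Fin m × Bool))
    (hr : ∀ z, n z ≠ 0 → (L z).ncard ≤ r)
    (hL : ∀ z s, n z ≠ 0 → FreeGroup.invLetter s ∉ L z → L (σ s z) = {s})
    (I : Fin m × Bool → Z → ℝ) (hI : ∀ s, (I s).support.Finite)
    (hI1 : ∀ s z, I s z ≤ 2 * n z + n (σ s z) / 8)
    (hI2 : ∀ s z, I s z ≤ 2 * n (σ s z) + n z / 8) :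
    ∑ s, ∑' z, I s z ≤ (2 * r + 2 + m / 2) * ∑' z, n z := by
  classical
  have hsn : Summable n := summable_of_hasFiniteSupport hn
  have hsn' : ∀ s, Summable fun z => n (σ s z) := fun s => (σ s).summable_iff.2 hsn
  let a : Fin m × Bool → Z → ℝ := fun s z => if FreeGroup.invLetter s ∈ L z then 2 * n z else 0
  let b : Fin m × Bool → Z → ℝ := fun s z => if L z = {s} then 2 * n z else 0
  have ha : ∀ s, Summable (a s) := fun s => (hsn.mul_left 2).of_nonneg_of_le
    (fun z => by simp only [a]; split_ifs <;> linarith [hn0 z])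
    (fun z => by simp only [a]; split_ifs <;> linarith [hn0 z])
  have hb : ∀ s, Summable (b s) := fun s => (hsn.mul_left 2).of_nonneg_of_le
    (fun z => by simp only [b]; split_ifs <;> linarith [hn0 z])
    (fun z => by simp only [b]; split_ifs <;> linarith [hn0 z])
  have hb' : ∀ s, Summable fun z => b s (σ s z) := fun s => (σ s).summable_iff.2 (hb s)
  have hpt : ∀ s z, I s z ≤ a s z + b s (σ s z) + (n (σ s z) / 8 + n z / 8) := by
    intro s z
    have h1 := hI1 s z
    have h2 := hI2 s z
    have h3 := hn0 z
    have h4 := hn0 (σ s z)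
    by_cases hz : n z = 0
    · have h5 : 0 ≤ b s (σ s z) := by simp only [b]; split_ifs <;> linarith
      have h6 : a s z = 0 := by simp [a, hz]
      linarith
    by_cases hs : FreeGroup.invLetter s ∈ L z
    · have h5 : 0 ≤ b s (σ s z) := by simp only [b]; split_ifs <;> linarith
      have h6 : a s z = 2 * n z := if_pos hs
      linarith
    · have h5 : b s (σ s z) = 2 * n (σ s z) := if_pos (hL z s hz hs)
      have h6 : a s z = 0 := if_neg hs
      linarith
  have hsum : ∀ s, ∑' z, I s z ≤ ∑' z, a s z + ∑' z, b s z + (∑' z, n z) / 4 := by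
    intro s
    refine ((summable_of_hasFiniteSupport (hI s)).tsum_le_tsum (hpt s)
      (((ha s).add (hb' s)).add (((hsn' s).div_const 8).add (hsn.div_const 8)))).trans (le_of_eq ?_)
    rw [((ha s).add (hb' s)).tsum_add (((hsn' s).div_const 8).add (hsn.div_const 8)),
      (ha s).tsum_add (hb' s), ((hsn' s).div_const 8).tsum_add (hsn.div_const 8),
      (σ s).tsum_eq (b s), tsum_div_const, tsum_div_const, (σ s).tsum_eq n]
    ring
  have hA : ∑ s, ∑' z, a s z ≤ 2 * r * ∑' z, n z := by
    rw [← Summable.tsum_finsetSum fun s _ => ha s, ← tsum_mul_left]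
    refine Summable.tsum_le_tsum (fun z => ?_) (summable_sum fun s _ => ha s) (hsn.mul_left _)
    by_cases hz : n z = 0
    · simp [a, hz]
    have h1 : (Finset.univ.filter fun s => FreeGroup.invLetter s ∈ L z).card ≤ r := by
      refine le_trans ?_ (hr z hz)
      rw [← Set.ncard_coe_finset]
      refine Set.ncard_le_ncard_of_injOn FreeGroup.invLetter (fun s hs => by simpa using hs) ?_
        (Set.toFinite _)
      intro s _ s' _ h
      simpa using congrArg FreeGroup.invLetter h
    simp only [a]
    rw [Finset.sum_ite, Finset.sum_const_zero, add_zero, Finset.sum_const, nsmul_eq_mul]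
    have h2 : ((Finset.univ.filter fun s => FreeGroup.invLetter s ∈ L z).card : ℝ) ≤ r := by
      exact_mod_cast h1
    nlinarith [hn0 z]
  have hB : ∑ s, ∑' z, b s z ≤ 2 * ∑' z, n z := by
    rw [← Summable.tsum_finsetSum fun s _ => hb s, ← tsum_mul_left]
    refine Summable.tsum_le_tsum (fun z => ?_) (summable_sum fun s _ => hb s) (hsn.mul_left _)
    by_cases h : ∃ s, L z = {s}
    · obtain ⟨s, hs⟩ := h
      rw [Finset.sum_eq_single s]
      · simp [b, hs]
      · intro s' _ hne
        simp [b, hs, hne.symm]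
      · simp
    · push Not at h
      simp only [b, h, if_false, Finset.sum_const_zero]
      linarith [hn0 z]
  calc _ ≤ ∑ s, (∑' z, a s z + ∑' z, b s z + (∑' z, n z) / 4) := Finset.sum_le_sum fun s _ => hsum s
    _ = ∑ s, ∑' z, a s z + ∑ s, ∑' z, b s z + m * 2 * ((∑' z, n z) / 4) := by
      rw [Finset.sum_add_distrib, Finset.sum_add_distrib]
      simp [Fintype.card_prod]
    _ ≤ _ := by linarith

section Gap

set_option linter.unusedSectionVars false

variable {J G : Type} [Group G] [Fintype G] [MeasurableSpace G] [DiscreteMeasurableSpace G]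
  [DecidableEq J]

/-- Expansion of a twisted sum of pure functions, reindexed by the image set. -/
theorem sum_comp_twist (σ : Equiv.Perm J) (t : J → G) (T₀ T : Finset (Finset J))
    (hT : ∀ A, A ∈ T₀ → A ∈ T) (hT' : ∀ A : Finset J, A.map σ.toEmbedding ∈ T₀ → A ∈ T)
    (Ψ : Finset J → (J → G) → ℝ) (hΨ : ∀ A, A ∉ T₀ → Ψ A = 0) (x : J → G) :
    ∑ A ∈ T, Ψ A (twist σ t x) = ∑ A ∈ T, Ψ (A.map σ.toEmbedding) (twist σ t x) := by
  have h1 := (Equiv.finsetCongr σ).tsum_eq fun A => Ψ A (twist σ t x)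
  rw [tsum_eq_sum (s := T) fun A hA => by
      rw [Equiv.finsetCongr_apply, hΨ _ fun h => hA (hT' A h)]; rfl,
    tsum_eq_sum (s := T) fun A hA => by rw [hΨ A fun h => hA (hT A h)]; rfl] at h1
  exact h1.symm

theorem integral_mul_le_two_mul_add {F F' : (J → G) → ℝ} (hF : IsCylinder F) (hF' : IsCylinder F') :
    ∫ x, F x * F' x ∂bernoulliMeasure J G ≤
      2 * ∫ x, F x ^ 2 ∂bernoulliMeasure J G + (∫ x, F' x ^ 2 ∂bernoulliMeasure J G) / 8 := by
  rw [← integral_const_mul, ← integral_div, ← integral_add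
    (((hF.comp fun a => a ^ 2).integrable).const_mul 2)
    (((hF'.comp fun a => a ^ 2).integrable).div_const 8)]
  refine integral_mono (hF.comp₂ hF' fun a b => a * b).integrable
    (hF.comp₂ hF' fun a b => 2 * a ^ 2 + b ^ 2 / 8).integrable fun x => ?_
  simp only
  nlinarith [sq_nonneg (4 * F x - F' x)]

/-- The overlap estimate for the nonbase part of a family of pure functions. -/
theorem sum_overlap_pure_le {m r : ℕ} (σ : Fin m × Bool → Equiv.Perm J) (O : Finset J)
    (hO : ∀ s j, σ s j ∈ O ↔ j ∈ O) (L : J → Set (Fin m × Bool))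
    (hr : ∀ j ∉ O, (L j).ncard ≤ r)
    (hL : ∀ j ∉ O, ∀ s, FreeGroup.invLetter s ∉ L j → L (σ s j) = {s})
    (N : Finset J → ℝ) (hN0 : ∀ A, 0 ≤ N A) (T : Finset (Finset J)) (hN : ∀ A ∉ T, N A = 0)
    (I : Fin m × Bool → Finset J → ℝ) (hIT : ∀ s, ∀ A ∉ T, I s A = 0)
    (hI1 : ∀ s A, I s A ≤ 2 * N A + N (A.map (σ s).toEmbedding) / 8)
    (hI2 : ∀ s A, I s A ≤ 2 * N (A.map (σ s).toEmbedding) + N A / 8) :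
    ∑ s, ∑ A ∈ T with ¬ A ⊆ O, I s A ≤ (2 * r + 2 + m / 2) * ∑ A ∈ T with ¬ A ⊆ O, N A := by
  classical
  let spread : (Finset J → ℝ) → Finset J × J → ℝ := fun f z =>
    if z.2 ∈ z.1 \ O then f z.1 / (z.1 \ O).card else 0
  have hfin : ∀ f : Finset J → ℝ, (∀ A ∉ T, f A = 0) → (spread f).support.Finite := by
    intro f hf
    refine Set.Finite.subset (T ×ˢ T.biUnion id).finite_toSet ?_
    intro z hz
    have h1 : z.2 ∈ z.1 \ O := by
      by_contra h; exact hz (if_neg h)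
    have h2 : z.1 ∈ T := by
      by_contra h; exact hz (by simp [spread, hf _ h])
    simp only [Finset.coe_product, Set.mem_prod, Finset.mem_coe, Finset.mem_biUnion]
    exact ⟨h2, z.1, h2, (Finset.mem_sdiff.1 h1).1⟩
  have htsum : ∀ f : Finset J → ℝ, (∀ A ∉ T, f A = 0) →
      ∑' z, spread f z = ∑ A ∈ T with ¬ A ⊆ O, f A := by
    intro f hf
    rw [(summable_of_hasFiniteSupport (hfin f hf)).tsum_prod]
    have h1 : ∀ A, ∑' j, spread f (A, j) = if ¬ A ⊆ O then f A else 0 := by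
      intro A
      rw [tsum_eq_sum (s := A \ O) fun j hj => if_neg hj]
      rw [Finset.sum_congr rfl fun j hj => if_pos hj]
      simp only [Finset.sum_const, nsmul_eq_mul]
      split_ifs with h
      · have : (A \ O).card = 0 := by simpa [Finset.sdiff_eq_empty_iff_subset] using h
        simp [this]
      · have : ((A \ O).card : ℝ) ≠ 0 := by
          simpa [Finset.sdiff_eq_empty_iff_subset] using h
        field_simp
    simp only [h1]
    rw [tsum_eq_sum (s := T) fun A hA => by simp [hf A hA], Finset.sum_filter]
  let σ' : Fin m × Bool → Equiv.Perm (Finset J × J) := fun s =>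
    (Equiv.finsetCongr (σ s)).prodCongr (σ s)
  have hsd : ∀ s (A : Finset J), A.map (σ s).toEmbedding \ O = (A \ O).map (σ s).toEmbedding := by
    intro s A
    ext k
    simp only [Finset.mem_sdiff, Finset.mem_map_equiv]
    rw [← hO s ((σ s).symm k), Equiv.apply_symm_apply]
  have hσ' : ∀ s z, spread N (σ' s z) =
      spread (fun A => N (A.map (σ s).toEmbedding)) z := by
    intro s z
    simp [spread, σ', hsd, Finset.mem_sdiff, hO]
  have hcomb : ∀ (f g h : Finset J → ℝ) (c d : ℝ), (∀ A, f A ≤ c * g A + h A / d) → ∀ z,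
      spread f z ≤ c * spread g z + spread h z / d := by
    intro f g h c d hfgh z
    simp only [spread]
    split_ifs
    · have := hfgh z.1
      calc _ ≤ (c * g z.1 + h z.1 / d) / ((z.1 \ O).card : ℝ) := by gcongr
        _ = _ := by ring
    · simp
  have hnz : ∀ z, spread N z ≠ 0 → z.2 ∉ O := by
    intro z hz h
    exact hz (if_neg (by simp [h]))
  have hmain := sum_tsum_overlap_le σ' (spread N)
    (fun z => by
      simp only [spread]
      split_ifs
      · exact div_nonneg (hN0 _) (by positivity)
      · exact le_rfl) (hfin N hN) (fun z => L z.2)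
    (fun z hz => hr _ (hnz z hz)) (fun z s hz h => hL _ (hnz z hz) s h)
    (fun s => spread (I s)) (fun s => hfin _ (hIT s))
    (fun s z => by rw [hσ']; exact hcomb _ _ _ _ _ (hI1 s) z)
    (fun s z => by rw [hσ']; exact hcomb _ _ _ _ _ (hI2 s) z)
  rw [htsum N hN] at hmain
  simpa only [htsum _ (hIT _)] using hmain

/-- The spectral gap on the orthogonal complement of the functions of the base coordinates. -/
theorem IsCylinder.exists_base_part {m r : ℕ} (hm : 4 * r + 4 ≤ m)
    (σ : Fin m × Bool → Equiv.Perm J) (t : Fin m × Bool → J → G) (O : Finset J)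
    (hO : ∀ s j, σ s j ∈ O ↔ j ∈ O) (L : J → Set (Fin m × Bool))
    (hr : ∀ j ∉ O, (L j).ncard ≤ r)
    (hL : ∀ j ∉ O, ∀ s, FreeGroup.invLetter s ∉ L j → L (σ s j) = {s})
    {F : (J → G) → ℝ} (hF : IsCylinder F) :
    ∃ F₀ : (J → G) → ℝ, DependsOn F₀ (O : Set J) ∧
      (∀ W : (J → G) → ℝ, DependsOn W (O : Set J) →
        ∫ x, (F x - F₀ x) * W x ∂bernoulliMeasure J G = 0) ∧
      2 * m * ∫ x, (F x - F₀ x) ^ 2 ∂bernoulliMeasure J G +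
        ∑ s, ∫ x, (F₀ (twist (σ s) (t s) x) - F₀ x) ^ 2 ∂bernoulliMeasure J G ≤
        ∑ s, ∫ x, (F (twist (σ s) (t s) x) - F x) ^ 2 ∂bernoulliMeasure J G := by
  classical
  obtain ⟨Φ, hΦ, rfl⟩ := hF.exists_finsupp
  let T : Finset (Finset J) := Φ.support ∪ Finset.univ.biUnion fun s =>
    Φ.support.map (Equiv.finsetCongr (σ s)).symm.toEmbedding
  have hT1 : ∀ A, A ∈ Φ.support → A ∈ T := fun A hA => Finset.mem_union_left _ hA
  have hT2 : ∀ s (A : Finset J), A.map (σ s).toEmbedding ∈ Φ.support → A ∈ T := by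
    intro s A hA
    refine Finset.mem_union_right _ (Finset.mem_biUnion.2 ⟨s, Finset.mem_univ _, ?_⟩)
    rw [Finset.mem_map_equiv, Equiv.symm_symm]
    exact hA
  have hΦT : ∀ A ∉ T, Φ A = 0 := fun A hA => Finsupp.notMem_support_iff.1 fun h => hA (hT1 A h)
  have hΦT2 : ∀ s (A : Finset J), A ∉ T → Φ (A.map (σ s).toEmbedding) = 0 := fun s A hA =>
    Finsupp.notMem_support_iff.1 fun h => hA (hT2 s A h)
  have hFT : ∀ x, (Φ.sum fun _ f => f) x = ∑ A ∈ T, Φ A x := by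
    intro x
    rw [Finsupp.sum_of_support_subset Φ (s := T) (fun A hA => hT1 A hA) _ (by simp),
      Finset.sum_apply]
  let Φ₀ : Finset J → (J → G) → ℝ := fun A => if A ⊆ O then Φ A else 0
  have hΦ₀ : ∀ A, Φ₀ A ∈ pureSubmodule G A := by
    intro A
    simp only [Φ₀]
    split_ifs
    · exact hΦ A
    · exact Submodule.zero_mem _
  let D : Fin m × Bool → Finset J → (J → G) → ℝ := fun s A =>
    (fun x => Φ (A.map (σ s).toEmbedding) (twist (σ s) (t s) x)) - Φ A
  have hD : ∀ s A, D s A ∈ pureSubmodule G A := fun s A =>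
    Submodule.sub_mem _ (twist_mem_pureSubmodule _ _ (hΦ _)) (hΦ A)
  have hsub : ∀ s (A : Finset J), A.map (σ s).toEmbedding ⊆ O ↔ A ⊆ O := by
    intro s A
    constructor
    · intro h j hj
      exact (hO s j).1 (h (Finset.mem_map_of_mem _ hj))
    · intro h k hk
      obtain ⟨j, hj, rfl⟩ := Finset.mem_map.1 hk
      exact (hO s j).2 (h hj)
  let D₀ : Fin m × Bool → Finset J → (J → G) → ℝ := fun s A => if A ⊆ O then D s A else 0
  have hD₀ : ∀ s A, D₀ s A ∈ pureSubmodule G A := by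
    intro s A
    simp only [D₀]
    split_ifs
    · exact hD s A
    · exact Submodule.zero_mem _
  have hdiff : ∀ s x, ∑ A ∈ T, Φ A (twist (σ s) (t s) x) - ∑ A ∈ T, Φ A x = ∑ A ∈ T, D s A x := by
    intro s x
    rw [sum_comp_twist (σ s) (t s) Φ.support T hT1 (hT2 s) (fun A => Φ A)
      (fun A hA => Finsupp.notMem_support_iff.1 hA), ← Finset.sum_sub_distrib]
    rfl
  have hdiff₀ : ∀ s x, ∑ A ∈ T, Φ₀ A (twist (σ s) (t s) x) - ∑ A ∈ T, Φ₀ A x =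
      ∑ A ∈ T, D₀ s A x := by
    intro s x
    rw [sum_comp_twist (σ s) (t s) Φ.support T hT1 (hT2 s) Φ₀
      (fun A hA => by simp [Φ₀, Finsupp.notMem_support_iff.1 hA]), ← Finset.sum_sub_distrib]
    refine Finset.sum_congr rfl fun A _ => ?_
    simp only [Φ₀, D₀, hsub]
    split_ifs
    · rfl
    · simp
  let F₀ : (J → G) → ℝ := fun x => ∑ A ∈ T, Φ₀ A x
  let Φ₁ : Finset J → (J → G) → ℝ := fun A => if A ⊆ O then 0 else Φ A
  have hΦ₁ : ∀ A, Φ₁ A ∈ pureSubmodule G A := by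
    intro A
    simp only [Φ₁]
    split_ifs
    · exact Submodule.zero_mem _
    · exact hΦ A
  have hFF₀ : ∀ x, (Φ.sum fun _ f => f) x - F₀ x = ∑ A ∈ T, Φ₁ A x := by
    intro x
    rw [hFT, ← Finset.sum_sub_distrib]
    refine Finset.sum_congr rfl fun A _ => ?_
    simp only [Φ₀, Φ₁]
    split_ifs <;> simp
  have hcyl := fun A => isCylinder_of_mem_pureSubmodule (hΦ A)
  refine ⟨F₀, ?_, ?_, ?_⟩
  · intro x y hxy
    refine Finset.sum_congr rfl fun A _ => ?_
    simp only [Φ₀]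
    split_ifs with h
    · exact (hΦ A).1 fun i hi => hxy i (h hi)
    · rfl
  · intro W hW
    simp only [hFF₀, Finset.sum_mul]
    rw [integral_finsetSum _ fun A _ =>
      ((isCylinder_of_mem_pureSubmodule (hΦ₁ A)).comp₂ ⟨O, hW⟩ fun a b => a * b).integrable]
    refine Finset.sum_eq_zero fun A _ => ?_
    by_cases h : A ⊆ O
    · simp [Φ₁, h]
    · obtain ⟨j, hj, hjO⟩ := Finset.not_subset.1 h
      exact integral_mul_eq_zero_of_notMem (hΦ₁ A) ⟨O, hW⟩ hj fun x g => hW.update_eq hjO x g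
  · let N : Finset J → ℝ := fun A => ∫ x, Φ A x ^ 2 ∂bernoulliMeasure J G
    let I : Fin m × Bool → Finset J → ℝ := fun s A =>
      ∫ x, Φ (A.map (σ s).toEmbedding) (twist (σ s) (t s) x) * Φ A x ∂bernoulliMeasure J G
    have hN' : ∀ s (A : Finset J), ∫ x, Φ (A.map (σ s).toEmbedding) (twist (σ s) (t s) x) ^ 2
        ∂bernoulliMeasure J G = N (A.map (σ s).toEmbedding) := fun s A =>
      integral_twist ((hcyl _).comp fun a => a ^ 2) (σ s) (t s)
    have hover := sum_overlap_pure_le σ O hO L hr hL N (fun A => integral_nonneg fun x => sq_nonneg _)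
      T (fun A hA => by simp [N, hΦT A hA]) I
      (fun s A hA => by simp [I, hΦT A hA])
      (fun s (A : Finset J) => by
        have := integral_mul_le_two_mul_add (hcyl A) ((hcyl (A.map (σ s).toEmbedding)).comp_twist (σ s) (t s))
        rw [hN'] at this
        simpa only [mul_comm (Φ A _)] using this)
      (fun s (A : Finset J) => by
        have := integral_mul_le_two_mul_add ((hcyl (A.map (σ s).toEmbedding)).comp_twist (σ s) (t s)) (hcyl A)
        rwa [hN'] at this)
    have hDint : ∀ s A, ∫ x, D s A x ^ 2 ∂bernoulliMeasure J G =
        N (A.map (σ s).toEmbedding) + N A - 2 * I s A := by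
      intro s A
      rw [← hN', ← integral_const_mul,
        ← integral_add ((((hcyl _).comp_twist _ _).comp fun a => a ^ 2).integrable)
          ((hcyl A).comp fun a => a ^ 2).integrable,
        ← integral_sub (((((hcyl _).comp_twist _ _).comp₂ (hcyl A) fun a b => a ^ 2 + b ^ 2)).integrable)
          ((((hcyl _).comp_twist _ _).comp₂ (hcyl A) fun a b => a * b).integrable.const_mul 2)]
      refine integral_congr_ae (Eventually.of_forall fun x => ?_)
      simp only [D, Pi.sub_apply]
      ring
    have hNshift : ∀ s, ∑ A ∈ T with ¬ A ⊆ O, N (A.map (σ s).toEmbedding) =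
        ∑ A ∈ T with ¬ A ⊆ O, N A := by
      intro s
      have h1 := (Equiv.finsetCongr (σ s)).tsum_eq fun A => if ¬ A ⊆ O then N A else 0
      rw [tsum_eq_sum (s := T) fun A hA => by
          simp [N, hΦT2 s A hA],
        tsum_eq_sum (s := T) fun A hA => by simp [N, hΦT A hA]] at h1
      simp only [Equiv.finsetCongr_apply, hsub] at h1
      rw [Finset.sum_filter, Finset.sum_filter]
      exact h1
    simp only [hFF₀]
    simp only [hFT, hdiff, F₀, hdiff₀]
    rw [integral_sq_sum_pure hΦ₁]
    simp only [integral_sq_sum_pure (hD _), integral_sq_sum_pure (hD₀ _)]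
    have e1 : ∑ A ∈ T, ∫ x, Φ₁ A x ^ 2 ∂bernoulliMeasure J G = ∑ A ∈ T with ¬ A ⊆ O, N A := by
      rw [Finset.sum_filter]
      refine Finset.sum_congr rfl fun A _ => ?_
      by_cases h : A ⊆ O <;> simp [Φ₁, N, h]
    have e2 : ∀ s, ∑ A ∈ T, ∫ x, D s A x ^ 2 ∂bernoulliMeasure J G =
        ∑ A ∈ T, ∫ x, D₀ s A x ^ 2 ∂bernoulliMeasure J G +
          (2 * ∑ A ∈ T with ¬ A ⊆ O, N A - 2 * ∑ A ∈ T with ¬ A ⊆ O, I s A) := by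
      intro s
      rw [← Finset.sum_filter_add_sum_filter_not T (fun A => A ⊆ O)]
      congr 1
      · rw [Finset.sum_filter]
        refine Finset.sum_congr rfl fun A _ => ?_
        by_cases h : A ⊆ O <;> simp [D₀, h]
      · simp only [hDint]
        rw [Finset.sum_sub_distrib, Finset.sum_add_distrib, hNshift, ← Finset.mul_sum]
        ring
    simp only [e2]
    rw [e1, Finset.sum_add_distrib, Finset.sum_sub_distrib, ← Finset.mul_sum (a := 2)
      (f := fun s => ∑ A ∈ T with ¬ A ⊆ O, I s A)]
    have hcard : ∑ _s : Fin m × Bool, 2 * ∑ A ∈ T with ¬ A ⊆ O, N A =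
        4 * m * ∑ A ∈ T with ¬ A ⊆ O, N A := by
      simp [Fintype.card_prod]; ring
    rw [hcard]
    have hS : 0 ≤ ∑ A ∈ T with ¬ A ⊆ O, N A :=
      Finset.sum_nonneg fun A _ => integral_nonneg fun x => sq_nonneg _
    have hm' : (4 * r + 4 : ℝ) ≤ m := by exact_mod_cast hm
    nlinarith

end Gap

/-- A sparse labelling of a countable action with a distinguished point `o` fixed by a free
subgroup, together with cocycles restricting at `o` to any given homomorphism of that subgroup. -/
theorem HasSparseFreeSubgroup.exists_action {Γ : Type} [Group Γ] [Countable Γ] {r m : ℕ}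
    (h : HasSparseFreeSubgroup Γ r m) (hr : 1 ≤ r) :
    ∃ (J : Type) (_ : Countable J) (a : Γ →* Equiv.Perm J) (o : J) (e : Γ × ℕ → J)
      (ℓ : Fin m × Bool → Γ) (L : J → Set (Fin m × Bool)),
      Function.Injective e ∧ (∀ γ δ l, a γ (e (δ, l)) = e (γ * δ, l)) ∧
      (∀ s, a (ℓ s) o = o) ∧ (∀ k, k ≠ o → (L k).ncard ≤ r) ∧
      (∀ k s, FreeGroup.invLetter s ∉ L k → L (a (ℓ s) k) = {s}) ∧
      ∀ (G : Type) [Group G] (φ : FreeGroup (Fin m) →* G), ∃ τ : Γ → J → G,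
        (∀ γ δ k, τ (γ * δ) k = τ γ (a δ k) * τ δ k) ∧
        (∀ s, τ (ℓ s) o = φ (FreeGroup.ofLetter s)) ∧ ∀ γ p, τ γ (e p) = 1 := by
  classical
  obtain ⟨Q, _, π, j, hπ, hj, A, hA, hA'⟩ := h
  let _ : MulAction (FreeGroup (Fin m)) Γ := MulAction.compHom Γ j
  obtain ⟨B, hB, hB'⟩ := FreeGroup.exists_letter_labelling (α := Fin m) Γ
  have hQ : Countable Q := hπ.countable
  let a : Γ →* Equiv.Perm ((Q ⧸ (π.comp j).range) ⊕ (Γ × ℕ)) :=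
    { toFun := fun γ => Equiv.sumCongr (MulAction.toPerm (π γ))
        (Equiv.prodCongr (Equiv.mulLeft γ) (Equiv.refl ℕ))
      map_one' := by
        ext k
        rcases k with k | k <;> simp
      map_mul' := fun γ δ => by
        ext k
        rcases k with k | ⟨k, l⟩ <;> simp [mul_smul, mul_assoc] }
  let κ : FreeGroup (Fin m) ≃* (π.comp j).range := MonoidHom.ofInjective hj
  let b : Q ⧸ (π.comp j).range := ((1 : Q) : Q ⧸ (π.comp j).range)
  let σ : Q ⧸ (π.comp j).range → Q := fun ω => if ω = b then 1 else ω.out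
  have hσ : ∀ ω, ((σ ω : Q) : Q ⧸ (π.comp j).range) = ω := by
    intro ω
    simp only [σ]
    split_ifs with hω
    · exact hω.symm
    · exact QuotientGroup.out_eq' ω
  have hσb : σ b = 1 := by simp [σ]
  have hmem : ∀ (q : Q) ω, (σ (q • ω))⁻¹ * (q * σ ω) ∈ (π.comp j).range := by
    intro q ω
    rw [← QuotientGroup.eq, hσ, ← smul_eq_mul, ← MulAction.Quotient.smul_coe, hσ]
  have hfix : ∀ s, π (j (FreeGroup.ofLetter s)) • b = b := by
    intro s
    change ((π (j (FreeGroup.ofLetter s)) * 1 : Q) : Q ⧸ (π.comp j).range) = _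
    refine QuotientGroup.eq.2 ?_
    rw [mul_one, mul_one]
    exact inv_mem ⟨FreeGroup.ofLetter s, rfl⟩
  have hQ' : Countable (Q ⧸ (π.comp j).range) := QuotientGroup.mk_surjective.countable
  refine ⟨_, inferInstance, a, Sum.inl b, Sum.inr, fun s => j (FreeGroup.ofLetter s),
    Sum.elim A fun p => B p.1, Sum.inr_injective, fun γ δ l => rfl, fun s => ?_, ?_, ?_, ?_⟩
  · exact congrArg Sum.inl (hfix s)
  · rintro (ω | p) hk
    · exact hA ω fun h => hk (congrArg Sum.inl h)
    · refine (Set.ncard_le_one_iff_subsingleton.2 ?_).trans hr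
      rcases hB' p.1 with h | h
      · exact h
      · intro s hs
        obtain ⟨u, hu, hu1, -⟩ := h s hs
        have hu' : j u * p.1 = p.1 := hu
        have : j u = 1 := by simpa using hu'
        exact absurd (hj (by simp [this])) hu1
  · rintro (ω | p) s hs
    · exact hA' ω s hs
    · exact hB p.1 s hs
  · intro G _ φ
    refine ⟨fun γ => Sum.elim (fun ω => φ (κ.symm ⟨_, hmem (π γ) ω⟩)) fun _ => 1, ?_, ?_,
      fun _ _ => rfl⟩
    · rintro γ δ (ω | p)
      · change φ _ = φ (κ.symm ⟨_, hmem (π γ) (π δ • ω)⟩) * φ _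
        rw [← map_mul, ← map_mul]
        congr 2
        ext
        change _ = (_ * _ : Q)
        simp only [map_mul, mul_smul]
        group
      · exact (mul_one (1 : G)).symm
    · intro s
      change φ _ = _
      congr 1
      rw [MulEquiv.symm_apply_eq]
      ext
      change _ = π (j (FreeGroup.ofLetter s))
      simp only [hfix, hσb]
      simp

/-- The Bernoulli action over a permutation action, twisted by a cocycle. -/
noncomputable def twistedBernoulli {Γ J G : Type} [Group Γ] [Group G] [Fintype G] [MeasurableSpace G]
    [DiscreteMeasurableSpace G] (a : Γ →* Equiv.Perm J) (τ : Γ → J → G)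
    (hτ : ∀ γ δ k, τ (γ * δ) k = τ γ (a δ k) * τ δ k) : PMP Γ where
  X := J → G
  μ := bernoulliMeasure J G
  act γ := twist (a γ) (τ γ)
  one_act x := by
    have h1 : ∀ k, τ 1 k = 1 := fun k => by simpa using hτ 1 1 k
    funext k
    simp only [twist, h1, one_mul, map_one]
    rfl
  mul_act γ δ x := by
    funext k
    simp [twist, hτ, mul_assoc, Equiv.Perm.mul_def]
  preserves γ := measurePreserving_twist _ _

section InvariantPart

set_option linter.unusedSectionVars false

variable {J G : Type} [Group G] [Fintype G] [MeasurableSpace G] [DiscreteMeasurableSpace G]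
  [DecidableEq J]

theorem isCylinder_eval (o : J) : IsCylinder fun x : J → G => x o :=
  ⟨{o}, fun _ _ h => h o (by simp)⟩

theorem isCylinder_eval₂ {α : Type} (o o' : J) (u : G → G → α) :
    IsCylinder fun x : J → G => u (x o) (x o') :=
  (isCylinder_eval o).comp₂ (isCylinder_eval o') u

theorem dependsOn_eval₂ {α : Type} (o o' : J) (u : G → G → α) :
    DependsOn (fun x : J → G => u (x o) (x o')) (({o, o'} : Finset J) : Set J) := by
  intro x y h
  simp only [h o (by simp), h o' (by simp)]

theorem card_sq_mul_integral_eval₂ {o o' : J} (h : o ≠ o') (u : G → G → ℝ) :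
    (Fintype.card G : ℝ) ^ 2 * ∫ x, u (x o) (x o') ∂bernoulliMeasure J G = ∑ y : G × G, u y.1 y.2 := by
  rw [sq, mul_assoc, card_mul_integral (isCylinder_eval₂ o o' u) o]
  simp only [Function.update_self, Function.update_of_ne h.symm]
  rw [card_mul_integral (F := fun x => ∑ g, u g (x o'))
    (IsCylinder.sum fun g => (isCylinder_eval o').comp (u g)) o']
  simp only [Function.update_self]
  rw [integral_const, Finset.sum_comm, Fintype.sum_prod_type]
  simp

theorem card_sq_mul_integral_inv_mul {o o' : J} (h : o ≠ o') (w : G → ℝ) :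
    (Fintype.card G : ℝ) * ∫ x, w ((x o)⁻¹ * x o') ∂bernoulliMeasure J G = ∑ g, w g := by
  have h1 := card_sq_mul_integral_eval₂ h fun a b => w (a⁻¹ * b)
  have h2 : ∑ y : G × G, w (y.1⁻¹ * y.2) = Fintype.card G * ∑ g, w g := by
    rw [Fintype.sum_prod_type]
    have : ∀ a : G, ∑ b, w (a⁻¹ * b) = ∑ g, w g := fun a => Equiv.sum_comp (Equiv.mulLeft a⁻¹) w
    simp [this]
  rw [h2, sq, mul_assoc] at h1
  exact mul_left_cancel₀ (by simp) h1

/-- A function which is almost invariant under letters acting with a spectral gap is close to a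
function of the relative position of the two base coordinates. -/
theorem IsCylinder.exists_invariant_part {m r : ℕ} (hm : 4 * r + 4 ≤ m)
    (σ : Fin m × Bool → Equiv.Perm J) (t : Fin m × Bool → J → G) {o o' : J} (hoo : o ≠ o')
    (ho : ∀ s, σ s o = o) (ho' : ∀ s, σ s o' = o') (φ : Fin m × Bool → G)
    (hto : ∀ s, t s o = φ s) (hto' : ∀ s, t s o' = φ s) (L : J → Set (Fin m × Bool))
    (hr : ∀ j, j ≠ o → j ≠ o' → (L j).ncard ≤ r)
    (hL : ∀ j s, FreeGroup.invLetter s ∉ L j → L (σ s j) = {s}) {K : ℝ} (hK : 1 ≤ K)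
    (hgap : ∀ f : G × G → ℝ, (∀ y, ∑ g : G, f (g • y) = 0) →
      ∑ y, f y ^ 2 ≤ K * ∑ s, ∑ y, (f (φ s • y) - f y) ^ 2)
    {F : (J → G) → ℝ} (hF : IsCylinder F) :
    ∃ ψ : G → ℝ,
      (∀ w : G → ℝ, ∫ x, (F x - ψ ((x o)⁻¹ * x o')) * w ((x o)⁻¹ * x o') ∂bernoulliMeasure J G = 0) ∧
      ∫ x, (F x - ψ ((x o)⁻¹ * x o')) ^ 2 ∂bernoulliMeasure J G ≤
        K * ∑ s, ∫ x, (F (twist (σ s) (t s) x) - F x) ^ 2 ∂bernoulliMeasure J G := by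
  have hO : ∀ s j, σ s j ∈ ({o, o'} : Finset J) ↔ j ∈ ({o, o'} : Finset J) := by
    intro s j
    have h1 : σ s j = o ↔ j = o := by rw [← (σ s).apply_eq_iff_eq (x := j) (y := o), ho]
    have h2 : σ s j = o' ↔ j = o' := by rw [← (σ s).apply_eq_iff_eq (x := j) (y := o'), ho']
    simp [h1, h2]
  obtain ⟨F₀, hF₀, horth, hmain⟩ := hF.exists_base_part hm σ t {o, o'} hO L
    (fun j hj => by
      simp only [Finset.mem_insert, Finset.mem_singleton, not_or] at hj
      exact hr j hj.1 hj.2)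
    (fun j _ s => hL j s)
  have hF₀c : IsCylinder F₀ := ⟨_, hF₀⟩
  obtain ⟨f, hf⟩ : ∃ f : G × G → ℝ, ∀ x, F₀ x = f (x o, x o') := by
    refine ⟨fun y => F₀ (Function.update (fun _ => y.1) o' y.2), fun x => hF₀ fun i hi => ?_⟩
    simp only [Finset.coe_insert, Finset.coe_singleton, Set.mem_insert_iff,
      Set.mem_singleton_iff] at hi
    rcases hi with rfl | rfl
    · simp [Function.update_of_ne hoo]
    · simp
  have hG : (Fintype.card G : ℝ) ≠ 0 := by simp
  let ψ : G → ℝ := fun k => (∑ g, f (g, g * k)) / Fintype.card G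
  let f₁ : G × G → ℝ := fun y => f y - ψ (y.1⁻¹ * y.2)
  have hψf : ∀ y : G × G, ∑ g : G, f (g • y) = Fintype.card G * ψ (y.1⁻¹ * y.2) := by
    intro y
    simp only [ψ]
    rw [mul_div_cancel₀ _ hG]
    refine Eq.trans (Finset.sum_congr rfl fun g _ => ?_)
      (Equiv.sum_comp (Equiv.mulRight y.1) fun g => f (g, g * (y.1⁻¹ * y.2)))
    congr 1
    ext <;> simp [mul_assoc]
  have hinv : ∀ (g : G) (y : G × G), (g • y).1⁻¹ * (g • y).2 = y.1⁻¹ * y.2 := by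
    intro g y
    simp [mul_assoc]
  have hf₁ : ∀ y, ∑ g : G, f₁ (g • y) = 0 := by
    intro y
    simp only [f₁, hinv]
    rw [Finset.sum_sub_distrib, hψf]
    simp
  have hf₁' : ∀ w : G → ℝ, ∑ y : G × G, f₁ y * w (y.1⁻¹ * y.2) = 0 := by
    intro w
    have h1 : ∀ g : G, ∑ y : G × G, f₁ y * w (y.1⁻¹ * y.2) =
        ∑ y : G × G, f₁ (g • y) * w (y.1⁻¹ * y.2) := by
      intro g
      rw [← Equiv.sum_comp (MulAction.toPerm g : Equiv.Perm (G × G))]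
      simp only [MulAction.toPerm_apply, hinv]
    have h2 : ∑ g : G, ∑ y : G × G, f₁ y * w (y.1⁻¹ * y.2) = 0 := by
      rw [Finset.sum_congr rfl fun g _ => h1 g, Finset.sum_comm]
      refine Finset.sum_eq_zero fun y _ => ?_
      rw [← Finset.sum_mul, hf₁, zero_mul]
    simpa [hG] using h2
  have hcard : 0 < (Fintype.card G : ℝ) ^ 2 := by positivity
  have hψc : IsCylinder fun x : J → G => ψ ((x o)⁻¹ * x o') :=
    isCylinder_eval₂ o o' fun a b => ψ (a⁻¹ * b)
  have hgap' : ∫ x, (F₀ x - ψ ((x o)⁻¹ * x o')) ^ 2 ∂bernoulliMeasure J G ≤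
      K * ∑ s, ∫ x, (F₀ (twist (σ s) (t s) x) - F₀ x) ^ 2 ∂bernoulliMeasure J G := by
    have h1 := hgap f₁ hf₁
    have e1 : ∑ y, f₁ y ^ 2 =
        (Fintype.card G : ℝ) ^ 2 * ∫ x, (F₀ x - ψ ((x o)⁻¹ * x o')) ^ 2 ∂bernoulliMeasure J G := by
      simp only [hf]
      exact (card_sq_mul_integral_eval₂ hoo fun a b => (f (a, b) - ψ (a⁻¹ * b)) ^ 2).symm
    have e2 : ∀ s, ∑ y, (f₁ (φ s • y) - f₁ y) ^ 2 = (Fintype.card G : ℝ) ^ 2 *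
        ∫ x, (F₀ (twist (σ s) (t s) x) - F₀ x) ^ 2 ∂bernoulliMeasure J G := by
      intro s
      have e3 : ∀ x : J → G, twist (σ s) (t s) x o = φ s * x o := fun x => by
        conv_lhs => rw [← ho s]
        rw [twist_apply_perm, hto]
      have e4 : ∀ x : J → G, twist (σ s) (t s) x o' = φ s * x o' := fun x => by
        conv_lhs => rw [← ho' s]
        rw [twist_apply_perm, hto']
      simp only [hf, e3, e4]
      rw [card_sq_mul_integral_eval₂ hoo fun a b => (f (φ s * a, φ s * b) - f (a, b)) ^ 2]
      refine Finset.sum_congr rfl fun y _ => ?_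
      simp only [f₁, hinv]
      rw [sub_sub_sub_cancel_right]
      rfl
    rw [e1, Finset.sum_congr rfl fun s _ => e2 s, ← Finset.mul_sum] at h1
    nlinarith
  have horth' : ∀ w : G → ℝ,
      ∫ x, (F x - ψ ((x o)⁻¹ * x o')) * w ((x o)⁻¹ * x o') ∂bernoulliMeasure J G = 0 := by
    intro w
    have hwc : IsCylinder fun x : J → G => w ((x o)⁻¹ * x o') :=
      isCylinder_eval₂ o o' fun a b => w (a⁻¹ * b)
    have h1 := horth _ (dependsOn_eval₂ o o' fun a b => w (a⁻¹ * b))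
    have h2 : ∫ x, (F₀ x - ψ ((x o)⁻¹ * x o')) * w ((x o)⁻¹ * x o') ∂bernoulliMeasure J G = 0 := by
      have := card_sq_mul_integral_eval₂ hoo fun a b => f₁ (a, b) * w (a⁻¹ * b)
      rw [hf₁' w] at this
      simp only [hf]
      exact (mul_eq_zero.1 this).resolve_left hcard.ne'
    have h3 := integral_add ((hF.comp₂ hF₀c fun a b => a - b).comp₂ hwc fun a b => a * b).integrable
      ((hF₀c.comp₂ hψc fun a b => a - b).comp₂ hwc fun a b => a * b).integrable
    simp only [← add_mul, sub_add_sub_cancel] at h3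
    rw [h3, h1, h2, add_zero]
  refine ⟨ψ, horth', ?_⟩
  have hW : DependsOn (fun x : J → G => F₀ x - ψ ((x o)⁻¹ * x o')) (({o, o'} : Finset J) : Set J) := by
    intro x y hxy
    exact congrArg₂ (· - ·) (hF₀ hxy) (dependsOn_eval₂ o o' (fun a b => ψ (a⁻¹ * b)) hxy)
  have hc1 := hF.comp₂ hF₀c fun a b => a - b
  have hc2 := hF₀c.comp₂ hψc fun a b => a - b
  have hcross := horth _ hW
  have hsum : ∫ x, (F x - ψ ((x o)⁻¹ * x o')) ^ 2 ∂bernoulliMeasure J G =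
      ∫ x, (F x - F₀ x) ^ 2 ∂bernoulliMeasure J G +
        ∫ x, (F₀ x - ψ ((x o)⁻¹ * x o')) ^ 2 ∂bernoulliMeasure J G := by
    rw [← integral_add (hc1.comp fun a => a ^ 2).integrable (hc2.comp fun a => a ^ 2).integrable,
      ← sub_eq_zero, ← integral_sub ((hF.comp₂ hψc fun a b => (a - b) ^ 2)).integrable
        ((hc1.comp₂ hc2 fun a b => a ^ 2 + b ^ 2)).integrable,
      ← mul_zero 2, ← hcross, ← integral_const_mul]
    refine integral_congr_ae (Eventually.of_forall fun x => ?_)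
    simp only
    ring
  have h0 : 0 ≤ ∫ x, (F x - F₀ x) ^ 2 ∂bernoulliMeasure J G :=
    integral_nonneg fun x => sq_nonneg _
  have hm1 : (1 : ℝ) ≤ m := by
    have : 1 ≤ m := by omega
    exact_mod_cast this
  rw [hsum]
  nlinarith [mul_le_mul_of_nonneg_left hmain (zero_le_one.trans hK), mul_nonneg (sub_nonneg.2 hK) h0,
    mul_nonneg (mul_nonneg (sub_nonneg.2 hm1) (zero_le_one.trans hK)) h0]

end InvariantPart

theorem integral_comp_prod_finite {X Y Q Q' : Type} [MeasurableSpace X] [MeasurableSpace Y]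
    {μ : Measure X} {ν : Measure Y} [IsProbabilityMeasure μ] [IsProbabilityMeasure ν]
    [Fintype Q] [Fintype Q'] [MeasurableSpace Q] [MeasurableSpace Q'] [DiscreteMeasurableSpace Q]
    [DiscreteMeasurableSpace Q'] {u : X → Q} (hu : Measurable u) {v : Y → Q'} (hv : Measurable v)
    (θ : Q → Q' → ℝ) :
    ∫ z, θ (u z.1) (v z.2) ∂μ.prod ν =
      ∑ q, ∑ q', μ.real (u ⁻¹' {q}) * ν.real (v ⁻¹' {q'}) * θ q q' := by
  have hμ := Measure.isProbabilityMeasure_map (μ := μ) hu.aemeasurable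
  have hν := Measure.isProbabilityMeasure_map (μ := ν) hv.aemeasurable
  have h1 := integral_map (μ := μ.prod ν) (hu.prodMap hv).aemeasurable
    (f := fun y : Q × Q' => θ y.1 y.2) (measurable_of_countable _).aestronglyMeasurable
  rw [← Measure.map_prod_map _ _ hu hv, integral_fintype (.of_finite)] at h1
  simp only [Prod.map_fst, Prod.map_snd] at h1
  rw [← h1, Fintype.sum_prod_type]
  refine Finset.sum_congr rfl fun q _ => Finset.sum_congr rfl fun q' _ => ?_
  rw [smul_eq_mul]
  congr 1
  rw [measureReal_def, ← Set.singleton_prod_singleton, Measure.prod_prod, ENNReal.toReal_mul,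
    Measure.map_apply hu (.of_discrete), Measure.map_apply hv (.of_discrete)]
  rfl

section Square

set_option linter.unusedSectionVars false

variable {J G : Type} [Group G] [Fintype G] [MeasurableSpace G] [DiscreteMeasurableSpace G]

theorem measurePreserving_sumElim (J J' : Type) :
    MeasurePreserving (fun z : (J → G) × (J' → G) => (Sum.elim z.1 z.2 : J ⊕ J' → G))
      ((bernoulliMeasure J G).prod (bernoulliMeasure J' G)) (bernoulliMeasure (J ⊕ J') G) := by
  have hm : Measurable (fun z : (J → G) × (J' → G) => (Sum.elim z.1 z.2 : J ⊕ J' → G)) := by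
    refine measurable_pi_iff.2 ?_
    rintro (j | j)
    · exact (measurable_pi_apply j).comp measurable_fst
    · exact (measurable_pi_apply j).comp measurable_snd
  refine ⟨hm, Measure.eq_infinitePi _ fun s t ht => ?_⟩
  rw [Measure.map_apply hm (MeasurableSet.pi s.countable_toSet fun i _ => ht i)]
  have h1 : (fun z : (J → G) × (J' → G) => (Sum.elim z.1 z.2 : J ⊕ J' → G)) ⁻¹'
      Set.pi (s : Set (J ⊕ J')) t =
      (Set.pi (s.toLeft : Set J) fun j => t (Sum.inl j)) ×ˢ
        (Set.pi (s.toRight : Set J') fun j => t (Sum.inr j)) := by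
    ext z
    simp [Set.mem_pi]
  rw [h1, Measure.prod_prod, bernoulliMeasure, bernoulliMeasure,
    Measure.infinitePi_pi _ fun i _ => ht _, Measure.infinitePi_pi _ fun i _ => ht _,
    ← Finset.prod_disjSum s.toLeft s.toRight fun j => uniformMeasure G (t j),
    Finset.toLeft_disjSum_toRight]

theorem bernoulliMeasure_real_eval (o : J) (g : G) :
    (bernoulliMeasure J G).real {x | x o = g} = (Fintype.card G : ℝ)⁻¹ := by
  have h1 := (measurePreserving_eval_infinitePi (fun _ : J => uniformMeasure G) o).measure_preimage
    (s := {g}) (MeasurableSet.of_discrete.nullMeasurableSet)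
  have h2 : (fun x : J → G => x o) ⁻¹' {g} = {x | x o = g} := rfl
  change bernoulliMeasure J G ({x | x o = g}) = _ at h1
  rw [measureReal_def, h1, uniformMeasure]
  simp

/-- The variance of a function of a finite partition on the square of a twisted Bernoulli action. -/
theorem IsCylinder.variance_le [DecidableEq J] {m r : ℕ} (hm : 4 * r + 4 ≤ m)
    (σ : Fin m × Bool → Equiv.Perm J) (t : Fin m × Bool → J → G) {o : J}
    (ho : ∀ s, σ s o = o) (L : J → Set (Fin m × Bool))
    (hr : ∀ j, j ≠ o → (L j).ncard ≤ r)
    (hL : ∀ j s, FreeGroup.invLetter s ∉ L j → L (σ s j) = {s}) {K D : ℝ} (hK : 1 ≤ K) (hD : 0 < D)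
    (hgap : ∀ f : G × G → ℝ, (∀ y, ∑ g : G, f (g • y) = 0) →
      ∑ y, f y ^ 2 ≤ K * ∑ s, ∑ y, (f (t s o • y) - f y) ^ 2)
    (hmix : ∀ a b ψ : G → ℝ, ∑ g, ψ g = 0 → D * (∑ g, ∑ h, a g * b h * ψ (g⁻¹ * h)) ^ 2 ≤
      (Fintype.card G * ∑ g, ψ g ^ 2) * ((∑ g, a g ^ 2) * ∑ g, b g ^ 2))
    {Q : Type} [Fintype Q] {q : (J → G) → Q} (hq : IsCylinder q) (Φ : Q → Q → ℝ)
    (hΦ : ∀ a b, |Φ a b| ≤ 1) :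
    ∫ z, Φ (q z.1) (q z.2) ^ 2 ∂(bernoulliMeasure J G).prod (bernoulliMeasure J G) -
      (∫ z, Φ (q z.1) (q z.2) ∂(bernoulliMeasure J G).prod (bernoulliMeasure J G)) ^ 2 ≤
      K * ∑ s, ∫ z, (Φ (q (twist (σ s) (t s) z.1)) (q (twist (σ s) (t s) z.2)) -
        Φ (q z.1) (q z.2)) ^ 2 ∂(bernoulliMeasure J G).prod (bernoulliMeasure J G) +
      Fintype.card Q ^ 4 / D := by
  classical
  have hmp := measurePreserving_sumElim (G := G) J J
  let F : (J ⊕ J → G) → ℝ := fun x => Φ (q fun j => x (Sum.inl j)) (q fun j => x (Sum.inr j))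
  have hF : IsCylinder F := by
    obtain ⟨A, hA⟩ := hq
    refine ⟨A.disjSum A, fun x y hxy => ?_⟩
    simp only [F]
    rw [hA (x := fun j => x (Sum.inl j)) (y := fun j => y (Sum.inl j)) fun j hj =>
        hxy (Sum.inl j) (by simpa using hj),
      hA (x := fun j => x (Sum.inr j)) (y := fun j => y (Sum.inr j)) fun j hj =>
        hxy (Sum.inr j) (by simpa using hj)]
  have hint : ∀ W : (J ⊕ J → G) → ℝ, IsCylinder W →
      ∫ z, W (Sum.elim z.1 z.2) ∂(bernoulliMeasure J G).prod (bernoulliMeasure J G) =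
        ∫ x, W x ∂bernoulliMeasure (J ⊕ J) G := by
    intro W hW
    rw [← integral_map (f := W) hmp.measurable.aemeasurable hW.measurable.aestronglyMeasurable,
      hmp.map_eq]
  let σ₂ : Fin m × Bool → Equiv.Perm (J ⊕ J) := fun s => Equiv.sumCongr (σ s) (σ s)
  let t₂ : Fin m × Bool → J ⊕ J → G := fun s => Sum.elim (t s) (t s)
  have htw : ∀ s (z : (J → G) × (J → G)), twist (σ₂ s) (t₂ s) (Sum.elim z.1 z.2) =
      Sum.elim (twist (σ s) (t s) z.1) (twist (σ s) (t s) z.2) := by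
    intro s z
    funext j
    rcases j with j | j <;> rfl
  obtain ⟨ψ, hψ1, hψ2⟩ := hF.exists_invariant_part hm σ₂ t₂ (o := Sum.inl o) (o' := Sum.inr o)
    Sum.inl_ne_inr (fun s => congrArg Sum.inl (ho s)) (fun s => congrArg Sum.inr (ho s))
    (fun s => t s o) (fun s => rfl) (fun s => rfl) (Sum.elim L L)
    (by
      rintro (j | j) h1 h2
      · exact hr j fun h => h1 (congrArg _ h)
      · exact hr j fun h => h2 (congrArg _ h))
    (by
      rintro (j | j) s h
      · exact hL j s h
      · exact hL j s h) hK hgap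
  have hcyl : ∀ w : G → ℝ, IsCylinder fun x : J ⊕ J → G => w ((x (Sum.inl o))⁻¹ * x (Sum.inr o)) :=
    fun w => isCylinder_eval₂ _ _ fun a b => w (a⁻¹ * b)
  set ν := bernoulliMeasure (J ⊕ J) G
  set c := ∫ x, F x ∂ν with hc
  have hψc : ∫ x, ψ ((x (Sum.inl o))⁻¹ * x (Sum.inr o)) ∂ν = c := by
    have := hψ1 fun _ => 1
    simp only [mul_one] at this
    rw [integral_sub hF.integrable (hcyl ψ).integrable, sub_eq_zero] at this
    exact this.symm
  let ψ' : G → ℝ := fun g => ψ g - c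
  have hψ'0 : ∫ x, ψ' ((x (Sum.inl o))⁻¹ * x (Sum.inr o)) ∂ν = 0 := by
    simp only [ψ']
    rw [integral_sub (hcyl ψ).integrable (integrable_const _), hψc]
    simp
  have hψ's : ∑ g, ψ' g = 0 := by
    rw [← card_sq_mul_integral_inv_mul (Sum.inl_ne_inr (a := o) (b := o)) ψ', hψ'0, mul_zero]
  let V : ℝ := ∫ x, ψ' ((x (Sum.inl o))⁻¹ * x (Sum.inr o)) ^ 2 ∂ν
  have hV : Fintype.card G * V = ∑ g, ψ' g ^ 2 :=
    card_sq_mul_integral_inv_mul (Sum.inl_ne_inr (a := o) (b := o)) fun g => ψ' g ^ 2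
  have hV0 : 0 ≤ V := integral_nonneg fun x => sq_nonneg _
  have hVF : V = ∫ x, F x * ψ' ((x (Sum.inl o))⁻¹ * x (Sum.inr o)) ∂ν := by
    rw [← sub_eq_zero, ← integral_sub ((hcyl ψ').comp fun a => a ^ 2).integrable
      (hF.comp₂ (hcyl ψ') fun a b => a * b).integrable, ← neg_eq_zero, ← integral_neg,
      ← hψ1 ψ', ← sub_eq_zero, ← integral_sub, ← mul_zero c, ← hψ'0, ← integral_const_mul]
    · refine integral_congr_ae (Eventually.of_forall fun x => ?_)
      simp only [ψ']
      ring
    · exact ((hF.comp₂ (hcyl ψ') fun a b => -(b ^ 2 - a * b))).integrable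
    · exact ((hF.comp₂ (hcyl ψ) fun a b => (a - b) * (b - c))).integrable
  have hvar : ∫ x, F x ^ 2 ∂ν =
      ∫ x, (F x - ψ ((x (Sum.inl o))⁻¹ * x (Sum.inr o))) ^ 2 ∂ν + V + c ^ 2 := by
    have i1 := ((hF.comp₂ (hcyl ψ) fun a b => (a - b) ^ 2)).integrable
    have i2 := ((hcyl ψ').comp fun a => a ^ 2).integrable
    have i3 := ((hF.comp₂ (hcyl ψ) fun a b => (a - b) * b)).integrable
    have i4 := ((hcyl ψ').comp fun a => 2 * c * a + c ^ 2).integrable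
    have i5 := ((hcyl ψ').comp fun a => 2 * c * a).integrable
    have h4 : ∫ x, (2 * c * ψ' ((x (Sum.inl o))⁻¹ * x (Sum.inr o)) + c ^ 2) ∂ν = c ^ 2 := by
      rw [integral_add i5 (integrable_const (μ := ν) (c ^ 2)), integral_const_mul, hψ'0]
      simp
    have h3 := integral_add (i3.const_mul 2) i4
    rw [integral_const_mul, hψ1 ψ, h4, mul_zero, zero_add] at h3
    have h2 := integral_add i1 i2
    have h1 := integral_add (i1.add i2) ((i3.const_mul 2).add i4)
    simp only [Pi.add_apply] at h1
    rw [h2, h3] at h1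
    rw [← h1]
    refine integral_congr_ae (Eventually.of_forall fun x => ?_)
    simp only [ψ']
    ring
  have hVle : V ≤ Fintype.card Q ^ 4 / D := by
    let _ : MeasurableSpace Q := ⊤
    have hQd : DiscreteMeasurableSpace Q := ⟨fun _ => trivial⟩
    have hQn : Nonempty Q := ⟨q fun _ => 1⟩
    let u : (J → G) → Q × G := fun x => (q x, x o)
    have hu : Measurable u := (hq.comp₂ (isCylinder_eval o) Prod.mk).measurable
    let P : Q → G → ℝ := fun a g => (bernoulliMeasure J G).real (u ⁻¹' {(a, g)})
    let T : Q → Q → ℝ := fun a b => ∑ g, ∑ h, P a g * P b h * ψ' (g⁻¹ * h)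
    have hVT : V = ∑ y : Q × Q, Φ y.1 y.2 * T y.1 y.2 := by
      have h1 := integral_comp_prod_finite (μ := bernoulliMeasure J G) (ν := bernoulliMeasure J G)
        hu hu fun a b => Φ a.1 b.1 * ψ' (a.2⁻¹ * b.2)
      rw [hVF, ← hint _ (hF.comp₂ (hcyl ψ') fun a b => a * b)]
      refine h1.trans ?_
      simp only [Fintype.sum_prod_type, T, P, Finset.mul_sum]
      refine Finset.sum_congr rfl fun a _ => ?_
      rw [Finset.sum_comm]
      refine Finset.sum_congr rfl fun b _ => Finset.sum_congr rfl fun g _ =>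
        Finset.sum_congr rfl fun h _ => ?_
      ring
    have hcard : (0 : ℝ) < Fintype.card G := by simp [Fintype.card_pos]
    have hP : ∀ a, ∑ g, P a g ^ 2 ≤ (Fintype.card G : ℝ)⁻¹ := by
      intro a
      have h1 : ∀ g, P a g ≤ (Fintype.card G : ℝ)⁻¹ := by
        intro g
        rw [← bernoulliMeasure_real_eval o g]
        refine measureReal_mono fun x hx => ?_
        have hx' : u x = (a, g) := hx
        exact congrArg Prod.snd hx'
      calc ∑ g, P a g ^ 2 ≤ ∑ _g : G, ((Fintype.card G : ℝ)⁻¹) ^ 2 :=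
            Finset.sum_le_sum fun g _ => pow_le_pow_left₀ measureReal_nonneg (h1 g) 2
        _ = (Fintype.card G : ℝ)⁻¹ := by
            simp only [Finset.sum_const, Finset.card_univ, nsmul_eq_mul]
            field_simp
    have hT : ∀ y : Q × Q, T y.1 y.2 ^ 2 ≤ V / D := by
      intro y
      rw [le_div_iff₀' hD]
      refine (hmix (P y.1) (P y.2) ψ' hψ's).trans ?_
      rw [← hV]
      calc _ ≤ (Fintype.card G * (Fintype.card G * V) : ℝ) *
            ((Fintype.card G : ℝ)⁻¹ * (Fintype.card G : ℝ)⁻¹) := by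
            refine mul_le_mul_of_nonneg_left (mul_le_mul (hP _) (hP _)
              (Finset.sum_nonneg fun g _ => sq_nonneg _) (by positivity)) (by positivity)
        _ = V := by field_simp
    have hV2 : V ^ 2 ≤ (Fintype.card Q : ℝ) ^ 2 * ((Fintype.card Q : ℝ) ^ 2 * (V / D)) := by
      have h1 : ∑ y : Q × Q, Φ y.1 y.2 ^ 2 ≤ (Fintype.card Q : ℝ) ^ 2 := by
        refine (Finset.sum_le_sum fun y _ => (sq_le_one_iff_abs_le_one _).2 (hΦ y.1 y.2)).trans ?_
        simp [sq]
      have h2 : ∑ y : Q × Q, T y.1 y.2 ^ 2 ≤ (Fintype.card Q : ℝ) ^ 2 * (V / D) := by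
        refine (Finset.sum_le_sum fun y _ => hT y).trans ?_
        simp [sq]
      conv_lhs => rw [hVT]
      refine (Finset.sum_mul_sq_le_sq_mul_sq _ _ _).trans ?_
      exact mul_le_mul h1 h2 (Finset.sum_nonneg fun g _ => sq_nonneg _) (by positivity)
    rcases hV0.eq_or_lt with h0 | h0
    · rw [← h0]
      positivity
    · rw [le_div_iff₀ hD]
      have : (Fintype.card Q : ℝ) ^ 2 * ((Fintype.card Q : ℝ) ^ 2 * (V / D)) =
        (Fintype.card Q : ℝ) ^ 4 * V / D := by ring
      rw [this, le_div_iff₀ hD] at hV2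
      exact le_of_mul_le_mul_right (by nlinarith) h0
  have e1 := hint _ (hF.comp fun a => a ^ 2)
  have e2 := hint _ hF
  have e3 : ∀ s, ∫ z, (Φ (q (twist (σ s) (t s) z.1)) (q (twist (σ s) (t s) z.2)) -
      Φ (q z.1) (q z.2)) ^ 2 ∂(bernoulliMeasure J G).prod (bernoulliMeasure J G) =
      ∫ x, (F (twist (σ₂ s) (t₂ s) x) - F x) ^ 2 ∂ν := by
    intro s
    rw [← hint _ ((hF.comp_twist (σ₂ s) (t₂ s)).comp₂ hF fun a b => (a - b) ^ 2)]
    simp only [htw]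
    rfl
  simp only [e3]
  change ∫ z : (J → G) × (J → G), F (Sum.elim z.1 z.2) ^ 2
      ∂(bernoulliMeasure J G).prod (bernoulliMeasure J G) -
    (∫ z : (J → G) × (J → G), F (Sum.elim z.1 z.2)
      ∂(bernoulliMeasure J G).prod (bernoulliMeasure J G)) ^ 2 ≤ _
  rw [e1, e2, hvar]
  linarith

end Square

/-- Measurable maps into a finite set are approximated by functions of finitely many of a
generating family of finite-valued maps. -/
theorem exists_finite_approx {Z I : Type} {E : I → Type} [mZ : MeasurableSpace Z]
    [mE : ∀ i, MeasurableSpace (E i)] [∀ i, Finite (E i)] [∀ i, DiscreteMeasurableSpace (E i)]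
    (π : ∀ i, Z → E i) (hgen : mZ = ⨆ i, (mE i).comap (π i)) (μ : Measure Z)
    [IsProbabilityMeasure μ] {κ : Type} [Fintype κ] [Nonempty κ] [MeasurableSpace κ]
    [DiscreteMeasurableSpace κ] {f : Z → κ} (hf : Measurable f) {ε : ℝ} (hε : 0 < ε) :
    ∃ (K : Finset I) (f' : Z → κ), (∀ z z', (∀ i ∈ K, π i z = π i z') → f' z = f' z') ∧
      μ.real {z | f z ≠ f' z} ≤ ε := by
  classical
  let 𝒜 : Set (Set Z) :=
    {s | ∃ K : Finset I, ∀ z z', (∀ i ∈ K, π i z = π i z') → (z ∈ s ↔ z' ∈ s)}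
  have hπ : ∀ i, Measurable (π i) := fun i => by
    rw [measurable_iff_comap_le]
    conv_rhs => rw [hgen]
    exact le_iSup (fun i => (mE i).comap (π i)) i
  have h𝒜 : IsSetAlgebra 𝒜 := by
    refine ⟨⟨∅, fun z z' _ => Iff.rfl⟩, ?_, ?_⟩
    · rintro s ⟨K, hK⟩
      exact ⟨K, fun z z' h => not_congr (hK z z' h)⟩
    · rintro s t ⟨K, hK⟩ ⟨L, hL⟩
      refine ⟨K ∪ L, fun z z' h => or_congr (hK z z' fun i hi => h i ?_)
        (hL z z' fun i hi => h i ?_)⟩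
      · exact Finset.mem_union_left _ hi
      · exact Finset.mem_union_right _ hi
  have hgen' : mZ = MeasurableSpace.generateFrom 𝒜 := by
    apply le_antisymm
    · conv_lhs => rw [hgen]
      refine iSup_le fun i => ?_
      rintro _ ⟨s, -, rfl⟩
      refine MeasurableSpace.measurableSet_generateFrom ⟨{i}, fun z z' h => ?_⟩
      simp [h i (by simp)]
    · refine MeasurableSpace.generateFrom_le ?_
      rintro s ⟨K, hK⟩
      let R : Z → (∀ i : K, E i) := fun z i => π i z
      have hR : Measurable R := measurable_pi_iff.2 fun i => hπ i
      have : s = R ⁻¹' (R '' s) := by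
        refine (Set.subset_preimage_image _ _).antisymm ?_
        rintro z ⟨z', hz', h⟩
        exact (hK z' z fun i hi => congrFun h ⟨i, hi⟩).1 hz'
      rw [this]
      exact hR (Set.toFinite _).measurableSet
  have hd := Measure.MeasureDense.of_generateFrom_isSetAlgebra_finite μ h𝒜 hgen'
  have hε' : 0 < ε / Fintype.card κ := by positivity
  choose t ht1 ht2 using fun c : κ => hd.approx (f ⁻¹' {c}) (hf (.of_discrete)) (measure_ne_top _ _)
    (ε / Fintype.card κ) hε'
  choose K hK using ht1
  let F : (κ → Prop) → κ := Function.invFun fun c c' => c = c'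
  have hF : ∀ c : κ, F (fun c' => c = c') = c := Function.leftInverse_invFun fun c c' h => by
    have := congrFun h c'
    simpa using this
  refine ⟨Finset.univ.biUnion K, fun z => F fun c => z ∈ t c, fun z z' h => ?_, ?_⟩
  · refine congrArg F (funext fun c => propext (hK c z z' fun i hi => h i ?_))
    exact Finset.mem_biUnion.2 ⟨c, Finset.mem_univ _, hi⟩
  · have hsub : {z | f z ≠ F fun c => z ∈ t c} ⊆ ⋃ c ∈ (Finset.univ : Finset κ),
        symmDiff (f ⁻¹' {c}) (t c) := by
      intro z hz
      by_contra hcon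
      refine hz ?_
      have : (fun c => z ∈ t c) = fun c => f z = c := by
        funext c
        refine propext ?_
        by_contra hne
        refine hcon (Set.mem_iUnion₂.2 ⟨c, Finset.mem_univ _, ?_⟩)
        rw [Set.mem_symmDiff]
        simp only [Set.mem_preimage, Set.mem_singleton_iff]
        tauto
      rw [this, hF]
    refine (measureReal_mono hsub (measure_ne_top _ _)).trans ((measureReal_biUnion_finset_le _ _).trans ?_)
    calc ∑ c : κ, μ.real (symmDiff (f ⁻¹' {c}) (t c)) ≤ ∑ _c : κ, ε / Fintype.card κ := by
          refine Finset.sum_le_sum fun c _ => ?_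
          exact ENNReal.toReal_le_of_le_ofReal hε'.le (ht2 c).le
      _ = ε := by
          simp only [Finset.sum_const, Finset.card_univ, nsmul_eq_mul]
          field_simp

theorem abs_measureReal_sub_le {Z : Type} [MeasurableSpace Z] (μ : Measure Z)
    [IsProbabilityMeasure μ] {s t u : Set Z} (h : symmDiff s t ⊆ u) :
    |μ.real s - μ.real t| ≤ μ.real u := by
  have key : ∀ s t : Set Z, symmDiff s t ⊆ u → μ.real s ≤ μ.real t + μ.real u := by
    intro s t h
    refine le_trans (measureReal_mono fun x hx => ?_) (measureReal_union_le t u)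
    by_cases hxt : x ∈ t
    · exact Or.inl hxt
    · exact Or.inr (h (Or.inl ⟨hx, hxt⟩))
  rw [abs_le]
  have h1 := key s t h
  have h2 := key t s (symmDiff_comm s t ▸ h)
  constructor <;> linarith

theorem PMP.dist_M_le {Γ : Type} [Group Γ] (a : PMP Γ) (S : Finset Γ) {k : ℕ} {f f' : a.X → Fin k}
    (hf : Measurable f) (hf' : Measurable f') {ε : ℝ}
    (h : a.μ.real {x | f x ≠ f' x} ≤ ε) : dist (a.M S k f) (a.M S k f') ≤ 2 * ε := by
  have hε : 0 ≤ ε := measureReal_nonneg.trans h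
  refine (dist_pi_le_iff (by linarith)).2 fun q => ?_
  rw [Real.dist_eq]
  have hm : MeasurableSet {x | f x ≠ f' x} := (measurableSet_eq_fun hf hf').compl
  refine (abs_measureReal_sub_le a.μ (u := {x | f x ≠ f' x} ∪
    a.act q.1 ⁻¹' {x | f x ≠ f' x}) ?_).trans ?_
  · rintro x (⟨⟨h1, h2⟩, h3⟩ | ⟨⟨h1, h2⟩, h3⟩)
    · by_contra hcon
      simp only [Set.mem_union, Set.mem_preimage, Set.mem_ofPred_eq, not_or, not_not, ne_eq] at hcon
      exact h3 ⟨hcon.1 ▸ h1, hcon.2 ▸ h2⟩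
    · by_contra hcon
      simp only [Set.mem_union, Set.mem_preimage, Set.mem_ofPred_eq, not_or, not_not, ne_eq] at hcon
      exact h3 ⟨hcon.1 ▸ h1, hcon.2 ▸ h2⟩
  · refine (measureReal_union_le _ _).trans ?_
    have := (a.preserves q.1).measureReal_preimage hm.nullMeasurableSet
    rw [this]
    linarith

/-- A sequence of fair bits that separates almost every point from its translates. -/
structure PMP.HasFairBits {Γ : Type} [Group Γ] (a : PMP Γ) (g : ℕ → a.X → Fin 2) : Prop where
  measurable : ∀ l, Measurable (g l)
  measure_eq_le : ∀ (k : ℕ) (c : ℕ → Fin 2), a.μ.real {x | ∀ l < k, g l x = c l} ≤ (1 / 2) ^ k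
  measure_act_le : ∀ γ ≠ 1, ∀ k : ℕ,
    a.μ.real {x | ∀ l < k, g l (a.act γ x) = g l x} ≤ (1 / 2) ^ k

theorem measure_eq_zero_of_forall_subset {Z : Type} [MeasurableSpace Z] {μ : Measure Z}
    [IsProbabilityMeasure μ] {s : Set Z} {t : ℕ → Set Z} (h : ∀ k, s ⊆ t k)
    (ht : ∀ k, μ.real (t k) ≤ (1 / 2) ^ k) : μ s = 0 := by
  have h1 : μ.real s ≤ 0 := ge_of_tendsto'
    (tendsto_pow_atTop_nhds_zero_of_lt_one (by norm_num : (0 : ℝ) ≤ 1 / 2) (by norm_num))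
    fun k => (measureReal_mono (h k)).trans (ht k)
  exact (measureReal_eq_zero_iff).1 (le_antisymm h1 measureReal_nonneg)

theorem PMP.HasFairBits.noAtoms {Γ : Type} [Group Γ] {a : PMP Γ} {g : ℕ → a.X → Fin 2}
    (h : a.HasFairBits g) : NullSingletonClass a.μ := by
  refine ⟨fun x => measure_eq_zero_of_forall_subset (t := fun k => {y | ∀ l < k, g l y = g l x})
    ?_ fun k => h.measure_eq_le k fun l => g l x⟩
  rintro k _ rfl l -
  rfl

theorem PMP.HasFairBits.free {Γ : Type} [Group Γ] [Countable Γ] {a : PMP Γ} {g : ℕ → a.X → Fin 2}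
    (h : a.HasFairBits g) : a.Free := by
  have h0 : ∀ γ : Γ, γ ≠ 1 → ∀ᵐ x ∂a.μ, a.act γ x ≠ x := fun γ hγ =>
    measure_eq_zero_of_forall_subset (t := fun k => {x | ∀ l < k, g l (a.act γ x) = g l x})
      (by
        intro k x hx l _
        have hx' : a.act γ x = x := not_not.1 hx
        rw [hx']) fun k => h.measure_act_le γ hγ k
  have h1 : ∀ᵐ x ∂a.μ, ∀ γ : Γ, γ ≠ 1 → a.act γ x ≠ x := by
    refine ae_all_iff.2 fun γ => ?_
    by_cases hγ : γ = 1
    · exact Eventually.of_forall fun x hx => absurd hγ hx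
    · filter_upwards [h0 γ hγ] with x hx _ using hx
  rw [PMP.Free, measure_congr (t := Set.univ) (eventuallyEq_univ.2 h1), measure_univ]

/-- A balanced two-colouring of a finite type. -/
def IsFair {G : Type} [Fintype G] (b : G → Fin 2) : Prop :=
  ∀ c, 2 * (Finset.univ.filter fun g => b g = c).card = Fintype.card G

theorem exists_isFair {G : Type} [Fintype G] (h : Even (Fintype.card G)) :
    ∃ b : G → Fin 2, IsFair b := by
  classical
  obtain ⟨n, hn⟩ := h
  obtain ⟨B, -, hB⟩ := Finset.exists_subset_card_eq (s := (Finset.univ : Finset G)) (n := n)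
    (by rw [Finset.card_univ]; omega)
  refine ⟨fun g => if g ∈ B then 1 else 0, fun c => ?_⟩
  have h1 : (Finset.univ.filter fun g => (if g ∈ B then (1 : Fin 2) else 0) = 1) = B := by
    ext g
    by_cases hg : g ∈ B <;> simp [hg]
  have h0 : (Finset.univ.filter fun g => (if g ∈ B then (1 : Fin 2) else 0) = 0) = Bᶜ := by
    ext g
    by_cases hg : g ∈ B <;> simp [hg]
  have hc := Finset.card_add_card_compl B
  fin_cases c
  · change 2 * (Finset.univ.filter fun g => (if g ∈ B then (1 : Fin 2) else 0) = 0).card = _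
    rw [h0]
    omega
  · change 2 * (Finset.univ.filter fun g => (if g ∈ B then (1 : Fin 2) else 0) = 1).card = _
    rw [h1]
    omega

theorem isCylinder_prod {J G : Type} [Group G] [Fintype G] [MeasurableSpace G]
    [DiscreteMeasurableSpace G] {F : ℕ → (J → G) → ℝ}
    (hF : ∀ l, IsCylinder (F l)) (k : ℕ) : IsCylinder fun x => ∏ l ∈ Finset.range k, F l x := by
  induction k with
  | zero => exact ⟨∅, fun x y _ => by simp⟩
  | succ k ih =>
    simp only [Finset.prod_range_succ]
    exact ih.comp₂ (hF k) fun a b => a * b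

theorem bernoulliMeasure_forall_eq_le {J G : Type} [Group G] [Fintype G] [MeasurableSpace G]
    [DiscreteMeasurableSpace G] [DecidableEq J] {b : G → Fin 2} (hb : IsFair b) {j : ℕ → J}
    (hj : Function.Injective j) {c : ℕ → (J → G) → Fin 2} (hc : ∀ l, IsCylinder (c l))
    (hcj : ∀ l l' x g, c l (Function.update x (j l') g) = c l x) (k : ℕ) :
    (bernoulliMeasure J G).real {x | ∀ l < k, b (x (j l)) = c l x} ≤ (1 / 2) ^ k := by
  let F : ℕ → (J → G) → ℝ := fun l x => if b (x (j l)) = c l x then 1 else 0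
  have hFc : ∀ l, IsCylinder (F l) := fun l =>
    (isCylinder_eval (G := G) (j l)).comp₂ (hc l) fun g a => if b g = a then (1 : ℝ) else 0
  have hG : (0 : ℝ) < Fintype.card G := by simp [Fintype.card_pos]
  have key : ∀ k, ∫ x, ∏ l ∈ Finset.range k, F l x ∂bernoulliMeasure J G = (1 / 2) ^ k := by
    intro k
    induction k with
    | zero => simp
    | succ k ih =>
      have h1 := card_mul_integral (isCylinder_prod hFc (k + 1)) (j k)
      have h2 : ∀ x, ∑ g, ∏ l ∈ Finset.range (k + 1), F l (Function.update x (j k) g) =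
          (∏ l ∈ Finset.range k, F l x) * (Fintype.card G / 2) := by
        intro x
        have h3 : ∀ g, ∏ l ∈ Finset.range (k + 1), F l (Function.update x (j k) g) =
            (∏ l ∈ Finset.range k, F l x) * if b g = c k x then 1 else 0 := by
          intro g
          rw [Finset.prod_range_succ]
          congr 1
          · refine Finset.prod_congr rfl fun l hl => ?_
            have : j l ≠ j k := fun h => (Finset.mem_range.1 hl).ne (hj h)
            simp only [F, hcj, Function.update_of_ne this]
          · simp only [F, hcj, Function.update_self]
        simp only [h3, ← Finset.mul_sum]
        congr 1
        rw [Finset.sum_boole, ← hb (c k x)]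
        push_cast
        ring
      simp only [h2] at h1
      rw [integral_mul_const, ih] at h1
      have h4 : (Fintype.card G : ℝ) * ((∫ x, ∏ l ∈ Finset.range (k + 1), F l x ∂bernoulliMeasure J G) -
        (1 / 2) ^ (k + 1)) = 0 := by
        rw [mul_sub, h1]
        ring
      exact sub_eq_zero.1 ((mul_eq_zero.1 h4).resolve_left hG.ne')
  have hm : MeasurableSet {x | ∀ l < k, b (x (j l)) = c l x} := by
    have : {x | ∀ l < k, b (x (j l)) = c l x} =
        ⋂ l ∈ Finset.range k, {x | b (x (j l)) = c l x} := by
      ext x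
      simp
    rw [this]
    exact Finset.measurableSet_biInter _ fun l _ => measurableSet_eq_fun
      (((isCylinder_eval (G := G) (j l)).comp b).measurable) (hc l).measurable
  refine le_of_eq ?_
  rw [← integral_indicator_one hm, ← key k]
  refine integral_congr_ae (Eventually.of_forall fun x => ?_)
  simp only [F, Finset.prod_ite_zero, Finset.prod_const_one, Finset.mem_range, Set.indicator_apply,
    Set.mem_ofPred_eq, Pi.one_apply]

theorem twistedBernoulli_hasFairBits {Γ J G : Type} [Group Γ] [Group G] [Fintype G]
    [MeasurableSpace G] [DiscreteMeasurableSpace G] (a : Γ →* Equiv.Perm J) (τ : Γ → J → G)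
    (hτ : ∀ γ δ k, τ (γ * δ) k = τ γ (a δ k) * τ δ k) {e : Γ × ℕ → J} (he : Function.Injective e)
    (hae : ∀ γ δ l, a γ (e (δ, l)) = e (γ * δ, l)) (hτe : ∀ γ p, τ γ (e p) = 1) {b : G → Fin 2}
    (hb : IsFair b) :
    (twistedBernoulli a τ hτ).HasFairBits fun l (x : J → G) => b (x (e (1, l))) := by
  classical
  refine ⟨fun l => ((isCylinder_eval (G := G) (e (1, l))).comp b).measurable, fun k c => ?_,
    fun γ hγ k => ?_⟩
  · exact bernoulliMeasure_forall_eq_le hb (j := fun l => e (1, l))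
      (fun l l' h => congrArg Prod.snd (he h)) (c := fun l _ => c l)
      (fun l => ⟨∅, fun _ _ _ => rfl⟩) (fun _ _ _ _ => rfl) k
  · have h1 := bernoulliMeasure_forall_eq_le (G := G) hb (j := fun l => e (1, l))
      (fun l l' h => congrArg Prod.snd (he h)) (c := fun l x => b (x (e (γ⁻¹, l))))
      (fun l => (isCylinder_eval (G := G) (e (γ⁻¹, l))).comp b) (fun l l' x g => by
        rw [Function.update_of_ne]
        intro h
        exact hγ (inv_eq_one.1 (congrArg Prod.fst (he h)))) k
    refine le_trans (measureReal_mono fun (x : J → G) hx => ?_) h1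
    intro l hl
    have h2 : b (twist (a γ) (τ γ) x (e (1, l))) = b (x (e (1, l))) := hx l hl
    have h3 : e (1, l) = a γ (e (γ⁻¹, l)) := by rw [hae, mul_inv_cancel]
    rw [h3, twist_apply_perm, hτe, one_mul, ← h3] at h2
    exact h2.symm

theorem apply_congr_snd {Γ Λ : Type} {κ : Λ → ℕ} (x : ∀ p : Λ × Γ, Fin (κ p.1 + 1)) (l : Λ)
    {γ δ : Γ} (h : γ = δ) : x (l, γ) = x (l, δ) := by
  subst h
  rfl

/-- Right translation of the group coordinate on a product over `Λ × Γ`. -/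
def shift {Γ Λ : Type} [Group Γ] {κ : Λ → ℕ} (γ : Γ) (x : ∀ p : Λ × Γ, Fin (κ p.1 + 1)) :
    ∀ p : Λ × Γ, Fin (κ p.1 + 1) := fun p => x (p.1, p.2 * γ)

theorem continuous_shift {Γ Λ : Type} [Group Γ] {κ : Λ → ℕ} (γ : Γ) :
    Continuous (shift (Λ := Λ) (κ := κ) γ) :=
  continuous_pi fun p => continuous_apply (p.1, p.2 * γ)

/-- Limit along an ultrafilter of p.m.p. actions with a countable family of labellings. -/
theorem PMP.exists_ultralimit {Γ : Type} [Group Γ] [Countable Γ] (𝒰 : Ultrafilter ℕ)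
    (A : ℕ → PMP Γ) {Λ : Type} [Countable Λ] (κ : Λ → ℕ)
    (f : ∀ n l, (A n).X → Fin (κ l + 1)) (hf : ∀ n l, Measurable (f n l)) :
    ∃ (α : PMP Γ) (ξ : ∀ l, α.X → Fin (κ l + 1)), StandardBorelSpace α.X ∧
      (∀ l, Measurable (ξ l)) ∧
      α.mX = ⨆ p : Λ × Γ, MeasurableSpace.comap (fun x => ξ p.1 (α.act p.2 x)) inferInstance ∧
      ∀ (K : Finset (Λ × Γ)) (B : Set (∀ p : K, Fin (κ p.1.1 + 1))),
        Tendsto (fun n => (A n).μ.real {x | (fun p : K => f n p.1.1 ((A n).act p.1.2 x)) ∈ B})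
          𝒰 (𝓝 (α.μ.real {x | (fun p : K => ξ p.1.1 (α.act p.1.2 x)) ∈ B})) := by
  let Ξ : Type := ∀ p : Λ × Γ, Fin (κ p.1 + 1)
  let Φ : ∀ n, (A n).X → Ξ := fun n x p => f n p.1 ((A n).act p.2 x)
  have hΦ : ∀ n, Measurable (Φ n) := fun n =>
    measurable_pi_iff.2 fun p => (hf n p.1).comp ((A n).preserves p.2).measurable
  have hshift : ∀ n γ x, shift γ (Φ n x) = Φ n ((A n).act γ x) := by
    intro n γ x
    funext p
    simp only [shift, Φ, PMP.mul_act]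
  let M : ∀ n, ProbabilityMeasure (A n).X := fun n => ⟨(A n).μ, (A n).prob⟩
  let N : ℕ → ProbabilityMeasure Ξ := fun n => (M n).map (hΦ n).aemeasurable
  obtain ⟨ν, -, hν⟩ := (isCompact_univ (X := ProbabilityMeasure Ξ)).ultrafilter_le_nhds
    (𝒰.map N) (by simp)
  have hN : Tendsto N 𝒰 (𝓝 ν) := hν
  have hms : ∀ γ : Γ, Measurable (shift (Λ := Λ) (κ := κ) γ) := fun γ =>
    (continuous_shift γ).measurable
  have hinv : ∀ γ : Γ, ν.map (hms γ).aemeasurable = ν := by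
    intro γ
    have h1 := ProbabilityMeasure.tendsto_map_of_tendsto_of_continuous N ν hN
      (continuous_shift (Λ := Λ) (κ := κ) γ)
    have h2 : ∀ n, (N n).map (hms γ).aemeasurable = N n := by
      intro n
      apply Subtype.ext
      change Measure.map (shift γ) (Measure.map (Φ n) (A n).μ) = Measure.map (Φ n) (A n).μ
      rw [Measure.map_map (hms γ) (hΦ n)]
      have : shift γ ∘ Φ n = Φ n ∘ (A n).act γ := funext fun x => hshift n γ x
      rw [this, ← Measure.map_map (hΦ n) ((A n).preserves γ).measurable, ((A n).preserves γ).map_eq]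
    exact tendsto_nhds_unique h1 (hN.congr fun n => (h2 n).symm)
  let α : PMP Γ :=
    { X := Ξ
      μ := ν
      act := shift
      one_act := fun x => funext fun p => apply_congr_snd x p.1 (mul_one p.2)
      mul_act := fun γ δ x => funext fun p => apply_congr_snd x p.1 (mul_assoc p.2 γ δ).symm
      preserves := fun γ => ⟨hms γ, congrArg Subtype.val (hinv γ)⟩ }
  have hα : ∀ (p : Λ × Γ) (x : Ξ), shift p.2 x (p.1, 1) = x p := fun p x =>
    apply_congr_snd x p.1 (one_mul p.2)
  refine ⟨α, fun l (x : Ξ) => x (l, 1), ?_, ?_, ?_, ?_⟩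
  · change StandardBorelSpace Ξ
    infer_instance
  · intro l
    exact measurable_pi_apply (l, 1)
  · change MeasurableSpace.pi = ⨆ p : Λ × Γ, MeasurableSpace.comap
      (fun x : Ξ => shift p.2 x (p.1, 1)) inferInstance
    simp only [hα]
    rfl
  · intro K B
    let R : Ξ → (∀ p : K, Fin (κ p.1.1 + 1)) := fun x p => x p
    have hR : Continuous R := continuous_pi fun p => continuous_apply _
    have hclopen : IsClopen (R ⁻¹' B) := (isClopen_discrete B).preimage hR
    have h1 := ProbabilityMeasure.tendsto_measure_of_null_frontier_of_tendsto hN (E := R ⁻¹' B)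
      (by rw [hclopen.frontier_eq]; simp)
    have h2 := (NNReal.tendsto_coe.2 h1)
    have h3 : {x : α.X | (fun p : K => (shift p.1.2 (x : Ξ)) (p.1.1, 1)) ∈ B} = R ⁻¹' B := by
      ext x
      have : (fun p : K => (shift p.1.2 (x : Ξ)) (p.1.1, 1)) = R x := funext fun p => hα p.1 x
      exact iff_of_eq (congrArg (· ∈ B) this)
    refine (h2.congr fun n => ?_).trans (le_of_eq (congrArg 𝓝 ?_))
    · change (Measure.map (Φ n) (A n).μ).real (R ⁻¹' B) = _
      rw [map_measureReal_apply (hΦ n) hclopen.1.measurableSet]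
      rfl
    · change (ν : Measure Ξ).real (R ⁻¹' B) = (ν : Measure Ξ).real _
      exact congrArg _ h3.symm

theorem tendsto_hausdorffDist_of_approx {V : Type} [MetricSpace V] {Z : Set V} (hZ : IsCompact Z)
    {𝓕 : Filter ℕ} (h𝓕 : 𝓕 ≤ atTop) {C : ℕ → Set V} {D : Set V} (hCZ : ∀ n, C n ⊆ Z) (hDZ : D ⊆ Z)
    {q : ℕ → V} (hq : DenseRange q) {w : ℕ → ℕ → V}
    (hw : ∀ n l, dist (w n l) (q l) < Metric.infDist (q l) (C n) + 1 / (n + 1)) {v : ℕ → V}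
    (hv : ∀ l, v l ∈ D) (hwv : ∀ l, Tendsto (fun n => w n l) 𝓕 (𝓝 (v l)))
    (hup : ∀ d ∈ D, ∀ ε > 0, ∀ᶠ n in 𝓕, Metric.infDist d (C n) < ε) :
    Tendsto (fun n => Metric.hausdorffDist (C n) D) 𝓕 (𝓝 0) := by
  refine Metric.tendsto_nhds.2 fun ε hε => ?_
  have hδ : 0 < ε / 5 := by positivity
  set δ := ε / 5 with hδε
  obtain ⟨L, hL⟩ := hZ.elim_finite_subcover (fun l => Metric.ball (q l) δ)
    (fun l => Metric.isOpen_ball) fun z _ => by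
      obtain ⟨l, hl⟩ := hq.exists_dist_lt z hδ
      exact Set.mem_iUnion.2 ⟨l, hl⟩
  obtain ⟨T, hTD, hTf, hT⟩ := Metric.finite_approx_of_totallyBounded
    (hZ.totallyBounded.subset hDZ) δ hδ
  have h1 : ∀ᶠ n in 𝓕, ∀ d ∈ T, Metric.infDist d (C n) < δ :=
    (eventually_all_finite hTf).2 fun d hd => hup d (hTD hd) δ hδ
  have h2 : ∀ᶠ n in 𝓕, ∀ l ∈ L, dist (w n l) (v l) < δ :=
    (eventually_all_finset L).2 fun l _ => Metric.tendsto_nhds.1 (hwv l) δ hδ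
  have h3 : ∀ᶠ n : ℕ in 𝓕, (1 : ℝ) / (n + 1) < δ := by
    have := (tendsto_one_div_add_atTop_nhds_zero_nat (𝕜 := ℝ)).mono_left h𝓕
    exact this.eventually (gt_mem_nhds hδ)
  filter_upwards [h1, h2, h3] with n h1 h2 h3
  rw [Real.dist_eq, sub_zero, abs_of_nonneg Metric.hausdorffDist_nonneg]
  refine lt_of_le_of_lt (b := 4 * δ) (Metric.hausdorffDist_le_of_infDist (by positivity) ?_ ?_)
    (by linarith)
  · intro x hx
    obtain ⟨l, hl, hxl⟩ := Set.mem_iUnion₂.1 (hL (hCZ n hx))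
    have h4 : dist x (q l) < δ := hxl
    have h5 := hw n l
    have h6 : Metric.infDist (q l) (C n) ≤ dist (q l) x := Metric.infDist_le_dist_of_mem hx
    have h7 := h2 l hl
    refine (Metric.infDist_le_dist_of_mem (hv l)).trans ?_
    have h8 := dist_triangle4 x (q l) (w n l) (v l)
    rw [dist_comm (q l) (w n l)] at h8
    rw [dist_comm (q l) x] at h6
    linarith
  · intro d hd
    obtain ⟨t, ht, hdt⟩ := Set.mem_iUnion₂.1 (hT hd)
    have h4 : dist d t < δ := hdt
    have h5 := Metric.infDist_le_infDist_add_dist (s := C n) (x := d) (y := t)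
    have := h1 t ht
    linarith

section Pattern
set_option linter.unusedSectionVars false

variable {Γ Λ : Type} [Group Γ] {κ : Λ → ℕ}

/-- The joint labels of the translates of a point. -/
def PMP.pattern (a : PMP Γ) (f : ∀ l, a.X → Fin (κ l + 1)) (K : Finset (Λ × Γ)) (x : a.X) :
    ∀ p : K, Fin (κ p.1.1 + 1) := fun p => f p.1.1 (a.act p.1.2 x)

theorem PMP.measurable_pattern (a : PMP Γ) {f : ∀ l, a.X → Fin (κ l + 1)}
    (hf : ∀ l, Measurable (f l)) (K : Finset (Λ × Γ)) : Measurable (a.pattern f K) :=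
  measurable_pi_iff.2 fun p => (hf p.1.1).comp (a.preserves p.1.2).measurable

/-- Convergence of the joint laws of all patterns along an ultrafilter. -/
def PatternsConverge (𝒰 : Ultrafilter ℕ) (A : ℕ → PMP Γ) (f : ∀ n l, (A n).X → Fin (κ l + 1))
    (α : PMP Γ) (ξ : ∀ l, α.X → Fin (κ l + 1)) : Prop :=
  ∀ (K : Finset (Λ × Γ)) (B : Set (∀ p : K, Fin (κ p.1.1 + 1))),
    Tendsto (fun n => (A n).μ.real {x | (A n).pattern (f n) K x ∈ B}) 𝒰
      (𝓝 (α.μ.real {x | α.pattern ξ K x ∈ B}))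

theorem exists_pattern_act (K : Finset (Λ × Γ)) (γ : Γ) : ∃ (K' : Finset (Λ × Γ))
    (T : (∀ p : K', Fin (κ p.1.1 + 1)) →
      (∀ p : K, Fin (κ p.1.1 + 1)) × (∀ p : K, Fin (κ p.1.1 + 1))),
    ∀ (a : PMP Γ) (f : ∀ l, a.X → Fin (κ l + 1)) (x : a.X),
      T (a.pattern f K' x) = (a.pattern f K x, a.pattern f K (a.act γ x)) := by
  classical
  let K' := K ∪ K.image fun p => (p.1, p.2 * γ)
  have h1 : ∀ p : K, (p.1.1, p.1.2) ∈ K' := fun p => Finset.mem_union_left _ p.2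
  have h2 : ∀ p : K, (p.1.1, p.1.2 * γ) ∈ K' := fun p =>
    Finset.mem_union_right _ (Finset.mem_image.2 ⟨p.1, p.2, rfl⟩)
  refine ⟨K', fun y => (fun p => y ⟨_, h1 p⟩, fun p => y ⟨_, h2 p⟩), fun a f x => ?_⟩
  refine Prod.ext rfl (funext fun p => ?_)
  simp only [PMP.pattern, PMP.mul_act]

variable {𝒰 : Ultrafilter ℕ} {A : ℕ → PMP Γ} {f : ∀ n l, (A n).X → Fin (κ l + 1)} {α : PMP Γ}
  {ξ : ∀ l, α.X → Fin (κ l + 1)}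

theorem PatternsConverge.tendsto_pair (h : PatternsConverge 𝒰 A f α ξ) (K : Finset (Λ × Γ)) (γ : Γ)
    (P : (∀ p : K, Fin (κ p.1.1 + 1)) → (∀ p : K, Fin (κ p.1.1 + 1)) → Prop) :
    Tendsto (fun n => (A n).μ.real {x | P ((A n).pattern (f n) K x)
      ((A n).pattern (f n) K ((A n).act γ x))}) 𝒰
      (𝓝 (α.μ.real {x | P (α.pattern ξ K x) (α.pattern ξ K (α.act γ x))})) := by
  obtain ⟨K', T, hT⟩ := exists_pattern_act (κ := κ) K γ
  have := h K' {y | P (T y).1 (T y).2}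
  simpa only [Set.mem_ofPred_eq, hT] using this

theorem PatternsConverge.tendsto_M (h : PatternsConverge 𝒰 A f α ξ) (S : Finset Γ) {k : ℕ}
    (K : Finset (Λ × Γ)) (F : (∀ p : K, Fin (κ p.1.1 + 1)) → Fin k) :
    Tendsto (fun n => (A n).M S k fun x => F ((A n).pattern (f n) K x)) 𝒰
      (𝓝 (α.M S k fun x => F (α.pattern ξ K x))) :=
  tendsto_pi_nhds.2 fun q => h.tendsto_pair K q.1 fun y z => F y = q.2.1 ∧ F z = q.2.2

theorem PatternsConverge.tendsto_M_label (h : PatternsConverge 𝒰 A f α ξ) (S : Finset Γ) (l : Λ) :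
    Tendsto (fun n => (A n).M S (κ l + 1) (f n l)) 𝒰 (𝓝 (α.M S (κ l + 1) (ξ l))) := by
  have := h.tendsto_M S {(l, 1)} fun y => y ⟨(l, 1), Finset.mem_singleton_self _⟩
  simpa only [PMP.pattern, PMP.one_act] using this

theorem PMP.C_subset_Icc (a : PMP Γ) (S : Finset Γ) (k : ℕ) : a.C S k ⊆ Set.Icc 0 1 := by
  refine closure_minimal ?_ isClosed_Icc
  rintro _ ⟨f, -, rfl⟩
  exact ⟨fun q => ENNReal.toReal_nonneg, fun q => measureReal_le_one⟩

theorem PatternsConverge.tendsto_hausdorffDist (h : PatternsConverge 𝒰 A f α ξ)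
    (h𝒰 : (𝒰 : Filter ℕ) ≤ atTop) (hf : ∀ n l, Measurable (f n l)) (hξ : ∀ l, Measurable (ξ l))
    (hgen : α.mX = ⨆ p : Λ × Γ, MeasurableSpace.comap (fun x => ξ p.1 (α.act p.2 x)) inferInstance)
    (S : Finset Γ) {k : ℕ} (hk : 0 < k) {q : ℕ → ↥S × Fin k × Fin k → ℝ} (hq : DenseRange q)
    {w : ∀ n, ℕ → (A n).X → Fin k} {v : ℕ → α.X → Fin k} (hv : ∀ l, Measurable (v l))
    (hw : ∀ n l, dist ((A n).M S k (w n l)) (q l) <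
      Metric.infDist (q l) ((A n).C S k) + 1 / (n + 1))
    (hwv : ∀ l, Tendsto (fun n => (A n).M S k (w n l)) 𝒰 (𝓝 (α.M S k (v l)))) :
    Tendsto (fun n => Metric.hausdorffDist ((A n).C S k) (α.C S k)) 𝒰 (𝓝 0) := by
  refine tendsto_hausdorffDist_of_approx (isCompact_Icc (a := 0) (b := 1)) h𝒰
    (fun n => (A n).C_subset_Icc S k) (α.C_subset_Icc S k) hq hw
    (fun l => subset_closure ⟨v l, hv l, rfl⟩) hwv fun d hd ε hε => ?_
  have hδ : 0 < ε / 4 := by positivity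
  obtain ⟨_, ⟨g, hg, rfl⟩, hdg⟩ := Metric.mem_closure_iff.1 hd (ε / 4) hδ
  have hkn : Nonempty (Fin k) := ⟨⟨0, hk⟩⟩
  obtain ⟨K, g', hg', hgg'⟩ := exists_finite_approx (fun (p : Λ × Γ) x => ξ p.1 (α.act p.2 x)) hgen
    α.μ hg hδ
  have hg'F : ∃ F : (∀ p : K, Fin (κ p.1.1 + 1)) → Fin k, g' = fun x => F (α.pattern ξ K x) := by
    refine ⟨Function.extend (α.pattern ξ K) g' fun _ => ⟨0, hk⟩, funext fun x => ?_⟩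
    refine (Function.FactorsThrough.extend_apply (fun x y hxy => hg' x y fun i hi => ?_) _ x).symm
    exact congrFun hxy ⟨i, hi⟩
  obtain ⟨F, rfl⟩ := hg'F
  have hFm : Measurable fun x => F (α.pattern ξ K x) :=
    (measurable_of_countable F).comp (α.measurable_pattern hξ K)
  have h1 := α.dist_M_le S hg hFm hgg'
  filter_upwards [Metric.tendsto_nhds.1 (h.tendsto_M S K F) (ε / 4) hδ] with n hn
  have h2 : (A n).M S k (fun x => F ((A n).pattern (f n) K x)) ∈ (A n).C S k :=
    subset_closure ⟨_, (measurable_of_countable F).comp ((A n).measurable_pattern (hf n) K), rfl⟩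
  refine (Metric.infDist_le_dist_of_mem h2).trans_lt ?_
  have h3 := dist_triangle4 d (α.M S k g) (α.M S k fun x => F (α.pattern ξ K x))
    ((A n).M S k (fun x => F ((A n).pattern (f n) K x)))
  rw [dist_comm] at hn
  linarith

theorem PatternsConverge.hasFairBits (h : PatternsConverge 𝒰 A f α ξ) (hξ : ∀ l, Measurable (ξ l))
    {ι : ℕ → Λ} {g : ∀ n, ℕ → (A n).X → Fin 2} {g' : ℕ → α.X → Fin 2}
    (hg : ∀ n, (A n).HasFairBits (g n)) (b : ∀ l, Fin (κ (ι l) + 1) → Fin 2)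
    (hgf : ∀ n l x, g n l x = b l (f n (ι l) x)) (hg' : ∀ l x, g' l x = b l (ξ (ι l) x)) :
    α.HasFairBits g' := by
  classical
  have hK : ∀ k (l : ℕ), l < k → (ι l, (1 : Γ)) ∈ (Finset.range k).image fun l => (ι l, (1 : Γ)) :=
    fun k l hl => Finset.mem_image.2 ⟨l, Finset.mem_range.2 hl, rfl⟩
  refine ⟨fun l => ?_, fun k c => ?_, fun γ hγ k => ?_⟩
  · rw [funext (hg' l)]
    exact (measurable_of_countable (b l)).comp (hξ _)
  · have h1 := h _ {y | ∀ l (hl : l < k), b l (y ⟨_, hK k l hl⟩) = c l}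
    simp only [Set.mem_ofPred_eq, PMP.pattern, PMP.one_act, ← hgf, ← hg'] at h1
    exact le_of_tendsto' h1 fun n => (hg n).measure_eq_le k c
  · have h1 := h.tendsto_pair _ γ fun y z =>
      ∀ l (hl : l < k), b l (z ⟨_, hK k l hl⟩) = b l (y ⟨_, hK k l hl⟩)
    simp only [PMP.pattern, PMP.one_act, ← hgf, ← hg'] at h1
    exact le_of_tendsto' h1 fun n => (hg n).measure_act_le γ hγ k

end Pattern

/-- The vector of an invariant balanced two-colouring. -/
noncomputable def balancedVector {Γ : Type} (S : Finset Γ) : ↥S × Fin 2 × Fin 2 → ℝ :=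
  fun q => if q.2.1 = q.2.2 then 1 / 2 else 0

section Limit
set_option linter.unusedSectionVars false

variable {Γ Λ : Type} [Group Γ] {κ : Λ → ℕ}
variable {𝒰 : Ultrafilter ℕ} {A : ℕ → PMP Γ} {f : ∀ n l, (A n).X → Fin (κ l + 1)} {α : PMP Γ}
  {ξ : ∀ l, α.X → Fin (κ l + 1)}

theorem PatternsConverge.tendsto_integral_prod (h : PatternsConverge 𝒰 A f α ξ)
    (hf : ∀ n l, Measurable (f n l)) (hξ : ∀ l, Measurable (ξ l)) (K : Finset (Λ × Γ)) (γ : Γ)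
    (θ : (∀ p : K, Fin (κ p.1.1 + 1)) × (∀ p : K, Fin (κ p.1.1 + 1)) →
      (∀ p : K, Fin (κ p.1.1 + 1)) × (∀ p : K, Fin (κ p.1.1 + 1)) → ℝ) :
    Tendsto (fun n => ∫ z, θ ((A n).pattern (f n) K z.1, (A n).pattern (f n) K ((A n).act γ z.1))
        ((A n).pattern (f n) K z.2, (A n).pattern (f n) K ((A n).act γ z.2)) ∂(A n).μ.prod (A n).μ) 𝒰
      (𝓝 (∫ z, θ (α.pattern ξ K z.1, α.pattern ξ K (α.act γ z.1))
        (α.pattern ξ K z.2, α.pattern ξ K (α.act γ z.2)) ∂α.μ.prod α.μ)) := by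
  classical
  have hm : ∀ (a : PMP Γ) (g : ∀ l, a.X → Fin (κ l + 1)) (_ : ∀ l, Measurable (g l)),
      Measurable fun x => (a.pattern g K x, a.pattern g K (a.act γ x)) := fun a g hg =>
    (a.measurable_pattern hg K).prodMk
      ((a.measurable_pattern hg K).comp (a.preserves γ).measurable)
  have h1 : ∀ q, Tendsto (fun n => (A n).μ.real ((fun x => ((A n).pattern (f n) K x,
      (A n).pattern (f n) K ((A n).act γ x))) ⁻¹' {q})) 𝒰 (𝓝 (α.μ.real ((fun x =>
      (α.pattern ξ K x, α.pattern ξ K (α.act γ x))) ⁻¹' {q}))) := fun q =>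
    h.tendsto_pair K γ fun y z => (y, z) = q
  rw [integral_comp_prod_finite (hm α ξ hξ) (hm α ξ hξ) θ]
  refine Tendsto.congr (fun n => (integral_comp_prod_finite (hm _ _ (hf n)) (hm _ _ (hf n)) θ).symm) ?_
  exact tendsto_finsetSum _ fun q _ => tendsto_finsetSum _ fun q' _ =>
    ((h1 q).mul (h1 q')).mul_const _

theorem PatternsConverge.variance_le (h : PatternsConverge 𝒰 A f α ξ)
    (hf : ∀ n l, Measurable (f n l)) (hξ : ∀ l, Measurable (ξ l)) {I : Type} [Fintype I] (ℓ : I → Γ)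
    (c : ℝ) {D : ℕ → ℝ} (hD : Tendsto D 𝒰 atTop) (K : Finset (Λ × Γ))
    (Φ : (∀ p : K, Fin (κ p.1.1 + 1)) → (∀ p : K, Fin (κ p.1.1 + 1)) → ℝ) {E : ℝ}
    (hvar : ∀ n, ∫ z, Φ ((A n).pattern (f n) K z.1) ((A n).pattern (f n) K z.2) ^ 2
          ∂(A n).μ.prod (A n).μ -
        (∫ z, Φ ((A n).pattern (f n) K z.1) ((A n).pattern (f n) K z.2) ∂(A n).μ.prod (A n).μ) ^ 2 ≤
      c * ∑ s, ∫ z, (Φ ((A n).pattern (f n) K ((A n).act (ℓ s) z.1))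
          ((A n).pattern (f n) K ((A n).act (ℓ s) z.2)) -
        Φ ((A n).pattern (f n) K z.1) ((A n).pattern (f n) K z.2)) ^ 2 ∂(A n).μ.prod (A n).μ +
      E / D n) :
    ∫ z, Φ (α.pattern ξ K z.1) (α.pattern ξ K z.2) ^ 2 ∂α.μ.prod α.μ -
        (∫ z, Φ (α.pattern ξ K z.1) (α.pattern ξ K z.2) ∂α.μ.prod α.μ) ^ 2 ≤
      c * ∑ s, ∫ z, (Φ (α.pattern ξ K (α.act (ℓ s) z.1)) (α.pattern ξ K (α.act (ℓ s) z.2)) -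
        Φ (α.pattern ξ K z.1) (α.pattern ξ K z.2)) ^ 2 ∂α.μ.prod α.μ := by
  have t1 := h.tendsto_integral_prod hf hξ K 1 fun a b => Φ a.1 b.1 ^ 2
  have t2 := h.tendsto_integral_prod hf hξ K 1 fun a b => Φ a.1 b.1
  have t3 := fun s => h.tendsto_integral_prod hf hξ K (ℓ s) fun a b =>
    (Φ a.2 b.2 - Φ a.1 b.1) ^ 2
  have t4 := ((tendsto_finsetSum Finset.univ fun s _ => t3 s).const_mul c).add
    ((tendsto_const_nhds (x := E)).div_atTop hD)
  rw [add_zero] at t4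
  exact le_of_tendsto_of_tendsto' (t1.sub (t2.pow 2)) t4 hvar

theorem exists_factor_pattern_prod
    (hgen : α.mX = ⨆ p : Λ × Γ, MeasurableSpace.comap (fun x => ξ p.1 (α.act p.2 x)) inferInstance)
    {F : α.X × α.X → Fin 2} (hF : Measurable F) {ε : ℝ} (hε : 0 < ε) :
    ∃ (K : Finset (Λ × Γ)) (Θ : (∀ p : K, Fin (κ p.1.1 + 1)) → (∀ p : K, Fin (κ p.1.1 + 1)) → Fin 2),
      (α.μ.prod α.μ).real {z | F z ≠ Θ (α.pattern ξ K z.1) (α.pattern ξ K z.2)} ≤ ε := by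
  let π : ∀ p : Λ × Γ, α.X × α.X → Fin (κ p.1 + 1) × Fin (κ p.1 + 1) :=
    fun p z => (ξ p.1 (α.act p.2 z.1), ξ p.1 (α.act p.2 z.2))
  have hgen2 : (Prod.instMeasurableSpace : MeasurableSpace (α.X × α.X)) =
      ⨆ p, MeasurableSpace.comap (π p) inferInstance := by
    have h1 : ∀ p, MeasurableSpace.comap (π p) inferInstance =
        MeasurableSpace.comap Prod.fst
          (MeasurableSpace.comap (fun x => ξ p.1 (α.act p.2 x)) inferInstance) ⊔
        MeasurableSpace.comap Prod.snd
          (MeasurableSpace.comap (fun x => ξ p.1 (α.act p.2 x)) inferInstance) := by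
      intro p
      simp only [Prod.instMeasurableSpace, MeasurableSpace.prod, MeasurableSpace.comap_sup,
        MeasurableSpace.comap_comp]
      rfl
    simp only [h1, iSup_sup_eq, ← MeasurableSpace.comap_iSup]
    rw [← hgen]
    rfl
  obtain ⟨K, g, hg, hFg⟩ := exists_finite_approx π hgen2 (α.μ.prod α.μ) hF hε
  let R : α.X × α.X → (∀ p : K, Fin (κ p.1.1 + 1)) × (∀ p : K, Fin (κ p.1.1 + 1)) :=
    fun z => (α.pattern ξ K z.1, α.pattern ξ K z.2)
  have h2 : ∀ z, Function.extend R g (fun _ => 0) (R z) = g z := fun z =>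
    Function.FactorsThrough.extend_apply (fun x y hxy => hg x y fun i hi => Prod.ext
      (congrFun (congrArg Prod.fst hxy) ⟨i, hi⟩) (congrFun (congrArg Prod.snd hxy) ⟨i, hi⟩)) _ z
  refine ⟨K, fun y z => Function.extend R g (fun _ => 0) (y, z), ?_⟩
  refine le_trans (le_of_eq ?_) hFg
  congr 1
  ext z
  exact not_congr (iff_of_eq (congrArg (F z = ·) (h2 z)))

theorem balancedVector_notMem (hξ : ∀ l, Measurable (ξ l))
    (hgen : α.mX = ⨆ p : Λ × Γ, MeasurableSpace.comap (fun x => ξ p.1 (α.act p.2 x)) inferInstance)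
    {I : Type} [Fintype I] [Nonempty I] (ℓ : I → Γ) {c : ℝ} (hc : 0 ≤ c) {S : Finset Γ}
    (hS : ∀ s, ℓ s ∈ S)
    (hvar : ∀ (K : Finset (Λ × Γ))
      (Φ : (∀ p : K, Fin (κ p.1.1 + 1)) → (∀ p : K, Fin (κ p.1.1 + 1)) → ℝ),
      (∀ y z, |Φ y z| ≤ 1) →
      ∫ z, Φ (α.pattern ξ K z.1) (α.pattern ξ K z.2) ^ 2 ∂α.μ.prod α.μ -
        (∫ z, Φ (α.pattern ξ K z.1) (α.pattern ξ K z.2) ∂α.μ.prod α.μ) ^ 2 ≤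
      c * ∑ s, ∫ z, (Φ (α.pattern ξ K (α.act (ℓ s) z.1)) (α.pattern ξ K (α.act (ℓ s) z.2)) -
        Φ (α.pattern ξ K z.1) (α.pattern ξ K z.2)) ^ 2 ∂α.μ.prod α.μ) :
    balancedVector S ∉ (α.prod α).C S 2 := by
  intro hmem
  set c' := c * Fintype.card I with hc'
  have hc'0 : 0 ≤ c' := by positivity
  set η : ℝ := 1 / (16 * (c' + 1)) with hη
  have hη0 : 0 < η := by positivity
  obtain ⟨_, ⟨F, hF, rfl⟩, hdF⟩ := Metric.mem_closure_iff.1 hmem (η / 4) (by positivity)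
  have hF' : Measurable (fun z : α.X × α.X => F z) := hF
  obtain ⟨K, Θ, hΘ⟩ := exists_factor_pattern_prod hgen hF' (by positivity : 0 < η / 4)
  let H : α.X × α.X → Fin 2 := fun z => Θ (α.pattern ξ K z.1) (α.pattern ξ K z.2)
  have hH : Measurable H := by
    have h1 : Measurable fun z : α.X × α.X => (α.pattern ξ K z.1, α.pattern ξ K z.2) :=
      (α.measurable_pattern hξ K).prodMap (α.measurable_pattern hξ K)
    exact (measurable_of_countable fun y => Θ y.1 y.2).comp h1
  have hd : dist (balancedVector S) ((α.prod α).M S 2 H) < η := by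
    have h1 := (α.prod α).dist_M_le S hF hH hΘ
    have h2 := dist_triangle (balancedVector S) ((α.prod α).M S 2 F) ((α.prod α).M S 2 H)
    linarith
  have hq : ∀ q, |balancedVector S q - (α.prod α).M S 2 H q| < η := fun q =>
    (dist_le_pi_dist (balancedVector S) ((α.prod α).M S 2 H) q).trans_lt hd
  have hMreal : ∀ (s : I) i j, (α.prod α).M S 2 H (⟨ℓ s, hS s⟩, i, j) = (α.μ.prod α.μ).real
      {z | H z = i ∧ H (α.act (ℓ s) z.1, α.act (ℓ s) z.2) = j} := fun s i j => rfl
  have hHs : ∀ s, Measurable fun z : α.X × α.X => H (α.act (ℓ s) z.1, α.act (ℓ s) z.2) := fun s =>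
    hH.comp ((α.preserves (ℓ s)).measurable.prodMap (α.preserves (ℓ s)).measurable)
  have hms : ∀ s i j, MeasurableSet {z : α.X × α.X | H z = i ∧
      H (α.act (ℓ s) z.1, α.act (ℓ s) z.2) = j} := fun s i j =>
    (hH (.of_discrete (s := {i}))).inter (hHs s (.of_discrete (s := {j})))
  have hsum : ∀ s i i' j j', (i, j) ≠ (i', j') → (α.μ.prod α.μ).real ({z | H z = i ∧
      H (α.act (ℓ s) z.1, α.act (ℓ s) z.2) = j} ∪ {z | H z = i' ∧
      H (α.act (ℓ s) z.1, α.act (ℓ s) z.2) = j'}) = (α.prod α).M S 2 H (⟨ℓ s, hS s⟩, i, j) +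
      (α.prod α).M S 2 H (⟨ℓ s, hS s⟩, i', j') := by
    intro s i i' j j' hne
    rw [hMreal, hMreal]
    refine measureReal_union (Set.disjoint_left.2 ?_) (hms _ _ _)
    rintro z ⟨h1, h2⟩ ⟨h3, h4⟩
    exact hne (Prod.ext (h1.symm.trans h3) (h2.symm.trans h4))
  let Φ : (∀ p : K, Fin (κ p.1.1 + 1)) → (∀ p : K, Fin (κ p.1.1 + 1)) → ℝ := fun y z =>
    ((Θ y z : ℕ) : ℝ)
  have h01 : ∀ i : Fin 2, ((i : ℕ) : ℝ) ^ 2 = ((i : ℕ) : ℝ) ∧ |((i : ℕ) : ℝ)| ≤ 1 := by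
    intro i
    fin_cases i <;> simp
  have hv := hvar K Φ fun y z => (h01 _).2
  have e1 : ∀ z : α.X × α.X, Φ (α.pattern ξ K z.1) (α.pattern ξ K z.2) ^ 2 =
      Φ (α.pattern ξ K z.1) (α.pattern ξ K z.2) := fun z => (h01 _).1
  have hm : ∀ s, ∫ z, Φ (α.pattern ξ K z.1) (α.pattern ξ K z.2) ∂α.μ.prod α.μ =
      (α.prod α).M S 2 H (⟨ℓ s, hS s⟩, 1, 0) + (α.prod α).M S 2 H (⟨ℓ s, hS s⟩, 1, 1) := by
    intro s
    rw [← hsum s 1 1 0 1 (by simp), ← integral_indicator_one ((hms _ _ _).union (hms _ _ _))]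
    refine integral_congr_ae (Eventually.of_forall fun z => ?_)
    have h1 : ∀ i j : Fin 2, ((i : ℕ) : ℝ) =
        if (i = 1 ∧ j = 0) ∨ (i = 1 ∧ j = 1) then 1 else 0 := by
      intro i j
      fin_cases i <;> fin_cases j <;> simp
    simp only [Set.indicator_apply, Pi.one_apply]
    exact h1 (H z) (H (α.act (ℓ s) z.1, α.act (ℓ s) z.2))
  have hdiff : ∀ s, ∫ z, (Φ (α.pattern ξ K (α.act (ℓ s) z.1)) (α.pattern ξ K (α.act (ℓ s) z.2)) -
        Φ (α.pattern ξ K z.1) (α.pattern ξ K z.2)) ^ 2 ∂α.μ.prod α.μ =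
      (α.prod α).M S 2 H (⟨ℓ s, hS s⟩, 0, 1) + (α.prod α).M S 2 H (⟨ℓ s, hS s⟩, 1, 0) := by
    intro s
    rw [← hsum s 0 1 1 0 (by simp), ← integral_indicator_one ((hms _ _ _).union (hms _ _ _))]
    refine integral_congr_ae (Eventually.of_forall fun z => ?_)
    have h1 : ∀ i j : Fin 2, (((j : ℕ) : ℝ) - ((i : ℕ) : ℝ)) ^ 2 =
        if (i = 0 ∧ j = 1) ∨ (i = 1 ∧ j = 0) then 1 else 0 := by
      intro i j
      fin_cases i <;> fin_cases j <;> simp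
    simp only [Set.indicator_apply, Pi.one_apply]
    exact h1 (H z) (H (α.act (ℓ s) z.1, α.act (ℓ s) z.2))
  have hdle : ∑ s, ∫ z, (Φ (α.pattern ξ K (α.act (ℓ s) z.1)) (α.pattern ξ K (α.act (ℓ s) z.2)) -
        Φ (α.pattern ξ K z.1) (α.pattern ξ K z.2)) ^ 2 ∂α.μ.prod α.μ ≤
      Fintype.card I * (2 * η) := by
    refine (Finset.sum_le_card_nsmul _ _ (2 * η) fun s _ => ?_).trans (by simp)
    rw [hdiff]
    have h1 := abs_lt.1 (hq (⟨ℓ s, hS s⟩, 0, 1))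
    have h2 := abs_lt.1 (hq (⟨ℓ s, hS s⟩, 1, 0))
    simp only [balancedVector] at h1 h2
    norm_num at h1 h2
    linarith
  obtain ⟨s⟩ := (inferInstance : Nonempty I)
  have h1 := abs_lt.1 (hq (⟨ℓ s, hS s⟩, 1, 0))
  have h2 := abs_lt.1 (hq (⟨ℓ s, hS s⟩, 1, 1))
  simp only [balancedVector] at h1 h2
  norm_num at h1 h2
  simp only [e1, hm s] at hv
  set m := (α.prod α).M S 2 H (⟨ℓ s, hS s⟩, 1, 0) + (α.prod α).M S 2 H (⟨ℓ s, hS s⟩, 1, 1) with hmdef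
  have h3 : |m - 1 / 2| ≤ 2 * η := by
    rw [abs_le]
    constructor <;> linarith
  have h4 : (m - 1 / 2) ^ 2 ≤ (2 * η) ^ 2 := sq_le_sq' (abs_le.1 h3).1 (abs_le.1 h3).2
  have h5 : m - m ^ 2 ≤ c' * (2 * η) := by
    refine hv.trans ?_
    rw [hc', mul_assoc]
    exact mul_le_mul_of_nonneg_left hdle hc
  have h6 : η * (c' + 1) = 1 / 16 := by
    rw [hη]
    field_simp
  have h7 : η ≤ 1 / 16 := by nlinarith
  nlinarith

end Limit

/-- A p.m.p. action with fair bits and a dense family `𝒟` of labellings for which the translations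
by `ℓ` control the variance on the square of the action, up to an error inversely proportional to
`D`, although the square has an invariant fair bit. -/
structure PMP.IsAlmostExpanding {Γ I : Type} [Group Γ] [Fintype I] (a : PMP Γ) (ℓ : I → Γ)
    (c D : ℝ) (𝒟 : ∀ k, Set (a.X → Fin (k + 1))) (g : ℕ → a.X → Fin 2) : Prop where
  standardBorel : StandardBorelSpace a.X
  measurable : ∀ k, ∀ f ∈ 𝒟 k, Measurable f
  exists_approx : ∀ k (f : a.X → Fin (k + 1)), Measurable f → ∀ ε > 0,
    ∃ f' ∈ 𝒟 k, a.μ.real {x | f x ≠ f' x} ≤ ε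
  hasFairBits : a.HasFairBits g
  bits_mem : ∀ l, g l ∈ 𝒟 1
  variance_le : ∀ {Λ : Type} (κ : Λ → ℕ) (f : ∀ l, a.X → Fin (κ l + 1)), (∀ l, f l ∈ 𝒟 (κ l)) →
    ∀ (K : Finset (Λ × Γ))
      (Φ : (∀ p : K, Fin (κ p.1.1 + 1)) → (∀ p : K, Fin (κ p.1.1 + 1)) → ℝ),
      (∀ y z, |Φ y z| ≤ 1) →
      ∫ z, Φ (a.pattern f K z.1) (a.pattern f K z.2) ^ 2 ∂a.μ.prod a.μ -
        (∫ z, Φ (a.pattern f K z.1) (a.pattern f K z.2) ∂a.μ.prod a.μ) ^ 2 ≤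
      c * ∑ s, ∫ z, (Φ (a.pattern f K (a.act (ℓ s) z.1)) (a.pattern f K (a.act (ℓ s) z.2)) -
        Φ (a.pattern f K z.1) (a.pattern f K z.2)) ^ 2 ∂a.μ.prod a.μ +
      (Nat.card (∀ p : K, Fin (κ p.1.1 + 1)) : ℝ) ^ 4 / D
  balancedVector_mem : ∀ S : Finset Γ, (∀ γ ∈ S, ∃ s, ℓ s = γ) →
    balancedVector S ∈ (a.prod a).C S 2

theorem isCylinder_pi {J G : Type} {K : Type} [Finite K] {α : K → Type}
    {F : ∀ p, (J → G) → α p} (hF : ∀ p, IsCylinder (F p)) : IsCylinder fun x p => F p x := by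
  classical
  have := Fintype.ofFinite K
  choose A hA using hF
  refine ⟨Finset.univ.biUnion A, fun x y hxy => ?_⟩
  funext p
  exact hA p fun j hj => hxy j (Finset.mem_biUnion.2 ⟨p, Finset.mem_univ p, hj⟩)

theorem IsFair.two_mul_sum {G : Type} [Fintype G] {b : G → Fin 2} (hb : IsFair b) (c : Fin 2) :
    ∑ g, (if b g = c then (1 : ℝ) else 0) = Fintype.card G / 2 := by
  rw [Finset.sum_boole, ← hb c]
  push_cast
  ring

/-- The measure of the level sets of a fair function of the quotient of two coordinates. -/
theorem bernoulliMeasure_prod_real_quotient {J G : Type} [Group G] [Fintype G] [MeasurableSpace G]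
    [DiscreteMeasurableSpace G] {b : G → Fin 2} (hb : IsFair b) (o : J) (c : Fin 2) :
    ((bernoulliMeasure J G).prod (bernoulliMeasure J G)).real
      {z | b ((z.1 o)⁻¹ * z.2 o) = c} = 1 / 2 := by
  have hu : Measurable fun x : J → G => x o := measurable_pi_apply o
  have hm : MeasurableSet {z : (J → G) × (J → G) | b ((z.1 o)⁻¹ * z.2 o) = c} := by
    have h1 : Measurable fun z : (J → G) × (J → G) => (z.1 o, z.2 o) :=
      (hu.comp measurable_fst).prodMk (hu.comp measurable_snd)
    exact h1 (MeasurableSet.of_discrete (s := {y : G × G | b (y.1⁻¹ * y.2) = c}))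
  have h2 := integral_comp_prod_finite (μ := bernoulliMeasure J G) (ν := bernoulliMeasure J G)
    hu hu fun g h => if b (g⁻¹ * h) = c then (1 : ℝ) else 0
  have h3 : ∫ z : (J → G) × (J → G), (if b ((z.1 o)⁻¹ * z.2 o) = c then (1 : ℝ) else 0)
      ∂(bernoulliMeasure J G).prod (bernoulliMeasure J G) =
      ((bernoulliMeasure J G).prod (bernoulliMeasure J G)).real
        {z | b ((z.1 o)⁻¹ * z.2 o) = c} := by
    rw [← integral_indicator_one hm]
    refine integral_congr_ae (Eventually.of_forall fun z => ?_)
    simp only [Set.indicator_apply, Set.mem_ofPred_eq, Pi.one_apply]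
  rw [← h3, h2]
  have h4 : ∀ g : G, (bernoulliMeasure J G).real ((fun x : J → G => x o) ⁻¹' {g}) =
      (Fintype.card G : ℝ)⁻¹ := fun g => bernoulliMeasure_real_eval o g
  simp_rw [h4, ← Finset.mul_sum]
  have h5 : ∀ g : G, ∑ h : G, (if b (g⁻¹ * h) = c then (1 : ℝ) else 0) = Fintype.card G / 2 :=
    fun g => by
      rw [← hb.two_mul_sum c]
      exact Equiv.sum_comp (Equiv.mulLeft g⁻¹) fun h => if b h = c then (1 : ℝ) else 0
  simp_rw [h5]
  have h6 : (Fintype.card G : ℝ) ≠ 0 := by simp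
  rw [Finset.sum_const, Finset.card_univ, nsmul_eq_mul]
  field_simp

/-- A labelling invariant under `S` with parts of measure one half has the balanced statistics. -/
theorem balancedVector_mem_of_invariant {Γ : Type} [Group Γ] (a : PMP Γ) {S : Finset Γ}
    {F : a.X → Fin 2} (hF : Measurable F) (hinv : ∀ γ ∈ S, ∀ x, F (a.act γ x) = F x)
    (hhalf : ∀ c, a.μ.real {x | F x = c} = 1 / 2) : balancedVector S ∈ a.C S 2 := by
  refine subset_closure ⟨F, hF, ?_⟩
  funext q
  rw [PMP.M, balancedVector]
  simp only [hinv q.1 q.1.2]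
  split_ifs with h
  · rw [← hhalf q.2.1, measureReal_def]
    congr 2
    ext x
    simp [← h]
  · have h1 : {x | F x = q.2.1 ∧ F x = q.2.2} = ∅ := by
      ext x
      simp only [Set.mem_ofPred_eq, Set.mem_empty_iff_false, iff_false]
      rintro ⟨h2, h3⟩
      exact h (h2.symm.trans h3)
    rw [h1]
    simp

theorem HasSparseFreeSubgroup.exists_isAlmostExpanding {Γ : Type} [Group Γ] [Countable Γ] {r m : ℕ}
    (h : HasSparseFreeSubgroup Γ r m) (hr : 1 ≤ r) (hm : 4 * r + 4 ≤ m) :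
    ∃ ℓ : Fin m × Bool → Γ, ∀ (G : Type) [Group G] [Fintype G] (φ : FreeGroup (Fin m) →* G)
      (c D : ℝ), 1 ≤ c → 0 < D →
      (∀ f : G × G → ℝ, (∀ y, ∑ g : G, f (g • y) = 0) →
        ∑ y, f y ^ 2 ≤ c * ∑ s, ∑ y, (f (φ (FreeGroup.ofLetter s) • y) - f y) ^ 2) →
      (∀ a b ψ : G → ℝ, ∑ g, ψ g = 0 → D * (∑ g, ∑ h, a g * b h * ψ (g⁻¹ * h)) ^ 2 ≤
        (Fintype.card G * ∑ g, ψ g ^ 2) * ((∑ g, a g ^ 2) * ∑ g, b g ^ 2)) →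
      Even (Fintype.card G) →
      ∃ (a : PMP Γ) (𝒟 : ∀ k, Set (a.X → Fin (k + 1))) (g : ℕ → a.X → Fin 2),
        a.IsAlmostExpanding ℓ c D 𝒟 g := by
  classical
  obtain ⟨J, _, a, o, e, ℓ, L, he, hae, ho, hLr, hL, hτ⟩ := h.exists_action hr
  refine ⟨ℓ, fun G _ _ φ c D hc hD hgap hmix heven => ?_⟩
  obtain ⟨τ, hτ, hτo, hτe⟩ := hτ G φ
  obtain ⟨b, hb⟩ := exists_isFair heven
  let _ : MeasurableSpace G := ⊤
  have : DiscreteMeasurableSpace G := ⟨fun _ => trivial⟩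
  refine ⟨twistedBernoulli a τ hτ, fun k => {f | IsCylinder (J := J) (G := G) f},
    fun l (x : J → G) => b (x (e (1, l))), ?_⟩
  refine
    { standardBorel := ?_
      measurable := fun k f hf => IsCylinder.measurable (J := J) (G := G) hf
      exists_approx := fun k f hf ε hε => ?_
      hasFairBits := twistedBernoulli_hasFairBits a τ hτ he hae hτe hb
      bits_mem := fun l => (isCylinder_eval (G := G) (e (1, l))).comp b
      variance_le := fun κ f hf K Φ hΦ => ?_
      balancedVector_mem := fun S hS => ?_ }
  · change StandardBorelSpace (J → G)
    infer_instance
  · obtain ⟨K, f', hf', h1⟩ := exists_finite_approx (Z := J → G) (fun (j : J) x => x j) rfl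
      (bernoulliMeasure J G) hf hε
    exact ⟨f', ⟨K, fun x y hxy => hf' x y hxy⟩, h1⟩
  · have hq : IsCylinder (J := J) (G := G) ((twistedBernoulli a τ hτ).pattern f K) :=
      isCylinder_pi fun p => IsCylinder.comp_twist (hf p.1.1) (a p.1.2) (τ p.1.2)
    have h1 := IsCylinder.variance_le hm (fun s => a (ℓ s)) (fun s => τ (ℓ s)) ho L hLr hL hc hD
      (fun f hf => by simpa only [hτo] using hgap f hf) hmix hq Φ hΦ
    rw [Nat.card_eq_fintype_card]
    exact h1
  · let F : (J → G) × (J → G) → Fin 2 := fun z => b ((z.1 o)⁻¹ * z.2 o)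
    have hu : Measurable fun x : J → G => x o := measurable_pi_apply o
    have hF : Measurable F :=
      (Measurable.of_discrete (f := fun y : G × G => b (y.1⁻¹ * y.2))).comp
        ((hu.comp measurable_fst).prodMk (hu.comp measurable_snd))
    refine balancedVector_mem_of_invariant
      ((twistedBernoulli a τ hτ).prod (twistedBernoulli a τ hτ)) (F := F) hF ?_
      (bernoulliMeasure_prod_real_quotient hb o)
    intro γ hγ z
    obtain ⟨s, rfl⟩ := hS γ hγ
    have h1 : ∀ x : J → G, twist (a (ℓ s)) (τ (ℓ s)) x o = τ (ℓ s) o * x o := fun x => by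
      conv_lhs => rw [← ho s, twist_apply_perm]
    have h2 : ∀ x y : J → G, b ((twist (a (ℓ s)) (τ (ℓ s)) x o)⁻¹ *
        twist (a (ℓ s)) (τ (ℓ s)) y o) = b ((x o)⁻¹ * y o) := fun x y => by
      rw [h1, h1]
      congr 1
      group
    exact h2 z.1 z.2

section SpecialLinear

open Matrix Matrix.SpecialLinearGroup

theorem even_card_specialLinearGroup {p : ℕ} [Fact p.Prime] (hp : p ≠ 2) :
    Even (Fintype.card (SpecialLinearGroup (Fin 3) (ZMod p))) := by
  have hp2 : (2 : ZMod p) ≠ 0 := by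
    intro h
    have h1 : ((2 : ℕ) : ZMod p) = 0 := by exact_mod_cast h
    rw [ZMod.natCast_eq_zero_iff] at h1
    exact hp ((Nat.prime_dvd_prime_iff_eq Fact.out Nat.prime_two).1 h1)
  let x : SpecialLinearGroup (Fin 3) (ZMod p) :=
    ⟨Matrix.diagonal ![-1, -1, 1], by simp [Matrix.det_diagonal, Fin.prod_univ_three]⟩
  have hx : orderOf x = 2 := by
    refine orderOf_eq_prime (p := 2) ?_ fun h => ?_
    · apply Subtype.ext
      rw [pow_two, Matrix.SpecialLinearGroup.coe_mul, Matrix.SpecialLinearGroup.coe_one,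
        Matrix.diagonal_mul_diagonal, ← Matrix.diagonal_one]
      congr 1
      funext i
      fin_cases i <;> simp
    · have h1 := congrArg (fun y : SpecialLinearGroup (Fin 3) (ZMod p) => y.1 0 0) h
      simp only [x, Matrix.diagonal_apply_eq, Matrix.cons_val_zero,
        Matrix.SpecialLinearGroup.coe_one, Matrix.one_apply_eq] at h1
      refine hp2 ?_
      linear_combination -h1
  rw [even_iff_two_dvd, ← hx]
  exact orderOf_dvd_card

theorem HasSparseFreeSubgroup.exists_isAlmostExpanding_prime {Γ : Type} [Group Γ] [Countable Γ]
    {r m : ℕ} (h : HasSparseFreeSubgroup Γ r m) (hr : 1 ≤ r) (hm : 4 * r + 4 ≤ m) (hm6 : 6 ≤ m) :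
    ∃ ℓ : Fin m × Bool → Γ, ∀ p : ℕ, p.Prime → p ≠ 2 →
      ∃ (a : PMP Γ) (𝒟 : ∀ k, Set (a.X → Fin (k + 1))) (g : ℕ → a.X → Fin 2),
        a.IsAlmostExpanding ℓ (20000 ^ 2) (p - 1 : ℕ) 𝒟 g := by
  obtain ⟨ℓ, hℓ⟩ := h.exists_isAlmostExpanding hr hm
  refine ⟨ℓ, fun p hp hp2 => ?_⟩
  have : Fact p.Prime := ⟨hp⟩
  obtain ⟨u⟩ : Nonempty ({y : Fin 3 × Fin 3 // y.1 ≠ y.2} ↪ Fin m) :=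
    Function.Embedding.nonempty_of_card_le (by
      rw [Fintype.card_fin]
      exact le_trans (by decide) hm6)
  let gen : Fin m → SpecialLinearGroup (Fin 3) (ZMod p) :=
    Function.extend u (fun y => transvection y.2 1) 1
  refine hℓ _ (FreeGroup.lift gen) _ _ (by norm_num)
    (by exact_mod_cast Nat.sub_pos_of_lt hp.one_lt) (fun f hf => ?_)
    (fun a b ψ hψ => mul_sq_sum_le_of_sum_eq_zero a b ψ hψ) (even_card_specialLinearGroup hp2)
  obtain ⟨i, j, hij, h1⟩ := exists_transvection_sum_sq_le f hf
  refine h1.trans (mul_le_mul_of_nonneg_left ?_ (by norm_num))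
  have h2 : FreeGroup.lift gen (FreeGroup.ofLetter (u ⟨(i, j), hij⟩, true)) =
      transvection hij 1 := by
    rw [FreeGroup.ofLetter]
    simp only [FreeGroup.lift_mk, List.map_cons, List.map_nil, List.prod_cons, List.prod_nil,
      mul_one, cond_true, gen]
    exact u.injective.extend_apply _ _ _
  have h3 := Finset.single_le_sum (f := fun s : Fin m × Bool =>
    ∑ y, (f (FreeGroup.lift gen (FreeGroup.ofLetter s) • y) - f y) ^ 2)
    (fun s _ => Finset.sum_nonneg fun y _ => sq_nonneg _)
    (Finset.mem_univ (u ⟨(i, j), hij⟩, true))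
  simp only [h2] at h3
  exact h3

end SpecialLinear

theorem PMP.C_nonempty {Γ : Type} [Group Γ] (a : PMP Γ) (S : Finset Γ) {k : ℕ} (hk : 0 < k) :
    (a.C S k).Nonempty :=
  ⟨_, subset_closure ⟨fun _ => ⟨0, hk⟩, measurable_const, rfl⟩⟩

theorem PMP.isBounded_C {Γ : Type} [Group Γ] (a : PMP Γ) (S : Finset Γ) (k : ℕ) :
    Bornology.IsBounded (a.C S k) :=
  (isCompact_Icc (a := (0 : ↥S × Fin k × Fin k → ℝ)) (b := 1)).isBounded.subset (a.C_subset_Icc S k)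

theorem PMP.mem_C_of_tendsto_hausdorffDist {Γ : Type} [Group Γ] {A : ℕ → PMP Γ} {α : PMP Γ}
    {S : Finset Γ} {k : ℕ} (hk : 0 < k) {v : ↥S × Fin k × Fin k → ℝ} (hv : ∀ n, v ∈ (A n).C S k)
    (h : Tendsto (fun n => Metric.hausdorffDist ((A n).C S k) (α.C S k)) atTop (𝓝 0)) :
    v ∈ α.C S k := by
  have hcl : IsClosed (α.C S k) := isClosed_closure
  refine (hcl.mem_iff_infDist_zero (α.C_nonempty S hk)).2
    (le_antisymm (ge_of_tendsto' h fun n => ?_) Metric.infDist_nonneg)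
  exact Metric.infDist_le_hausdorffDist_of_mem (hv n)
    (Metric.hausdorffEDist_ne_top_of_nonempty_of_bounded ((A n).C_nonempty S hk)
      (α.C_nonempty S hk) ((A n).isBounded_C S k) (α.isBounded_C S k))

theorem PMP.IsAlmostExpanding.exists_mem_dist_lt {Γ I : Type} [Group Γ] [Fintype I] {a : PMP Γ}
    {ℓ : I → Γ} {c D : ℝ} {𝒟 : ∀ k, Set (a.X → Fin (k + 1))} {g : ℕ → a.X → Fin 2}
    (h : a.IsAlmostExpanding ℓ c D 𝒟 g) (S : Finset Γ) (k : ℕ)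
    (v : ↥S × Fin (k + 1) × Fin (k + 1) → ℝ) {ε : ℝ} (hε : 0 < ε) :
    ∃ f ∈ 𝒟 k, dist (a.M S (k + 1) f) v < Metric.infDist v (a.C S (k + 1)) + ε := by
  have h1 : Metric.infDist v (a.C S (k + 1)) < Metric.infDist v (a.C S (k + 1)) + ε / 2 := by
    linarith
  rw [PMP.C, Metric.infDist_closure] at h1 ⊢
  have hne : {u | ∃ f : a.X → Fin (k + 1), Measurable f ∧ a.M S (k + 1) f = u}.Nonempty :=
    ⟨_, fun _ => 0, measurable_const, rfl⟩
  obtain ⟨_, ⟨f, hf, rfl⟩, h2⟩ := (Metric.infDist_lt_iff hne).1 h1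
  obtain ⟨f', hf', h3⟩ := h.exists_approx k f hf (ε / 4) (by positivity)
  refine ⟨f', hf', ?_⟩
  have h4 := a.dist_M_le S hf (h.measurable k f' hf') h3
  have h5 := dist_triangle_right (a.M S (k + 1) f') v (a.M S (k + 1) f)
  rw [dist_comm] at h4
  linarith

/-- An ultralimit of almost expanding actions whose square has no invariant fair bit. -/
theorem exists_limit_of_isAlmostExpanding {Γ I : Type} [Group Γ] [Countable Γ] [Fintype I]
    [Nonempty I] {𝒰 : Ultrafilter ℕ} (h𝒰 : (𝒰 : Filter ℕ) ≤ atTop) {A : ℕ → PMP Γ} {ℓ : I → Γ}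
    {c : ℝ} (hc : 0 ≤ c) {D : ℕ → ℝ} (hD : Tendsto D atTop atTop)
    {𝒟 : ∀ n k, Set ((A n).X → Fin (k + 1))} {g : ∀ n, ℕ → (A n).X → Fin 2}
    (h : ∀ n, (A n).IsAlmostExpanding ℓ c (D n) (𝒟 n) (g n)) {S₀ : Finset Γ} (hS₀ : ∀ s, ℓ s ∈ S₀) :
    ∃ α : PMP Γ, StandardBorelSpace α.X ∧ (∃ g', α.HasFairBits g') ∧
      (∀ (S : Finset Γ) (k : ℕ), 0 < k →
        Tendsto (fun n => Metric.hausdorffDist ((A n).C S k) (α.C S k)) 𝒰 (𝓝 0)) ∧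
      balancedVector S₀ ∉ (α.prod α).C S₀ 2 := by
  choose w hw𝒟 hw using fun n (y : Finset Γ × ℕ × ℕ) =>
    (h n).exists_mem_dist_lt y.1 y.2.1 (TopologicalSpace.denseSeq _ y.2.2)
      (ε := 1 / (n + 1)) (by positivity)
  let κ : (Finset Γ × ℕ × ℕ) ⊕ ℕ → ℕ := Sum.elim (fun y => y.2.1) fun _ => 1
  let f : ∀ n l, (A n).X → Fin (κ l + 1) := fun n l =>
    match l with
    | Sum.inl y => w n y
    | Sum.inr l => g n l
  have hf𝒟 : ∀ n l, f n l ∈ 𝒟 n (κ l) := fun n l =>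
    match l with
    | Sum.inl y => hw𝒟 n y
    | Sum.inr l => (h n).bits_mem l
  have hf : ∀ n l, Measurable (f n l) := fun n l => (h n).measurable _ _ (hf𝒟 n l)
  obtain ⟨α, ξ, hα, hξ, hgen, hconv⟩ := PMP.exists_ultralimit 𝒰 A κ f hf
  have hconv : PatternsConverge 𝒰 A f α ξ := hconv
  refine ⟨α, hα, ⟨fun l => ξ (Sum.inr l), ?_⟩, fun S k hk => ?_, ?_⟩
  · exact hconv.hasFairBits hξ (ι := Sum.inr) (fun n => (h n).hasFairBits) (fun _ y => y)
      (fun n l x => rfl) fun l x => rfl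
  · obtain ⟨k, rfl⟩ := Nat.exists_eq_succ_of_ne_zero hk.ne'
    exact hconv.tendsto_hausdorffDist h𝒰 hf hξ hgen S hk (TopologicalSpace.denseRange_denseSeq _)
      (w := fun n l => w n (S, k, l)) (v := fun l => ξ (Sum.inl (S, k, l)))
      (fun l => hξ _) (fun n l => hw n (S, k, l))
      fun l => hconv.tendsto_M_label S (Sum.inl (S, k, l))
  · exact balancedVector_notMem hξ hgen ℓ hc hS₀ fun K Φ hΦ =>
      hconv.variance_le hf hξ ℓ c (hD.mono_left h𝒰) K Φ fun n =>
        (h n).variance_le κ (f n) (hf𝒟 n) K Φ hΦ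

/-- Diagonal extraction from convergence along a nontrivial filter of countably many sequences. -/
theorem exists_seq_tendsto_of_forall_tendsto {P : Type} [Countable P] {𝓕 : Filter ℕ} [𝓕.NeBot]
    {u : P → ℕ → ℝ} (hu : ∀ y, Tendsto (u y) 𝓕 (𝓝 0)) :
    ∃ N : ℕ → ℕ, ∀ y, Tendsto (fun i => u y (N i)) atTop (𝓝 0) := by
  obtain ⟨E, hE⟩ := exists_injective_nat P
  have h1 : ∀ i : ℕ, ∃ n, ∀ y, E y ≤ i → |u y n| < 1 / (i + 1) := by
    intro i
    have hfin : {y : P | E y ≤ i}.Finite := (Set.finite_Iic i).preimage hE.injOn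
    refine Eventually.exists (f := 𝓕) ((eventually_all_finite hfin).2 fun y _ => ?_)
    have := Metric.tendsto_nhds.1 (hu y) (1 / (i + 1)) (by positivity)
    simpa only [Real.dist_eq, sub_zero] using this
  choose N hN using h1
  refine ⟨N, fun y => squeeze_zero_norm' ?_ tendsto_one_div_add_atTop_nhds_zero_nat⟩
  filter_upwards [eventually_ge_atTop (E y)] with i hi
  exact (hN i y hi).le

/-- Theorem (main, part (1)): for a countably infinite Zariski dense subgroup
`Γ ≤ SL_d(ℤ)` (`d ≥ 2`), the squaring map `𝔞 ↦ 𝔞 × 𝔞` on free weak equivalence classes is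
discontinuous: there are free p.m.p. actions `α_i`, `α` of `Γ` on atomless standard
probability spaces with `C(α_i,S,k) → C(α,S,k)` in the Hausdorff metric for all finite
`S ⊆ Γ` and all `k ∈ ℕ⁺`, while for some `S`, `k` the distances
`dist_H(C(α_i×α_i,S,k), C(α×α,S,k))` do not tend to `0`. -/
theorem squaring_discontinuous
    (d : ℕ) (hd : 2 ≤ d)
    (Γ : Subgroup (Matrix.SpecialLinearGroup (Fin d) ℤ))
    (hinf : Infinite ↥Γ) (hZD : ZariskiDense d Γ) :
    ∃ (A : ℕ → PMP ↥Γ) (α : PMP ↥Γ),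
      (∀ i, StandardBorelSpace (A i).X) ∧ StandardBorelSpace α.X ∧
      (∀ i, NoAtoms (A i).μ) ∧ NoAtoms α.μ ∧
      (∀ i, (A i).Free) ∧ α.Free ∧
      (∀ (S : Finset ↥Γ) (k : ℕ), 0 < k →
        Tendsto (fun i => Metric.hausdorffDist ((A i).C S k) (α.C S k)) atTop (𝓝 0)) ∧
      (∃ (S : Finset ↥Γ) (k : ℕ), 0 < k ∧
        ¬ Tendsto (fun i =>
            Metric.hausdorffDist (((A i).prod (A i)).C S k) ((α.prod α).C S k))
          atTop (𝓝 0)) := by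
  classical
  have hcount : Countable ↥Γ := Function.Injective.countable
    (f := fun (γ : ↥Γ) (i j : Fin d) => (γ : Matrix.SpecialLinearGroup (Fin d) ℤ).1 i j)
    fun γ δ h => Subtype.ext (Subtype.ext h)
  obtain ⟨r, hr⟩ := hZD.exists_hasSparseFreeSubgroup hd
  have hsparse : HasSparseFreeSubgroup ↥Γ (max r 1) (4 * max r 1 + 4 + 6) := by
    obtain ⟨Q, iQ, π, j, hπ, hj, L, hL, hL'⟩ := hr (4 * max r 1 + 4 + 6)
    exact ⟨Q, iQ, π, j, hπ, hj, L, fun ω hω => (hL ω hω).trans (le_max_left r 1), hL'⟩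
  obtain ⟨ℓ, hℓ⟩ := hsparse.exists_isAlmostExpanding_prime (le_max_right r 1) (by omega) (by omega)
  choose p hp3 hp using fun n : ℕ => Nat.exists_infinite_primes (n + 3)
  choose A 𝒟 g h using fun n => hℓ (p n) (hp n) (by have := hp3 n; omega)
  have hD : Tendsto (fun n => ((p n - 1 : ℕ) : ℝ)) atTop atTop :=
    tendsto_natCast_atTop_atTop.comp
      (tendsto_atTop_mono (f := fun n => n) (fun n => by have := hp3 n; omega) tendsto_id)
  have hne : Nonempty (Fin (4 * max r 1 + 4 + 6) × Bool) := ⟨(⟨0, by omega⟩, true)⟩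
  obtain ⟨α, hα, ⟨g', hg'⟩, hconv, hbal⟩ := exists_limit_of_isAlmostExpanding
    (S₀ := Finset.univ.image ℓ) Nat.hyperfilter_le_atTop (by norm_num) hD h
    fun s => Finset.mem_image_of_mem ℓ (Finset.mem_univ s)
  obtain ⟨N, hN⟩ := exists_seq_tendsto_of_forall_tendsto (P := {y : Finset ↥Γ × ℕ // 0 < y.2})
    fun y => hconv y.1.1 y.1.2 y.2
  refine ⟨fun i => A (N i), α, fun i => (h _).standardBorel, hα, fun i => (h _).hasFairBits.noAtoms,
    hg'.noAtoms, fun i => (h _).hasFairBits.free, hg'.free, fun S k hk => hN ⟨(S, k), hk⟩,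
    Finset.univ.image ℓ, 2, two_pos, fun hlim => hbal ?_⟩
  refine PMP.mem_C_of_tendsto_hausdorffDist (A := fun i => (A (N i)).prod (A (N i))) two_pos
    (fun n => (h _).balancedVector_mem _ fun γ hγ => ?_) hlim
  obtain ⟨s, -, hs⟩ := Finset.mem_image.1 hγ
  exact ⟨s, hs⟩
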